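/- Let U₁ ⊆ ℂ^{n₁} and U₂ ⊆ ℂ^{n₂} be open sets, f_a : U_a → ℂ holomorphic, and x_a ∈ U_a with f_a(x_a) = 0 and with the germ of f_a at x_a nonzero (a = 1,2). Identify ℂ^{n₁} × ℂ^{n₂} with ℂ^{n₁+n₂}, set f := f₁ ∘ pr₁ + f₂ ∘ pr₂ on U₁ × U₂ and x := (x₁, x₂). Then for every rational α ∈ (0,1) one has the equality of ideals of the local ring of holomorphic germs at x: 𝒥(f^α)_x equals the ideal generated by all products (g₁ ∘ pr₁)·(g₂ ∘ pr₂), where α₁, α₂ ∈ (0,α) are rational with α₁ + α₂ = α, and g_a is a holomorphic germ at x_a lying in 𝒥(f_a^{α_a})_{x_a} (a = 1,2). Equivalently: a holomorphic germ g at x satisfies the multiplier condition for (f, α) at x if and only if g is a finite sum Σ_i h_i·(g₁ᵢ ∘ pr₁)·(g₂ᵢ ∘ pr₂) with h_i holomorphic germs at x, rationals α₁ᵢ, α₂ᵢ ∈ (0,α) with α₁ᵢ + α₂ᵢ = α, and g_{aᵢ} satisfying the multiplier condition for (f_a, α_{aᵢ}) at x_a. -/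

import Mathlib

open MeasureTheory Filter Topology

noncomputable section

variable {E : Type*} [NormedAddCommGroup E] [NormedSpace ℂ E] [MeasureSpace E]

/-- `g` is holomorphic on some open neighborhood of `x`. -/
def HolNear (g : E → ℂ) (x : E) : Prop :=
  ∃ W : Set E, IsOpen W ∧ x ∈ W ∧ DifferentiableOn ℂ g W

/-- `g` satisfies the multiplier condition for `(f, α)` at `x`, where `U` is the domain of the
holomorphic function `f`: on some open neighborhood `V ∋ x` contained in the domains of `f` and
`g`, the function `|g|²/|f|^{2α}` is Lebesgue integrable. -/
def MultCond (f : E → ℂ) (U : Set E) (g : E → ℂ) (x : E) (α : ℝ) : Prop :=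
  ∃ V : Set E, IsOpen V ∧ x ∈ V ∧ V ⊆ U ∧ DifferentiableOn ℂ g V ∧
    IntegrableOn (fun y => ‖g y‖ ^ 2 / ‖f y‖ ^ (2 * α)) V volume

/-- `α` is a jumping coefficient of `f` at `x`. -/
def JumpCoeff (f : E → ℂ) (U : Set E) (x : E) (α : ℝ) : Prop :=
  ∃ g : E → ℂ, HolNear g x ∧ (∀ α' : ℝ, α' < α → MultCond f U g x α') ∧ ¬ MultCond f U g x α

/-- the log canonical threshold of `f` at `x`. -/
def Lct (f : E → ℂ) (U : Set E) (x : E) : ℝ :=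
  sSup {α : ℝ | 0 ≤ α ∧ MultCond f U (fun _ => 1) x α}

section Osgood

variable {X : Type*} [NormedAddCommGroup X] [NormedSpace ℂ X]

/-- Derivative along `v` of a continuous function that is holomorphic on lines is continuous. -/
theorem continuousAt_deriv_line {F : X → ℂ} {U : Set X} (hU : IsOpen U) (hc : ContinuousOn F U)
    (hl : ∀ x ∈ U, ∀ v, DifferentiableAt ℂ (fun t : ℂ => F (x + t • v)) 0) (v : X) {x : X}
    (hx : x ∈ U) : ContinuousAt (fun y => deriv (fun t : ℂ => F (y + t • v)) 0) x := by
  have hl' : ∀ y : X, ∀ t : ℂ, y + t • v ∈ U →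
      DifferentiableAt ℂ (fun t : ℂ => F (y + t • v)) t := by
    intro y t h
    have h1 := hl _ h v
    have h2 : (fun s : ℂ => F (y + s • v)) =
        (fun s : ℂ => F (y + t • v + s • v)) ∘ (fun s => s - t) := by
      funext s; simp only [Function.comp]; congr 1; module
    rw [h2]
    apply DifferentiableAt.comp
    · simpa using h1
    · fun_prop
  have hn : ∀ᶠ p : X × ℂ in 𝓝 (x, 0), p.1 + p.2 • v ∈ U := by
    have : ContinuousAt (fun p : X × ℂ => p.1 + p.2 • v) (x, 0) := by fun_prop
    exact this.eventually (by simpa using hU.mem_nhds hx)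
  rw [nhds_prod_eq, (Metric.nhds_basis_ball.prod Metric.nhds_basis_closedBall).eventually_iff] at hn
  obtain ⟨⟨a, r⟩, ⟨ha, hr⟩, hn⟩ := hn
  simp only [Set.mem_prod, and_imp, Prod.forall, Metric.mem_ball, Metric.mem_closedBall] at hn ha hr
  rw [Metric.continuousAt_iff']
  intro ε hε
  have key : ∀ᶠ y in 𝓝 x, ∀ ζ ∈ Metric.sphere (0 : ℂ) r,
      dist (F (y + ζ • v)) (F (x + ζ • v)) < ε * r / 2 := by
    apply (isCompact_sphere (0 : ℂ) r).eventually_forall_of_forall_eventually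
    intro ζ hζ
    have hm : x + ζ • v ∈ U := hn x ζ (by simpa using ha) (by
      simpa [Complex.dist_eq] using (mem_sphere_iff_norm.1 hζ).le)
    have h1 : ContinuousAt F (x + ζ • v) := hc.continuousAt (hU.mem_nhds hm)
    have h2 : ContinuousAt (fun z : X × ℂ => dist (F (z.1 + z.2 • v)) (F (x + z.2 • v)))
        (x, ζ) := by
      apply Filter.Tendsto.dist
      · exact ContinuousAt.comp (g := F) (f := fun z : X × ℂ => z.1 + z.2 • v) h1 (by fun_prop)
      · exact ContinuousAt.comp (g := F) (f := fun z : X × ℂ => x + z.2 • v) h1 (by fun_prop)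
    exact h2.eventually_lt continuousAt_const (by simp only [dist_self]; positivity)
  filter_upwards [key, Metric.ball_mem_nhds x ha] with y hy hya
  have hd : ∀ z ∈ Metric.ball x a, DifferentiableOn ℂ (fun t : ℂ => F (z + t • v))
      (Metric.closedBall 0 r) := fun z hz t ht =>
    (hl' z t (hn z t (by simpa using hz) (by simpa using ht))).differentiableWithinAt
  have hxa : x ∈ Metric.ball x a := Metric.mem_ball_self ha
  have hd0 : ∀ z ∈ Metric.ball x a, DifferentiableAt ℂ (fun t : ℂ => F (z + t • v)) 0 :=
    fun z hz => (hd z hz).differentiableAt (Metric.closedBall_mem_nhds _ hr)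
  rw [dist_eq_norm, ← deriv_sub (hd0 y hya) (hd0 x hxa)]
  calc _ ≤ (ε * r / 2) / r := by
        apply Complex.norm_deriv_le_of_forall_mem_sphere_norm_le hr
        · apply DifferentiableOn.diffContOnCl
          rw [closure_ball _ hr.ne']
          exact (hd y hya).sub (hd x hxa)
        · intro z hz
          have := (hy z hz).le
          rwa [dist_eq_norm] at this
    _ < ε := by
      have : ε * r / 2 / r = ε / 2 := by field_simp
      rw [this]; linarith

/-- Osgood's lemma as a property of the space. -/
def OsgoodProp (X : Type*) [NormedAddCommGroup X] [NormedSpace ℂ X] : Prop :=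
  ∀ (F : X → ℂ) (U : Set X), IsOpen U → ContinuousOn F U →
    (∀ x ∈ U, ∀ v, DifferentiableAt ℂ (fun t : ℂ => F (x + t • v)) 0) → DifferentiableOn ℂ F U

theorem OsgoodProp.of_equiv {Y : Type*} [NormedAddCommGroup Y] [NormedSpace ℂ Y]
    (h : OsgoodProp X) (e : X ≃L[ℂ] Y) : OsgoodProp Y := by
  intro F U hU hc hl
  have := h (F ∘ e) (e ⁻¹' U) (hU.preimage e.continuous)
    (hc.comp e.continuous.continuousOn (fun _ h => h)) (by
      intro x hx v
      have := hl (e x) hx (e v)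
      simpa [Function.comp] using this)
  have h2 : F = (F ∘ e) ∘ e.symm := by ext; simp
  rw [h2]
  exact this.comp e.symm.differentiable.differentiableOn (fun y hy => by simpa using hy)

theorem OsgoodProp.prod [FiniteDimensional ℂ X] (h : OsgoodProp X) : OsgoodProp (X × ℂ) := by
  intro F U hU hc hl
  have d1 : ∀ v ∈ U, DifferentiableAt ℂ (fun x => F (x, v.2)) v.1 := by
    intro v hv
    have ho : IsOpen ((fun x : X => (x, v.2)) ⁻¹' U) := hU.preimage (by fun_prop)
    refine (h (fun x => F (x, v.2)) _ ho ?_ ?_).differentiableAt (ho.mem_nhds hv)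
    · exact hc.comp (by fun_prop) (fun _ h => h)
    · intro x hx w
      have := hl _ hx (w, 0)
      simpa using this
  have d2 : ∀ v ∈ U, DifferentiableAt ℂ (fun z => F (v.1, z)) v.2 := by
    intro v hv
    have := hl _ hv (0, 1)
    have e : (fun z => F (v.1, z)) = (fun t : ℂ => F (v + t • ((0 : X), (1 : ℂ)))) ∘
        (fun z => z - v.2) := by
      funext z; simp only [Function.comp]; congr 1
      ext <;> simp
    rw [e]
    apply DifferentiableAt.comp
    · simpa using this
    · fun_prop
  intro u hu
  have hUn : ∀ᶠ v in 𝓝 u, v ∈ U := hU.mem_nhds hu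
  refine (hasStrictFDerivAt_uncurry_coprod (u := u) (f := fun x z => F (x, z))
    (f₁ := fun x z => fderiv ℂ (fun x => F (x, z)) x)
    (f₂ := fun x z => fderiv ℂ (fun z => F (x, z)) z) ?_ ?_ ?_ ?_).hasFDerivAt.differentiableAt
      |>.differentiableWithinAt
  · filter_upwards [hUn] with v hv
    exact (d1 v hv).hasFDerivAt
  · filter_upwards [hUn] with v hv
    exact (d2 v hv).hasFDerivAt
  · rw [continuousAt_clm_apply]
    intro w
    have h1 := continuousAt_deriv_line hU hc hl (w, 0) hu
    refine (h1.congr ?_)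
    filter_upwards [hUn] with v hv
    have := (d1 v hv).hasFDerivAt.comp_hasDerivAt_of_eq (0 : ℂ) (f := fun t : ℂ => v.1 + t • w)
      (f' := w) (by
        simpa using ((hasDerivAt_id (0 : ℂ)).smul_const w).const_add v.1) (by simp)
    have h3 := this.deriv
    simp only [Function.HasUncurry.uncurry, id]
    rw [← h3]
    congr 1
    funext t
    exact congrArg F (by ext <;> simp)
  · rw [continuousAt_clm_apply]
    intro w
    have h1 := continuousAt_deriv_line hU hc hl (0, w) hu
    refine (h1.congr ?_)
    filter_upwards [hUn] with v hv
    have := (d2 v hv).hasFDerivAt.comp_hasDerivAt_of_eq (0 : ℂ) (f := fun t : ℂ => v.2 + t • w)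
      (f' := w) (by
        simpa using ((hasDerivAt_id (0 : ℂ)).smul_const w).const_add v.2) (by simp)
    have h3 := this.deriv
    simp only [Function.HasUncurry.uncurry, id]
    rw [← h3]
    congr 1
    funext t
    exact congrArg F (by ext <;> simp)

theorem osgoodProp_fin : ∀ n, OsgoodProp (Fin n → ℂ)
  | 0 => by
    intro F U _ _ _ x _
    exact (differentiable_of_subsingleton x).differentiableWithinAt
  | n + 1 => by
    refine (osgoodProp_fin n).prod.of_equiv (ContinuousLinearEquiv.ofFinrankEq ?_)
    simp

/-- **Osgood's lemma**. -/
theorem differentiableOn_of_lines [FiniteDimensional ℂ X] {F : X → ℂ} {U : Set X} (hU : IsOpen U)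
    (hc : ContinuousOn F U)
    (hl : ∀ x ∈ U, ∀ v, DifferentiableAt ℂ (fun t : ℂ => F (x + t • v)) 0) :
    DifferentiableOn ℂ F U :=
  (osgoodProp_fin (Module.finrank ℂ X)).of_equiv (Y := X)
    (ContinuousLinearEquiv.ofFinrankEq (by simp)) F U hU hc hl

end Osgood

section HolBasics

variable {X : Type*} [NormedAddCommGroup X] [NormedSpace ℂ X]

theorem eventually_nhds_zero_line {U : Set X} (hU : IsOpen U) {x : X} (hx : x ∈ U) (v : X) :
    ∃ r > 0, ∀ t : ℂ, ‖t‖ < r → x + t • v ∈ U := by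
  have : ContinuousAt (fun t : ℂ => x + t • v) 0 := by fun_prop
  have h := this.eventually (show ∀ᶠ y in 𝓝 (x + (0 : ℂ) • v), y ∈ U by
    simpa using hU.mem_nhds hx)
  rw [Metric.eventually_nhds_iff_ball] at h
  obtain ⟨r, hr, h⟩ := h
  exact ⟨r, hr, fun t ht => h t (by simpa using ht)⟩

theorem DifferentiableOn.line {F : X → ℂ} {U : Set X} (hU : IsOpen U)
    (hF : DifferentiableOn ℂ F U) {x v : X} {t : ℂ} (h : x + t • v ∈ U) :
    DifferentiableAt ℂ (fun t : ℂ => F (x + t • v)) t :=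
  DifferentiableAt.comp (g := F) t (hF.differentiableAt (hU.mem_nhds h)) (by fun_prop)

/-- Holomorphic dependence of integrals on parameters. -/
theorem differentiableOn_integral_param [FiniteDimensional ℂ X] {A : Type*} [MeasurableSpace A]
    {μ : Measure A} {Φ : X → A → ℂ} {U : Set X} (hU : IsOpen U)
    (hm : ∀ x ∈ U, AEStronglyMeasurable (Φ x) μ)
    (hb : ∀ x ∈ U, ∃ V ∈ 𝓝 x, ∃ b : A → ℝ, Integrable b μ ∧ ∀ᵐ a ∂μ, ∀ y ∈ V, ‖Φ y a‖ ≤ b a)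
    (hd : ∀ᵐ a ∂μ, DifferentiableOn ℂ (fun x => Φ x a) U) :
    DifferentiableOn ℂ (fun x => ∫ a, Φ x a ∂μ) U := by
  apply differentiableOn_of_lines hU
  · intro x hx
    obtain ⟨V, hV, b, hbi, hb⟩ := hb x hx
    apply ContinuousAt.continuousWithinAt
    apply continuousAt_of_dominated (bound := b)
    · filter_upwards [hU.mem_nhds hx] with y hy using hm y hy
    · filter_upwards [hV] with y hy
      filter_upwards [hb] with a ha using ha y hy
    · exact hbi
    · filter_upwards [hd] with a ha using ha.continuousOn.continuousAt (hU.mem_nhds hx)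
  · intro x hx v
    obtain ⟨V, hV, b, hbi, hb⟩ := hb x hx
    obtain ⟨O, hOV, hO, hxO⟩ := mem_nhds_iff.1 hV
    obtain ⟨r, hr, hr'⟩ := eventually_nhds_zero_line (hU.inter hO) (x := x) ⟨hx, hxO⟩ v
    have hdl : ∀ a, DifferentiableOn ℂ (fun x => Φ x a) U → ∀ t : ℂ, ‖t‖ < r →
        DifferentiableAt ℂ (fun t : ℂ => Φ (x + t • v) a) t := fun a ha t ht =>
      ha.line hU (hr' t ht).1
    refine (hasDerivAt_integral_of_dominated_loc_of_deriv_le (F := fun t a => Φ (x + t • v) a)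
      (F' := fun t a => deriv (fun t : ℂ => Φ (x + t • v) a) t) (bound := fun a => b a / (r / 2))
      (s := Metric.ball 0 (r / 2)) (Metric.ball_mem_nhds _ (half_pos hr)) ?_ ?_ ?_ ?_ ?_ ?_).2
        |>.differentiableAt
    · filter_upwards [Metric.ball_mem_nhds (0 : ℂ) hr] with t ht
      exact hm _ (hr' t (by simpa using ht)).1
    · refine Integrable.mono' hbi (hm _ (by simpa using hx)) ?_
      filter_upwards [hb] with a ha
      exact ha _ (by simpa using mem_of_mem_nhds hV)
    · refine aestronglyMeasurable_of_tendsto_ae (u := atTop) (f := fun (n : ℕ) a =>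
        ((r / 2 / (n + 1) : ℝ) : ℂ)⁻¹ • (Φ (x + ((r / 2 / (n + 1) : ℝ) : ℂ) • v) a - Φ (x + (0 : ℂ) • v) a)) ?_ ?_
      · intro n
        have hin : ‖((r / 2 / (n + 1) : ℝ) : ℂ)‖ < r := ?_
        · have h1 := (hm _ (hr' _ hin).1).sub (hm (x + (0 : ℂ) • v) (by simpa using hx))
          exact AEStronglyMeasurable.const_smul (𝕜 := ℂ) h1 _
        rw [Complex.norm_real, Real.norm_of_nonneg (by positivity)]
        calc r / 2 / (n + 1) ≤ r / 2 := div_le_self (by positivity) (by linarith [n.cast_nonneg (α := ℝ)])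
          _ < r := by linarith
      · filter_upwards [hd] with a ha
        have h1 := (hdl a ha 0 (by simpa using hr)).hasDerivAt
        have h2 := h1.tendsto_slope_zero
        simp only [zero_add] at h2
        refine h2.comp (f := fun n : ℕ => ((r / 2 / (n + 1) : ℝ) : ℂ)) ?_
        apply tendsto_nhdsWithin_of_tendsto_nhds_of_eventually_within
        · have : Tendsto (fun n : ℕ => r / 2 / ((n : ℝ) + 1)) atTop (𝓝 0) := by
            have := (tendsto_one_div_add_atTop_nhds_zero_nat (𝕜 := ℝ)).const_mul (r / 2)
            simpa [mul_one_div, div_eq_mul_inv] using this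
          have h3 := (Complex.continuous_ofReal.tendsto 0).comp this
          rw [Complex.ofReal_zero] at h3
          exact h3
        · refine Eventually.of_forall fun n => ?_
          simp only [Set.mem_compl_iff, Set.mem_singleton_iff, Complex.ofReal_eq_zero]
          positivity
    · filter_upwards [hd, hb] with a ha hba t ht
      have ht : ‖t‖ < r / 2 := by simpa using ht
      have hin : ∀ z ∈ Metric.closedBall t (r / 2), ‖z‖ < r := by
        intro z hz
        have : ‖z - t‖ ≤ r / 2 := by simpa [dist_eq_norm] using hz
        calc ‖z‖ = ‖z - t + t‖ := by simp
          _ ≤ ‖z - t‖ + ‖t‖ := norm_add_le _ _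
          _ < r := by linarith
      apply Complex.norm_deriv_le_of_forall_mem_sphere_norm_le (half_pos hr)
      · apply DifferentiableOn.diffContOnCl
        rw [closure_ball _ (half_pos hr).ne']
        intro z hz
        exact (hdl a ha z (hin z hz)).differentiableWithinAt
      · intro z hz
        exact hba _ (hOV (hr' z (hin z (Metric.sphere_subset_closedBall hz))).2)
    · exact hbi.div_const _
    · filter_upwards [hd] with a ha t ht
      have ht : ‖t‖ < r / 2 := by simpa using ht
      exact (hdl a ha t (by linarith)).hasDerivAt

/-- Holomorphic dependence of integrals over `[0,1]` on parameters. -/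
theorem differentiableOn_intervalIntegral_param [FiniteDimensional ℂ X] {Φ : X → ℝ → ℂ} {U : Set X}
    (hU : IsOpen U) (hc : ContinuousOn (fun p : X × ℝ => Φ p.1 p.2) (U ×ˢ Set.Icc 0 1))
    (hd : ∀ s ∈ Set.Icc (0 : ℝ) 1, DifferentiableOn ℂ (fun x => Φ x s) U) :
    DifferentiableOn ℂ (fun x => ∫ s in (0 : ℝ)..1, Φ x s) U := by
  have h0 : ∀ x, ∫ s in (0 : ℝ)..1, Φ x s = ∫ s in Set.Icc (0 : ℝ) 1, Φ x s := fun x => by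
    rw [intervalIntegral.integral_of_le zero_le_one, integral_Icc_eq_integral_Ioc]
  simp_rw [h0]
  have : FiniteDimensional ℝ X := FiniteDimensional.complexToReal X
  have : ProperSpace X := FiniteDimensional.proper ℂ X
  apply differentiableOn_integral_param hU
  · intro x hx
    have : ContinuousOn (fun s => Φ x s) (Set.Icc (0 : ℝ) 1) :=
      hc.comp (f := fun s : ℝ => (x, s)) (by fun_prop) (fun s hs => ⟨hx, hs⟩)
    exact this.aestronglyMeasurable measurableSet_Icc
  · intro x hx
    obtain ⟨K, hK, hxK, hKU⟩ := exists_compact_subset hU hx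
    obtain ⟨C, hC⟩ := (hK.prod isCompact_Icc).exists_bound_of_continuousOn
      (hc.mono (Set.prod_mono hKU subset_rfl))
    refine ⟨K, mem_interior_iff_mem_nhds.1 hxK, fun _ => C, by simp, ?_⟩
    filter_upwards [ae_restrict_mem measurableSet_Icc] with s hs y hy
    exact hC (y, s) ⟨hy, hs⟩
  · filter_upwards [ae_restrict_mem measurableSet_Icc] with s hs using hd s hs

theorem DifferentiableOn.continuousOn_fderiv [FiniteDimensional ℂ X] {F : X → ℂ} {U : Set X}
    (hU : IsOpen U) (hF : DifferentiableOn ℂ F U) : ContinuousOn (fderiv ℂ F) U := by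
  rw [continuousOn_clm_apply]
  intro v x hx
  have h := continuousAt_deriv_line hU hF.continuousOn
    (fun x hx v => hF.line hU (t := 0) (by simpa using hx)) v hx
  refine (h.congr ?_).continuousWithinAt
  filter_upwards [hU.mem_nhds hx] with y hy
  have := (hF.differentiableAt (hU.mem_nhds hy)).hasFDerivAt.comp_hasDerivAt_of_eq (0 : ℂ)
    (f := fun t : ℂ => y + t • v) (f' := v) (by
        simpa using ((hasDerivAt_id (0 : ℂ)).smul_const v).const_add y) (by simp)
  exact this.deriv

/-- Restriction of the derivative to a direction is holomorphic. -/
theorem DifferentiableOn.fderiv_apply [FiniteDimensional ℂ X] {F : X → ℂ} {U : Set X}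
    (hU : IsOpen U) (hF : DifferentiableOn ℂ F U) (v : X) :
    DifferentiableOn ℂ (fun x => fderiv ℂ F x v) U := by
  intro x hx
  obtain ⟨ε, hε, hεU⟩ := Metric.isOpen_iff.1 hU x hx
  obtain ⟨r, hr, hrv⟩ : ∃ r > 0, r * ‖v‖ < ε / 2 := by
    refine ⟨ε / 2 / (‖v‖ + 1), by positivity, ?_⟩
    rw [div_mul_eq_mul_div, div_lt_iff₀ (by positivity)]
    nlinarith [norm_nonneg v]
  have hin : ∀ y ∈ Metric.ball x (ε / 2), ∀ z : ℂ, ‖z‖ ≤ r → y + z • v ∈ U := by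
    intro y hy z hz
    apply hεU
    rw [Metric.mem_ball, dist_eq_norm] at hy ⊢
    calc ‖y + z • v - x‖ = ‖(y - x) + z • v‖ := by congr 1; abel
      _ ≤ ‖y - x‖ + ‖z‖ * ‖v‖ := by rw [← norm_smul]; exact norm_add_le _ _
      _ < ε := by nlinarith [norm_nonneg v]
  set c : ℝ → ℂ := fun s => circleMap 0 r (2 * Real.pi * s) with hcdef
  have hcn : ∀ s, ‖c s‖ = r := fun s => by simp [hcdef, abs_of_pos hr]
  have hcc : Continuous c := by
    have := continuous_circleMap (0 : ℂ) r
    exact this.comp (by fun_prop)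
  have key : ∀ y ∈ Metric.ball x (ε / 2), fderiv ℂ F y v =
      ∫ s in (0 : ℝ)..1, (c s)⁻¹ * F (y + c s • v) := by
    intro y hy
    have hyU : y ∈ U := by simpa using hin y hy 0 (by simpa using hr.le)
    have h1 := (hF.differentiableAt (hU.mem_nhds hyU)).hasFDerivAt.comp_hasDerivAt_of_eq (0 : ℂ)
      (f := fun t : ℂ => y + t • v) (f' := v) (by
        simpa using ((hasDerivAt_id (0 : ℂ)).smul_const v).const_add y) (by simp)
    rw [← h1.deriv]
    change _root_.deriv (fun t : ℂ => F (y + t • v)) 0 = _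
    have hO : IsOpen ((fun t : ℂ => y + t • v) ⁻¹' U) := hU.preimage (by fun_prop)
    rw [← Complex.two_pi_I_inv_smul_circleIntegral_sub_sq_inv_smul_of_differentiable hO
      (c := 0) (R := r) (fun z hz => hin y hy z (by simpa using hz))
      (f := fun t : ℂ => F (y + t • v)) (w₀ := 0)
      (fun t ht => (DifferentiableOn.line hU hF ht).differentiableWithinAt) (by simpa using hr)]
    rw [circleIntegral]
    have h2 := intervalIntegral.smul_integral_comp_mul_left (a := 0) (b := 1)
      (fun θ : ℝ => _root_.deriv (circleMap 0 r) θ • ((circleMap 0 r θ - 0) ^ 2)⁻¹ •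
        F (y + circleMap 0 r θ • v)) (2 * Real.pi)
    rw [mul_zero, mul_one] at h2
    rw [← h2, ← intervalIntegral.integral_smul, ← intervalIntegral.integral_smul]
    refine intervalIntegral.integral_congr fun s _ => ?_
    have hne : c s ≠ 0 := by rw [← norm_ne_zero_iff, hcn]; exact hr.ne'
    simp only [deriv_circleMap, sub_zero, smul_eq_mul, Complex.real_smul]
    change _ = (c s)⁻¹ * F (y + c s • v)
    have : circleMap 0 r (2 * Real.pi * s) = c s := rfl
    rw [this]
    have hpi : (Real.pi : ℂ) ≠ 0 := by exact_mod_cast Real.pi_ne_zero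
    push_cast
    field_simp
  have hdiff : DifferentiableOn ℂ (fun y => ∫ s in (0 : ℝ)..1, (c s)⁻¹ * F (y + c s • v))
      (Metric.ball x (ε / 2)) := by
    apply differentiableOn_intervalIntegral_param Metric.isOpen_ball
    · apply ContinuousOn.mul
      · apply ContinuousOn.inv₀ (by fun_prop)
        intro p _
        rw [← norm_ne_zero_iff, hcn]; exact hr.ne'
      · exact hF.continuousOn.comp (f := fun p : X × ℝ => p.1 + c p.2 • v) (by fun_prop)
          (fun p hp => hin _ hp.1 _ (hcn _).le)
    · intro s _
      apply DifferentiableOn.const_mul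
      exact hF.comp (f := fun y => y + c s • v) (by fun_prop) (fun y hy => hin y hy _ (hcn s).le)
  have hx' : x ∈ Metric.ball x (ε / 2) := Metric.mem_ball_self (half_pos hε)
  exact ((hdiff.congr key).differentiableAt (Metric.isOpen_ball.mem_nhds hx')).differentiableWithinAt

theorem DifferentiableOn.contDiffOn_one [FiniteDimensional ℂ X] {F : X → ℂ} {U : Set X}
    (hU : IsOpen U) (hF : DifferentiableOn ℂ F U) : ContDiffOn ℂ 1 F U := by
  rw [show (1 : WithTop ℕ∞) = 0 + 1 by simp, contDiffOn_succ_iff_fderiv_of_isOpen hU]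
  exact ⟨hF, by simp, by simpa using hF.continuousOn_fderiv hU⟩

end HolBasics

section Germs

variable {X Y Z : Type*} [NormedAddCommGroup X] [NormedSpace ℂ X]
  [NormedAddCommGroup Y] [NormedSpace ℂ Y] [NormedAddCommGroup Z] [NormedSpace ℂ Z]

/-- `F` is holomorphic near the origin. -/
def Hol (F : X → Y) : Prop := ∀ᶠ x in 𝓝 (0 : X), DifferentiableAt ℂ F x

theorem Hol.differentiableAt {F : X → Y} (h : Hol F) : DifferentiableAt ℂ F 0 := h.self_of_nhds

theorem Hol.continuousAt {F : X → Y} (h : Hol F) : ContinuousAt F 0 :=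
  h.differentiableAt.continuousAt

theorem Hol.tendsto {F : X → Y} (h : Hol F) (h0 : F 0 = 0) : Tendsto F (𝓝 0) (𝓝 0) := by
  have := h.continuousAt; rwa [ContinuousAt, h0] at this

theorem Hol.congr {F G : X → Y} (h : Hol F) (e : F =ᶠ[𝓝 0] G) : Hol G := by
  filter_upwards [h, e.eventuallyEq_nhds] with x hx he
  exact he.differentiableAt_iff.1 hx

theorem Differentiable.hol {F : X → Y} (h : Differentiable ℂ F) : Hol F :=
  Eventually.of_forall h

theorem hol_of_differentiableOn {F : X → Y} {U : Set X} (hU : U ∈ 𝓝 0)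
    (h : DifferentiableOn ℂ F U) : Hol F := by
  filter_upwards [eventually_mem_nhds_iff.2 hU] with x hx using h.differentiableAt hx

theorem Hol.exists_ball {F : X → Y} (h : Hol F) :
    ∃ r > 0, DifferentiableOn ℂ F (Metric.ball 0 r) := by
  obtain ⟨r, hr, h⟩ := Metric.eventually_nhds_iff_ball.1 h
  exact ⟨r, hr, fun x hx => (h x hx).differentiableWithinAt⟩

theorem Hol.comp {F : Y → Z} {φ : X → Y} (hF : Hol F) (hφ : Hol φ) (h0 : φ 0 = 0) :
    Hol (fun x => F (φ x)) := by
  filter_upwards [hφ, (hφ.tendsto h0).eventually hF] with x h1 h2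
  exact DifferentiableAt.comp x h2 h1

theorem Hol.const (c : Y) : Hol (fun _ : X => c) := (differentiable_const c).hol

theorem Hol.id : Hol (fun x : X => x) := differentiable_id.hol

theorem Hol.add {F G : X → Y} (hF : Hol F) (hG : Hol G) : Hol (fun x => F x + G x) := by
  filter_upwards [hF, hG] with x h1 h2 using h1.add h2

theorem Hol.sub {F G : X → Y} (hF : Hol F) (hG : Hol G) : Hol (fun x => F x - G x) := by
  filter_upwards [hF, hG] with x h1 h2 using h1.sub h2

theorem Hol.neg {F : X → Y} (hF : Hol F) : Hol (fun x => - F x) := by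
  filter_upwards [hF] with x h1 using h1.neg

theorem Hol.mul {F G : X → ℂ} (hF : Hol F) (hG : Hol G) : Hol (fun x => F x * G x) := by
  filter_upwards [hF, hG] with x h1 h2 using h1.mul h2

theorem Hol.pow {F : X → ℂ} (hF : Hol F) (n : ℕ) : Hol (fun x => F x ^ n) := by
  filter_upwards [hF] with x h1 using h1.pow n

theorem Hol.inv {F : X → ℂ} (hF : Hol F) (h0 : F 0 ≠ 0) : Hol (fun x => (F x)⁻¹) := by
  filter_upwards [hF, hF.continuousAt.eventually_ne h0] with x h1 h2 using h1.inv h2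

theorem Hol.sum {ι : Type*} {s : Finset ι} {F : ι → X → Y} (h : ∀ i ∈ s, Hol (F i)) :
    Hol (fun x => ∑ i ∈ s, F i x) := by
  classical
  induction s using Finset.induction_on with
  | empty => simpa using Hol.const 0
  | insert a s ha ih =>
    simp only [Finset.sum_insert ha]
    exact (h a (by simp)).add (ih fun i hi => h i (by simp [hi]))

theorem Hol.prod {ι : Type*} {s : Finset ι} {F : ι → X → ℂ} (h : ∀ i ∈ s, Hol (F i)) :
    Hol (fun x => ∏ i ∈ s, F i x) := by
  classical
  induction s using Finset.induction_on with
  | empty => simpa using Hol.const 1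
  | insert a s ha ih =>
    simp only [Finset.prod_insert ha]
    exact (h a (by simp)).mul (ih fun i hi => h i (by simp [hi]))

theorem Hol.pi {n : ℕ} {F : X → Fin n → ℂ} (h : ∀ i, Hol (fun x => F x i)) : Hol F := by
  have := eventually_all.2 h
  filter_upwards [this] with x hx using differentiableAt_pi.2 hx

theorem Hol.apply {n : ℕ} {F : X → Fin n → ℂ} (h : Hol F) (i : Fin n) : Hol (fun x => F x i) := by
  filter_upwards [h] with x hx using differentiableAt_pi.1 hx i

/-- Germs of holomorphic functions form an integral domain. -/
theorem Hol.eq_zero_or_eq_zero_of_mul {F G : X → ℂ} (hF : Hol F) (hG : Hol G)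
    (h : (fun x => F x * G x) =ᶠ[𝓝 0] 0) : F =ᶠ[𝓝 0] 0 ∨ G =ᶠ[𝓝 0] 0 := by
  obtain ⟨r, hr, hb⟩ := Metric.eventually_nhds_iff_ball.1 (hF.and (hG.and h))
  by_contra! hcon
  have hex : ∀ H : X → ℂ, ¬ H =ᶠ[𝓝 0] 0 → ∃ a ∈ Metric.ball (0 : X) r, H a ≠ 0 := by
    intro H hH
    by_contra! hc
    exact hH (by filter_upwards [Metric.ball_mem_nhds 0 hr] with x hx using hc x hx)
  obtain ⟨a, ha, hFa⟩ := hex F hcon.1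
  obtain ⟨b, hb', hGb⟩ := hex G hcon.2
  set L : ℂ → X := fun t => a + t • (b - a) with hL
  have hLc : Continuous L := by fun_prop
  set O : Set ℂ := L ⁻¹' Metric.ball 0 r with hO
  have hOo : IsOpen O := Metric.isOpen_ball.preimage hLc
  have hOc : IsPreconnected O := by
    let _ : NormedSpace ℝ X := NormedSpace.complexToReal
    apply Convex.isPreconnected
    intro s hs t ht p q hp hq hpq
    have : L (p • s + q • t) = p • L s + q • L t := by
      simp only [hL]
      obtain rfl : p = 1 - q := by linarith
      simp only [← Complex.coe_smul, smul_eq_mul]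
      push_cast
      module
    change L (p • s + q • t) ∈ Metric.ball (0 : X) r
    rw [this]
    exact convex_ball (0 : X) r hs ht hp hq hpq
  have hFd : AnalyticOnNhd ℂ (fun t => F (L t)) O := by
    apply DifferentiableOn.analyticOnNhd _ hOo
    intro t ht
    exact (DifferentiableAt.comp t (hb _ ht).1 (by fun_prop)).differentiableWithinAt
  have hGd : AnalyticOnNhd ℂ (fun t => G (L t)) O := by
    apply DifferentiableOn.analyticOnNhd _ hOo
    intro t ht
    exact (DifferentiableAt.comp t (hb _ ht).2.1 (by fun_prop)).differentiableWithinAt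
  have h0 : (0 : ℂ) ∈ O := by simp [hO, hL]; simpa using ha
  have h1 : (1 : ℂ) ∈ O := by simp [hO, hL]; simpa using hb'
  have hFn : ∀ᶠ t in 𝓝 (0 : ℂ), F (L t) ≠ 0 := by
    apply ContinuousAt.eventually_ne (hFd 0 h0).continuousAt
    simpa [hL] using hFa
  have hGz : (fun t => G (L t)) =ᶠ[𝓝 0] 0 := by
    filter_upwards [hFn, hOo.mem_nhds h0] with t ht htO
    exact (mul_eq_zero.1 (hb _ htO).2.2).resolve_left ht
  have := hGd.eqOn_zero_of_preconnected_of_eventuallyEq_zero hOc h0 hGz h1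
  exact hGb (by simpa [hL] using this)

theorem Hol.mul_ne_zero {F G : X → ℂ} (hF : Hol F) (hG : Hol G) (h1 : ¬ F =ᶠ[𝓝 0] 0)
    (h2 : ¬ G =ᶠ[𝓝 0] 0) : ¬ (fun x => F x * G x) =ᶠ[𝓝 0] 0 := fun h =>
  (hF.eq_zero_or_eq_zero_of_mul hG h).elim h1 h2

theorem Hol.cancel {F G H : X → ℂ} (hF : Hol F) (hG : Hol G) (hH : Hol H) (h1 : ¬ F =ᶠ[𝓝 0] 0)
    (h : (fun x => F x * G x) =ᶠ[𝓝 0] fun x => F x * H x) : G =ᶠ[𝓝 0] H := by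
  have := (hF.eq_zero_or_eq_zero_of_mul (hG.sub hH) (by
    filter_upwards [h] with x hx
    simp [mul_sub, hx])).resolve_left h1
  filter_upwards [this] with x hx
  exact sub_eq_zero.1 hx

omit [NormedSpace ℂ X] in
theorem not_eventually_zero_of_apply {F : X → ℂ} (h : F 0 ≠ 0) : ¬ F =ᶠ[𝓝 0] 0 := fun h' =>
  h h'.self_of_nhds

theorem Hol.prod_ne_zero {ι : Type*} {s : Finset ι} {F : ι → X → ℂ} (h : ∀ i ∈ s, Hol (F i))
    (h' : ∀ i ∈ s, ¬ F i =ᶠ[𝓝 0] 0) : ¬ (fun x => ∏ i ∈ s, F i x) =ᶠ[𝓝 0] 0 := by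
  classical
  induction s using Finset.induction_on with
  | empty => exact not_eventually_zero_of_apply (by simp)
  | insert a s ha ih =>
    simp only [Finset.prod_insert ha]
    exact (h a (by simp)).mul_ne_zero (Hol.prod fun i hi => h i (by simp [hi])) (h' a (by simp))
      (ih (fun i hi => h i (by simp [hi])) (fun i hi => h' i (by simp [hi])))

theorem Hol.pow_ne_zero {F : X → ℂ} (h : Hol F) (h' : ¬ F =ᶠ[𝓝 0] 0) (n : ℕ) :
    ¬ (fun x => F x ^ n) =ᶠ[𝓝 0] 0 := by
  have := Hol.prod_ne_zero (s := Finset.range n) (F := fun _ => F) (fun _ _ => h) (fun _ _ => h')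
  simpa using this

variable [FiniteDimensional ℂ X]

theorem Hol.fderiv_apply {F : X → ℂ} (hF : Hol F) (v : X) : Hol (fun x => fderiv ℂ F x v) := by
  obtain ⟨r, hr, h⟩ := hF.exists_ball
  exact hol_of_differentiableOn (Metric.ball_mem_nhds _ hr) (h.fderiv_apply Metric.isOpen_ball v)

/-- Integral remainder along the family of segments `x ↦ [P x, x]`. -/
theorem hadamard_along {F : X → ℂ} {U W : Set X} (hU : IsOpen U) (hW : IsOpen W)
    (hF : DifferentiableOn ℂ F U) (P : X → X) (hP : Differentiable ℂ P)
    (hseg : ∀ x ∈ W, ∀ s ∈ Set.Icc (0 : ℝ) 1, P x + (s : ℂ) • (x - P x) ∈ U) (v : X) :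
    DifferentiableOn ℂ
      (fun x => ∫ s in (0 : ℝ)..1, fderiv ℂ F (P x + (s : ℂ) • (x - P x)) v) W := by
  apply differentiableOn_intervalIntegral_param hW
  · have := hP.continuous
    exact (hF.fderiv_apply hU v).continuousOn.comp
      (f := fun p : X × ℝ => P p.1 + (p.2 : ℂ) • (p.1 - P p.1)) (by fun_prop)
      (fun p hp => hseg _ hp.1 _ hp.2)
  · intro s hs
    exact (hF.fderiv_apply hU v).comp (f := fun x => P x + (s : ℂ) • (x - P x))
      (by fun_prop) (fun x hx => hseg x hx s hs)

theorem integral_fderiv_segment {F : X → ℂ} {U : Set X} (hU : IsOpen U)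
    (hF : DifferentiableOn ℂ F U) {x p : X}
    (hseg : ∀ s ∈ Set.Icc (0 : ℝ) 1, p + (s : ℂ) • (x - p) ∈ U) :
    F x - F p = ∫ s in (0 : ℝ)..1, fderiv ℂ F (p + (s : ℂ) • (x - p)) (x - p) := by
  have hc : ContinuousOn (fun s : ℝ => fderiv ℂ F (p + (s : ℂ) • (x - p)) (x - p))
      (Set.Icc 0 1) :=
    (hF.fderiv_apply hU (x - p)).continuousOn.comp
      (f := fun s : ℝ => p + (s : ℂ) • (x - p)) (by fun_prop) hseg
  rw [intervalIntegral.integral_eq_sub_of_hasDerivAt (f := fun s : ℝ => F (p + (s : ℂ) • (x - p)))]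
  · simp
  · intro s hs
    rw [Set.uIcc_of_le zero_le_one] at hs
    have h1 := (hF.differentiableAt (hU.mem_nhds (hseg s hs))).hasFDerivAt.comp_hasDerivAt (s : ℂ)
      (f := fun t : ℂ => p + t • (x - p)) (f' := x - p) (by
        simpa using ((hasDerivAt_id (s : ℂ)).smul_const (x - p)).const_add p)
    exact h1.comp_ofReal
  · rw [intervalIntegrable_iff_integrableOn_Icc_of_le zero_le_one]
    exact hc.integrableOn_compact isCompact_Icc

omit [FiniteDimensional ℂ X] in
theorem segment_mem_ball_of_norm {r : ℝ} {x p : X} (hx : x ∈ Metric.ball (0 : X) r)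
    (hp : p ∈ Metric.ball (0 : X) r) {s : ℝ} (hs : s ∈ Set.Icc (0 : ℝ) 1) :
    p + (s : ℂ) • (x - p) ∈ Metric.ball (0 : X) r := by
  rw [mem_ball_zero_iff] at *
  have e : p + (s : ℂ) • (x - p) = ((1 - s : ℝ) : ℂ) • p + (s : ℂ) • x := by
    push_cast; module
  rw [e]
  refine (norm_add_le _ _).trans_lt ?_
  rw [norm_smul, norm_smul, Complex.norm_real, Complex.norm_real, Real.norm_of_nonneg hs.1,
    Real.norm_of_nonneg (by linarith [hs.2])]
  rcases hs.1.eq_or_lt with h | h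
  · rw [← h]; simpa using hp
  · nlinarith [hs.2]

/-- Division with remainder by a linear form. -/
theorem Hol.div_linear {F : X → ℂ} (hF : Hol F) (l : X →L[ℂ] ℂ) (v : X) :
    ∃ G : X → ℂ, Hol G ∧ ∀ᶠ x in 𝓝 0, F x = F (x - l x • v) + l x * G x := by
  obtain ⟨r, hr, h⟩ := hF.exists_ball
  set P : X → X := fun x => x - l x • v with hP
  have hPd : Differentiable ℂ P := by fun_prop
  set W := Metric.ball (0 : X) r ∩ P ⁻¹' Metric.ball (0 : X) r with hW
  have hWo : IsOpen W := Metric.isOpen_ball.inter (Metric.isOpen_ball.preimage hPd.continuous)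
  have hW0 : W ∈ 𝓝 (0 : X) := hWo.mem_nhds (by simp [hW, hP, hr])
  refine ⟨_, hol_of_differentiableOn hW0 (hadamard_along Metric.isOpen_ball hWo h P hPd
    (fun x hx s hs => segment_mem_ball_of_norm hx.1 hx.2 hs) v), ?_⟩
  filter_upwards [hW0] with x hx
  have := integral_fderiv_segment Metric.isOpen_ball h (x := x) (p := P x)
    (fun s hs => segment_mem_ball_of_norm hx.1 hx.2 hs)
  have e : x - P x = l x • v := by simp [hP]
  rw [← sub_eq_iff_eq_add', this, ← intervalIntegral.integral_const_mul]
  refine intervalIntegral.integral_congr fun s _ => ?_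
  simp only [e, map_smul, smul_eq_mul]

theorem Hol.contDiffAt {n : ℕ} {F : X → Fin n → ℂ} (hF : Hol F) : ContDiffAt ℂ 1 F 0 := by
  rw [contDiffAt_pi]
  intro i
  obtain ⟨r, hr, h⟩ := (hF.apply i).exists_ball
  exact (h.contDiffOn_one Metric.isOpen_ball).contDiffAt (Metric.ball_mem_nhds _ hr)

/-- Holomorphic inverse function theorem. -/
theorem Hol.exists_inverse {n : ℕ} {φ : (Fin n → ℂ) → (Fin n → ℂ)} (hφ : Hol φ) (h0 : φ 0 = 0)
    (e : (Fin n → ℂ) ≃L[ℂ] (Fin n → ℂ))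
    (he : HasFDerivAt φ (e : (Fin n → ℂ) →L[ℂ] (Fin n → ℂ)) 0) :
    ∃ ψ : (Fin n → ℂ) → (Fin n → ℂ), Hol ψ ∧ ψ 0 = 0 ∧ (∀ᶠ x in 𝓝 0, φ (ψ x) = x) ∧
      ∀ᶠ x in 𝓝 0, ψ (φ x) = x := by
  have hc := hφ.contDiffAt
  have hs := hc.hasStrictFDerivAt' he one_ne_zero
  refine ⟨hc.localInverse he one_ne_zero, ?_, ?_, ?_, ?_⟩
  · have := hc.to_localInverse he one_ne_zero
    rw [h0] at this
    exact (this.eventually (by simp)).mono fun x hx => hx.differentiableAt one_ne_zero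
  · have := hs.localInverse_apply_image
    rwa [h0] at this
  · have := hs.eventually_right_inverse
    rwa [h0] at this
  · exact hs.eventually_left_inverse

omit [FiniteDimensional ℂ X] in
theorem Hol.exists_root {u : X → ℂ} (hu : Hol u) (h0 : u 0 ≠ 0) {k : ℕ} (hk : k ≠ 0) :
    ∃ w : X → ℂ, Hol w ∧ w 0 ≠ 0 ∧ ∀ᶠ x in 𝓝 0, w x ^ k = u x := by
  obtain ⟨c, hc⟩ := IsAlgClosed.exists_pow_nat_eq (u 0) (Nat.pos_of_ne_zero hk)
  have hc0 : c ≠ 0 := by rintro rfl; simp [hk] at hc; exact h0 hc.symm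
  have hq : Hol (fun x => u x / u 0) := by simpa [div_eq_mul_inv] using hu.mul (Hol.const _)
  have hs : ∀ᶠ x in 𝓝 (0 : X), u x / u 0 ∈ Complex.slitPlane :=
    hq.continuousAt.eventually (Complex.isOpen_slitPlane.mem_nhds (by simp [h0]))
  refine ⟨fun x => c * Complex.exp (Complex.log (u x / u 0) / k), ?_, by simp [hc0], ?_⟩
  · filter_upwards [hq, hs] with x h1 h2
    have h3 := h1.clog h2
    simp only [div_eq_mul_inv (Complex.log _)]
    exact (h3.mul_const _).cexp.const_mul _
  · filter_upwards [hs] with x h2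
    have : u x / u 0 ≠ 0 := Complex.slitPlane_ne_zero h2
    rw [mul_pow, hc, ← Complex.exp_nat_mul, mul_div_cancel₀ _ (by exact_mod_cast hk),
      Complex.exp_log this]
    field_simp

end Germs

section Monomials

variable {n : ℕ}

/-- The monomial `x ^ a`. -/
def mon (a : Fin n → ℕ) (x : Fin n → ℂ) : ℂ := ∏ i, x i ^ a i

theorem differentiable_mon (a : Fin n → ℕ) : Differentiable ℂ (mon a) := by
  unfold mon; fun_prop

theorem hol_mon (a : Fin n → ℕ) : Hol (mon a) := (differentiable_mon a).hol

theorem hol_coord (i : Fin n) : Hol (fun x : Fin n → ℂ => x i) :=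
  Differentiable.hol (by fun_prop)

theorem mon_add (a b : Fin n → ℕ) (x : Fin n → ℂ) : mon (a + b) x = mon a x * mon b x := by
  simp [mon, pow_add, Finset.prod_mul_distrib]

theorem mon_nsmul (k : ℕ) (a : Fin n → ℕ) (x : Fin n → ℂ) : mon (k • a) x = mon a x ^ k := by
  rw [mon, mon, ← Finset.prod_pow]
  exact Finset.prod_congr rfl fun i _ => by rw [← pow_mul, mul_comm, Pi.smul_apply, smul_eq_mul]

@[simp] theorem mon_zero (x : Fin n → ℂ) : mon 0 x = 1 := by simp [mon]

@[simp] theorem mon_single (i : Fin n) (x : Fin n → ℂ) : mon (Pi.single i 1) x = x i := by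
  classical
  rw [mon, Finset.prod_eq_single i]
  · simp
  · intro j _ hj; simp [hj]
  · simp

theorem mon_apply_zero {a : Fin n → ℕ} {i : Fin n} (h : a i ≠ 0) {x : Fin n → ℂ} (hx : x i = 0) :
    mon a x = 0 :=
  Finset.prod_eq_zero (Finset.mem_univ i) (by simp [hx, h])

theorem coord_ne_zero (i : Fin n) : ¬ (fun x : Fin n → ℂ => x i) =ᶠ[𝓝 0] 0 := by
  intro h
  have ht : Tendsto (fun t : ℂ => (fun _ => t : Fin n → ℂ)) (𝓝 0) (𝓝 0) := by
    have : Continuous (fun t : ℂ => (fun _ => t : Fin n → ℂ)) := by fun_prop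
    exact this.tendsto 0
  have h1 : ∀ᶠ t in 𝓝 (0 : ℂ), t = 0 := ht.eventually h
  have h2 : ∃ᶠ t in 𝓝 (0 : ℂ), t ≠ 0 := by
    have : (𝓝[≠] (0 : ℂ)).NeBot := inferInstance
    exact frequently_iff_neBot.2 this
  exact h2 (h1.mono fun t ht => by simpa using ht)

theorem mon_ne_zero (a : Fin n → ℕ) : ¬ mon a =ᶠ[𝓝 0] 0 :=
  Hol.prod_ne_zero (fun i _ => (hol_coord i).pow _) fun i _ => (hol_coord i).pow_ne_zero
    (coord_ne_zero i) _

/-- The germ is a unit times a monomial. -/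
def IsMono (F : (Fin n → ℂ) → ℂ) : Prop :=
  ∃ (u : (Fin n → ℂ) → ℂ) (a : Fin n → ℕ), Hol u ∧ u 0 ≠ 0 ∧ F =ᶠ[𝓝 0] fun x => u x * mon a x

theorem IsMono.congr {F G : (Fin n → ℂ) → ℂ} (h : IsMono F) (e : F =ᶠ[𝓝 0] G) : IsMono G := by
  obtain ⟨u, a, hu, hu0, h⟩ := h
  exact ⟨u, a, hu, hu0, e.symm.trans h⟩

theorem IsMono.hol {F : (Fin n → ℂ) → ℂ} (h : IsMono F) : Hol F := by
  obtain ⟨u, a, hu, hu0, h⟩ := h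
  exact (hu.mul (hol_mon a)).congr h.symm

theorem IsMono.ne_zero {F : (Fin n → ℂ) → ℂ} (h : IsMono F) : ¬ F =ᶠ[𝓝 0] 0 := by
  obtain ⟨u, a, hu, hu0, h⟩ := h
  intro h'
  exact hu.mul_ne_zero (hol_mon a) (not_eventually_zero_of_apply hu0) (mon_ne_zero a)
    (h.symm.trans h')

theorem IsMono.of_unit {u : (Fin n → ℂ) → ℂ} (hu : Hol u) (h0 : u 0 ≠ 0) : IsMono u :=
  ⟨u, 0, hu, h0, by simp⟩

theorem isMono_mon (a : Fin n → ℕ) : IsMono (mon a) := ⟨fun _ => 1, a, Hol.const 1, by simp, by simp⟩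

theorem IsMono.mul {F G : (Fin n → ℂ) → ℂ} (h : IsMono F) (h' : IsMono G) :
    IsMono (fun x => F x * G x) := by
  obtain ⟨u, a, hu, hu0, h⟩ := h
  obtain ⟨v, b, hv, hv0, h'⟩ := h'
  refine ⟨fun x => u x * v x, a + b, hu.mul hv, by simp [hu0, hv0], ?_⟩
  filter_upwards [h, h'] with x h1 h2
  rw [h1, h2, mon_add]; ring

theorem isMono_coord (i : Fin n) : IsMono (fun x : Fin n → ℂ => x i) :=
  (isMono_mon (Pi.single i 1)).congr (Eventually.of_forall (mon_single i))

theorem IsMono.pow {F : (Fin n → ℂ) → ℂ} (h : IsMono F) (k : ℕ) : IsMono (fun x => F x ^ k) := by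
  obtain ⟨u, a, hu, hu0, h⟩ := h
  refine ⟨fun x => u x ^ k, k • a, hu.pow k, by simp [hu0], ?_⟩
  filter_upwards [h] with x h1
  rw [h1, mon_nsmul]; ring

theorem differentiable_update_zero (i : Fin n) :
    Differentiable ℂ (fun x : Fin n → ℂ => Function.update x i 0) := by
  have : (fun x : Fin n → ℂ => Function.update x i 0) = fun x => x - x i • Pi.single i 1 := by
    funext x j
    by_cases h : j = i
    · subst h; simp
    · simp [h]
  rw [this]; fun_prop

theorem hol_update_zero (i : Fin n) : Hol (fun x : Fin n → ℂ => Function.update x i 0) :=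
  (differentiable_update_zero i).hol

theorem tendsto_update_zero (i : Fin n) :
    Tendsto (fun x : Fin n → ℂ => Function.update x i 0) (𝓝 0) (𝓝 0) :=
  (hol_update_zero i).tendsto (by simp)

theorem mon_update {a : Fin n → ℕ} {i : Fin n} (h : a i = 0) (x : Fin n → ℂ) (z : ℂ) :
    mon a (Function.update x i z) = mon a x := by
  refine Finset.prod_congr rfl fun j _ => ?_
  by_cases hj : j = i
  · subst hj; simp [h]
  · simp [hj]

/-- A germ vanishing on a coordinate hyperplane is divisible by the coordinate. -/
theorem Hol.exists_coord_mul {F : (Fin n → ℂ) → ℂ} (hF : Hol F) (i : Fin n)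
    (h : ∀ᶠ x in 𝓝 0, F (Function.update x i 0) = 0) :
    ∃ G, Hol G ∧ F =ᶠ[𝓝 0] fun x => x i * G x := by
  obtain ⟨G, hG, e⟩ := hF.div_linear (ContinuousLinearMap.proj i) (Pi.single i 1)
  refine ⟨G, hG, ?_⟩
  filter_upwards [e, h] with x h1 h2
  have e : x - x i • (Pi.single i 1 : Fin n → ℂ) = Function.update x i 0 := by
    funext j
    by_cases h : j = i
    · subst h; simp
    · simp [h]
  simp only [ContinuousLinearMap.proj_apply, e, h2, zero_add] at h1
  exact h1

theorem isMono_of_mul_aux (N : ℕ) : ∀ {F G : (Fin n → ℂ) → ℂ} (_ : Hol F) (_ : Hol G)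
    (u : (Fin n → ℂ) → ℂ) (a : Fin n → ℕ), Hol u → u 0 ≠ 0 → ∑ i, a i = N →
    (fun x => F x * G x) =ᶠ[𝓝 0] (fun x => u x * mon a x) → IsMono F := by
  induction N with
  | zero =>
    intro F G hF hG u a hu hu0 ha h
    have ha : a = 0 := by
      funext i
      exact (Finset.sum_eq_zero_iff.1 ha) i (Finset.mem_univ i)
    subst ha
    apply IsMono.of_unit hF
    have := h.self_of_nhds
    simp only [mon_zero, mul_one] at this
    intro h0
    rw [h0, zero_mul] at this
    exact hu0 this.symm
  | succ N ih =>
    intro F G hF hG u a hu hu0 ha h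
    obtain ⟨i, hi⟩ : ∃ i, a i ≠ 0 := by
      by_contra! hc
      simp [hc] at ha
    set b : Fin n → ℕ := a - Pi.single i 1 with hb
    have hab : a = Pi.single i 1 + b := by
      funext j
      by_cases hj : j = i
      · subst hj; simp [hb]; omega
      · simp [hb, hj]
    have hbN : ∑ i, b i = N := by
      rw [hab] at ha
      simp [Finset.sum_add_distrib] at ha
      omega
    have hz : (fun x => F (Function.update x i 0) * G (Function.update x i 0)) =ᶠ[𝓝 0] 0 := by
      filter_upwards [(tendsto_update_zero i).eventually h] with x hx
      rw [hx, mon_apply_zero hi (by simp), mul_zero]; rfl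
    have hxa : ∀ x, mon a x = x i * mon b x := fun x => by rw [hab, mon_add, mon_single]
    rcases (hF.comp (hol_update_zero i) (by simp)).eq_zero_or_eq_zero_of_mul
      (hG.comp (hol_update_zero i) (by simp)) hz with h1 | h1
    · obtain ⟨F', hF', e⟩ := hF.exists_coord_mul i h1
      have h2 : (fun x => F' x * G x) =ᶠ[𝓝 0] (fun x => u x * mon b x) := by
        refine (hol_coord i).cancel (hF'.mul hG) (hu.mul (hol_mon b)) (coord_ne_zero i) ?_
        filter_upwards [h, e] with x h1 h2
        rw [h2, hxa] at h1
        linear_combination h1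
      exact ((isMono_coord i).mul (ih hF' hG u b hu hu0 hbN h2)).congr e.symm
    · obtain ⟨G', hG', e⟩ := hG.exists_coord_mul i h1
      have h2 : (fun x => F x * G' x) =ᶠ[𝓝 0] (fun x => u x * mon b x) := by
        refine (hol_coord i).cancel (hF.mul hG') (hu.mul (hol_mon b)) (coord_ne_zero i) ?_
        filter_upwards [h, e] with x h1 h2
        rw [h2, hxa] at h1
        linear_combination h1
      exact ih hF hG' u b hu hu0 hbN h2

theorem IsMono.of_mul_left {F G : (Fin n → ℂ) → ℂ} (hF : Hol F) (hG : Hol G)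
    (h : IsMono (fun x => F x * G x)) : IsMono F := by
  obtain ⟨u, a, hu, hu0, h⟩ := h
  exact isMono_of_mul_aux _ hF hG u a hu hu0 rfl h

theorem IsMono.of_prod {ι : Type*} {s : Finset ι} {F : ι → (Fin n → ℂ) → ℂ}
    (hF : ∀ i ∈ s, Hol (F i)) (h : IsMono (fun x => ∏ i ∈ s, F i x)) {i : ι} (hi : i ∈ s) :
    IsMono (F i) := by
  classical
  simp only [← Finset.mul_prod_erase s _ hi] at h
  exact h.of_mul_left (hF i hi) (Hol.prod fun j hj => hF j (Finset.mem_of_mem_erase hj))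

theorem unit_mon_ne_zero {u : (Fin n → ℂ) → ℂ} (hu : Hol u) (h0 : u 0 ≠ 0) (a : Fin n → ℕ) :
    ¬ (fun x => u x * mon a x) =ᶠ[𝓝 0] 0 :=
  IsMono.ne_zero ⟨u, a, hu, h0, EventuallyEq.rfl⟩

theorem unit_mon_update_ne_zero {u : (Fin n → ℂ) → ℂ} (hu : Hol u) (h0 : u 0 ≠ 0) {a : Fin n → ℕ}
    {i : Fin n} (hi : a i = 0) :
    ¬ (fun x => u (Function.update x i 0) * mon a (Function.update x i 0)) =ᶠ[𝓝 0] 0 := by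
  simp only [mon_update hi]
  exact unit_mon_ne_zero (hu.comp (hol_update_zero i) (by simp)) (by simpa) a

/-- If a difference of monomial germs is a monomial germ then the exponents are comparable. -/
theorem exponents_comparable {u v w : (Fin n → ℂ) → ℂ} (hu : Hol u) (hv : Hol v) (hw : Hol w)
    (hu0 : u 0 ≠ 0) (hv0 : v 0 ≠ 0) (hw0 : w 0 ≠ 0) {a b e : Fin n → ℕ}
    (h : (fun x => u x * mon a x - v x * mon b x) =ᶠ[𝓝 0] fun x => w x * mon e x) :
    a ≤ b ∨ b ≤ a := by
  by_contra! hcon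
  obtain ⟨i, hi⟩ : ∃ i, b i < a i := by simpa [Pi.le_def] using hcon.1
  obtain ⟨k, hk⟩ : ∃ k, a k < b k := by simpa [Pi.le_def] using hcon.2
  set m := a ⊓ b with hm
  set a' := a - m with ha'
  set b' := b - m with hb'
  have haa : a = m + a' := by funext j; simp [ha', hm]
  have hbb : b = m + b' := by funext j; simp [hb', hm]
  set m0 := m ⊓ e with hm0
  set m1 := m - m0 with hm1
  set e1 := e - m0 with he1
  have hmm : m = m0 + m1 := by funext j; simp [hm1, hm0]
  have hee : e = m0 + e1 := by funext j; simp [he1, hm0]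
  have hdiff : Hol fun x => u x * mon a' x - v x * mon b' x :=
    (hu.mul (hol_mon _)).sub (hv.mul (hol_mon _))
  have h1 : (fun x => mon m1 x * (u x * mon a' x - v x * mon b' x)) =ᶠ[𝓝 0]
      fun x => w x * mon e1 x := by
    refine (hol_mon m0).cancel ((hol_mon m1).mul hdiff) (hw.mul (hol_mon e1)) (mon_ne_zero _) ?_
    filter_upwards [h] with x hx
    rw [haa, hbb, hee, hmm] at hx
    simp only [mon_add] at hx
    linear_combination hx
  have hm1z : m1 = 0 := by
    funext l
    by_contra hl
    have hl' : m1 l ≠ 0 := hl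
    have hel : e1 l = 0 := by
      simp only [hm1, he1, hm0, Pi.sub_apply, Pi.inf_apply] at hl' ⊢; omega
    apply unit_mon_update_ne_zero hw hw0 hel
    filter_upwards [(tendsto_update_zero l).eventually h1] with x hx
    rw [← hx, mon_apply_zero hl' (by simp), zero_mul]; rfl
  simp only [hm1z, mon_zero, one_mul] at h1
  have hai : a' i ≠ 0 := by simp [ha', hm]; omega
  have hbi : b' i = 0 := by simp [hb', hm]; omega
  have hbk : b' k ≠ 0 := by simp [hb', hm]; omega
  have hak : a' k = 0 := by simp [ha', hm]; omega
  have hei : e1 i = 0 := by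
    by_contra hne
    apply unit_mon_update_ne_zero hv hv0 hbi
    filter_upwards [(tendsto_update_zero i).eventually h1] with x hx
    rw [mon_apply_zero hne (by simp), mon_apply_zero hai (by simp)] at hx
    simpa using hx
  have hek : e1 k = 0 := by
    by_contra hne
    apply unit_mon_update_ne_zero hu hu0 hak
    filter_upwards [(tendsto_update_zero k).eventually h1] with x hx
    rw [mon_apply_zero hne (by simp), mon_apply_zero hbk (by simp)] at hx
    simpa using hx
  have hik : i ≠ k := by rintro rfl; omega
  apply unit_mon_update_ne_zero (u := fun x => w (Function.update x i 0))
    (hw.comp (hol_update_zero i) (by simp)) (by simpa) hek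
  filter_upwards [((tendsto_update_zero i).comp (tendsto_update_zero k)).eventually h1] with x hx
  simp only [Function.comp] at hx
  rw [mon_apply_zero hai (by simp), mon_apply_zero hbk (x := Function.update _ i 0)
    (by simp [hik.symm]), mon_update hei] at hx
  simpa using hx.symm

end Monomials

section WeierstrassDivision

/-- Sums of geometrically small holomorphic functions are holomorphic. -/
theorem differentiableOn_tsum_of_summable {X : Type*} [NormedAddCommGroup X] [NormedSpace ℂ X]
    [FiniteDimensional ℂ X] {F : ℕ → X → ℂ} {U : Set X} (hU : IsOpen U) {u : ℕ → ℝ}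
    (hu : Summable u) (hF : ∀ i, DifferentiableOn ℂ (F i) U) (hle : ∀ i, ∀ x ∈ U, ‖F i x‖ ≤ u i) :
    DifferentiableOn ℂ (fun x => ∑' i, F i x) U := by
  apply differentiableOn_of_lines hU
  · exact continuousOn_tsum (fun i => (hF i).continuousOn) hu hle
  · intro x hx v
    obtain ⟨r, hr, h⟩ := eventually_nhds_zero_line hU hx v
    have := Complex.differentiableOn_tsum_of_summable_norm (F := fun i (t : ℂ) => F i (x + t • v)) hu
      (U := Metric.ball 0 r)
      (fun i t ht => ((hF i).line hU (h t (by simpa using ht))).differentiableWithinAt)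
      Metric.isOpen_ball (fun i t ht => hle i _ (h t (by simpa using ht)))
    exact this.differentiableAt (Metric.ball_mem_nhds _ hr)

variable {n : ℕ}

/-- Prepend a coordinate. -/
def cn (z : ℂ) (y : Fin n → ℂ) : Fin (n + 1) → ℂ := Fin.cons z y

/-- Forget the first coordinate. -/
def tl (x : Fin (n + 1) → ℂ) : Fin n → ℂ := fun i => x i.succ

@[simp] theorem cn_apply_zero (z : ℂ) (y : Fin n → ℂ) : cn z y 0 = z := rfl
@[simp] theorem cn_apply_succ (z : ℂ) (y : Fin n → ℂ) (i : Fin n) : cn z y i.succ = y i := rfl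
@[simp] theorem tl_cn (z : ℂ) (y : Fin n → ℂ) : tl (cn z y) = y := rfl
@[simp] theorem tl_apply (x : Fin (n + 1) → ℂ) (i : Fin n) : tl x i = x i.succ := rfl
@[simp] theorem cn_tl (x : Fin (n + 1) → ℂ) : cn (x 0) (tl x) = x := by
  funext i; refine Fin.cases rfl (fun _ => rfl) i
@[simp] theorem tl_zero : tl (0 : Fin (n + 1) → ℂ) = 0 := rfl
@[simp] theorem cn_zero_zero : cn 0 (0 : Fin n → ℂ) = 0 := by
  funext i; refine Fin.cases rfl (fun _ => rfl) i

theorem differentiable_tl : Differentiable ℂ (tl (n := n)) :=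
  differentiable_pi.2 fun i => by simp only [tl_apply]; fun_prop

theorem DifferentiableAt.consn {X : Type*} [NormedAddCommGroup X] [NormedSpace ℂ X] {a : X → ℂ}
    {b : X → Fin n → ℂ} {x : X} (ha : DifferentiableAt ℂ a x) (hb : DifferentiableAt ℂ b x) :
    DifferentiableAt ℂ (fun x => cn (a x) (b x)) x := by
  rw [differentiableAt_pi]
  intro i
  refine Fin.cases ?_ (fun j => ?_) i
  · simpa using ha
  · simpa using differentiableAt_pi.1 hb j

theorem hol_tl : Hol (tl (n := n)) := differentiable_tl.hol

theorem Hol.comp_tl {g : (Fin n → ℂ) → ℂ} (hg : Hol g) : Hol (fun x : Fin (n + 1) → ℂ => g (tl x)) :=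
  hg.comp hol_tl rfl

theorem Hol.consn {X : Type*} [NormedAddCommGroup X] [NormedSpace ℂ X] {a : X → ℂ}
    {b : X → Fin n → ℂ} (ha : Hol a) (hb : Hol b) : Hol (fun x => cn (a x) (b x)) := by
  filter_upwards [ha, hb] with x h1 h2 using h1.consn h2

/-- The polydisc of radius `r` in the first and `ρ` in the other coordinates. -/
def polydisc (n : ℕ) (r ρ : ℝ) : Set (Fin (n + 1) → ℂ) := {x | ‖x 0‖ < r ∧ ‖tl x‖ < ρ}

theorem isOpen_polydisc (r ρ : ℝ) : IsOpen (polydisc n r ρ) :=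
  (isOpen_lt (f := fun x : Fin (n + 1) → ℂ => ‖x 0‖) (by fun_prop) continuous_const).inter
    (isOpen_lt (differentiable_tl.continuous.norm) continuous_const)

theorem polydisc_mem_nhds {r ρ : ℝ} (hr : 0 < r) (hρ : 0 < ρ) : polydisc n r ρ ∈ 𝓝 0 :=
  (isOpen_polydisc r ρ).mem_nhds ⟨by simpa, by simpa⟩

theorem polydisc_subset {r ρ r' ρ' : ℝ} (h : r ≤ r') (h' : ρ ≤ ρ') :
    polydisc n r ρ ⊆ polydisc n r' ρ' := fun _ hx => ⟨hx.1.trans_le h, hx.2.trans_le h'⟩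

theorem polydisc_subset_ball {r : ℝ} (hr : 0 < r) : polydisc n r r ⊆ Metric.ball 0 r := by
  intro x hx
  rw [mem_ball_zero_iff, pi_norm_lt_iff hr]
  intro i
  refine Fin.cases hx.1 (fun j => ?_) i
  exact (norm_le_pi_norm (tl x) j).trans_lt hx.2

theorem exists_polydisc_of_eventually {p : (Fin (n + 1) → ℂ) → Prop} (h : ∀ᶠ x in 𝓝 0, p x) :
    ∃ r > 0, ∀ x ∈ polydisc n r r, p x := by
  obtain ⟨r, hr, h⟩ := Metric.eventually_nhds_iff_ball.1 h
  exact ⟨r, hr, fun x hx => h x (polydisc_subset_ball hr hx)⟩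

/-- One step of division by the first coordinate, with estimates. -/
theorem exists_div_step {r ρ M : ℝ} (hr : 0 < r) {h : (Fin (n + 1) → ℂ) → ℂ}
    (hd : DifferentiableOn ℂ h (polydisc n r ρ)) (hM : ∀ x ∈ polydisc n r ρ, ‖h x‖ ≤ M) :
    ∃ S : (Fin (n + 1) → ℂ) → ℂ, DifferentiableOn ℂ S (polydisc n r ρ) ∧
      (∀ x ∈ polydisc n r ρ, ‖S x‖ ≤ (2 * M) / r) ∧
      (∀ x ∈ polydisc n r ρ, h x = h (cn 0 (tl x)) + x 0 * S x) := by
  set D := polydisc n r ρ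
  have hDo : IsOpen D := isOpen_polydisc r ρ
  set P : (Fin (n + 1) → ℂ) → (Fin (n + 1) → ℂ) := fun x => cn 0 (tl x) with hP
  have hPd : Differentiable ℂ P := fun x =>
    (differentiableAt_const _).consn differentiable_tl.differentiableAt
  have hsub : ∀ x, x - P x = x 0 • Pi.single 0 1 := by
    intro x; funext i
    refine Fin.cases ?_ (fun j => ?_) i
    · simp [hP]
    · simp [hP]
  have hseg' : ∀ (x : Fin (n + 1) → ℂ) (s : ℂ), P x + s • (x - P x) = cn (s * x 0) (tl x) := by
    intro x s; rw [hsub]; funext i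
    refine Fin.cases ?_ (fun j => ?_) i
    · simp [hP]
    · simp [hP]
  have hseg : ∀ x ∈ D, ∀ s ∈ Set.Icc (0 : ℝ) 1, P x + (s : ℂ) • (x - P x) ∈ D := by
    intro x hx s hs
    rw [hseg']
    refine ⟨?_, hx.2⟩
    rw [cn_apply_zero, norm_mul, Complex.norm_real, Real.norm_of_nonneg hs.1]
    exact (mul_le_of_le_one_left (norm_nonneg _) hs.2).trans_lt hx.1
  set S : (Fin (n + 1) → ℂ) → ℂ := fun x =>
    ∫ s in (0 : ℝ)..1, fderiv ℂ h (P x + (s : ℂ) • (x - P x)) (Pi.single 0 1) with hS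
  have hSd : DifferentiableOn ℂ S D := hadamard_along hDo hDo hd P hPd hseg _
  have hSe : ∀ x ∈ D, h x = h (cn 0 (tl x)) + x 0 * S x := by
    intro x hx
    have := integral_fderiv_segment hDo hd (x := x) (p := P x) (hseg x hx)
    rw [← sub_eq_iff_eq_add', this, hS, ← intervalIntegral.integral_const_mul]
    refine intervalIntegral.integral_congr fun s _ => ?_
    simp only [hsub, map_smul, smul_eq_mul]
  refine ⟨S, hSd, ?_, hSe⟩
  have hne : ∀ y, ‖y‖ < ρ → ∀ t, ‖t‖ < r → t ≠ 0 → ‖S (cn t y)‖ ≤ (2 * M) / r := by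
    intro y hy t ht ht0
    have hmem : ∀ t, ‖t‖ < r → cn t y ∈ D := fun t ht => ⟨ht, hy⟩
    have h0 : ‖(0 : ℂ)‖ < r := by simpa
    have := Complex.norm_dslope_le_div_of_mapsTo_ball (f := fun t => h (cn t y)) (c := 0) (R₁ := r)
      (R₂ := 2 * M) (z := t) (fun s hs => by
        refine (DifferentiableAt.comp s (hd.differentiableAt (hDo.mem_nhds (hmem s (by simpa using hs))))
          (DifferentiableAt.consn differentiableAt_id (differentiableAt_const _))).differentiableWithinAt)
      (fun s hs => by
        rw [Metric.mem_closedBall, dist_eq_norm]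
        refine (norm_sub_le _ _).trans ?_
        have := hM _ (hmem s (by simpa using hs))
        have := hM _ (hmem 0 h0)
        linarith) (by simpa using ht)
    rw [dslope_of_ne _ ht0, slope_def_field, hSe _ (hmem t ht)] at this
    simpa [ht0] using this
  intro x hx
  have hc : ContinuousAt (fun t : ℂ => S (cn t (tl x))) (x 0) := by
    have h1 : ContinuousAt S (cn (x 0) (tl x)) := by
      rw [cn_tl]; exact (hSd.differentiableAt (hDo.mem_nhds hx)).continuousAt
    exact ContinuousAt.comp (f := fun t : ℂ => cn t (tl x)) h1
      (DifferentiableAt.consn differentiableAt_id (differentiableAt_const _)).continuousAt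
  have hf : ∃ᶠ t in 𝓝 (x 0), ‖S (cn t (tl x))‖ ≤ (2 * M) / r := by
    have h1 : ∀ᶠ t in 𝓝 (x 0), ‖t‖ < r := (continuous_norm.tendsto (x 0)).eventually_lt_const hx.1
    have h2 : ∃ᶠ t in 𝓝 (x 0), t ≠ 0 := 
      mem_closure_iff_frequently.1 (dense_compl_singleton (0 : ℂ) (x 0))
    exact (h2.and_eventually h1).mono fun t ht => hne _ hx.2 t ht.2 ht.1
  have := le_of_tendsto_of_frequently hc.norm hf
  simpa using this

/-- Division by a power of the first coordinate, with estimates. -/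
theorem exists_div_pow {r : ℝ} (hr : 0 < r) (d : ℕ) : ∃ K : ℝ, 0 ≤ K ∧ ∀ (ρ M : ℝ), 0 ≤ M →
    ∀ (h : (Fin (n + 1) → ℂ) → ℂ), DifferentiableOn ℂ h (polydisc n r ρ) →
    (∀ x ∈ polydisc n r ρ, ‖h x‖ ≤ M) →
    ∃ (c : ℕ → (Fin n → ℂ) → ℂ) (S : (Fin (n + 1) → ℂ) → ℂ),
      (∀ j, DifferentiableOn ℂ (c j) (Metric.ball 0 ρ)) ∧
      (∀ j, ∀ y ∈ Metric.ball 0 ρ, ‖c j y‖ ≤ K * M) ∧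
      DifferentiableOn ℂ S (polydisc n r ρ) ∧ (∀ x ∈ polydisc n r ρ, ‖S x‖ ≤ K * M) ∧
      ∀ x ∈ polydisc n r ρ, h x = ∑ j ∈ Finset.range d, c j (tl x) * x 0 ^ j + x 0 ^ d * S x := by
  induction d with
  | zero =>
    refine ⟨1, zero_le_one, fun ρ M hM h hd hb => ⟨fun _ _ => 0, h, fun _ => by fun_prop,
      fun _ _ _ => by simpa, hd, by simpa using hb, fun x _ => by simp⟩⟩
  | succ d ih =>
    obtain ⟨K, hK0, hK⟩ := ih
    refine ⟨max 1 (K * (2 / r)), by positivity, fun ρ M hM h hd hb => ?_⟩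
    obtain ⟨S, hS, hSb, hSe⟩ := exists_div_step hr hd hb
    obtain ⟨c, T, hc, hcb, hT, hTb, hTe⟩ := hK ρ (2 * M / r) (by positivity) S hS hSb
    have hle : K * (2 * M / r) ≤ max 1 (K * (2 / r)) * M := by
      calc K * (2 * M / r) = K * (2 / r) * M := by ring
        _ ≤ _ := by gcongr; exact le_max_right _ _
    have hmem : ∀ y ∈ Metric.ball (0 : Fin n → ℂ) ρ, cn 0 y ∈ polydisc n r ρ := fun y hy =>
      ⟨by simpa, by simpa using hy⟩
    refine ⟨fun j => if j = 0 then (fun y => h (cn 0 y)) else c (j - 1), T, ?_, ?_, hT,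
      fun x hx => (hTb x hx).trans hle, ?_⟩
    · rintro (_ | j)
      · intro y hy
        exact (DifferentiableAt.comp y (hd.differentiableAt
          ((isOpen_polydisc r ρ).mem_nhds (hmem y hy)))
          ((differentiableAt_const _).consn differentiableAt_id)).differentiableWithinAt
      · exact hc j
    · rintro (_ | j) y hy
      · refine (hb _ (hmem y hy)).trans (le_mul_of_one_le_left hM (le_max_left _ _))
      · exact (hcb j y hy).trans hle
    · intro x hx
      have e : x 0 * ∑ j ∈ Finset.range d, c j (tl x) * x 0 ^ j =
          ∑ j ∈ Finset.range d, c j (tl x) * x 0 ^ (j + 1) := by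
        rw [Finset.mul_sum]
        exact Finset.sum_congr rfl fun j _ => by ring
      rw [hSe x hx, hTe x hx, Finset.sum_range_succ', mul_add, e]
      simp only [Nat.add_eq_zero_iff, one_ne_zero, and_false, if_false, Nat.add_sub_cancel, if_true]
      rw [pow_succ' (x 0) d]
      ring

/-- If `∑_{j<d} a_j t^j` is divisible by `t^d` then all `a_j` vanish. -/
theorem coeff_eq_zero_of_sum_eq_pow_mul {d : ℕ} : ∀ {a : ℕ → ℂ} {v : ℂ → ℂ}, ContinuousAt v 0 →
    (∀ᶠ t in 𝓝[≠] 0, ∑ j ∈ Finset.range d, a j * t ^ j = t ^ d * v t) → ∀ j < d, a j = 0 := by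
  induction d with
  | zero => intro a v _ _ j hj; omega
  | succ d ih =>
    intro a v hv h
    have hn : (𝓝[≠] (0 : ℂ)).NeBot := inferInstance
    have h1 : Tendsto (fun t : ℂ => ∑ j ∈ Finset.range (d + 1), a j * t ^ j) (𝓝[≠] 0) (𝓝 (a 0)) := by
      have : ContinuousAt (fun t : ℂ => ∑ j ∈ Finset.range (d + 1), a j * t ^ j) 0 := by fun_prop
      have := this.tendsto.mono_left (nhdsWithin_le_nhds (s := {0}ᶜ))
      simpa [Finset.sum_range_succ'] using this
    have h2 : Tendsto (fun t : ℂ => t ^ (d + 1) * v t) (𝓝[≠] 0) (𝓝 0) := by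
      have : ContinuousAt (fun t : ℂ => t ^ (d + 1) * v t) 0 := by fun_prop
      have := this.tendsto.mono_left (nhdsWithin_le_nhds (s := {0}ᶜ))
      simpa using this
    have h0 : a 0 = 0 := tendsto_nhds_unique h1 (h2.congr' (h.mono fun t ht => ht.symm))
    have := ih (a := fun j => a (j + 1)) hv (by
      filter_upwards [h, self_mem_nhdsWithin] with t ht ht0
      rw [Finset.sum_range_succ', h0] at ht
      simp only [pow_succ, zero_mul, add_zero, ← mul_assoc, ← Finset.sum_mul] at ht
      have ht0 : t ≠ 0 := ht0
      apply mul_right_cancel₀ ht0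
      linear_combination ht)
    rintro (_ | j) hj
    · exact h0
    · exact this j (by omega)

/-- The germ is regular of order `d` in the first coordinate. -/
def RegularOrder (f : (Fin (n + 1) → ℂ) → ℂ) (d : ℕ) : Prop :=
  ∃ (c : ℕ → (Fin n → ℂ) → ℂ) (u : (Fin (n + 1) → ℂ) → ℂ), (∀ j, Hol (c j)) ∧
    (∀ j < d, c j 0 = 0) ∧ Hol u ∧ u 0 ≠ 0 ∧
    ∀ᶠ x in 𝓝 0, f x = ∑ j ∈ Finset.range d, c j (tl x) * x 0 ^ j + x 0 ^ d * u x

theorem tendsto_cn_zero : Tendsto (fun t : ℂ => cn t (0 : Fin n → ℂ)) (𝓝 0) (𝓝 0) := by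
  have : ContinuousAt (fun t : ℂ => cn t (0 : Fin n → ℂ)) 0 :=
    (DifferentiableAt.consn differentiableAt_id (differentiableAt_const _)).continuousAt
  simpa [ContinuousAt] using this

theorem hol_cn_zero : Hol (fun t : ℂ => cn t (0 : Fin n → ℂ)) := Hol.id.consn (Hol.const _)

theorem Hol.exists_regularOrder {f : (Fin (n + 1) → ℂ) → ℂ} (hf : Hol f)
    (h : ¬ ∀ᶠ t in 𝓝 (0 : ℂ), f (cn t 0) = 0) :
    ∃ d, RegularOrder f d ∧ ∃ w : ℂ → ℂ, ContinuousAt w 0 ∧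
      ∀ᶠ t in 𝓝 0, f (cn t 0) = t ^ d * w t := by
  have hφ : Hol (fun t : ℂ => f (cn t 0)) := hf.comp hol_cn_zero (by simp)
  have han : AnalyticAt ℂ (fun t : ℂ => f (cn t 0)) 0 := by
    obtain ⟨r, hr, h⟩ := hφ.exists_ball
    exact h.analyticAt (Metric.ball_mem_nhds _ hr)
  obtain ⟨d, w, hw, hw0, hwe⟩ := han.exists_eventuallyEq_pow_smul_nonzero_iff.2 h
  simp only [sub_zero, smul_eq_mul] at hwe
  refine ⟨d, ?_, w, hw.continuousAt, hwe⟩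
  have hbd : ∀ᶠ x in 𝓝 0, ‖f x‖ ≤ ‖f 0‖ + 1 :=
    (hf.continuousAt.norm.eventually_lt_const (lt_add_one _)).mono fun x hx => le_of_lt hx
  obtain ⟨r, hr, hrp⟩ := exists_polydisc_of_eventually (hf.and hbd)
  obtain ⟨K, hK0, hK⟩ := exists_div_pow (n := n) hr d
  obtain ⟨c, u, hc, -, hu, -, he⟩ := hK r _ (by positivity) f
    (fun x hx => (hrp x hx).1.differentiableWithinAt) (fun x hx => (hrp x hx).2)
  have hu' : Hol u := hol_of_differentiableOn (polydisc_mem_nhds hr hr) hu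
  have he' : ∀ᶠ x in 𝓝 0, f x = ∑ j ∈ Finset.range d, c j (tl x) * x 0 ^ j + x 0 ^ d * u x :=
    Filter.mem_of_superset (polydisc_mem_nhds hr hr) he
  have hut : ContinuousAt (fun t : ℂ => u (cn t 0)) 0 := (hu'.comp hol_cn_zero (by simp)).continuousAt
  have hc0 : ∀ j < d, c j 0 = 0 := by
    apply coeff_eq_zero_of_sum_eq_pow_mul (v := fun t => w t - u (cn t 0))
      (hw.continuousAt.sub hut)
    refine Eventually.filter_mono nhdsWithin_le_nhds ?_
    filter_upwards [tendsto_cn_zero.eventually he', hwe] with t h1 h2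
    rw [h1] at h2
    simp only [tl_cn, cn_apply_zero] at h2
    linear_combination h2
  refine ⟨c, u, fun j => hol_of_differentiableOn (Metric.ball_mem_nhds _ hr) (hc j), hc0, hu', ?_, he'⟩
  have : (fun t : ℂ => u (cn t 0)) =ᶠ[𝓝[≠] 0] w := by
    have h3 : ∀ᶠ t in 𝓝[≠] (0 : ℂ), f (cn t 0) = t ^ d * w t := hwe.filter_mono nhdsWithin_le_nhds
    have h4 := (tendsto_cn_zero (n := n).eventually he').filter_mono
      (nhdsWithin_le_nhds (s := {(0 : ℂ)}ᶜ))
    filter_upwards [h3, h4, self_mem_nhdsWithin] with t h3 h4 ht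
    rw [h3] at h4
    simp only [tl_cn, cn_apply_zero] at h4
    rw [Finset.sum_eq_zero (fun j hj => by rw [hc0 j (Finset.mem_range.1 hj), zero_mul]),
      zero_add] at h4
    exact (mul_left_cancel₀ (_root_.pow_ne_zero d ht) h4).symm
  have h5 : u (cn 0 0) = w 0 := tendsto_nhds_unique
    (hut.tendsto.mono_left (nhdsWithin_le_nhds (s := {(0 : ℂ)}ᶜ)))
    ((hw.continuousAt.tendsto.mono_left nhdsWithin_le_nhds).congr' this.symm)
  rw [cn_zero_zero] at h5
  rwa [h5]

/-- An approximate Weierstrass division. -/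
theorem RegularOrder.exists_approx {f : (Fin (n + 1) → ℂ) → ℂ} {d : ℕ} (hf : RegularOrder f d)
    {r₀ : ℝ} (hr₀ : 0 < r₀) :
    ∃ r ρ K : ℝ, 0 < r ∧ r ≤ r₀ ∧ 0 < ρ ∧ ρ ≤ r₀ ∧ 0 ≤ K ∧ DifferentiableOn ℂ f (polydisc n r ρ) ∧
      ∀ (h : (Fin (n + 1) → ℂ) → ℂ) (M : ℝ), (0 ≤ M ∧ DifferentiableOn ℂ h (polydisc n r ρ) ∧
        ∀ x ∈ polydisc n r ρ, ‖h x‖ ≤ M) →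
      ∃ (q : (Fin (n + 1) → ℂ) → ℂ) (c : ℕ → (Fin n → ℂ) → ℂ),
        DifferentiableOn ℂ q (polydisc n r ρ) ∧ (∀ x ∈ polydisc n r ρ, ‖q x‖ ≤ K * M) ∧
        (∀ j, DifferentiableOn ℂ (c j) (Metric.ball 0 ρ)) ∧
        (∀ j, ∀ y ∈ Metric.ball 0 ρ, ‖c j y‖ ≤ K * M) ∧
        ∀ x ∈ polydisc n r ρ,
          ‖h x - (q x * f x + ∑ j ∈ Finset.range d, c j (tl x) * x 0 ^ j)‖ ≤ M / 2 := by
  obtain ⟨b, u, hb, hb0, hu, hu0, he⟩ := hf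
  have hui := hu.inv hu0
  have h1 : ∀ᶠ x in 𝓝 0, ‖(u x)⁻¹‖ ≤ ‖(u 0)⁻¹‖ + 1 :=
    (hui.continuousAt.norm.eventually_lt_const (lt_add_one _)).mono fun x hx => le_of_lt hx
  have h2 : ∀ᶠ x in 𝓝 0, u x ≠ 0 := hu.continuousAt.eventually_ne hu0
  have hbs : ∀ᶠ x : Fin (n + 1) → ℂ in 𝓝 0, ∀ j ∈ Finset.range d, DifferentiableAt ℂ (b j) (tl x) :=
    (Finset.eventually_all _).2 fun j _ => (hol_tl.tendsto rfl).eventually (hb j)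
  obtain ⟨r₁, hr₁, hp⟩ := exists_polydisc_of_eventually ((h1.and h2).and (he.and (hu.and hbs)))
  set A := ‖(u 0)⁻¹‖ + 1 with hA
  have hA0 : 0 < A := by positivity
  set r := min r₀ r₁ with hr
  have hr0 : 0 < r := lt_min hr₀ hr₁
  obtain ⟨K, hK0, hK⟩ := exists_div_pow (n := n) hr0 d
  set ε := 1 / (2 * A * (K + 1)) with hε
  have hε0 : 0 < ε := by positivity
  have h3 : ∀ᶠ y in 𝓝 (0 : Fin n → ℂ), ∑ j ∈ Finset.range d, ‖b j y‖ * r ^ j < ε := by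
    have : ContinuousAt (fun y : Fin n → ℂ => ∑ j ∈ Finset.range d, ‖b j y‖ * r ^ j) 0 := by
      have := fun j => (hb j).continuousAt
      fun_prop
    refine this.eventually_lt_const ?_
    refine lt_of_eq_of_lt (Finset.sum_eq_zero fun j hj => ?_) hε0
    simp [hb0 j (Finset.mem_range.1 hj)]
  obtain ⟨ρ₁, hρ₁, hρp⟩ := Metric.eventually_nhds_iff_ball.1 h3
  set ρ := min (min r₀ r₁) ρ₁ with hρ
  have hρ0 : 0 < ρ := lt_min hr0 hρ₁
  have hsub : polydisc n r ρ ⊆ polydisc n r₁ r₁ := polydisc_subset (min_le_right _ _)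
    ((min_le_left _ _).trans (min_le_right _ _))
  refine ⟨r, ρ, K * A + K, hr0, min_le_left _ _, hρ0, (min_le_left _ _).trans (min_le_left _ _),
    by positivity, ?_, ?_⟩
  · intro x hx
    have hd : DifferentiableAt ℂ
        (fun x => ∑ j ∈ Finset.range d, b j (tl x) * x 0 ^ j + x 0 ^ d * u x) x := by
      have hux := (hp x (hsub hx)).2.2.1
      have hbx : ∀ j ∈ Finset.range d, DifferentiableAt ℂ (fun x => b j (tl x) * x 0 ^ j) x :=
        fun j hj => (DifferentiableAt.comp x ((hp x (hsub hx)).2.2.2 j hj)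
          differentiable_tl.differentiableAt).mul (by fun_prop)
      exact (DifferentiableAt.fun_sum hbx).add (by fun_prop)
    refine (hd.congr_of_eventuallyEq ?_).differentiableWithinAt
    filter_upwards [(isOpen_polydisc r ρ).mem_nhds hx] with y hy using (hp y (hsub hy)).2.1
  · rintro h M ⟨hM, hd, hbd⟩
    obtain ⟨c, S, hc, hcb, hS, hSb, hSe⟩ := hK ρ M hM h hd hbd
    refine ⟨fun x => S x * (u x)⁻¹, c, ?_, ?_, hc, fun j y hy => (hcb j y hy).trans ?_, ?_⟩
    · exact hS.mul fun x hx => ((hp x (hsub hx)).2.2.1.inv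
        (hp x (hsub hx)).1.2).differentiableWithinAt
    · intro x hx
      rw [norm_mul]
      calc ‖S x‖ * ‖(u x)⁻¹‖ ≤ (K * M) * A := by
            gcongr
            · exact hSb x hx
            · exact (hp x (hsub hx)).1.1
        _ ≤ (K * A + K) * M := by nlinarith [mul_nonneg hK0 hM]
    · nlinarith [mul_nonneg (mul_nonneg hK0 hA0.le) hM]
    · intro x hx
      obtain ⟨⟨hui, hu0⟩, hfe, -⟩ := hp x (hsub hx)
      have e : h x - (S x * (u x)⁻¹ * f x + ∑ j ∈ Finset.range d, c j (tl x) * x 0 ^ j) =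
          - (S x * (u x)⁻¹ * ∑ j ∈ Finset.range d, b j (tl x) * x 0 ^ j) := by
        rw [hSe x hx, hfe]; field_simp; ring
      have hP : ‖∑ j ∈ Finset.range d, b j (tl x) * x 0 ^ j‖ ≤ ε := by
        refine (norm_sum_le _ _).trans (le_trans (Finset.sum_le_sum fun j _ => ?_)
          (hρp (tl x) (by simpa using hx.2.trans_le (min_le_right _ _))).le)
        rw [norm_mul, norm_pow]
        gcongr
        exact hx.1.le
      rw [e, norm_neg, norm_mul, norm_mul]
      calc ‖S x‖ * ‖(u x)⁻¹‖ * _ ≤ (K * M) * A * ε := by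
            gcongr
            exact hSb x hx
        _ = K / (K + 1) * (M / 2) := by rw [hε]; field_simp
        _ ≤ 1 * (M / 2) := by gcongr; rw [div_le_one (by positivity)]; linarith
        _ = M / 2 := one_mul _

/-- **Weierstrass division theorem**. -/
theorem RegularOrder.exists_division {f : (Fin (n + 1) → ℂ) → ℂ} {d : ℕ} (hf : RegularOrder f d)
    {g : (Fin (n + 1) → ℂ) → ℂ} (hg : Hol g) :
    ∃ (q : (Fin (n + 1) → ℂ) → ℂ) (c : ℕ → (Fin n → ℂ) → ℂ), Hol q ∧ (∀ j, Hol (c j)) ∧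
      ∀ᶠ x in 𝓝 0, g x = q x * f x + ∑ j ∈ Finset.range d, c j (tl x) * x 0 ^ j := by
  have hbd : ∀ᶠ x in 𝓝 0, ‖g x‖ ≤ ‖g 0‖ + 1 :=
    (hg.continuousAt.norm.eventually_lt_const (lt_add_one _)).mono fun x hx => le_of_lt hx
  obtain ⟨r₀, hr₀, hp⟩ := exists_polydisc_of_eventually (hg.and hbd)
  obtain ⟨r, ρ, K, hr, hrr, hρ, hρr, hK, hfd, H⟩ := hf.exists_approx hr₀
  choose! Q C hQ hQb hC hCb hQC using H
  have hsub := polydisc_subset (n := n) hrr hρr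
  set M := ‖g 0‖ + 1 with hM
  have hM0 : 0 ≤ M := by positivity
  let h : ℕ → (Fin (n + 1) → ℂ) → ℂ := fun k => Nat.rec g (fun k h x => h x -
    (Q h (M / 2 ^ k) x * f x + ∑ j ∈ Finset.range d, C h (M / 2 ^ k) j (tl x) * x 0 ^ j)) k
  have hsucc : ∀ k x, h (k + 1) x = h k x - (Q (h k) (M / 2 ^ k) x * f x +
      ∑ j ∈ Finset.range d, C (h k) (M / 2 ^ k) j (tl x) * x 0 ^ j) := fun k x => rfl
  have hh : ∀ k, 0 ≤ M / 2 ^ k ∧ DifferentiableOn ℂ (h k) (polydisc n r ρ) ∧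
      ∀ x ∈ polydisc n r ρ, ‖h k x‖ ≤ M / 2 ^ k := by
    intro k
    induction k with
    | zero =>
      exact ⟨by positivity, fun x hx => (hp x (hsub hx)).1.differentiableWithinAt,
        fun x hx => by simpa [h] using (hp x (hsub hx)).2⟩
    | succ k ih =>
      refine ⟨by positivity, ?_, fun x hx => ?_⟩
      · refine DifferentiableOn.sub ih.2.1 (((hQ _ _ ih).mul hfd).add
          (DifferentiableOn.fun_sum fun j _ => DifferentiableOn.mul ?_ (by fun_prop)))
        exact (hC _ _ ih j).comp differentiable_tl.differentiableOn fun x hx => by simpa using hx.2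
      · rw [hsucc]
        refine (hQC _ _ ih x hx).trans (le_of_eq ?_)
        rw [pow_succ]; field_simp
  have hsum : Summable (fun k : ℕ => K * (M / 2 ^ k)) := by
    have := (summable_geometric_two.mul_left (K * M))
    refine this.congr fun k => ?_
    rw [one_div, inv_pow]; ring
  have hqs := fun x hx => Summable.of_norm_bounded hsum fun k => hQb _ _ (hh k) x hx
  have hcs := fun j y hy => Summable.of_norm_bounded hsum fun k => hCb _ _ (hh k) j y hy
  refine ⟨fun x => ∑' k, Q (h k) (M / 2 ^ k) x, fun j y => ∑' k, C (h k) (M / 2 ^ k) j y,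
    hol_of_differentiableOn (polydisc_mem_nhds hr hρ) ?_,
    fun j => hol_of_differentiableOn (Metric.ball_mem_nhds _ hρ) ?_, ?_⟩
  · exact differentiableOn_tsum_of_summable (isOpen_polydisc r ρ) hsum (fun k => hQ _ _ (hh k))
      fun k => hQb _ _ (hh k)
  · exact differentiableOn_tsum_of_summable Metric.isOpen_ball hsum (fun k => hC _ _ (hh k) j)
      fun k => hCb _ _ (hh k) j
  · filter_upwards [polydisc_mem_nhds hr hρ] with x hx
    have hx' : tl x ∈ Metric.ball (0 : Fin n → ℂ) ρ := by simpa using hx.2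
    have s1 := ((hqs x hx).hasSum.mul_right (f x)).add
      (hasSum_sum (s := Finset.range d) fun j _ => (hcs j _ hx').hasSum.mul_right (x 0 ^ j))
    have hpart : ∀ N, ∑ k ∈ Finset.range N, (Q (h k) (M / 2 ^ k) x * f x +
        ∑ j ∈ Finset.range d, C (h k) (M / 2 ^ k) j (tl x) * x 0 ^ j) = g x - h N x := by
      intro N
      induction N with
      | zero => simp [h]
      | succ N ih => rw [Finset.sum_range_succ, ih, hsucc]; ring
    have hN : Tendsto (fun N => h N x) atTop (𝓝 0) := by
      refine squeeze_zero_norm (fun k => (hh k).2.2 x hx) ?_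
      have := (tendsto_pow_atTop_nhds_zero_of_lt_one (r := (1 / 2 : ℝ)) (by norm_num)
        (by norm_num)).const_mul M
      simpa [div_eq_mul_inv] using this
    have s2 := s1.tendsto_sum_nat
    simp only [hpart] at s2
    have s3 := (tendsto_const_nhds (x := g x)).sub hN
    rw [sub_zero] at s3
    exact tendsto_nhds_unique s3 s2

/-- **Weierstrass preparation theorem**. -/
theorem RegularOrder.exists_preparation {f : (Fin (n + 1) → ℂ) → ℂ} {d : ℕ}
    (hf : RegularOrder f d) :
    ∃ (v : (Fin (n + 1) → ℂ) → ℂ) (c : ℕ → (Fin n → ℂ) → ℂ), Hol v ∧ v 0 ≠ 0 ∧ (∀ j, Hol (c j)) ∧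
      (∀ j < d, c j 0 = 0) ∧
      ∀ᶠ x in 𝓝 0, f x = v x * (x 0 ^ d + ∑ j ∈ Finset.range d, c j (tl x) * x 0 ^ j) := by
  obtain ⟨q, c, hq, hc, he⟩ := hf.exists_division ((hol_coord 0).pow d)
  obtain ⟨b, u, hb, hb0, hu, hu0, hfe⟩ := hf
  have hcont : ∀ {F : (Fin (n + 1) → ℂ) → ℂ}, Hol F → ContinuousAt (fun t : ℂ => F (cn t 0)) 0 :=
    fun hF => (hF.comp hol_cn_zero (by simp)).continuousAt
  have hev : ∀ᶠ t in 𝓝 (0 : ℂ), ∑ j ∈ Finset.range d, c j 0 * t ^ j =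
      t ^ d * (1 - q (cn t 0) * u (cn t 0)) := by
    filter_upwards [tendsto_cn_zero.eventually he, tendsto_cn_zero.eventually hfe] with t h1 h2
    simp only [tl_cn, cn_apply_zero] at h1 h2
    rw [Finset.sum_eq_zero (fun j hj => by rw [hb0 j (Finset.mem_range.1 hj), zero_mul]),
      zero_add] at h2
    rw [h2] at h1
    linear_combination -h1
  have hc0 : ∀ j < d, c j 0 = 0 := coeff_eq_zero_of_sum_eq_pow_mul
    (continuousAt_const.sub ((hcont hq).mul (hcont hu))) (hev.filter_mono nhdsWithin_le_nhds)
  have hq0 : q 0 ≠ 0 := by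
    have h1 : Tendsto (fun t : ℂ => 1 - q (cn t 0) * u (cn t 0)) (𝓝[≠] 0)
        (𝓝 (1 - q (cn 0 0) * u (cn 0 0))) :=
      (continuousAt_const.sub ((hcont hq).mul (hcont hu))).tendsto.mono_left nhdsWithin_le_nhds
    have h2 : (fun t : ℂ => 1 - q (cn t 0) * u (cn t 0)) =ᶠ[𝓝[≠] 0] fun _ => 0 := by
      filter_upwards [hev.filter_mono nhdsWithin_le_nhds, self_mem_nhdsWithin] with t h1 ht
      rw [Finset.sum_eq_zero (fun j hj => by rw [hc0 j (Finset.mem_range.1 hj), zero_mul])] at h1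
      exact (mul_eq_zero.1 h1.symm).resolve_left (pow_ne_zero d ht)
    have h3 := tendsto_nhds_unique (h1.congr' h2) tendsto_const_nhds
    intro h0
    simp [h0] at h3
  refine ⟨fun x => (q x)⁻¹, fun j y => - c j y, hq.inv hq0, inv_ne_zero hq0, fun j => (hc j).neg,
    fun j hj => by simp [hc0 j hj], ?_⟩
  filter_upwards [he, hq.continuousAt.eventually_ne hq0] with x h1 h2
  rw [h1]
  simp only [neg_mul, Finset.sum_neg_distrib]
  field_simp
  ring

end WeierstrassDivision

section GoodGerms

variable {n : ℕ}

/-- The substitution `x_i ↦ x_i ^ k`. -/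
def powMap (i : Fin n) (k : ℕ) (x : Fin n → ℂ) : Fin n → ℂ := Function.update x i (x i ^ k)

/-- The chart `x_j ↦ x_i (v + x_j)` of a blow-up in two coordinates. -/
def blowMap (i j : Fin n) (v : ℂ) (x : Fin n → ℂ) : Fin n → ℂ :=
  Function.update x j (x i * (v + x j))

theorem hol_update {i : Fin n} {F : (Fin n → ℂ) → ℂ} (hF : Hol F) :
    Hol (fun x => Function.update x i (F x)) := by
  apply Hol.pi
  intro j
  by_cases h : j = i
  · subst h; simpa using hF
  · simpa [h] using hol_coord j

theorem hol_powMap (i : Fin n) (k : ℕ) : Hol (powMap i k) := hol_update ((hol_coord i).pow k)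

theorem hol_blowMap (i j : Fin n) (v : ℂ) : Hol (blowMap i j v) :=
  hol_update ((hol_coord i).mul ((Hol.const v).add (hol_coord j)))

@[simp] theorem powMap_zero (i : Fin n) {k : ℕ} (hk : k ≠ 0) : powMap i k 0 = 0 := by
  simp [powMap, hk]

@[simp] theorem blowMap_zero (i j : Fin n) (v : ℂ) : blowMap i j v 0 = 0 := by
  simp [blowMap]

/-- Germs that can be made monomial by coordinate changes, ramified covers and blow-ups. -/
inductive Good : ((Fin n → ℂ) → ℂ) → Prop
  | mono {F : (Fin n → ℂ) → ℂ} : IsMono F → Good F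
  | coord {F : (Fin n → ℂ) → ℂ} (φ ψ : (Fin n → ℂ) → (Fin n → ℂ)) : Hol F → Hol φ → Hol ψ →
      φ 0 = 0 → ψ 0 = 0 → (∀ᶠ x in 𝓝 0, φ (ψ x) = x) → (∀ᶠ x in 𝓝 0, ψ (φ x) = x) →
      Good (fun x => F (φ x)) → Good F
  | pow {F : (Fin n → ℂ) → ℂ} (i : Fin n) (k : ℕ) : k ≠ 0 → Hol F →
      Good (fun x => F (powMap i k x)) → Good F
  | blow {F : (Fin n → ℂ) → ℂ} (i j : Fin n) : i ≠ j → Hol F →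
      Good (fun x => F (blowMap j i 0 x)) → (∀ v, Good (fun x => F (blowMap i j v x))) → Good F

theorem Good.congr {F : (Fin n → ℂ) → ℂ} (h : Good F) :
    ∀ {G : (Fin n → ℂ) → ℂ}, F =ᶠ[𝓝 0] G → Good G := by
  induction h with
  | mono h => exact fun e => .mono (h.congr e)
  | coord φ ψ hF hφ hψ hφ0 hψ0 h1 h2 _ ih =>
    exact fun e => .coord φ ψ (hF.congr e) hφ hψ hφ0 hψ0 h1 h2 (ih ((hφ.tendsto hφ0).eventually e))
  | pow i k hk hF _ ih =>
    exact fun e => .pow i k hk (hF.congr e)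
      (ih (((hol_powMap i k).tendsto (powMap_zero i hk)).eventually e))
  | blow i j hij hF _ _ ih1 ih2 =>
    exact fun e => .blow i j hij (hF.congr e)
      (ih1 (((hol_blowMap j i 0).tendsto (blowMap_zero j i 0)).eventually e))
      (fun v => ih2 v (((hol_blowMap i j v).tendsto (blowMap_zero i j v)).eventually e))

theorem Good.unit_mul {F : (Fin n → ℂ) → ℂ} (h : Good F) :
    ∀ {u : (Fin n → ℂ) → ℂ}, Hol u → u 0 ≠ 0 → Good (fun x => u x * F x) := by
  induction h with
  | mono h => exact fun hu hu0 => .mono ((IsMono.of_unit hu hu0).mul h)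
  | coord φ ψ hF hφ hψ hφ0 hψ0 h1 h2 _ ih =>
    exact fun hu hu0 => .coord φ ψ (hu.mul hF) hφ hψ hφ0 hψ0 h1 h2
      (ih (hu.comp hφ hφ0) (by simpa [hφ0]))
  | pow i k hk hF _ ih =>
    exact fun hu hu0 => .pow i k hk (hu.mul hF)
      (ih (hu.comp (hol_powMap i k) (powMap_zero i hk)) (by simpa [powMap_zero i hk]))
  | blow i j hij hF _ _ ih1 ih2 =>
    exact fun hu hu0 => .blow i j hij (hu.mul hF)
      (ih1 (hu.comp (hol_blowMap j i 0) (blowMap_zero j i 0)) (by simpa))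
      (fun v => ih2 v (hu.comp (hol_blowMap i j v) (blowMap_zero i j v)) (by simpa))

/-- A map of the last coordinates, extended by the identity of the first one. -/
def liftMap (μ : (Fin n → ℂ) → (Fin n → ℂ)) (x : Fin (n + 1) → ℂ) : Fin (n + 1) → ℂ :=
  cn (x 0) (μ (tl x))

theorem hol_liftMap {μ : (Fin n → ℂ) → (Fin n → ℂ)} (hμ : Hol μ) : Hol (liftMap μ) :=
  (hol_coord 0).consn (hμ.comp hol_tl rfl)

theorem liftMap_zero {μ : (Fin n → ℂ) → (Fin n → ℂ)} (hμ : μ 0 = 0) : liftMap μ 0 = 0 := by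
  simp [liftMap, hμ]

theorem update_succ (x : Fin (n + 1) → ℂ) (i : Fin n) (z : ℂ) :
    Function.update x i.succ z = cn (x 0) (Function.update (tl x) i z) := by
  funext j
  refine Fin.cases ?_ (fun j => ?_) j
  · simp [Function.update_of_ne (Fin.succ_ne_zero i).symm]
  · by_cases h : j = i
    · subst h; simp
    · simp [h, (Fin.succ_injective n).ne h]

theorem liftMap_powMap (i : Fin n) (k : ℕ) : liftMap (powMap i k) = powMap i.succ k := by
  funext x; simp [liftMap, powMap, update_succ]

theorem liftMap_blowMap (i j : Fin n) (v : ℂ) :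
    liftMap (blowMap i j v) = blowMap i.succ j.succ v := by
  funext x; simp [liftMap, blowMap, update_succ]

/-- To show that a germ is good, one may first make a germ in the last coordinates monomial. -/
theorem Good.lift {H : (Fin n → ℂ) → ℂ} (h : Good H) : ∀ {F : (Fin (n + 1) → ℂ) → ℂ}, Hol F →
    (∀ μ, Hol μ → μ 0 = 0 → IsMono (fun y => H (μ y)) → Good (fun x => F (liftMap μ x))) →
    Good F := by
  induction h with
  | mono h =>
    intro F hF hμ
    simpa [liftMap] using hμ (fun y => y) Hol.id rfl h
  | coord φ ψ hF hφ hψ hφ0 hψ0 h1 h2 _ ih =>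
    intro F hF hμ
    refine .coord (liftMap φ) (liftMap ψ) hF (hol_liftMap hφ) (hol_liftMap hψ) (liftMap_zero hφ0)
      (liftMap_zero hψ0) ?_ ?_ (ih (hF.comp (hol_liftMap hφ) (liftMap_zero hφ0)) ?_)
    · filter_upwards [(hol_tl.tendsto rfl).eventually h1] with x hx
      simp [liftMap, hx]
    · filter_upwards [(hol_tl.tendsto rfl).eventually h2] with x hx
      simp [liftMap, hx]
    · intro μ h3 h4 h5
      exact hμ (fun y => φ (μ y)) (hφ.comp h3 h4) (by simp [h4, hφ0]) h5
  | pow i k hk hF _ ih =>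
    intro F hF hμ
    refine .pow i.succ k hk hF ?_
    rw [← liftMap_powMap]
    have h0 := powMap_zero i hk
    refine ih (hF.comp (hol_liftMap (hol_powMap i k)) (liftMap_zero h0)) ?_
    intro μ h3 h4 h5
    exact hμ (fun y => powMap i k (μ y)) ((hol_powMap i k).comp h3 h4) (by simp [h4, h0]) h5
  | blow i j hij hF _ _ ih1 ih2 =>
    intro F hF hμ
    refine .blow i.succ j.succ ((Fin.succ_injective _).ne hij) hF ?_ fun v => ?_
    · rw [← liftMap_blowMap]
      refine ih1 (hF.comp (hol_liftMap (hol_blowMap j i 0)) (liftMap_zero (by simp))) ?_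
      intro μ h3 h4 h5
      exact hμ (fun y => blowMap j i 0 (μ y)) ((hol_blowMap j i 0).comp h3 h4) (by simp [h4]) h5
    · rw [← liftMap_blowMap]
      refine ih2 v (hF.comp (hol_liftMap (hol_blowMap i j v)) (liftMap_zero (by simp))) ?_
      intro μ h3 h4 h5
      exact hμ (fun y => blowMap i j v (μ y)) ((hol_blowMap i j v).comp h3 h4) (by simp [h4]) h5

/-- The substitution `x_i ↦ x_i ^ k` in several coordinates. -/
def powMaps (s : Finset (Fin n)) (k : ℕ) (x : Fin n → ℂ) : Fin n → ℂ :=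
  fun i => if i ∈ s then x i ^ k else x i

theorem hol_powMaps (s : Finset (Fin n)) (k : ℕ) : Hol (powMaps s k) := by
  apply Hol.pi
  intro i
  by_cases h : i ∈ s
  · simpa [powMaps, h] using (hol_coord i).pow k
  · simpa [powMaps, h] using hol_coord i

theorem Good.of_powMaps {F : (Fin n → ℂ) → ℂ} (hF : Hol F) {k : ℕ} (hk : k ≠ 0)
    (s : Finset (Fin n)) : Good (fun x => F (powMaps s k x)) → Good F := by
  induction s using Finset.induction_on with
  | empty =>
    intro h
    have e : ∀ x : Fin n → ℂ, powMaps ∅ k x = x := fun x => by funext i; simp [powMaps]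
    simpa only [e] using h
  | insert i s hi ih =>
    intro h
    refine ih (.pow i k hk (hF.comp (hol_powMaps s k) (by funext; simp [powMaps, hk])) ?_)
    convert h using 3 with x
    funext j
    by_cases hj : j = i
    · subst hj; simp [powMaps, powMap, hi]
    · simp [powMaps, powMap, hj]

theorem IsMono.comp_tl {g : (Fin n → ℂ) → ℂ} (h : IsMono g) :
    IsMono (fun x : Fin (n + 1) → ℂ => g (tl x)) := by
  obtain ⟨u, a, hu, hu0, h⟩ := h
  refine ⟨fun x => u (tl x), Fin.cons 0 a, hu.comp_tl, hu0, ?_⟩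
  filter_upwards [(hol_tl.tendsto rfl).eventually h] with x hx
  rw [hx]
  simp [mon, Fin.prod_univ_succ]

theorem IsMono.comp_powMaps {g : (Fin n → ℂ) → ℂ} (h : IsMono g) {k : ℕ} (hk : k ≠ 0) :
    IsMono (fun x : Fin n → ℂ => g (powMaps Finset.univ k x)) := by
  obtain ⟨u, a, hu, hu0, h⟩ := h
  have h0 : powMaps Finset.univ k (0 : Fin n → ℂ) = 0 := by funext; simp [powMaps, hk]
  refine ⟨_, k • a, hu.comp (hol_powMaps _ k) h0, by rwa [h0], ?_⟩
  filter_upwards [((hol_powMaps _ k).tendsto h0).eventually h] with x hx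
  rw [hx]
  congr 1
  simp only [mon, powMaps, Finset.mem_univ, if_true, ← pow_mul, Pi.smul_apply, smul_eq_mul]

end GoodGerms

section Monomialization

variable {n : ℕ}

/-- Coefficients of `(x - b) ^ d + ∑ r_j (x - b) ^ j` with respect to `x`. -/
def shiftCoeff (d : ℕ) (b : ℂ) (r : ℕ → ℂ) (j : ℕ) : ℂ :=
  (-b) ^ (d - j) * d.choose j + ∑ m ∈ Finset.range d, r m * ((-b) ^ (m - j) * m.choose j)

theorem sub_pow_add_sum_eq (d : ℕ) (b : ℂ) (r : ℕ → ℂ) (x : ℂ) :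
    (x - b) ^ d + ∑ j ∈ Finset.range d, r j * (x - b) ^ j =
      x ^ d + ∑ j ∈ Finset.range d, shiftCoeff d b r j * x ^ j := by
  have h1 : ∀ m < d, (x - b) ^ m =
      ∑ j ∈ Finset.range d, (-b) ^ (m - j) * m.choose j * x ^ j := by
    intro m hm
    rw [sub_eq_add_neg, add_pow]
    rw [← Finset.sum_subset (Finset.range_mono (show m + 1 ≤ d from hm))]
    · exact Finset.sum_congr rfl fun j _ => by ring
    · intro j _ hj
      rw [Nat.choose_eq_zero_of_lt (by simpa using hj)]; simp
  have h2 : (x - b) ^ d = x ^ d + ∑ j ∈ Finset.range d, (-b) ^ (d - j) * d.choose j * x ^ j := by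
    rw [sub_eq_add_neg, add_pow, Finset.sum_range_succ, add_comm]
    simp only [Nat.sub_self, pow_zero, Nat.choose_self, Nat.cast_one, mul_one]
    congr 1
    exact Finset.sum_congr rfl fun j _ => by ring
  rw [h2, add_assoc]
  congr 1
  have h3 : ∑ j ∈ Finset.range d, r j * (x - b) ^ j = ∑ m ∈ Finset.range d,
      ∑ j ∈ Finset.range d, r m * ((-b) ^ (m - j) * m.choose j * x ^ j) :=
    Finset.sum_congr rfl fun m hm => by rw [h1 m (by simpa using hm), Finset.mul_sum]
  rw [h3, Finset.sum_comm, ← Finset.sum_add_distrib]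
  refine Finset.sum_congr rfl fun j _ => ?_
  rw [shiftCoeff, add_mul, Finset.sum_mul]
  congr 1
  exact Finset.sum_congr rfl fun m _ => by ring

theorem shiftCoeff_pred (d : ℕ) (b : ℂ) (r : ℕ → ℂ) :
    shiftCoeff (d + 1) b r d = r d - (d + 1) * b := by
  rw [shiftCoeff, Finset.sum_range_succ, Finset.sum_eq_zero]
  · simp; ring
  · intro m hm
    rw [Nat.choose_eq_zero_of_lt (by simpa using hm)]; simp

theorem shiftCoeff_zero_of {d : ℕ} {r : ℕ → ℂ} (h : ∀ j < d, r j = 0) {j : ℕ} (hj : j < d) :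
    shiftCoeff d 0 r j = 0 := by
  rw [shiftCoeff, Finset.sum_eq_zero]
  · simp [show d - j ≠ 0 by omega]
  · intro m hm
    rw [h m (by simpa using hm)]; simp

theorem Hol.shiftCoeff {X : Type*} [NormedAddCommGroup X] [NormedSpace ℂ X] {b : X → ℂ}
    {r : ℕ → X → ℂ} (hb : Hol b) (hr : ∀ j, Hol (r j)) (d j : ℕ) :
    Hol (fun x => shiftCoeff d (b x) (fun m => r m x) j) := by
  unfold _root_.shiftCoeff
  exact ((hb.neg.pow _).mul (Hol.const _)).add
    (Hol.sum fun m _ => (hr m).mul ((hb.neg.pow _).mul (Hol.const _)))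

/-- A Weierstrass polynomial in the first coordinate times a function of the other ones. -/
def wp (d : ℕ) (c : (Fin n → ℂ) → ℂ) (r : ℕ → (Fin n → ℂ) → ℂ) (x : Fin (n + 1) → ℂ) : ℂ :=
  c (tl x) * (x 0 ^ d + ∑ j ∈ Finset.range d, r j (tl x) * x 0 ^ j)

theorem hol_wp {c : (Fin n → ℂ) → ℂ} {r : ℕ → (Fin n → ℂ) → ℂ} (d : ℕ) (hc : Hol c)
    (hr : ∀ j, Hol (r j)) : Hol (wp d c r) :=
  hc.comp_tl.mul (((hol_coord 0).pow d).add
    (Hol.sum fun j _ => (hr j).comp_tl.mul ((hol_coord 0).pow j)))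

theorem wp_liftMap (d : ℕ) (c : (Fin n → ℂ) → ℂ) (r : ℕ → (Fin n → ℂ) → ℂ)
    (μ : (Fin n → ℂ) → (Fin n → ℂ)) (x : Fin (n + 1) → ℂ) :
    wp d c r (liftMap μ x) = wp d (fun y => c (μ y)) (fun j y => r j (μ y)) x := by
  simp [wp, liftMap]

/-- One may make a finite family of germs in the last coordinates monomial or zero. -/
theorem Good.lift_family (hn : ∀ H : (Fin n → ℂ) → ℂ, Hol H → ¬ H =ᶠ[𝓝 0] 0 → Good H)
    {ι : Type*} (s : Finset ι) (g : ι → (Fin n → ℂ) → ℂ) (hg : ∀ i ∈ s, Hol (g i))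
    {F : (Fin (n + 1) → ℂ) → ℂ} (hF : Hol F)
    (h : ∀ μ, Hol μ → μ 0 = 0 → (∀ i ∈ s, (g i =ᶠ[𝓝 0] 0 ∧ (fun y => g i (μ y)) =ᶠ[𝓝 0] 0) ∨
      IsMono (fun y => g i (μ y))) → Good (fun x => F (liftMap μ x))) : Good F := by
  classical
  set G : ι → (Fin n → ℂ) → ℂ := fun i => if g i =ᶠ[𝓝 0] 0 then fun _ => 1 else g i with hG
  have hGh : ∀ i ∈ s, Hol (G i) := by
    intro i hi
    by_cases h0 : g i =ᶠ[𝓝 0] 0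
    · simpa only [hG, if_pos h0] using Hol.const 1
    · simpa only [hG, if_neg h0] using hg i hi
  have hGn : ∀ i ∈ s, ¬ G i =ᶠ[𝓝 0] 0 := by
    intro i hi
    by_cases h0 : g i =ᶠ[𝓝 0] 0
    · simp only [hG, if_pos h0]; exact not_eventually_zero_of_apply (by simp)
    · simpa only [hG, if_neg h0] using h0
  refine Good.lift (hn (fun y => ∏ i ∈ s, G i y) (Hol.prod hGh) (Hol.prod_ne_zero hGh hGn)) hF ?_
  intro μ hμ hμ0 hm
  refine h μ hμ hμ0 fun i hi => ?_
  by_cases h0 : g i =ᶠ[𝓝 0] 0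
  · exact .inl ⟨h0, (hμ.tendsto hμ0).eventually h0⟩
  · have := IsMono.of_prod (F := fun i y => G i (μ y)) (fun i hi => (hGh i hi).comp hμ hμ0) hm hi
    simp only [hG, if_neg h0] at this
    exact .inr this

/-- The induction hypothesis on the degree of Weierstrass polynomials. -/
def GoodDeg (n d : ℕ) : Prop :=
  ∀ (c : (Fin n → ℂ) → ℂ) (r : ℕ → (Fin n → ℂ) → ℂ), Hol c → ¬ c =ᶠ[𝓝 0] 0 → (∀ j, Hol (r j)) →
    (∀ j < d, r j 0 = 0) → Good (wp d c r)

theorem good_of_lower_order {d : ℕ} (hd : ∀ k < d, GoodDeg n k) {c : (Fin n → ℂ) → ℂ} (hc : Hol c)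
    (hc0 : ¬ c =ᶠ[𝓝 0] 0) {f : (Fin (n + 1) → ℂ) → ℂ} (hf : Hol f) {a : ℕ → ℂ}
    (ha : ∀ᶠ t in 𝓝 (0 : ℂ), f (cn t 0) = t ^ d + ∑ j ∈ Finset.range d, a j * t ^ j)
    {j : ℕ} (hj : j < d) (haj : a j ≠ 0) : Good (fun x => c (tl x) * f x) := by
  have hne : ¬ ∀ᶠ t in 𝓝 (0 : ℂ), f (cn t 0) = 0 := by
    intro h
    refine haj (coeff_eq_zero_of_sum_eq_pow_mul (v := fun _ => -1) continuousAt_const ?_ j hj)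
    refine Filter.Eventually.filter_mono nhdsWithin_le_nhds ?_
    filter_upwards [h, ha] with t h1 h2
    rw [h1] at h2
    linear_combination -h2
  obtain ⟨k, hk, w, hw, hfw⟩ := hf.exists_regularOrder hne
  have hkd : k < d := by
    by_contra! hkd
    refine haj (coeff_eq_zero_of_sum_eq_pow_mul (v := fun t => t ^ (k - d) * w t - 1)
      (by fun_prop) ?_ j hj)
    refine Filter.Eventually.filter_mono nhdsWithin_le_nhds ?_
    filter_upwards [hfw, ha] with t h1 h2
    rw [h1] at h2
    have : t ^ k = t ^ d * t ^ (k - d) := by rw [← pow_add]; congr 1; omega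
    rw [this] at h2
    linear_combination -h2
  obtain ⟨v, r, hv, hv0, hr, hr0, e⟩ := hk.exists_preparation
  refine ((hd k hkd c r hc hc0 hr hr0).unit_mul hv hv0).congr ?_
  filter_upwards [e] with x hx
  rw [hx, wp]; ring

theorem good_wp_mono_aux {d : ℕ} (hd : ∀ k < d, GoodDeg n k) (N : ℕ) :
    ∀ (γ : Fin n → ℕ) (c : (Fin n → ℂ) → ℂ) (s : ℕ → (Fin n → ℂ) → ℂ), ∑ i, γ i = N →
      IsMono c → (∀ j, Hol (s j)) → (∀ j, j + 1 = d → s j 0 = 0) →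
      (∃ j < d, s j 0 ≠ 0) → Good (wp d c fun j y => mon γ y ^ (d - j) * s j y) := by
  induction N with
  | zero =>
    intro γ c s hγ hc hs _ ⟨j, hj, hj0⟩
    have hγ0 : γ = 0 := by
      funext i; exact (Finset.sum_eq_zero_iff.1 hγ) i (Finset.mem_univ i)
    subst hγ0
    simp only [mon_zero, one_pow, one_mul]
    refine good_of_lower_order hd hc.hol hc.ne_zero (a := fun j => s j 0)
      (f := fun x => x 0 ^ d + ∑ j ∈ Finset.range d, s j (tl x) * x 0 ^ j) ?_ ?_ hj hj0
    · exact ((hol_coord 0).pow d).add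
        (Hol.sum fun j _ => (hs j).comp_tl.mul ((hol_coord 0).pow j))
    · simp
  | succ N ih =>
    intro γ c s hγ hc hs hpred hex
    obtain ⟨i, hi⟩ : ∃ i, γ i ≠ 0 := by
      by_contra! hcon
      simp [hcon] at hγ
    set γ' : Fin n → ℕ := γ - Pi.single i 1 with hγ'
    have hadd : γ = Pi.single i 1 + γ' := by
      funext j
      by_cases hj : j = i
      · subst hj; simp [hγ']; omega
      · simp [hγ', hj]
    have hγN : ∑ i, γ' i = N := by
      rw [hadd] at hγ
      simp [Finset.sum_add_distrib] at hγ
      omega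
    have hmon : ∀ y, mon γ y = y i * mon γ' y := fun y => by rw [hadd, mon_add, mon_single]
    have hr : ∀ j, Hol fun y => mon γ y ^ (d - j) * s j y := fun j => ((hol_mon γ).pow _).mul (hs j)
    refine .blow i.succ 0 (Fin.succ_ne_zero i) (hol_wp d hc.hol hr) ?_ fun v => ?_
    · -- the chart at infinity
      have htl : ∀ x : Fin (n + 1) → ℂ,
          tl (blowMap 0 i.succ 0 x) = Function.update (tl x) i (x 0 * x i.succ) := fun x => by
        simp [blowMap, update_succ]
      have h0 : ∀ x : Fin (n + 1) → ℂ, blowMap 0 i.succ 0 x 0 = x 0 := fun x => by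
        simp [blowMap, update_succ]
      have hupd : ∀ (a : Fin n → ℕ) (x : Fin (n + 1) → ℂ),
          mon a (Function.update (tl x) i (x 0 * x i.succ)) = x 0 ^ a i * mon a (tl x) := by
        intro a x
        simp only [mon]
        rw [← Finset.mul_prod_erase Finset.univ _ (Finset.mem_univ i),
          ← Finset.mul_prod_erase Finset.univ (fun j => tl x j ^ a j) (Finset.mem_univ i)]
        rw [Finset.prod_congr rfl (g := fun j => tl x j ^ a j) fun j hj => by
          rw [Function.update_of_ne (Finset.ne_of_mem_erase hj)]]
        simp only [Function.update_self, mul_pow, tl_apply]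
        ring
      have hB : Hol fun x : Fin (n + 1) → ℂ => Function.update (tl x) i (x 0 * x i.succ) := by
        have := hol_tl.comp (hol_blowMap 0 i.succ 0) (blowMap_zero (n := n + 1) 0 i.succ 0)
        exact this.congr (Eventually.of_forall htl)
      have hB0 : Function.update (tl (0 : Fin (n + 1) → ℂ)) i
          ((0 : Fin (n + 1) → ℂ) 0 * (0 : Fin (n + 1) → ℂ) i.succ) = 0 := by simp
      have hcm : IsMono fun x : Fin (n + 1) → ℂ =>
          c (Function.update (tl x) i (x 0 * x i.succ)) := by
        obtain ⟨u, a, hu, hu0, e⟩ := hc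
        have h1 : IsMono fun x : Fin (n + 1) → ℂ =>
            u (Function.update (tl x) i (x 0 * x i.succ)) :=
          IsMono.of_unit (hu.comp hB hB0) (by rwa [hB0])
        have h2 : IsMono fun x : Fin (n + 1) → ℂ => mon a (tl x) := (isMono_mon a).comp_tl
        refine (h1.mul (((isMono_coord 0).pow (a i)).mul h2)).congr ?_
        filter_upwards [(hB.tendsto hB0).eventually e] with x hx
        rw [hx, hupd]
      have hunit : IsMono fun x : Fin (n + 1) → ℂ => 1 + ∑ j ∈ Finset.range d,
          (x 0 ^ (γ' i * (d - j)) * mon γ (tl x) ^ (d - j)) *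
            s j (Function.update (tl x) i (x 0 * x i.succ)) := by
        refine IsMono.of_unit ((Hol.const 1).add (Hol.sum fun j _ => ?_)) ?_
        · exact (((hol_coord 0).pow _).mul ((hol_mon γ).comp_tl.pow _)).mul ((hs j).comp hB hB0)
        · rw [Finset.sum_eq_zero]
          · simp
          · intro j hj
            have : d - j ≠ 0 := by have := Finset.mem_range.1 hj; omega
            rw [tl_zero, mon_apply_zero hi (by simp)]
            simp [this]
      refine .mono (((hcm.mul ((isMono_coord 0).pow d)).mul hunit).congr
        (Eventually.of_forall fun x => ?_))
      simp only [wp, htl, h0, hupd]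
      rw [mul_assoc, mul_add, mul_one, Finset.mul_sum]
      congr 2
      refine Finset.sum_congr rfl fun j hj => ?_
      have hj := Finset.mem_range.1 hj
      have hgi : γ i = γ' i + 1 := by simp [hγ']; omega
      have : x 0 ^ d = x 0 ^ (d - j) * x 0 ^ j := by rw [← pow_add]; congr 1; omega
      rw [this, hgi, pow_mul]
      ring
    · have key : (fun x => wp d c (fun j y => mon γ y ^ (d - j) * s j y) (blowMap i.succ 0 v x)) =
          fun x => (c (tl x) * tl x i ^ d) * ((v + x 0) ^ d + ∑ j ∈ Finset.range d,
            (mon γ' (tl x) ^ (d - j) * s j (tl x)) * (v + x 0) ^ j) := by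
        funext x
        have htl : tl (blowMap i.succ 0 v x) = tl x := by
          funext k; simp [blowMap]
        simp only [wp, htl, hmon]
        simp only [blowMap, Function.update_self, ← tl_apply]
        rw [mul_assoc, mul_add (tl x i ^ d), Finset.mul_sum, mul_pow]
        congr 2
        refine Finset.sum_congr rfl fun j hj => ?_
        have hj := Finset.mem_range.1 hj
        have : tl x i ^ d = tl x i ^ (d - j) * tl x i ^ j := by rw [← pow_add]; congr 1; omega
        rw [this, mul_pow, mul_pow]
        ring
      rw [key]
      have hcm : IsMono fun y => c y * y i ^ d := hc.mul ((isMono_coord i).pow d)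
      by_cases hv : v = 0
      · subst hv
        simp only [zero_add]
        exact ih γ' _ s hγN hcm hs hpred hex
      · obtain ⟨k, rfl⟩ : ∃ k, d = k + 1 := by
          obtain ⟨j, hj, _⟩ := hex
          exact ⟨d - 1, by omega⟩
        set b : ℕ → ℂ := fun j => mon γ' 0 ^ (k + 1 - j) * s j 0
        refine good_of_lower_order hd hcm.hol hcm.ne_zero (a := shiftCoeff (k + 1) (-v) b)
          (f := fun x => (v + x 0) ^ (k + 1) + ∑ j ∈ Finset.range (k + 1),
            (mon γ' (tl x) ^ (k + 1 - j) * s j (tl x)) * (v + x 0) ^ j) ?_ ?_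
          (Nat.lt_succ_self k) ?_
        · have h1 : Hol fun x : Fin (n + 1) → ℂ => v + x 0 := (Hol.const v).add (hol_coord 0)
          exact (h1.pow _).add (Hol.sum fun j _ =>
            (((hol_mon γ').comp_tl.pow _).mul (hs j).comp_tl).mul (h1.pow j))
        · refine Eventually.of_forall fun t => ?_
          rw [← sub_pow_add_sum_eq]
          simp only [cn_apply_zero, tl_cn, b, sub_neg_eq_add, add_comm t v]
        · rw [shiftCoeff_pred]
          simp only [b, hpred k rfl, mul_zero, zero_sub, mul_neg, neg_neg]
          exact mul_ne_zero (by exact_mod_cast Nat.succ_ne_zero k) hv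

theorem good_wp_of_mono {d : ℕ} (hd : ∀ k < d, GoodDeg n k) {c : (Fin n → ℂ) → ℂ}
    {r : ℕ → (Fin n → ℂ) → ℂ} (hc : IsMono c) (hr : ∀ j, Hol (r j))
    (hpred : ∀ j, j + 1 = d → r j =ᶠ[𝓝 0] 0) (hm : ∀ j < d, r j =ᶠ[𝓝 0] 0 ∨ IsMono (r j))
    (hcmp : ∀ j < d, ∀ k < d,
      (fun y => r j y ^ (d.factorial / (d - j)) - r k y ^ (d.factorial / (d - k))) =ᶠ[𝓝 0] 0 ∨
      IsMono fun y => r j y ^ (d.factorial / (d - j)) - r k y ^ (d.factorial / (d - k))) :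
    Good (wp d c r) := by
  classical
  set N := d.factorial with hN
  have hN0 : N ≠ 0 := Nat.factorial_ne_zero d
  by_cases hall : ∀ j < d, r j =ᶠ[𝓝 0] 0
  · refine .mono ((hc.comp_tl.mul ((isMono_coord 0).pow d)).congr ?_)
    have : ∀ᶠ y in 𝓝 (0 : Fin n → ℂ), ∀ j ∈ Finset.range d, r j y = 0 :=
      (Filter.eventually_all_finset _).2 fun j hj => hall j (Finset.mem_range.1 hj)
    filter_upwards [(hol_tl.tendsto rfl).eventually this] with x hx
    rw [wp, Finset.sum_eq_zero fun j hj => by rw [hx j hj, zero_mul], add_zero]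
  push Not at hall
  have hu : ∀ j, ∃ (u : (Fin n → ℂ) → ℂ) (a : Fin n → ℕ), Hol u ∧
      (j < d → ¬ r j =ᶠ[𝓝 0] 0 → u 0 ≠ 0) ∧ (j < d → r j =ᶠ[𝓝 0] 0 → u = 0) ∧
      (j < d → r j =ᶠ[𝓝 0] fun x => u x * mon a x) := by
    intro j
    by_cases hj : j < d
    · by_cases h0 : r j =ᶠ[𝓝 0] 0
      · exact ⟨0, 0, Hol.const 0, fun _ h => (h h0).elim, fun _ _ => rfl, fun _ => h0.trans (by simp; rfl)⟩
      · obtain ⟨u, a, hu, hu0, e⟩ := (hm j hj).resolve_left h0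
        exact ⟨u, a, hu, fun _ _ => hu0, fun _ h => (h0 h).elim, fun _ => e⟩
    · exact ⟨0, 0, Hol.const 0, fun h => (hj h).elim, fun h => (hj h).elim, fun h => (hj h).elim⟩
  choose u a hu hu0 huz e using hu
  set A : ℕ → Fin n → ℕ := fun j => (N / (d - j)) • a j with hA
  set J : Finset ℕ := (Finset.range d).filter fun j => ¬ r j =ᶠ[𝓝 0] 0 with hJ
  have hJne : J.Nonempty := by
    obtain ⟨j, hj, h⟩ := hall
    exact ⟨j, by simp only [hJ, Finset.mem_filter, Finset.mem_range]; exact ⟨hj, h⟩⟩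
  have hJd : ∀ j ∈ J, j < d := fun j hj => by simpa using (Finset.mem_filter.1 hj).1
  have hJ0 : ∀ j ∈ J, ¬ r j =ᶠ[𝓝 0] 0 := fun j hj => (Finset.mem_filter.1 hj).2
  have hpowe : ∀ j ∈ J, (fun y => r j y ^ (N / (d - j))) =ᶠ[𝓝 0]
      fun y => u j y ^ (N / (d - j)) * mon (A j) y := by
    intro j hj
    filter_upwards [e j (hJd j hj)] with y hy
    rw [hy, mul_pow, hA, mon_nsmul]
  have htot : ∀ j ∈ J, ∀ k ∈ J, A j ≤ A k ∨ A k ≤ A j := by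
    intro j hj k hk
    have hv := (hu j).pow (N / (d - j))
    have hw := (hu k).pow (N / (d - k))
    have hv0 : u j 0 ^ (N / (d - j)) ≠ 0 := _root_.pow_ne_zero _ (hu0 j (hJd j hj) (hJ0 j hj))
    have hw0 : u k 0 ^ (N / (d - k)) ≠ 0 := _root_.pow_ne_zero _ (hu0 k (hJd k hk) (hJ0 k hk))
    rcases hcmp j (hJd j hj) k (hJd k hk) with h | ⟨w, b, h1, h2, h3⟩
    · refine exponents_comparable (((Hol.const 2).mul hv)) hw hv (by simpa using hv0) hw0 hv0
        (e := A j) ?_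
      filter_upwards [h, hpowe j hj, hpowe k hk] with y h1 h2 h3
      simp only [h2, h3] at h1
      have h1 : u j y ^ (N / (d - j)) * mon (A j) y - u k y ^ (N / (d - k)) * mon (A k) y = 0 := h1
      linear_combination h1
    · refine exponents_comparable hv hw h1 hv0 hw0 h2 (e := b) ?_
      filter_upwards [h3, hpowe j hj, hpowe k hk] with y h1 h2 h3
      simp only [h2, h3] at h1
      exact h1
  obtain ⟨j0, hj0, hmin⟩ : ∃ j0 ∈ J, ∀ j ∈ J, A j0 ≤ A j := by
    obtain ⟨j0, hj0⟩ := J.exists_minimalFor A hJne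
    exact ⟨j0, hj0.1, fun j hj => (htot j0 hj0.1 j hj).elim id fun h => hj0.2 hj h⟩
  set γ := A j0 with hγ
  have hle : ∀ j ∈ J, (d - j) • γ ≤ N • a j := by
    intro j hj
    have h1 := smul_le_smul_of_nonneg_left (hmin j hj) (Nat.zero_le (d - j))
    refine h1.trans (le_of_eq ?_)
    have := hJd j hj
    rw [hA, smul_smul, Nat.mul_div_cancel' (Nat.dvd_factorial (by omega) (by omega))]
  have heq : (d - j0) • γ = N • a j0 := by
    have := hJd j0 hj0
    rw [hγ, hA, smul_smul, Nat.mul_div_cancel' (Nat.dvd_factorial (by omega) (by omega))]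
  have h0 : powMaps Finset.univ N (0 : Fin n → ℂ) = 0 := by funext; simp [powMaps, hN0]
  have hP := hol_powMaps (Finset.univ : Finset (Fin n)) N
  have hmonP : ∀ (b : Fin n → ℕ) (y : Fin n → ℂ),
      mon b (powMaps Finset.univ N y) = mon (N • b) y := by
    intro b y
    simp only [mon, powMaps, Finset.mem_univ, if_true, ← pow_mul, Pi.smul_apply, smul_eq_mul]
  set s : ℕ → (Fin n → ℂ) → ℂ := fun j y =>
    u j (powMaps Finset.univ N y) * mon (N • a j - (d - j) • γ) y with hs
  have hmain := good_wp_mono_aux hd (∑ i, γ i) γ (fun y => c (powMaps Finset.univ N y)) s rfl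
    (hc.comp_powMaps hN0) (fun j => ((hu j).comp hP h0).mul (hol_mon _))
    (fun j hj => by simp [hs, huz j (by omega) (hpred j hj)])
    ⟨j0, hJd j0 hj0, by
      simp only [hs, h0, heq, tsub_self, mon_zero, mul_one]
      exact hu0 j0 (hJd j0 hj0) (hJ0 j0 hj0)⟩
  refine Good.of_powMaps (hol_wp d hc.hol hr) hN0 (Finset.univ.map ⟨Fin.succ, Fin.succ_injective _⟩)
    (hmain.congr ?_)
  have hev : ∀ᶠ y in 𝓝 (0 : Fin n → ℂ), ∀ j ∈ Finset.range d, r j y = u j y * mon (a j) y :=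
    (Filter.eventually_all_finset _).2 fun j hj => e j (Finset.mem_range.1 hj)
  filter_upwards [((hP.comp hol_tl rfl).tendsto (by simpa using h0)).eventually hev] with x hx
  have hx0 : powMaps (Finset.univ.map ⟨Fin.succ, Fin.succ_injective _⟩) N x 0 = x 0 := by
    simp [powMaps, Fin.succ_ne_zero]
  have hxt : tl (powMaps (Finset.univ.map ⟨Fin.succ, Fin.succ_injective _⟩) N x) =
      powMaps Finset.univ N (tl x) := by
    funext i; simp [powMaps]
  rw [wp, wp, hx0, hxt]
  congr 2
  refine Finset.sum_congr rfl fun j hj => ?_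
  rw [hx j hj]
  congr 1
  have hjd := Finset.mem_range.1 hj
  by_cases hjJ : r j =ᶠ[𝓝 0] 0
  · simp [hs, huz j hjd hjJ]
  · have hjJ : j ∈ J := by
      simp only [hJ, Finset.mem_filter, Finset.mem_range]; exact ⟨hjd, hjJ⟩
    simp only [hs]
    rw [hmonP, ← mon_nsmul, ← add_tsub_cancel_of_le (hle j hjJ), mon_add,
      add_tsub_cancel_of_le (hle j hjJ)]
    ring

theorem goodDeg (hn : ∀ H : (Fin n → ℂ) → ℂ, Hol H → ¬ H =ᶠ[𝓝 0] 0 → Good H) (d : ℕ) :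
    GoodDeg n d := by
  induction d using Nat.strong_induction_on with
  | _ d ih =>
    -- polynomials without term of second highest degree
    have key : ∀ (c : (Fin n → ℂ) → ℂ) (r : ℕ → (Fin n → ℂ) → ℂ), Hol c → ¬ c =ᶠ[𝓝 0] 0 →
        (∀ j, Hol (r j)) → (∀ j < d, r j 0 = 0) → (∀ j, j + 1 = d → r j =ᶠ[𝓝 0] 0) →
        Good (wp d c r) := by
      intro c r hc hc0 hr hr0 hpred
      set g : Option (ℕ ⊕ ℕ × ℕ) → (Fin n → ℂ) → ℂ := fun o => match o with
        | none => c
        | some (.inl j) => r j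
        | some (.inr p) => fun y =>
          r p.1 y ^ (d.factorial / (d - p.1)) - r p.2 y ^ (d.factorial / (d - p.2)) with hg
      have hgh : ∀ o, Hol (g o) := by
        rintro (_ | (j | ⟨j, k⟩))
        · exact hc
        · exact hr j
        · exact ((hr j).pow _).sub ((hr k).pow _)
      refine Good.lift_family hn (Finset.insertNone ((Finset.range d).disjSum
        (Finset.range d ×ˢ Finset.range d))) g (fun o _ => hgh o) (hol_wp d hc hr) ?_
      intro μ hμ hμ0 hfam
      simp only [wp_liftMap]
      refine good_wp_of_mono ih ?_ (fun j => (hr j).comp hμ hμ0)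
        (fun j hj => (hμ.tendsto hμ0).eventually (hpred j hj)) ?_ ?_
      · exact (hfam none (by simp)).resolve_left fun h => hc0 h.1
      · intro j hj
        exact (hfam (some (.inl j)) (by simpa using hj)).imp_left (·.2)
      · intro j hj k hk
        exact (hfam (some (.inr (j, k))) (by simpa using ⟨hj, hk⟩)).imp_left (·.2)
    intro c r hc hc0 hr hr0
    set b : (Fin n → ℂ) → ℂ := fun y => (d : ℂ)⁻¹ * r (d - 1) y with hb
    have hbh : Hol b := (Hol.const _).mul (hr _)
    by_cases hd : d = 0
    · subst hd
      exact key c r hc hc0 hr hr0 (fun j hj => by omega)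
    have hb0 : b 0 = 0 := by simp [hb, hr0 (d - 1) (by omega)]
    refine .coord (fun x => cn (x 0 - b (tl x)) (tl x)) (fun x => cn (x 0 + b (tl x)) (tl x))
      (hol_wp d hc hr) (((hol_coord 0).sub hbh.comp_tl).consn hol_tl)
      (((hol_coord 0).add hbh.comp_tl).consn hol_tl) (by simp [hb0]) (by simp [hb0])
      (by simp) (by simp) ?_
    refine (key c (fun j y => shiftCoeff d (b y) (fun m => r m y) j) hc hc0
      (fun j => hbh.shiftCoeff hr d j) ?_ ?_).congr ?_
    · intro j hj
      rw [hb0]; exact shiftCoeff_zero_of hr0 hj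
    · rintro j rfl
      refine Eventually.of_forall fun y => ?_
      have : ((j : ℂ) + 1) ≠ 0 := by exact_mod_cast Nat.succ_ne_zero j
      simp only [shiftCoeff_pred, hb, Nat.add_sub_cancel, Nat.cast_add, Nat.cast_one, Pi.zero_apply]
      field_simp
      simp
    · refine Eventually.of_forall fun x => ?_
      simp only [wp, tl_cn, cn_apply_zero]
      rw [sub_pow_add_sum_eq]

theorem exists_line_ne_zero {X : Type*} [NormedAddCommGroup X] [NormedSpace ℂ X] {F : X → ℂ}
    (hF : Hol F) (h : ¬ F =ᶠ[𝓝 0] 0) : ∃ v : X, ¬ ∀ᶠ t in 𝓝 (0 : ℂ), F (t • v) = 0 := by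
  obtain ⟨r, hr, hd⟩ := hF.exists_ball
  by_contra! hcon
  apply h
  filter_upwards [Metric.ball_mem_nhds 0 hr] with v hv
  set S : Set ℂ := (fun t : ℂ => t • v) ⁻¹' Metric.ball 0 r with hS
  have hSo : IsOpen S := Metric.isOpen_ball.preimage (by fun_prop)
  have hSc : Convex ℝ S := by
    intro t ht s hs a b ha hb hab
    have h1 := (convex_ball (0 : X) r) ht hs ha hb hab
    simp only [hS, Set.mem_preimage] at h1 ⊢
    convert h1 using 1
    rw [add_smul, smul_assoc, smul_assoc]
  have hdS : DifferentiableOn ℂ (fun t : ℂ => F (t • v)) S :=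
    hd.comp (by fun_prop) fun t ht => ht
  have h0 : (0 : ℂ) ∈ S := by simp [hS, hr]
  have h1 : (1 : ℂ) ∈ S := by simpa [hS] using hv
  have := (hdS.analyticOnNhd hSo).eqOn_zero_of_preconnected_of_eventuallyEq_zero hSc.isPreconnected
    h0 (hcon v) h1
  simpa using this

theorem good_of_ne_zero {n : ℕ} : ∀ {F : (Fin n → ℂ) → ℂ}, Hol F → ¬ F =ᶠ[𝓝 0] 0 → Good F := by
  induction n with
  | zero =>
    intro F hF h
    refine .mono (IsMono.of_unit hF fun h0 => h ?_)
    exact Eventually.of_forall fun x => by rw [Subsingleton.elim x 0, h0]; rfl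
  | succ n ih =>
    intro F hF h
    by_cases h0 : F 0 = 0
    swap
    · exact .mono (IsMono.of_unit hF h0)
    obtain ⟨v, hv⟩ := exists_line_ne_zero hF h
    have hv0 : v ≠ 0 := by
      rintro rfl
      exact hv (by simp [h0])
    have he : (Pi.single 0 1 : Fin (n + 1) → ℂ) ≠ 0 := by simp
    obtain ⟨L, hL⟩ := SeparatingDual.exists_continuousLinearEquiv_apply_eq (R := ℂ) he hv0
    refine .coord L L.symm hF L.differentiable.hol L.symm.differentiable.hol (by simp) (by simp)
      (by simp) (by simp) ?_
    have hFL : Hol fun x => F (L x) := hF.comp L.differentiable.hol (by simp)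
    have hcn : ∀ t : ℂ, cn t (0 : Fin n → ℂ) = t • (Pi.single 0 1 : Fin (n + 1) → ℂ) := by
      intro t; funext i; refine Fin.cases (by simp) (fun i => by simp) i
    obtain ⟨d, hd, _⟩ := hFL.exists_regularOrder (by simpa [hcn, hL] using hv)
    obtain ⟨w, r, hw, hw0, hr, hr0, e⟩ := hd.exists_preparation
    refine ((goodDeg (fun H => ih) d (fun _ => 1) r (Hol.const 1)
      (not_eventually_zero_of_apply (by simp)) hr hr0).unit_mul hw hw0).congr ?_
    filter_upwards [e] with x hx
    rw [hx, wp, one_mul]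

end Monomialization

section ChangeOfVariables

open scoped ENNReal

/-- Holomorphic change of variables for the Lebesgue integral. -/
theorem lintegral_image_holomorphic {X : Type*} [NormedAddCommGroup X] [NormedSpace ℂ X]
    [FiniteDimensional ℂ X] [MeasurableSpace X] [BorelSpace X] (μ : Measure X) [μ.IsAddHaarMeasure]
    {s : Set X} (hs : MeasurableSet s) {f : X → X} {f' : X → X →L[ℂ] X}
    (hf : ∀ x ∈ s, HasFDerivAt f (f' x) x) (hi : Set.InjOn f s) (H : X → ℝ≥0∞) :
    ∫⁻ x in f '' s, H x ∂μ = ∫⁻ x in s, H (f x) * ‖(f' x).det‖ₑ ^ 2 ∂μ := by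
  let _ : NormedSpace ℝ X := NormedSpace.complexToReal
  have _ : FiniteDimensional ℝ X := FiniteDimensional.complexToReal X
  rw [lintegral_image_eq_lintegral_abs_det_fderiv_mul μ hs
    (fun x hx => ((hf x hx).restrictScalars ℝ).hasFDerivWithinAt) hi]
  refine lintegral_congr fun x => ?_
  have : ((f' x).restrictScalars ℝ).det = ‖(f' x).det‖ ^ 2 := by
    have := LinearMap.det_restrictScalars (R := ℝ) (S := ℂ) (f := (f' x : X →ₗ[ℂ] X))
    rw [Algebra.norm_complex_apply, Complex.normSq_eq_norm_sq] at this
    exact this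
  rw [this, abs_of_nonneg (by positivity), mul_comm, ENNReal.ofReal_pow (norm_nonneg _),
    ofReal_norm]

theorem lintegral_image_deriv {s : Set ℂ} (hs : MeasurableSet s) {f f' : ℂ → ℂ}
    (hf : ∀ x ∈ s, HasDerivAt f (f' x) x) (hi : Set.InjOn f s) (H : ℂ → ℝ≥0∞) :
    ∫⁻ x in f '' s, H x = ∫⁻ x in s, H (f x) * ‖f' x‖ₑ ^ 2 := by
  rw [lintegral_image_holomorphic volume hs (fun x hx => (hf x hx).hasFDerivAt) hi]
  refine lintegral_congr fun x => ?_
  congr 3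
  simp [ContinuousLinearMap.det]

theorem lintegral_comp_affine {a : ℂ} (ha : a ≠ 0) (v : ℂ) (H : ℂ → ℝ≥0∞) :
    ∫⁻ z, H (a * (v + z)) * ‖a‖ₑ ^ 2 = ∫⁻ z, H z := by
  have h := lintegral_image_deriv (s := Set.univ) (f := fun z => a * (v + z)) (f' := fun _ => a)
    MeasurableSet.univ (fun z _ => by
      simpa using ((hasDerivAt_id z).const_add v).const_mul a) (fun z _ w _ h => by
      simpa [ha] using h) H
  have e : (fun z => a * (v + z)) '' Set.univ = Set.univ := by
    rw [Set.image_univ]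
    refine Set.range_eq_univ.2 fun w => ⟨w / a - v, ?_⟩
    simp [mul_div_cancel₀ _ ha]
  rw [e] at h
  simpa using h.symm

theorem lintegral_comp_const_mul {a : ℂ} (ha : a ≠ 0) (H : ℂ → ℝ≥0∞) :
    ∫⁻ z, H (a * z) * ‖a‖ₑ ^ 2 = ∫⁻ z, H z := by
  simpa using lintegral_comp_affine ha 0 H

/-- The principal branch domain of the `k`-th root. -/
def rootSector (k : ℕ) : Set ℂ := {z | (z ^ k) ^ (1 / (k : ℂ)) = z}

theorem measurableSet_rootSector (k : ℕ) : MeasurableSet (rootSector k) :=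
  measurableSet_eq_fun (by fun_prop) measurable_id

theorem lintegral_rootSector {k : ℕ} (hk : k ≠ 0) (H : ℂ → ℝ≥0∞) :
    ∫⁻ z in rootSector k, H (z ^ k) * ‖z ^ (k - 1)‖ₑ ^ 2 * (k : ℝ≥0∞) ^ 2 = ∫⁻ z, H z := by
  have h := lintegral_image_deriv (measurableSet_rootSector k) (f := fun z => z ^ k)
    (f' := fun z => k * z ^ (k - 1)) (fun z _ => hasDerivAt_pow k z) (fun z hz w hw h => by
      have h1 : (z ^ k) ^ (1 / (k : ℂ)) = z := hz
      have h2 : (w ^ k) ^ (1 / (k : ℂ)) = w := hw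
      rw [← h1, ← h2]; simp only at h; rw [h]) H
  have e : (fun z : ℂ => z ^ k) '' rootSector k = Set.univ := by
    refine Set.eq_univ_of_forall fun w => ?_
    have hw : (w ^ (1 / (k : ℂ))) ^ k = w := by
      rw [one_div]; exact Complex.cpow_nat_inv_pow w hk
    exact ⟨w ^ (1 / (k : ℂ)), by simp only [rootSector, Set.mem_ofPred_eq, hw], hw⟩
  rw [e] at h
  rw [Measure.restrict_univ] at h
  rw [h]
  refine lintegral_congr fun z => ?_
  rw [enorm_mul, mul_pow, ← ofReal_norm (k : ℂ), Complex.norm_natCast, ENNReal.ofReal_natCast]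
  ring

theorem lintegral_le_pow_comp {k : ℕ} (hk : k ≠ 0) (H : ℂ → ℝ≥0∞) :
    ∫⁻ z, H z ≤ (k : ℝ≥0∞) ^ 2 * ∫⁻ z, H (z ^ k) * ‖z ^ (k - 1)‖ₑ ^ 2 := by
  rw [← lintegral_rootSector hk, ← lintegral_const_mul' _ _ (by finiteness)]
  refine (setLIntegral_le_lintegral _ _).trans (lintegral_mono fun z => ?_)
  rw [mul_comm]

theorem lintegral_pow_comp_le {k : ℕ} (hk : k ≠ 0) (H : ℂ → ℝ≥0∞) (hH : Measurable H) :
    ∫⁻ z, H (z ^ k) * ‖z ^ (k - 1)‖ₑ ^ 2 ≤ k * ∫⁻ z, H z := by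
  classical
  set G : ℂ → ℝ≥0∞ := fun z => H (z ^ k) * ‖z ^ (k - 1)‖ₑ ^ 2 with hG
  set S := rootSector k
  have hGm : Measurable G := by
    apply Measurable.mul
    · exact hH.comp (by fun_prop)
    · fun_prop
  have hS : ∫⁻ z in S, G z ≤ ∫⁻ z, H z := by
    rw [← lintegral_rootSector hk]
    refine lintegral_mono fun z => ?_
    have : (1 : ℝ≥0∞) ≤ (k : ℝ≥0∞) ^ 2 := by
      have : (1 : ℝ≥0∞) ≤ k := by exact_mod_cast Nat.one_le_iff_ne_zero.2 hk
      simpa using pow_le_pow_left₀ (by simp) this 2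
    exact le_mul_of_one_le_right' this
  set R : Finset ℂ := (Polynomial.nthRoots k (1 : ℂ)).toFinset with hR
  have hmem : ∀ ζ, ζ ∈ R ↔ ζ ^ k = 1 := fun ζ => by
    rw [hR, Multiset.mem_toFinset, Polynomial.mem_nthRoots (Nat.pos_of_ne_zero hk)]
  have hcov : ∀ z, G z ≤ ∑ ζ ∈ R, S.indicator G (ζ * z) := by
    intro z
    set w := (z ^ k) ^ (1 / (k : ℂ)) with hw
    have hwk : w ^ k = z ^ k := by rw [hw, one_div]; exact Complex.cpow_nat_inv_pow _ hk
    have hwS : w ∈ S := by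
      change (w ^ k) ^ (1 / (k : ℂ)) = w
      rw [hwk]
    have hζ : ∃ ζ ∈ R, ζ * z = w := by
      by_cases hz : z = 0
      · refine ⟨1, (hmem 1).2 (one_pow k), ?_⟩
        have : w ^ k = 0 := by rw [hwk, hz, zero_pow hk]
        rw [hz, (pow_eq_zero_iff hk).1 this, mul_zero]
      · refine ⟨w / z, (hmem _).2 ?_, div_mul_cancel₀ w hz⟩
        rw [div_pow, hwk, div_self (pow_ne_zero k hz)]
    obtain ⟨ζ, hζR, hζ⟩ := hζ
    have : G z = S.indicator G (ζ * z) := by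
      have hn : ‖ζ‖ₑ = 1 := by
        have := Complex.norm_eq_one_of_pow_eq_one ((hmem ζ).1 hζR) hk
        rw [← ofReal_norm, this, ENNReal.ofReal_one]
      rw [hζ, Set.indicator_of_mem hwS, hG]
      simp only
      rw [hwk, ← hζ, mul_pow, enorm_mul, enorm_pow ζ, hn, one_pow, one_mul]
    rw [this]
    exact Finset.single_le_sum (f := fun ζ => S.indicator G (ζ * z)) (fun _ _ => zero_le) hζR
  calc ∫⁻ z, G z ≤ ∫⁻ z, ∑ ζ ∈ R, S.indicator G (ζ * z) := lintegral_mono hcov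
    _ = ∑ ζ ∈ R, ∫⁻ z, S.indicator G (ζ * z) := lintegral_finsetSum _ fun ζ _ =>
        (hGm.indicator (measurableSet_rootSector k)).comp (measurable_const_mul ζ)
    _ ≤ ∑ ζ ∈ R, ∫⁻ z, H z := by
        refine Finset.sum_le_sum fun ζ hζ => ?_
        have h1 := (hmem ζ).1 hζ
        have hn : ‖ζ‖ₑ = 1 := by
          rw [← ofReal_norm, Complex.norm_eq_one_of_pow_eq_one h1 hk, ENNReal.ofReal_one]
        have h0 : ζ ≠ 0 := by rintro rfl; simp [hk] at h1
        have := lintegral_comp_const_mul h0 (S.indicator G)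
        simp only [hn, one_pow, mul_one] at this
        rw [this, lintegral_indicator (measurableSet_rootSector k)]
        exact hS
    _ ≤ k * ∫⁻ z, H z := by
        rw [Finset.sum_const, nsmul_eq_mul]
        gcongr
        exact (Multiset.toFinset_card_le _).trans (Polynomial.card_nthRoots k 1)

variable {n : ℕ}

/-- Comparison of integrals over `ℂⁿ` slice by slice. -/
theorem lintegral_le_of_slice (i : Fin n) {F G : (Fin n → ℂ) → ℝ≥0∞} (hF : Measurable F)
    (hG : Measurable G) (h : ∀ x, ∫⁻ z, F (Function.update x i z) ≤ ∫⁻ z, G (Function.update x i z)) :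
    ∫⁻ x, F x ≤ ∫⁻ x, G x := by
  refine lintegral_le_of_lmarginal_le (μ := fun _ => volume) {i} hF hG fun x => ?_
  rw [lmarginal_singleton, lmarginal_singleton]
  exact h x

theorem volume_coord_eq (i : Fin n) (c : ℂ) : volume {x : Fin n → ℂ | x i = c} = 0 :=
  Measure.pi_hyperplane (fun _ : Fin n => (volume : Measure ℂ)) i c

theorem ae_coord_ne_zero : ∀ᵐ x : Fin n → ℂ, ∀ i, x i ≠ 0 :=
  ae_all_iff.2 fun i => by simpa [ae_iff] using volume_coord_eq i 0

end ChangeOfVariables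

section Covers

open scoped ENNReal

variable {n : ℕ}

/-- A family of holomorphic germs of maps with Jacobian factors, whose images cover a
neighborhood of the origin with controlled multiplicities. -/
structure Cover {ι : Type} (π : ι → (Fin n → ℂ) → (Fin n → ℂ)) (J : ι → (Fin n → ℂ) → ℂ) :
    Prop where
  hol : ∀ i, Hol (π i)
  zero : ∀ i, π i 0 = 0
  holJ : ∀ i, Hol (J i)
  push : ∀ i, ∃ W ∈ 𝓝 (0 : Fin n → ℂ), ∃ k : ℝ≥0∞, k ≠ ∞ ∧
    ∀ H : (Fin n → ℂ) → ℝ≥0∞, Measurable H →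
      ∫⁻ x in W, H (π i x) * ‖J i x‖ₑ ^ 2 ≤ k * ∫⁻ x, H x
  cover : ∀ W : ι → Set (Fin n → ℂ), (∀ i, W i ∈ 𝓝 0) → ∃ S : Finset ι, ∃ V ∈ 𝓝 (0 : Fin n → ℂ),
    ∃ k : ℝ≥0∞, k ≠ ∞ ∧ ∀ H : (Fin n → ℂ) → ℝ≥0∞, Measurable H →
      ∫⁻ x in V, H x ≤ k * ∑ i ∈ S, ∫⁻ x in W i, H (π i x) * ‖J i x‖ₑ ^ 2

theorem Hol.det {L : (Fin n → ℂ) → (Fin n → ℂ) →L[ℂ] (Fin n → ℂ)}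
    (h : ∀ v, Hol (fun x => L x v)) : Hol (fun x => (L x).det) := by
  have : (fun x => (L x).det) = fun x =>
      (Matrix.of fun i j => L x (Pi.single j 1) i).det := by
    ext x
    rw [ContinuousLinearMap.det, ← LinearMap.det_toMatrix']
    congr 1
  rw [this]
  simp only [Matrix.det_apply]
  refine Hol.sum fun σ _ => ?_
  have : (fun x => Equiv.Perm.sign σ • ∏ i, (Matrix.of fun i j => L x (Pi.single j 1) i) (σ i) i) =
      fun x => ((Equiv.Perm.sign σ : ℤ) : ℂ) * ∏ i, L x (Pi.single i 1) (σ i) := by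
    ext x
    rw [Units.smul_def, zsmul_eq_mul]; rfl
  rw [this]
  exact (Hol.const _).mul (Hol.prod fun i _ => (h (Pi.single i 1)).apply (σ i))

theorem Hol.det_fderiv {φ : (Fin n → ℂ) → (Fin n → ℂ)} (hφ : Hol φ) :
    Hol (fun x => (fderiv ℂ φ x).det) := by
  refine Hol.det fun v => Hol.pi fun i => ?_
  refine ((hφ.apply i).fderiv_apply v).congr ?_
  filter_upwards [hφ] with x hx
  have := (hasFDerivAt_pi'.1 hx.hasFDerivAt i).fderiv
  rw [this]; rfl

theorem cover_coord {φ ψ : (Fin n → ℂ) → (Fin n → ℂ)} (hφ : Hol φ) (hψ : Hol ψ) (hφ0 : φ 0 = 0)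
    (hψ0 : ψ 0 = 0) (h1 : ∀ᶠ x in 𝓝 0, φ (ψ x) = x) (h2 : ∀ᶠ x in 𝓝 0, ψ (φ x) = x) :
    Cover (fun _ : Unit => φ) (fun _ x => (fderiv ℂ φ x).det) := by
  obtain ⟨r, hr, hB⟩ := Metric.eventually_nhds_iff_ball.1 (hφ.and h2)
  have key : ∀ s ⊆ Metric.ball (0 : Fin n → ℂ) r, MeasurableSet s → ∀ H : (Fin n → ℂ) → ℝ≥0∞,
      ∫⁻ x in φ '' s, H x = ∫⁻ x in s, H (φ x) * ‖(fderiv ℂ φ x).det‖ₑ ^ 2 := fun s hs hm H =>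
    lintegral_image_holomorphic volume hm (fun x hx => (hB x (hs hx)).1.hasFDerivAt)
      (fun x hx y hy h => by rw [← (hB x (hs hx)).2, ← (hB y (hs hy)).2, h]) H
  refine ⟨fun _ => hφ, fun _ => hφ0, fun _ => hφ.det_fderiv, fun _ => ?_, fun W hW => ?_⟩
  · refine ⟨_, Metric.ball_mem_nhds 0 hr, 1, by simp, fun H _ => ?_⟩
    rw [← key _ subset_rfl measurableSet_ball, one_mul]
    exact setLIntegral_le_lintegral _ _
  · obtain ⟨ρ, hρ, hρW⟩ := Metric.mem_nhds_iff.1 (inter_mem (hW ()) (Metric.ball_mem_nhds 0 hr))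
    refine ⟨{()}, {x | ψ x ∈ Metric.ball 0 ρ ∧ φ (ψ x) = x},
      ((hψ.tendsto hψ0).eventually (Metric.ball_mem_nhds 0 hρ)).and h1, 1, by simp, fun H _ => ?_⟩
    rw [Finset.sum_singleton, one_mul]
    refine le_trans (lintegral_mono_set ?_) ((key (Metric.ball 0 ρ)
      (fun x hx => (hρW hx).2) measurableSet_ball H).le.trans
        (lintegral_mono_set fun x hx => (hρW hx).1))
    exact fun x hx => ⟨ψ x, hx.1, hx.2⟩

theorem measurable_powMap (i : Fin n) (k : ℕ) : Measurable (powMap i k) := by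
  refine measurable_pi_lambda _ fun j => ?_
  by_cases h : j = i
  · subst h; simp only [powMap, Function.update_self]; fun_prop
  · simp only [powMap, Function.update_of_ne h]; fun_prop

theorem measurable_blowMap (i j : Fin n) (v : ℂ) : Measurable (blowMap i j v) := by
  refine measurable_pi_lambda _ fun l => ?_
  by_cases h : l = j
  · subst h; simp only [blowMap, Function.update_self]; fun_prop
  · simp only [blowMap, Function.update_of_ne h]; fun_prop

theorem cover_pow (i : Fin n) {k : ℕ} (hk : k ≠ 0) :
    Cover (fun _ : Unit => powMap i k) (fun _ x => x i ^ (k - 1)) := by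
  refine ⟨fun _ => hol_powMap i k, fun _ => powMap_zero i hk, fun _ => (hol_coord i).pow _,
    fun _ => ?_, fun W hW => ?_⟩
  · refine ⟨_, univ_mem, k, by simp, fun H hH => ?_⟩
    rw [Measure.restrict_univ, ← lintegral_const_mul _ hH]
    refine lintegral_le_of_slice i ?_ (hH.const_mul _) fun x => ?_
    · exact (hH.comp (measurable_powMap i k)).mul (by fun_prop)
    · simp only [powMap, Function.update_self, Function.update_idem]
      have hm := hH.comp (measurable_update x (a := i))
      rw [lintegral_const_mul' _ _ (by finiteness)]
      exact lintegral_pow_comp_le hk _ hm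
  · obtain ⟨ρ, hρ, hρW⟩ := Metric.mem_nhds_iff.1 (hW ())
    set ρ' := min ρ (ρ ^ k)
    have hρ' : 0 < ρ' := lt_min hρ (pow_pos hρ k)
    have hm := measurable_powMap i k
    refine ⟨{()}, Metric.ball 0 ρ', Metric.ball_mem_nhds 0 hρ', k ^ 2, by finiteness,
      fun H hH => ?_⟩
    set G := (Metric.ball (0 : Fin n → ℂ) ρ').indicator H with hG
    have hGm : Measurable G := hH.indicator measurableSet_ball
    rw [Finset.sum_singleton, ← lintegral_indicator measurableSet_ball]
    calc ∫⁻ x, G x ≤ ∫⁻ x, k ^ 2 * (G (powMap i k x) * ‖x i ^ (k - 1)‖ₑ ^ 2) := by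
          refine lintegral_le_of_slice i hGm ?_ fun x => ?_
          · exact ((hGm.comp hm).mul (by fun_prop)).const_mul _
          · simp only [powMap, Function.update_self, Function.update_idem]
            rw [lintegral_const_mul' _ _ (by finiteness)]
            exact lintegral_le_pow_comp hk (fun z => G (Function.update x i z))
      _ = k ^ 2 * ∫⁻ x, G (powMap i k x) * ‖x i ^ (k - 1)‖ₑ ^ 2 :=
          lintegral_const_mul' _ _ (by finiteness)
      _ ≤ k ^ 2 * ∫⁻ x in Metric.ball 0 ρ, H (powMap i k x) * ‖x i ^ (k - 1)‖ₑ ^ 2 := by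
          rw [← lintegral_indicator measurableSet_ball]
          gcongr with x
          by_cases hx : powMap i k x ∈ Metric.ball (0 : Fin n → ℂ) ρ'
          · have hxρ : x ∈ Metric.ball (0 : Fin n → ℂ) ρ := by
              rw [mem_ball_zero_iff, pi_norm_lt_iff hρ'] at hx
              rw [mem_ball_zero_iff, pi_norm_lt_iff hρ]
              intro j
              by_cases hj : j = i
              · subst hj
                have := (hx j).trans_le (min_le_right _ _)
                simp only [powMap, Function.update_self, norm_pow] at this
                exact lt_of_pow_lt_pow_left₀ k hρ.le this
              · have := (hx j).trans_le (min_le_left _ _)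
                simpa only [powMap, Function.update_of_ne hj] using this
            rw [Set.indicator_of_mem hxρ, hG, Set.indicator_of_mem hx]
          · rw [hG, Set.indicator_of_notMem hx, zero_mul]; exact zero_le
      _ ≤ _ := by gcongr

theorem lintegral_blowMap {i j : Fin n} (hij : i ≠ j) (v : ℂ) {H : (Fin n → ℂ) → ℝ≥0∞}
    (hH : Measurable H) : ∫⁻ x, H (blowMap i j v x) * ‖x i‖ₑ ^ 2 = ∫⁻ x, H x := by
  apply le_antisymm
  · refine lintegral_le_of_slice j ?_ hH fun x => ?_
    · exact (hH.comp (measurable_blowMap i j v)).mul (by fun_prop)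
    · simp only [blowMap, Function.update_self, Function.update_idem, Function.update_of_ne hij]
      by_cases h : x i = 0
      · simp [h]
      · exact (lintegral_comp_affine h v (fun z => H (Function.update x j z))).le
  · have hs : MeasurableSet {x : Fin n → ℂ | x i = 0} :=
      (measurable_pi_apply i) (measurableSet_singleton 0)
    have : ∫⁻ x, H x = ∫⁻ x, {x : Fin n → ℂ | x i = 0}ᶜ.indicator H x := by
      refine lintegral_congr_ae ?_
      filter_upwards [ae_coord_ne_zero] with x hx
      rw [Set.indicator_of_mem]
      exact hx i
    rw [this]
    refine lintegral_le_of_slice j (hH.indicator hs.compl)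
      ((hH.comp (measurable_blowMap i j v)).mul (by fun_prop)) fun x => ?_
    simp only [blowMap, Function.update_self, Function.update_idem, Function.update_of_ne hij]
    by_cases h : x i = 0
    · have : ∀ z, Function.update x j z ∉ {x : Fin n → ℂ | x i = 0}ᶜ := fun z hz =>
        hz (by simpa [Function.update_of_ne hij] using h)
      simp [Set.indicator_of_notMem (this _)]
    · have : ∀ z, Function.update x j z ∈ {x : Fin n → ℂ | x i = 0}ᶜ := fun z hz =>
        h (by simpa [Function.update_of_ne hij] using hz)
      simp only [Set.indicator_of_mem (this _)]
      exact (lintegral_comp_affine h v (fun z => H (Function.update x j z))).ge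

theorem cover_blow {i j : Fin n} (hij : i ≠ j) :
    Cover (fun o : Option ℂ => o.elim (blowMap j i 0) (blowMap i j))
      (fun o x => o.elim (x j) (fun _ => x i)) := by
  refine ⟨fun o => ?_, fun o => ?_, fun o => ?_, fun o => ?_, fun W hW => ?_⟩
  · cases o <;> exact hol_blowMap _ _ _
  · cases o <;> exact blowMap_zero _ _ _
  · cases o <;> exact hol_coord _
  · refine ⟨_, univ_mem, 1, by simp, fun H hH => ?_⟩
    rw [Measure.restrict_univ, one_mul]
    cases o
    · exact (lintegral_blowMap hij.symm 0 hH).le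
    · exact (lintegral_blowMap hij _ hH).le
  · classical
    have hball : ∀ o, ∃ ρ > 0, Metric.ball (0 : Fin n → ℂ) ρ ⊆ W o := fun o =>
      Metric.mem_nhds_iff.1 (hW o)
    choose ρ hρ hρW using hball
    obtain ⟨T, hT⟩ := (isCompact_closedBall (0 : ℂ) (ρ none)⁻¹).elim_nhds_subcover
      (fun v => Metric.ball v (ρ (some v))) (fun v _ => Metric.ball_mem_nhds _ (hρ _))
    set S : Finset (Option ℂ) := insert none (T.image some) with hS
    have hSne : S.Nonempty := ⟨none, by simp [hS]⟩
    set δ := S.inf' hSne ρ with hδ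
    have hδ0 : 0 < δ := (Finset.lt_inf'_iff _).2 fun o _ => hρ o
    set B := Metric.ball (0 : Fin n → ℂ) δ
    set π : Option ℂ → (Fin n → ℂ) → (Fin n → ℂ) := fun o =>
      o.elim (blowMap j i 0) (blowMap i j) with hπ
    set J : Option ℂ → (Fin n → ℂ) → ℂ := fun o x => o.elim (x j) (fun _ => x i) with hJ
    let A : Option ℂ → Set (Fin n → ℂ) := fun o =>
      o.elim {x | x ∈ B ∧ x j ≠ 0 ∧ ‖x i / x j‖ < ρ none}
        (fun v => {x | x ∈ B ∧ x i ≠ 0 ∧ ‖x j / x i - v‖ < ρ (some v)})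
    have hne : ∀ l : Fin n, MeasurableSet {x : Fin n → ℂ | x l ≠ 0} := fun l =>
      (measurable_pi_apply l) (measurableSet_singleton 0).compl
    have hAm : ∀ o, MeasurableSet (A o) := by
      intro o
      cases o with
      | none =>
        refine measurableSet_ball.inter ((hne j).inter ?_)
        exact measurableSet_lt (f := fun x : Fin n → ℂ => ‖x i / x j‖) (by fun_prop) measurable_const
      | some v =>
        refine measurableSet_ball.inter ((hne i).inter ?_)
        exact measurableSet_lt (f := fun x : Fin n → ℂ => ‖x j / x i - v‖) (by fun_prop)
          measurable_const
    have hπm : ∀ o, Measurable (π o) := by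
      intro o; cases o <;> exact measurable_blowMap _ _ _
    have hIntg : ∀ o, ∀ H : (Fin n → ℂ) → ℝ≥0∞, Measurable H →
        ∫⁻ x, H (π o x) * ‖J o x‖ₑ ^ 2 = ∫⁻ x, H x := by
      intro o H hH
      cases o with
      | none => exact lintegral_blowMap hij.symm 0 hH
      | some v => exact lintegral_blowMap hij v hH
    have hAW : ∀ o ∈ S, ∀ x, π o x ∈ A o → x ∈ W o := by
      intro o ho x hx
      have hδo : δ ≤ ρ o := Finset.inf'_le _ ho
      refine hρW o ?_
      rw [mem_ball_zero_iff, pi_norm_lt_iff (hρ o)]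
      intro l
      cases o with
      | none =>
        obtain ⟨h1, h2, h3⟩ := hx
        rw [mem_ball_zero_iff, pi_norm_lt_iff hδ0] at h1
        by_cases hl : l = i
        · subst hl
          simp only [hπ, Option.elim, blowMap, Function.update_self, zero_add,
            Function.update_of_ne hij.symm] at h2 h3
          rwa [mul_div_cancel_left₀ _ h2] at h3
        · have := h1 l
          simp only [hπ, Option.elim, blowMap, Function.update_of_ne hl] at this
          exact this.trans_le hδo
      | some v =>
        obtain ⟨h1, h2, h3⟩ := hx
        rw [mem_ball_zero_iff, pi_norm_lt_iff hδ0] at h1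
        by_cases hl : l = j
        · subst hl
          simp only [hπ, Option.elim, blowMap, Function.update_self,
            Function.update_of_ne hij] at h2 h3
          rwa [mul_div_cancel_left₀ _ h2, add_sub_cancel_left] at h3
        · have := h1 l
          simp only [hπ, Option.elim, blowMap, Function.update_of_ne hl] at this
          exact this.trans_le hδo
    refine ⟨S, B, Metric.ball_mem_nhds 0 hδ0, 1, by simp, fun H hH => ?_⟩
    rw [one_mul, ← lintegral_indicator measurableSet_ball]
    calc ∫⁻ x, B.indicator H x ≤ ∫⁻ x, ∑ o ∈ S, (A o).indicator H x := by
          refine lintegral_mono_ae ?_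
          filter_upwards [ae_coord_ne_zero] with x hx
          by_cases hxB : x ∈ B
          · have : ∃ o ∈ S, x ∈ A o := by
              by_cases h : ‖x i / x j‖ < ρ none
              · exact ⟨none, by simp [hS], hxB, hx j, h⟩
              · have h' : x j / x i ∈ Metric.closedBall (0 : ℂ) (ρ none)⁻¹ := by
                  rw [mem_closedBall_zero_iff, ← inv_div, norm_inv]
                  exact inv_anti₀ (hρ none) (not_lt.1 h)
                obtain ⟨v, hv, hv'⟩ := Set.mem_iUnion₂.1 (hT.2 h')
                exact ⟨some v, by simp [hS, hv], hxB, hx i, by simpa [dist_eq_norm] using hv'⟩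
            obtain ⟨o, ho, hxo⟩ := this
            rw [Set.indicator_of_mem hxB]
            calc H x = (A o).indicator H x := (Set.indicator_of_mem hxo _).symm
              _ ≤ _ := Finset.single_le_sum (f := fun o => (A o).indicator H x)
                (fun _ _ => zero_le) ho
          · rw [Set.indicator_of_notMem hxB]; exact zero_le
      _ = ∑ o ∈ S, ∫⁻ x, (A o).indicator H x :=
          lintegral_finsetSum _ fun o _ => hH.indicator (hAm o)
      _ ≤ _ := by
          refine Finset.sum_le_sum fun o ho => ?_
          rw [← hIntg o _ (hH.indicator (hAm o))]
          set M : (Fin n → ℂ) → ℝ≥0∞ := fun x => (A o).indicator H (π o x) * ‖J o x‖ₑ ^ 2 with hM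
          have hsupp : Function.support M ⊆ π o ⁻¹' A o := by
            intro x hx
            by_contra hxA
            refine hx ?_
            change (A o).indicator H (π o x) * _ = 0
            rw [Set.indicator_of_notMem (show π o x ∉ A o from hxA), zero_mul]
          rw [← setLIntegral_eq_of_support_subset hsupp]
          refine (lintegral_mono_set fun x hx => hAW o ho x hx).trans ?_
          refine lintegral_mono fun x => ?_
          exact mul_le_mul_left (Set.indicator_le_self _ _ _) _

theorem exists_root_coordinate {u : (Fin n → ℂ) → ℂ} (hu : Hol u) (h0 : u 0 ≠ 0)
    {a : Fin n → ℕ} {i : Fin n} (hi : a i ≠ 0) :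
    ∃ φ ψ : (Fin n → ℂ) → (Fin n → ℂ), Hol φ ∧ Hol ψ ∧ φ 0 = 0 ∧ ψ 0 = 0 ∧
      (∀ᶠ x in 𝓝 0, φ (ψ x) = x) ∧ (∀ᶠ x in 𝓝 0, ψ (φ x) = x) ∧
      ∀ᶠ x in 𝓝 0, mon a (φ x) = u x * mon a x := by
  classical
  obtain ⟨w, hw, hw0, hwu⟩ := hu.exists_root h0 hi
  set φ : (Fin n → ℂ) → (Fin n → ℂ) := fun x => Function.update x i (x i * w x) with hφd
  have hφ : Hol φ := hol_update ((hol_coord i).mul hw)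
  have hφ0 : φ 0 = 0 := by simp [hφd]
  set e : (Fin n → ℂ) ≃L[ℂ] (Fin n → ℂ) := ContinuousLinearEquiv.piCongrRight fun j =>
    ContinuousLinearEquiv.unitsEquivAut ℂ (if j = i then Units.mk0 (w 0) hw0 else 1) with he
  have hd : HasFDerivAt φ (e : (Fin n → ℂ) →L[ℂ] (Fin n → ℂ)) 0 := by
    refine hasFDerivAt_pi'.2 fun j => ?_
    by_cases hj : j = i
    · subst hj
      have h1 : HasFDerivAt (fun x : Fin n → ℂ => x j)
        (ContinuousLinearMap.proj j : (Fin n → ℂ) →L[ℂ] ℂ) 0 :=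
        (ContinuousLinearMap.proj j : (Fin n → ℂ) →L[ℂ] ℂ).hasFDerivAt
      have h2 := h1.mul hw.differentiableAt.hasFDerivAt
      simp only [hφd, Function.update_self]
      refine h2.congr_fderiv ?_
      ext v
      simp [he, mul_comm]
    · simp only [hφd, Function.update_of_ne hj]
      refine ((ContinuousLinearMap.proj j : (Fin n → ℂ) →L[ℂ] ℂ).hasFDerivAt).congr_fderiv ?_
      ext v
      simp [he, hj]
  obtain ⟨ψ, hψ, hψ0, h1, h2⟩ := hφ.exists_inverse hφ0 e hd
  refine ⟨φ, ψ, hφ, hψ, hφ0, hψ0, h1, h2, ?_⟩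
  filter_upwards [hwu] with x hx
  rw [← hx]
  simp only [mon, hφd]
  rw [← Finset.mul_prod_erase _ _ (Finset.mem_univ i), ← Finset.mul_prod_erase _ _
    (Finset.mem_univ i), Function.update_self, mul_pow, mul_comm (x i ^ a i), mul_assoc]
  congr 2
  exact Finset.prod_congr rfl fun j hj => by rw [Function.update_of_ne (Finset.ne_of_mem_erase hj)]

/-- To prove a property of all good germs it suffices to prove it for units and monomials and to
descend it along covers. -/
theorem Good.induct {P : ((Fin n → ℂ) → ℂ) → Prop} (hcongr : ∀ F G, P F → F =ᶠ[𝓝 0] G → P G)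
    (hcover : ∀ (ι : Type) (π : ι → (Fin n → ℂ) → (Fin n → ℂ)) (J : ι → (Fin n → ℂ) → ℂ),
      Cover π J → ∀ F, Hol F → (∀ i, P (fun x => F (π i x))) → P F)
    (hunit : ∀ u, Hol u → u 0 ≠ 0 → P u) (hmon : ∀ a i, a i ≠ 0 → P (mon a))
    {F : (Fin n → ℂ) → ℂ} (h : Good F) : P F := by
  induction h with
  | mono h =>
    obtain ⟨u, a, hu, hu0, e⟩ := h
    refine hcongr _ _ ?_ e.symm
    by_cases ha : ∃ i, a i ≠ 0
    · obtain ⟨i, hi⟩ := ha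
      obtain ⟨φ, ψ, hφ, hψ, hφ0, hψ0, h1, h2, h3⟩ := exists_root_coordinate hu hu0 hi
      refine hcover _ _ _ (cover_coord hψ hφ hψ0 hφ0 h2 h1) _ (hu.mul (hol_mon a)) fun _ => ?_
      refine hcongr _ _ (hmon a i hi) ?_
      filter_upwards [(hψ.tendsto hψ0).eventually h3, h1] with x hx hx1
      rw [← hx, hx1]
    · push Not at ha
      refine hunit _ (hu.mul (hol_mon a)) ?_
      simpa [mon, ha] using hu0
  | coord φ ψ hF hφ hψ hφ0 hψ0 h1 h2 _ ih =>
    exact hcover _ _ _ (cover_coord hφ hψ hφ0 hψ0 h1 h2) _ hF fun _ => ih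
  | pow i k hk hF _ ih => exact hcover _ _ _ (cover_pow i hk) _ hF fun _ => ih
  | blow i j hij hF _ _ ih1 ih2 =>
    refine hcover _ _ _ (cover_blow hij) _ hF fun o => ?_
    cases o with
    | none => exact ih1
    | some v => exact ih2 v

end Covers

section LocalProperties

open scoped ENNReal

variable {n : ℕ}

theorem ContinuousOn.measurable_indicator {X Y : Type*} [TopologicalSpace X] [MeasurableSpace X]
    [BorelSpace X] [TopologicalSpace Y] [MeasurableSpace Y] [BorelSpace Y] [Zero Y]
    {V : Set X} (hV : IsOpen V) {g : X → Y} (hg : ContinuousOn g V) : Measurable (V.indicator g) := by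
  classical
  rw [← Set.piecewise_eq_indicator]
  exact hg.measurable_piecewise continuousOn_const hV.measurableSet

theorem ContinuousOn.measurable_enorm_sq_mul {V : Set (Fin n → ℂ)} (hV : IsOpen V)
    {g : (Fin n → ℂ) → ℂ} (hg : ContinuousOn g V) {w : (Fin n → ℂ) → ℝ≥0∞} (hw : Measurable w) :
    Measurable (V.indicator fun x => ‖g x‖ₑ ^ 2 * w x) := by
  have : (V.indicator fun x => ‖g x‖ₑ ^ 2 * w x) = fun x => ‖V.indicator g x‖ₑ ^ 2 * w x := by
    ext x
    by_cases hx : x ∈ V <;> simp [hx]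
  rw [this]
  exact ((hg.measurable_indicator hV).enorm.pow_const 2).mul hw

theorem Hol.exists_measurable {F : (Fin n → ℂ) → ℂ} (hF : Hol F) :
    ∃ G, Measurable G ∧ Hol G ∧ F =ᶠ[𝓝 0] G := by
  obtain ⟨r, hr, h⟩ := hF.exists_ball
  have e : F =ᶠ[𝓝 0] (Metric.ball 0 r).indicator F := by
    filter_upwards [Metric.ball_mem_nhds 0 hr] with x hx
    rw [Set.indicator_of_mem hx]
  exact ⟨_, h.continuousOn.measurable_indicator Metric.isOpen_ball, hF.congr e, e⟩

/-- The zero set is a null set near the origin. -/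
def NullZeros (f : (Fin n → ℂ) → ℂ) : Prop :=
  ∃ V ∈ 𝓝 (0 : Fin n → ℂ), ∀ᵐ x ∂volume.restrict V, f x ≠ 0

/-- Local `L²`-estimates for the translates `f + t`. -/
def TranslateBound (f : (Fin n → ℂ) → ℂ) : Prop :=
  ∀ β α : ℝ, 0 < β → β < α → α < 1 → ∀ h : (Fin n → ℂ) → ℂ, Hol h →
    (∃ V ∈ 𝓝 (0 : Fin n → ℂ), ∫⁻ x in V, ‖h x‖ₑ ^ 2 * ‖f x‖ₑ ^ (-2 * β) ≠ ∞) →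
    ∃ V ∈ 𝓝 (0 : Fin n → ℂ), ∃ C : ℝ≥0∞, C ≠ ∞ ∧ ∃ ε > 0, ∀ t : ℂ, t ≠ 0 → ‖t‖ < ε →
      ∫⁻ x in V, ‖h x‖ₑ ^ 2 * ‖f x + t‖ₑ ^ (-2 * α) ≤ C * ‖t‖ₑ ^ (-2 * (α - β))

/-- Functionals `g ↦ ∫ g(p x) k(x) dx` that are small, of order `α - β`, for the weights
`max(|f|, r)^{-2α}`. -/
structure Theta (V : Set (Fin n → ℂ)) (f : (Fin n → ℂ) → ℂ) (α β : ℝ)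
    (p : (Fin n → ℂ) → (Fin n → ℂ)) (k : (Fin n → ℂ) → ℂ) : Prop where
  meas : Measurable p
  int : Integrable k
  compact : ∃ K ⊆ V, IsCompact K ∧ ∀ x, p x ∈ K
  bound : ∃ C : ℝ≥0∞, C ≠ ∞ ∧ ∀ g : (Fin n → ℂ) → ℂ, DifferentiableOn ℂ g V →
    ∀ r : ℝ≥0∞, r ≠ 0 → r ≤ 1 → ‖∫ x, g (p x) * k x‖ₑ ^ 2 ≤
      C * r ^ (2 * (α - β)) * ∫⁻ x in V, ‖g x‖ₑ ^ 2 * max ‖f x‖ₑ r ^ (-2 * α)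

/-- `g` is annihilated by all functionals in `Theta`. -/
def Killed (V : Set (Fin n → ℂ)) (f : (Fin n → ℂ) → ℂ) (α β : ℝ) (g : (Fin n → ℂ) → ℂ) : Prop :=
  ∀ p k, Theta V f α β p k → ∫ x, g (p x) * k x = 0

/-- Annihilation by `Theta` improves integrability slightly. -/
def Improves (f : (Fin n → ℂ) → ℂ) : Prop :=
  ∀ β α : ℝ, 0 ≤ β → β ≤ α → ∀ V : Set (Fin n → ℂ), IsOpen V → 0 ∈ V →
    ∃ V' ∈ 𝓝 (0 : Fin n → ℂ), ∃ ε > 0, ∀ g, DifferentiableOn ℂ g V → Killed V f α β g →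
      ∀ s ≤ β + ε, ∫⁻ x in V', ‖g x‖ₑ ^ 2 * ‖f x‖ₑ ^ (-2 * s) ≠ ∞

theorem NullZeros.congr {f f' : (Fin n → ℂ) → ℂ} (h : NullZeros f) (e : f =ᶠ[𝓝 0] f') :
    NullZeros f' := by
  obtain ⟨V, hV, h⟩ := h
  obtain ⟨r, hr, hB⟩ := Metric.mem_nhds_iff.1 (inter_mem hV e)
  refine ⟨_, Metric.ball_mem_nhds 0 hr, ?_⟩
  filter_upwards [ae_restrict_of_ae_restrict_of_subset (fun x hx => (hB hx).1) h,
    ae_restrict_mem measurableSet_ball] with x hx hxB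
  rwa [← show f x = f' x from (hB hxB).2]

theorem TranslateBound.congr {f f' : (Fin n → ℂ) → ℂ} (h : TranslateBound f) (e : f =ᶠ[𝓝 0] f') :
    TranslateBound f' := by
  obtain ⟨r, hr, hB⟩ := Metric.mem_nhds_iff.1 e
  intro β α hβ hβα hα g hg ⟨V, hV, hfin⟩
  have key : ∀ U : Set (Fin n → ℂ), ∀ (c : ℂ) (α : ℝ), ∫⁻ x in Metric.ball 0 r ∩ U,
      ‖g x‖ₑ ^ 2 * ‖f x + c‖ₑ ^ (-2 * α) ≤ ∫⁻ x in U, ‖g x‖ₑ ^ 2 * ‖f' x + c‖ₑ ^ (-2 * α) := by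
    intro U c α
    rw [← Measure.restrict_restrict measurableSet_ball]
    refine le_trans (le_of_eq (setLIntegral_congr_fun measurableSet_ball fun x hx => ?_))
      (setLIntegral_le_lintegral _ _)
    have : f x = f' x := hB hx
    simp only [this]
  have key' : ∀ U : Set (Fin n → ℂ), ∀ (c : ℂ) (α : ℝ), ∫⁻ x in Metric.ball 0 r ∩ U,
      ‖g x‖ₑ ^ 2 * ‖f' x + c‖ₑ ^ (-2 * α) ≤ ∫⁻ x in U, ‖g x‖ₑ ^ 2 * ‖f x + c‖ₑ ^ (-2 * α) := by
    intro U c α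
    rw [← Measure.restrict_restrict measurableSet_ball]
    refine le_trans (le_of_eq (setLIntegral_congr_fun measurableSet_ball fun x hx => ?_))
      (setLIntegral_le_lintegral _ _)
    have : f x = f' x := hB hx
    simp only [this]
  obtain ⟨V', hV', C, hC, ε, hε, hb⟩ := h β α hβ hβα hα g hg
    ⟨_, inter_mem (Metric.ball_mem_nhds 0 hr) hV,
      ne_top_of_le_ne_top hfin (by simpa using key V 0 β)⟩
  exact ⟨_, inter_mem (Metric.ball_mem_nhds 0 hr) hV', C, hC, ε, hε,
    fun t ht ht' => (key' _ _ _).trans (hb t ht ht')⟩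

theorem Theta.mono {V V' : Set (Fin n → ℂ)} {f : (Fin n → ℂ) → ℂ} {α β : ℝ}
    {p : (Fin n → ℂ) → (Fin n → ℂ)} {k : (Fin n → ℂ) → ℂ} (h : Theta V f α β p k) (hV : V ⊆ V') :
    Theta V' f α β p k := by
  obtain ⟨h1, h2, ⟨K, hK, h3⟩, ⟨C, hC, h4⟩⟩ := h
  refine ⟨h1, h2, ⟨K, hK.trans hV, h3⟩, C, hC, fun g hg r h0 h1 => (h4 g (hg.mono hV) r h0 h1).trans ?_⟩
  gcongr

theorem Killed.mono {V V' : Set (Fin n → ℂ)} {f g : (Fin n → ℂ) → ℂ} {α β : ℝ}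
    (h : Killed V f α β g) (hV : V' ⊆ V) : Killed V' f α β g :=
  fun p k hpk => h p k (hpk.mono hV)

theorem Theta.congr {V : Set (Fin n → ℂ)} (hV : MeasurableSet V) {f f' : (Fin n → ℂ) → ℂ} {α β : ℝ}
    {p : (Fin n → ℂ) → (Fin n → ℂ)} {k : (Fin n → ℂ) → ℂ} (h : Theta V f α β p k)
    (e : Set.EqOn f f' V) : Theta V f' α β p k := by
  obtain ⟨h1, h2, h3, ⟨C, hC, h4⟩⟩ := h
  refine ⟨h1, h2, h3, C, hC, fun g hg r h0 h1 => (h4 g hg r h0 h1).trans (le_of_eq ?_)⟩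
  congr 1
  exact setLIntegral_congr_fun hV fun x hx => by simp only [e hx]

/-- It suffices to check `Improves` on arbitrarily small neighborhoods. -/
theorem improves_of_small {f : (Fin n → ℂ) → ℂ} {ρ : ℝ} (hρ : 0 < ρ)
    (h : ∀ β α : ℝ, 0 ≤ β → β ≤ α → ∀ r, 0 < r → r < ρ →
      ∃ V' ∈ 𝓝 (0 : Fin n → ℂ), ∃ ε > 0, ∀ g, DifferentiableOn ℂ g (Metric.ball 0 r) →
        Killed (Metric.ball 0 r) f α β g →
        ∀ s ≤ β + ε, ∫⁻ x in V', ‖g x‖ₑ ^ 2 * ‖f x‖ₑ ^ (-2 * s) ≠ ∞) : Improves f := by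
  intro β α hβ hα V hV hV0
  obtain ⟨r, hr, hrV⟩ := Metric.mem_nhds_iff.1 (hV.mem_nhds hV0)
  have hm : Metric.ball (0 : Fin n → ℂ) (min r (ρ / 2)) ⊆ V :=
    (Metric.ball_subset_ball (min_le_left _ _)).trans hrV
  obtain ⟨V', hV', ε, hε, h⟩ := h β α hβ hα (min r (ρ / 2)) (lt_min hr (half_pos hρ))
    ((min_le_right _ _).trans_lt (half_lt_self hρ))
  exact ⟨V', hV', ε, hε, fun g hg hk => h g (hg.mono hm) (hk.mono hm)⟩

theorem Improves.congr {f f' : (Fin n → ℂ) → ℂ} (h : Improves f) (e : f =ᶠ[𝓝 0] f') :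
    Improves f' := by
  obtain ⟨ρ, hρ, hB⟩ := Metric.mem_nhds_iff.1 e
  refine improves_of_small hρ fun β α hβ hα r hr hrρ => ?_
  have he : ∀ x ∈ Metric.ball (0 : Fin n → ℂ) r, f x = f' x := fun x hx =>
    hB (Metric.ball_subset_ball hrρ.le hx)
  obtain ⟨V', hV', ε, hε, h⟩ := h β α hβ hα _ Metric.isOpen_ball (Metric.mem_ball_self hr)
  refine ⟨_, inter_mem (Metric.ball_mem_nhds 0 hr) hV', ε, hε, fun g hg hk s hs =>
    ne_top_of_le_ne_top (h g hg
      (fun p k hpk => hk p k (hpk.congr measurableSet_ball he)) s hs) ?_⟩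
  rw [← Measure.restrict_restrict measurableSet_ball]
  refine le_trans (le_of_eq (setLIntegral_congr_fun measurableSet_ball fun x hx => ?_))
    (setLIntegral_le_lintegral _ _)
  simp only [he x hx]

variable {ι : Type} {π : ι → (Fin n → ℂ) → (Fin n → ℂ)} {J : ι → (Fin n → ℂ) → ℂ}

theorem Cover.nullZeros (hc : Cover π J) {f : (Fin n → ℂ) → ℂ} (hf : Measurable f)
    (h : ∀ i, NullZeros (fun x => f (π i x))) : NullZeros f := by
  choose W hW hW0 using h
  obtain ⟨S, V, hV, k, hk, hb⟩ := hc.cover W hW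
  refine ⟨V, hV, ?_⟩
  have hm : MeasurableSet {x | f x = 0} := hf (measurableSet_singleton 0)
  have h1 := hb ({x | f x = 0}.indicator 1) (measurable_one.indicator hm)
  have h2 : ∀ i ∈ S, ∫⁻ x in W i, ({x | f x = 0}.indicator 1 (π i x) : ℝ≥0∞) * ‖J i x‖ₑ ^ 2 = 0 := by
    intro i _
    refine lintegral_eq_zero_of_ae_eq_zero ?_
    filter_upwards [hW0 i] with x hx
    simp [hx]
  rw [Finset.sum_eq_zero h2, mul_zero, lintegral_indicator_one hm, nonpos_iff_eq_zero] at h1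
  rw [ae_iff]
  simpa using h1

/-- Pulling back a finite weighted integral along a cover. -/
theorem Cover.exists_pullback_le (hc : Cover π J) (i : ι) {U : Set (Fin n → ℂ)} (hU : U ∈ 𝓝 0) :
    ∃ r > 0, Metric.ball (0 : Fin n → ℂ) r ⊆ π i ⁻¹' U ∧
      DifferentiableOn ℂ (π i) (Metric.ball 0 r) ∧ DifferentiableOn ℂ (J i) (Metric.ball 0 r) ∧
      ∃ k : ℝ≥0∞, k ≠ ∞ ∧ ∀ V : Set (Fin n → ℂ), IsOpen V → U ⊆ V → ∀ g : (Fin n → ℂ) → ℂ,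
        ContinuousOn g V → ∀ w : (Fin n → ℂ) → ℝ≥0∞, Measurable w →
        ∫⁻ x in Metric.ball 0 r, ‖g (π i x) * J i x‖ₑ ^ 2 * w (π i x) ≤
          k * ∫⁻ x in V, ‖g x‖ₑ ^ 2 * w x := by
  obtain ⟨W, hW, k, hk, hb⟩ := hc.push i
  obtain ⟨r₁, hr₁, hd₁⟩ := (hc.hol i).exists_ball
  obtain ⟨r₂, hr₂, hd₂⟩ := (hc.holJ i).exists_ball
  obtain ⟨r, hr, hB⟩ := Metric.mem_nhds_iff.1 (inter_mem hW (inter_mem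
    (((hc.hol i).tendsto (hc.zero i)) hU)
    (inter_mem (Metric.ball_mem_nhds 0 hr₁) (Metric.ball_mem_nhds 0 hr₂))))
  refine ⟨r, hr, fun x hx => (hB hx).2.1, hd₁.mono fun x hx => (hB hx).2.2.1,
    hd₂.mono fun x hx => (hB hx).2.2.2, k, hk, fun V hV hUV g hg w hw => ?_⟩
  rw [← lintegral_indicator hV.measurableSet]
  refine le_trans (le_trans (le_of_eq ?_) (lintegral_mono_set fun x hx => (hB hx).1))
    (hb _ (hg.measurable_enorm_sq_mul hV hw))
  refine setLIntegral_congr_fun measurableSet_ball fun x hx => ?_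
  have : π i x ∈ V := hUV (hB hx).2.1
  simp only [Set.indicator_of_mem this, enorm_mul]
  ring

/-- Integrability of a weighted function can be checked on a cover. -/
theorem Cover.exists_le_sum (hc : Cover π J) {W : ι → Set (Fin n → ℂ)} (hW : ∀ i, W i ∈ 𝓝 0) :
    ∃ S : Finset ι, ∀ U ∈ 𝓝 (0 : Fin n → ℂ), ∃ V' ∈ 𝓝 (0 : Fin n → ℂ), ∃ k : ℝ≥0∞, k ≠ ∞ ∧
      ∀ g : (Fin n → ℂ) → ℂ, ContinuousOn g U → ∀ w : (Fin n → ℂ) → ℝ≥0∞, Measurable w →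
      ∫⁻ x in V', ‖g x‖ₑ ^ 2 * w x ≤
        k * ∑ i ∈ S, ∫⁻ x in W i, ‖g (π i x) * J i x‖ₑ ^ 2 * w (π i x) := by
  obtain ⟨S, V, hV, k, hk, hb⟩ := hc.cover W hW
  refine ⟨S, fun U hU => ?_⟩
  obtain ⟨r, hr, hB⟩ := Metric.mem_nhds_iff.1 hU
  refine ⟨_, inter_mem (Metric.ball_mem_nhds 0 hr) hV, k, hk, fun g hg w hw => ?_⟩
  rw [← Measure.restrict_restrict measurableSet_ball, ← lintegral_indicator measurableSet_ball]
  refine (hb _ ((hg.mono hB).measurable_enorm_sq_mul Metric.isOpen_ball hw)).trans ?_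
  refine mul_le_mul_right (Finset.sum_le_sum fun i _ => lintegral_mono fun x => ?_) k
  rw [enorm_mul, mul_pow, mul_right_comm]
  exact mul_le_mul_left (Set.indicator_le_self _ (fun x => ‖g x‖ₑ ^ 2 * w x) _) _

theorem Cover.translateBound (hc : Cover π J) {f : (Fin n → ℂ) → ℂ} (hf : Measurable f)
    (h : ∀ i, TranslateBound (fun x => f (π i x))) : TranslateBound f := by
  intro β α hβ hβα hα g hg ⟨V, hV, hfin⟩
  obtain ⟨r₀, hr₀, hd⟩ := hg.exists_ball
  obtain ⟨r, hr, hB⟩ := Metric.mem_nhds_iff.1 (inter_mem hV (Metric.ball_mem_nhds 0 hr₀))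
  have hgd : ContinuousOn g (Metric.ball 0 r) := (hd.mono fun x hx => (hB hx).2).continuousOn
  have h1 : ∀ i, ∃ V ∈ 𝓝 (0 : Fin n → ℂ), ∃ C : ℝ≥0∞, C ≠ ∞ ∧ ∃ ε > 0, ∀ t : ℂ, t ≠ 0 → ‖t‖ < ε →
      ∫⁻ x in V, ‖g (π i x) * J i x‖ₑ ^ 2 * ‖f (π i x) + t‖ₑ ^ (-2 * α) ≤
        C * ‖t‖ₑ ^ (-2 * (α - β)) := by
    intro i
    refine h i β α hβ hβα hα _ ((hg.comp (hc.hol i) (hc.zero i)).mul (hc.holJ i)) ?_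
    obtain ⟨ρ, hρ, -, -, -, k, hk, hle⟩ := hc.exists_pullback_le i (Metric.ball_mem_nhds 0 hr)
    refine ⟨_, Metric.ball_mem_nhds 0 hρ, ne_top_of_le_ne_top (ENNReal.mul_ne_top hk ?_)
      (hle _ Metric.isOpen_ball subset_rfl g hgd (fun x => ‖f x‖ₑ ^ (-2 * β)) (by fun_prop))⟩
    exact ne_top_of_le_ne_top hfin (lintegral_mono_set fun x hx => (hB hx).1)
  choose W hW C hC ε hε hb using h1
  obtain ⟨S, hS⟩ := hc.exists_le_sum hW
  obtain ⟨V', hV', k, hk, hle⟩ := hS _ (Metric.ball_mem_nhds 0 hr)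
  have hδ : ∃ δ > 0, ∀ i ∈ S, δ ≤ ε i := by
    rcases S.eq_empty_or_nonempty with rfl | hne
    · exact ⟨1, one_pos, by simp⟩
    · exact ⟨S.inf' hne ε, (Finset.lt_inf'_iff _).2 fun i _ => hε i,
        fun i hi => Finset.inf'_le _ hi⟩
  obtain ⟨δ, hδ, hδε⟩ := hδ
  refine ⟨V', hV', k * ∑ i ∈ S, C i,
    ENNReal.mul_ne_top hk (ENNReal.sum_ne_top.2 fun i _ => hC i), δ, hδ, fun t ht htδ => ?_⟩
  refine (hle g hgd (fun x => ‖f x + t‖ₑ ^ (-2 * α)) (by fun_prop)).trans ?_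
  rw [mul_assoc, Finset.sum_mul]
  gcongr with i hi
  exact hb i t ht (htδ.trans_le (hδε i hi))

theorem Cover.improves (hc : Cover π J) {f : (Fin n → ℂ) → ℂ} (hf : Measurable f)
    (h : ∀ i, Improves (fun x => f (π i x))) : Improves f := by
  intro β α hβ hα V hV hV0
  have hVn := hV.mem_nhds hV0
  have h1 : ∀ i, ∃ W ∈ 𝓝 (0 : Fin n → ℂ), ∃ ε > 0, ∀ g, DifferentiableOn ℂ g V →
      Killed V f α β g → ∀ s ≤ β + ε,
        ∫⁻ x in W, ‖g (π i x) * J i x‖ₑ ^ 2 * ‖f (π i x)‖ₑ ^ (-2 * s) ≠ ∞ := by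
    intro i
    obtain ⟨ρ, hρ, hρV, hπd, hJd, k, hk, hle⟩ := hc.exists_pullback_le i hVn
    obtain ⟨W, hW, ε, hε, h'⟩ := h i β α hβ hα _ Metric.isOpen_ball (Metric.mem_ball_self hρ)
    have hd : ∀ g, DifferentiableOn ℂ g V →
        DifferentiableOn ℂ (fun x => g (π i x) * J i x) (Metric.ball 0 ρ) := fun g hg =>
      (hg.comp hπd hρV).mul hJd
    refine ⟨W, hW, ε, hε, fun g hg hgk => h' _ (hd g hg) ?_⟩
    intro p l hpl
    obtain ⟨hp, hl, ⟨K, hKρ, hK, hpK⟩, C, hC, hb⟩ := hpl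
    have hcomp : ∀ {Y : Type} [TopologicalSpace Y] [MeasurableSpace Y] [BorelSpace Y] [Zero Y]
        (F : (Fin n → ℂ) → Y), ContinuousOn F (Metric.ball 0 ρ) → Measurable fun x => F (p x) := by
      intro Y _ _ _ _ F hF
      have e : (fun x => F (p x)) = (Metric.ball 0 ρ).indicator F ∘ p := by
        ext x
        simp only [Function.comp, Set.indicator_of_mem (hKρ (hpK x))]
      rw [e]
      exact (hF.measurable_indicator Metric.isOpen_ball).comp hp
    have hIntg : Integrable fun x => J i (p x) * l x := by
      obtain ⟨B, hB⟩ := hK.exists_bound_of_continuousOn (hJd.continuousOn.mono hKρ)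
      exact hl.bdd_mul (hcomp _ hJd.continuousOn).aestronglyMeasurable
        (.of_forall fun x => hB _ (hpK x))
    have := hgk (fun x => π i (p x)) (fun x => J i (p x) * l x)
      ⟨hcomp _ hπd.continuousOn, hIntg, ⟨π i '' K, ?_, hK.image_of_continuousOn
        (hπd.continuousOn.mono hKρ), fun x => ⟨_, hpK x, rfl⟩⟩, C * k, ENNReal.mul_ne_top hC hk,
        fun u hu r hr0 hr1 => ?_⟩
    · rw [← this]; congr 1; ext x; ring
    · rintro _ ⟨x, hx, rfl⟩; exact hρV (hKρ hx)
    · have := hb _ (hd u hu) r hr0 hr1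
      simp only [mul_assoc] at this ⊢
      refine this.trans ?_
      rw [mul_left_comm k, ← mul_assoc, ← mul_assoc, mul_assoc, mul_assoc]
      gcongr
      exact hle V hV subset_rfl u hu.continuousOn (fun x => max ‖f x‖ₑ r ^ (-2 * α)) (by fun_prop)
  choose W hW ε hε hb using h1
  obtain ⟨S, hS⟩ := hc.exists_le_sum hW
  obtain ⟨V', hV', k, hk, hle⟩ := hS _ hVn
  have hδ : ∃ δ > 0, ∀ i ∈ S, δ ≤ ε i := by
    rcases S.eq_empty_or_nonempty with rfl | hne
    · exact ⟨1, one_pos, by simp⟩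
    · exact ⟨S.inf' hne ε, (Finset.lt_inf'_iff _).2 fun i _ => hε i,
        fun i hi => Finset.inf'_le _ hi⟩
  obtain ⟨δ, hδ, hδε⟩ := hδ
  refine ⟨V', hV', δ, hδ, fun g hg hgk s hs => ?_⟩
  refine ne_top_of_le_ne_top (ENNReal.mul_ne_top hk (ENNReal.sum_ne_top.2 fun i hi => ?_))
    (hle g hg.continuousOn (fun x => ‖f x‖ₑ ^ (-2 * s)) (by fun_prop))
  exact hb i g hg hgk s (hs.trans (by linarith [hδε i hi]))

end LocalProperties

section Integrals

open scoped ENNReal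

variable {n : ℕ}

theorem lintegral_pi_prod_ne_top {f : Fin n → ℂ → ℝ≥0∞} (hm : ∀ i, Measurable (f i))
    (h : ∀ i, ∫⁻ z, f i z ≠ ∞) : ∫⁻ x : Fin n → ℂ, ∏ i, f i (x i) ≠ ∞ := by
  have h1 : ∀ i, Integrable fun z => (f i z).toReal := fun i =>
    integrable_toReal_of_lintegral_ne_top (hm i).aemeasurable (h i)
  have h2 : Integrable fun x : Fin n → ℂ => ∏ i, (f i (x i)).toReal := Integrable.fintype_prod h1
  have h3 : ∀ᵐ x : Fin n → ℂ, ∀ i, f i (x i) < ∞ := ae_all_iff.2 fun i =>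
    (Measure.quasiMeasurePreserving_eval (fun _ : Fin n => (volume : Measure ℂ)) i).ae
      (ae_lt_top (hm i) (h i))
  refine ne_of_eq_of_ne (lintegral_congr_ae ?_) h2.2.ne
  filter_upwards [h3] with x hx
  rw [← ENNReal.toReal_prod, Real.enorm_of_nonneg ENNReal.toReal_nonneg, ENNReal.ofReal_toReal]
  exact (ENNReal.prod_lt_top fun i _ => hx i).ne

theorem lintegral_ball_enorm_rpow_ne_top (R : ℝ) {q : ℝ} (hq : -2 < q) :
    ∫⁻ z in Metric.ball (0 : ℂ) R, ‖z‖ₑ ^ q ≠ ∞ := by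
  have h := integrableOn_ball_of_norm_le_rpow (E := ℂ) (μ := volume) (f := fun z => ‖z‖ ^ q)
    (C := 1) (α := -q) (r := R) (by simp) (by simp; linarith)
    (.of_forall fun z => by simp [abs_of_nonneg (Real.rpow_nonneg (norm_nonneg z) q)])
    (measurable_norm.pow_const q).aestronglyMeasurable
  refine ne_of_eq_of_ne (lintegral_congr_ae (ae_restrict_of_ae ?_)) h.2.ne
  filter_upwards [(measure_eq_zero_iff_ae_notMem).1 (measure_singleton (μ := volume) (0 : ℂ))]
    with z hz
  have : z ≠ 0 := by simpa using hz
  rw [Real.enorm_of_nonneg (by positivity), ← ENNReal.ofReal_rpow_of_pos (norm_pos_iff.2 this),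
    ofReal_norm]

theorem lintegral_compl_ball_enorm_rpow_ne_top {r q : ℝ} (hr : 0 < r) (hq : q < -2) :
    ∫⁻ z in (Metric.ball (0 : ℂ) r)ᶜ, ‖z‖ₑ ^ q ≠ ∞ := by
  have h := (integrable_fun_norm_addHaar (E := ℂ) volume
    (f := (Set.Ici r).indicator fun y => y ^ q)).2 (by
      have h1 : IntegrableOn (fun y : ℝ => y ^ (q + 1)) (Set.Ici r) :=
        (integrableOn_Ici_iff_integrableOn_Ioi).2 (integrableOn_Ioi_rpow_of_lt (by linarith) hr)
      have h2 := (integrable_indicator_iff measurableSet_Ici).2 h1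
      refine (h2.congr (.of_forall fun y => ?_)).integrableOn
      by_cases hy : r ≤ y
      · have : 0 < y := hr.trans_le hy
        simp [hy, Complex.finrank_real_complex, Real.rpow_add_one this.ne', mul_comm]
      · simp [hy])
  rw [← lintegral_indicator Metric.isOpen_ball.measurableSet.compl]
  refine ne_of_eq_of_ne (lintegral_congr fun z => ?_) h.2.ne
  change _ = ‖(Set.Ici r).indicator (fun y => y ^ q) ‖z‖‖ₑ
  by_cases hz : r ≤ ‖z‖
  · have hz' : 0 < ‖z‖ := hr.trans_le hz
    rw [Set.indicator_of_mem (by simpa using hz), Set.indicator_of_mem (by simpa using hz),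
      Real.enorm_of_nonneg (by positivity), ← ENNReal.ofReal_rpow_of_pos hz', ofReal_norm]
  · rw [Set.indicator_of_notMem (by simpa using hz), Set.indicator_of_notMem (by simpa using hz)]
    simp

theorem enorm_rpow_neg_le {z : ℂ} {c q : ℝ} (hc : 0 < c) (hz : c ≤ ‖z‖) (hq : 0 ≤ q) :
    ‖z‖ₑ ^ (-q) ≤ ENNReal.ofReal (c ^ (-q)) := by
  have hz' : 0 < ‖z‖ := hc.trans_le hz
  rw [← ofReal_norm, ENNReal.ofReal_rpow_of_pos hz']
  exact ENNReal.ofReal_le_ofReal (Real.rpow_le_rpow_of_nonpos hc hz (by linarith))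

/-- A beta-type integral over the complex plane. -/
theorem lintegral_enorm_rpow_mul_ne_top {β α : ℝ} (hβ : 0 < β) (hβα : β < α) (hα : α < 1) :
    ∫⁻ y : ℂ, ‖y‖ₑ ^ (2 * β - 2) * ‖y + 1‖ₑ ^ (-2 * α) ≠ ∞ := by
  have e : -2 * α = -(2 * α) := by ring
  have e' : 2 * β - 2 = -(2 - 2 * β) := by ring
  set F : ℂ → ℝ≥0∞ := fun y => ‖y‖ₑ ^ (2 * β - 2) * ‖y + 1‖ₑ ^ (-2 * α) with hF
  have hFm : Measurable F := by fun_prop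
  have h1 : ∫⁻ y in Metric.ball 0 (1 / 2), F y ≠ ∞ := by
    refine ne_top_of_le_ne_top (b := ENNReal.ofReal ((1 / 2) ^ (-(2 * α))) *
      ∫⁻ y in Metric.ball (0 : ℂ) (1 / 2), ‖y‖ₑ ^ (2 * β - 2))
      (ENNReal.mul_ne_top ENNReal.ofReal_ne_top (lintegral_ball_enorm_rpow_ne_top _ (by linarith))) ?_
    rw [← lintegral_const_mul _ (by fun_prop)]
    refine setLIntegral_mono (by fun_prop) fun y hy => ?_
    simp only [hF, e]
    refine (mul_comm _ _).trans_le <| mul_le_mul_left (enorm_rpow_neg_le (c := 1 / 2) (by norm_num) ?_ (by linarith)) _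
    have h1 : ‖y‖ < 1 / 2 := by simpa using hy
    have h2 : ‖(1 : ℂ)‖ ≤ ‖y + 1‖ + ‖y‖ := by
      simpa using norm_sub_le (y + 1) y
    rw [norm_one] at h2; linarith
  have h2 : ∫⁻ y in Metric.ball (-1) (1 / 2), F y ≠ ∞ := by
    have h0 : ∫⁻ y in Metric.ball (-1 : ℂ) (1 / 2), ‖y + 1‖ₑ ^ (-2 * α) ≠ ∞ := by
      have := lintegral_ball_enorm_rpow_ne_top (1 / 2) (q := -2 * α) (by linarith)
      rw [← lintegral_indicator measurableSet_ball] at this ⊢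
      rw [← lintegral_add_right_eq_self _ (1 : ℂ)] at this
      refine ne_of_eq_of_ne (lintegral_congr fun y => ?_) this
      by_cases hy : ‖y + 1‖ < 1 / 2
      · rw [Set.indicator_of_mem (by simpa [dist_eq_norm] using hy),
          Set.indicator_of_mem (by simpa using hy)]
      · rw [Set.indicator_of_notMem (by simpa [dist_eq_norm] using hy),
          Set.indicator_of_notMem (by simpa using hy)]
    refine ne_top_of_le_ne_top (b := ENNReal.ofReal ((1 / 2) ^ (-(2 - 2 * β))) *
      ∫⁻ y in Metric.ball (-1 : ℂ) (1 / 2), ‖y + 1‖ₑ ^ (-2 * α))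
      (ENNReal.mul_ne_top ENNReal.ofReal_ne_top h0) ?_
    rw [← lintegral_const_mul _ (by fun_prop)]
    refine setLIntegral_mono (by fun_prop) fun y hy => ?_
    rw [hF, e']
    refine mul_le_mul_left (enorm_rpow_neg_le (c := 1 / 2) (by norm_num) ?_ (by linarith)) _
    have h1 : ‖y + 1‖ < 1 / 2 := by simpa [dist_eq_norm] using hy
    have h2 : ‖(1 : ℂ)‖ ≤ ‖y + 1‖ + ‖y‖ := by
      simpa using norm_sub_le (y + 1) y
    rw [norm_one] at h2; linarith
  set S : Set ℂ := Metric.ball 0 (1 / 2) ∪ Metric.ball (-1) (1 / 2) with hS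
  have hSm : MeasurableSet S := measurableSet_ball.union measurableSet_ball
  have h3 : ∫⁻ y in Sᶜ, F y ≠ ∞ := by
    refine ne_top_of_le_ne_top (b := ENNReal.ofReal ((1 / 3) ^ (-(2 * α))) *
      ∫⁻ y in (Metric.ball (0 : ℂ) (1 / 2))ᶜ, ‖y‖ₑ ^ (2 * β - 2 - 2 * α))
      (ENNReal.mul_ne_top ENNReal.ofReal_ne_top
        (lintegral_compl_ball_enorm_rpow_ne_top (by norm_num) (by linarith))) ?_
    rw [← lintegral_const_mul _ (by fun_prop)]
    refine (setLIntegral_mono (by fun_prop) fun y hy => ?_).trans (lintegral_mono_set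
      (Set.compl_subset_compl.2 Set.subset_union_left))
    have h1 : 1 / 2 ≤ ‖y‖ := by
      by_contra hc
      exact hy (Or.inl (by simpa using hc))
    have h2 : 1 / 2 ≤ ‖y + 1‖ := by
      by_contra hc
      exact hy (Or.inr (by simpa [dist_eq_norm] using hc))
    have h3 : ‖y‖ ≤ ‖y + 1‖ + 1 := by
      simpa using norm_sub_le (y + 1) 1
    have hy0 : 0 < ‖y‖ := by linarith
    have hy1 : 0 < ‖y + 1‖ := by linarith
    rw [hF, e]
    simp only [← ofReal_norm]
    rw [ENNReal.ofReal_rpow_of_pos hy0, ENNReal.ofReal_rpow_of_pos hy1,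
      ENNReal.ofReal_rpow_of_pos hy0, ← ENNReal.ofReal_mul (by positivity),
      ← ENNReal.ofReal_mul (by positivity)]
    refine ENNReal.ofReal_le_ofReal ?_
    rw [show 2 * β - 2 - 2 * α = (2 * β - 2) + (-(2 * α)) by ring, Real.rpow_add hy0,
      mul_left_comm]
    refine mul_le_mul_of_nonneg_left ?_ (by positivity)
    rw [← Real.mul_rpow (by norm_num) hy0.le]
    exact Real.rpow_le_rpow_of_nonpos (by positivity) (by linarith) (by linarith)
  rw [← lintegral_add_compl F hSm]
  exact ENNReal.add_ne_top.2 ⟨ne_top_of_le_ne_top (ENNReal.add_ne_top.2 ⟨h1, h2⟩)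
    (lintegral_union_le _ _ _), h3⟩

/-- The one-variable translate estimate for a power. -/
theorem lintegral_pow_translate_le {β α : ℝ} (hβ : 0 < β) (hβα : β < α) (hα : α < 1)
    {k : ℕ} (hk : k ≠ 0) : ∃ C : ℝ≥0∞, C ≠ ∞ ∧ ∀ c t : ℂ, c ≠ 0 → t ≠ 0 →
      ∫⁻ z : ℂ, ‖z‖ₑ ^ (2 * (k * β - 1)) * ‖z ^ k * c + t‖ₑ ^ (-2 * α) ≤
        C * ‖t‖ₑ ^ (-2 * (α - β)) * ‖c‖ₑ ^ (-2 * β) := by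
  refine ⟨k * _, ENNReal.mul_ne_top (by simp) (lintegral_enorm_rpow_mul_ne_top hβ hβα hα),
    fun c t hc ht => ?_⟩
  set H : ℂ → ℝ≥0∞ := fun w => ‖w‖ₑ ^ (2 * β - 2) * ‖w * c + t‖ₑ ^ (-2 * α) with hH
  have hHm : Measurable H := by fun_prop
  have hk1 : (1 : ℝ) ≤ k := by exact_mod_cast Nat.one_le_iff_ne_zero.2 hk
  have hz0 : ∀ᵐ z : ℂ, z ≠ 0 := by
    filter_upwards [(measure_eq_zero_iff_ae_notMem).1 (measure_singleton (μ := volume) (0 : ℂ))]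
      with z hz
    simpa using hz
  have h1 : ∫⁻ z : ℂ, ‖z‖ₑ ^ (2 * (k * β - 1)) * ‖z ^ k * c + t‖ₑ ^ (-2 * α) =
      ∫⁻ z, H (z ^ k) * ‖z ^ (k - 1)‖ₑ ^ 2 := by
    refine lintegral_congr_ae ?_
    filter_upwards [hz0] with z hz
    have hz1 : ‖z‖ₑ ≠ 0 := by simpa using hz
    have hz2 : ‖z‖ₑ ≠ ∞ := by simp
    simp only [hH]
    rw [mul_right_comm]
    congr 1
    rw [enorm_pow, enorm_pow, ← pow_mul, ← ENNReal.rpow_natCast, ← ENNReal.rpow_natCast,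
      ← ENNReal.rpow_mul, ← ENNReal.rpow_add _ _ hz1 hz2]
    congr 1
    push_cast [Nat.one_le_iff_ne_zero.2 hk]
    ring
  have h2 : ∫⁻ w, H w = ‖t‖ₑ ^ (-2 * (α - β)) * ‖c‖ₑ ^ (-2 * β) *
      ∫⁻ y : ℂ, ‖y‖ₑ ^ (2 * β - 2) * ‖y + 1‖ₑ ^ (-2 * α) := by
    have htc : t / c ≠ 0 := div_ne_zero ht hc
    rw [← lintegral_comp_const_mul htc, ← lintegral_const_mul _ (by fun_prop)]
    refine lintegral_congr_ae ?_
    filter_upwards [hz0, (measure_eq_zero_iff_ae_notMem).1 (measure_singleton (μ := volume) (-1 : ℂ))]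
      with y hy hy1
    have hy1 : y + 1 ≠ 0 := fun h => hy1 (by simpa using eq_neg_of_add_eq_zero_left h)
    have e : t / c * y * c + t = t * (y + 1) := by field_simp
    have hpt : 0 < ‖t‖ := norm_pos_iff.2 ht
    have hpc : 0 < ‖c‖ := norm_pos_iff.2 hc
    have hpy : 0 < ‖y‖ := norm_pos_iff.2 hy
    have hpy1 : 0 < ‖y + 1‖ := norm_pos_iff.2 hy1
    simp only [hH, e]
    simp only [← ofReal_norm, norm_mul, norm_div]
    have hp2 : 0 < ‖t‖ / ‖c‖ * ‖y‖ := by positivity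
    have hp3 : 0 < ‖t‖ * ‖y + 1‖ := by positivity
    rw [ENNReal.ofReal_rpow_of_pos hp2, ENNReal.ofReal_rpow_of_pos hp3,
      ENNReal.ofReal_rpow_of_pos hpt, ENNReal.ofReal_rpow_of_pos hpc,
      ENNReal.ofReal_rpow_of_pos hpy, ENNReal.ofReal_rpow_of_pos hpy1,
      ← ENNReal.ofReal_pow (by positivity), ← ENNReal.ofReal_mul (by positivity),
      ← ENNReal.ofReal_mul (by positivity), ← ENNReal.ofReal_mul (by positivity),
      ← ENNReal.ofReal_mul (by positivity), ← ENNReal.ofReal_mul (by positivity)]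
    congr 1
    have e1 : -2 * (α - β) = (2 * β - 2) + (-2 * α) + 2 := by ring
    have e2 : -2 * β = -((2 * β - 2) + 2) := by ring
    rw [e1, e2]
    generalize 2 * β - 2 = a
    rw [Real.mul_rpow (by positivity) (by positivity), Real.div_rpow (by positivity) (by positivity),
      Real.mul_rpow (by positivity) (by positivity), div_pow, Real.rpow_add hpt, Real.rpow_add hpt,
      Real.rpow_neg hpc.le, Real.rpow_add hpc, Real.rpow_two, Real.rpow_two]
    field_simp
  rw [h1]
  refine (lintegral_pow_comp_le hk H hHm).trans (le_of_eq ?_)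
  rw [h2]
  ring

end Integrals

section MonomialFunctionals

open scoped ENNReal ComplexConjugate

variable {n : ℕ}

theorem lintegral_mul_sq_le {A : Type*} [MeasurableSpace A] {μ : Measure A} {f h : A → ℝ≥0∞}
    (hf : AEMeasurable f μ) (hh : AEMeasurable h μ) :
    (∫⁻ x, f x * h x ∂μ) ^ 2 ≤ (∫⁻ x, f x ^ 2 ∂μ) * ∫⁻ x, h x ^ 2 ∂μ := by
  have := ENNReal.lintegral_mul_le_Lp_mul_Lq μ Real.HolderConjugate.two_two hf hh
  calc (∫⁻ x, f x * h x ∂μ) ^ 2 ≤ _ := pow_le_pow_left₀ zero_le this 2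
    _ = _ := by
      rw [mul_pow, ← ENNReal.rpow_natCast, ← ENNReal.rpow_natCast, ← ENNReal.rpow_mul,
        ← ENNReal.rpow_mul]
      norm_num

/-- Stretching the `i`-th coordinate. -/
def stretch (i : Fin n) (ω : ℂ) (x : Fin n → ℂ) : Fin n → ℂ := Function.update x i (ω * x i)

theorem stretch_apply (i : Fin n) (ω : ℂ) (x : Fin n → ℂ) (j : Fin n) :
    stretch i ω x j = if j = i then ω * x i else x j := by
  simp [stretch, Function.update_apply]

theorem stretch_one (i : Fin n) (x : Fin n → ℂ) : stretch i 1 x = x := by simp [stretch]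

theorem continuous_stretch (i : Fin n) : Continuous fun p : ℂ × (Fin n → ℂ) => stretch i p.1 p.2 := by
  refine continuous_pi fun j => ?_
  simp only [stretch_apply]
  by_cases h : j = i
  · simp only [h, if_true]; fun_prop
  · simp only [h, if_false]; fun_prop

theorem norm_stretch_le (i : Fin n) {ω : ℂ} (hω : ‖ω‖ ≤ 1) (x : Fin n → ℂ) :
    ‖stretch i ω x‖ ≤ ‖x‖ := by
  refine (pi_norm_le_iff_of_nonneg (norm_nonneg _)).2 fun j => ?_
  rw [stretch_apply]
  split_ifs with h
  · rw [norm_mul]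
    exact (mul_le_of_le_one_left (norm_nonneg _) hω).trans (norm_le_pi_norm x i)
  · exact norm_le_pi_norm x j

theorem measurePreserving_stretch (i : Fin n) {ω : ℂ} (hω : ‖ω‖ = 1) :
    MeasurePreserving (stretch i ω : (Fin n → ℂ) → (Fin n → ℂ)) := by
  have h1 : MeasurePreserving (fun z : ℂ => ω * z) := by
    have := (rotation ⟨ω, mem_sphere_zero_iff_norm.2 hω⟩).measurePreserving
    exact this
  have h2 := volume_preserving_pi (α' := fun _ : Fin n => ℂ) (β' := fun _ : Fin n => ℂ)
    (f := fun j => if j = i then fun z => ω * z else id) (fun j => by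
      by_cases h : j = i
      · simpa [h] using h1
      · simpa [h] using MeasurePreserving.id _)
  convert h2 using 1
  ext x j
  rw [stretch_apply]
  by_cases h : j = i
  · subst h; simp
  · simp [h]

/-- A weighted mean of `g` over a polydisc around `y`, stretched in the `i`-th direction. -/
def coordMean (i : Fin n) (m : ℕ) (s : ℝ) (y : Fin n → ℂ) (g : (Fin n → ℂ) → ℂ) (ω : ℂ) : ℂ :=
  ∫ x in Metric.ball (0 : Fin n → ℂ) s, g (y + stretch i ω x) * conj (x i) ^ m

variable {R s : ℝ} {y : Fin n → ℂ} {i : Fin n} {g : (Fin n → ℂ) → ℂ}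

theorem add_stretch_norm_le {ρ : ℝ} (hyi : y i = 0) {ω : ℂ} (hω : ‖ω‖ ≤ ρ)
    {x : Fin n → ℂ} (hx : ‖x‖ ≤ s) (hρ : 0 ≤ ρ) : ‖y + stretch i ω x‖ ≤ max (‖y‖ + s) (ρ * s) := by
  refine (pi_norm_le_iff_of_nonneg (le_max_of_le_right (mul_nonneg hρ
    ((norm_nonneg _).trans hx)))).2 fun j => ?_
  rw [Pi.add_apply, stretch_apply]
  split_ifs with h
  · subst h
    rw [hyi, zero_add, norm_mul]
    exact le_max_of_le_right (mul_le_mul hω ((norm_le_pi_norm x j).trans hx) (norm_nonneg _) hρ)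
  · exact le_max_of_le_left ((norm_add_le _ _).trans
      (add_le_add (norm_le_pi_norm y j) ((norm_le_pi_norm x j).trans hx)))

theorem differentiableOn_coordMean (hg : DifferentiableOn ℂ g (Metric.ball 0 R)) (hyi : y i = 0)
    (hs : 0 < s) (hys : ‖y‖ + s < R) (m : ℕ) :
    DifferentiableOn ℂ (coordMean i m s y g) (Metric.ball 0 (R / s)) := by
  have hmem : ∀ ω ∈ Metric.ball (0 : ℂ) (R / s), ∃ ρ, ‖ω‖ < ρ ∧ 0 ≤ ρ ∧
      max (‖y‖ + s) (ρ * s) < R := by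
    intro ω hω
    obtain ⟨ρ, h1, h2⟩ := exists_between (mem_ball_zero_iff.1 hω)
    exact ⟨ρ, h1, (norm_nonneg _).trans h1.le, max_lt hys ((lt_div_iff₀ hs).1 h2)⟩
  refine differentiableOn_integral_param Metric.isOpen_ball (fun ω hω => ?_) (fun ω hω => ?_) ?_
  · obtain ⟨ρ, h1, h0, h2⟩ := hmem ω hω
    refine ContinuousOn.aestronglyMeasurable (ContinuousOn.mul ?_ (by fun_prop)) measurableSet_ball
    refine hg.continuousOn.comp ?_ fun x hx => mem_ball_zero_iff.2
      ((add_stretch_norm_le hyi h1.le (mem_ball_zero_iff.1 hx).le h0).trans_lt h2)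
    have := continuous_stretch i
    exact (continuous_const.add (this.comp (by fun_prop : Continuous fun x => (ω, x)))).continuousOn
  · obtain ⟨ρ, h1, h0, h2⟩ := hmem ω hω
    obtain ⟨B, hB⟩ := (isCompact_closedBall (0 : Fin n → ℂ) (max (‖y‖ + s) (ρ * s))).exists_bound_of_continuousOn
      (hg.continuousOn.mono (Metric.closedBall_subset_ball h2))
    refine ⟨Metric.ball 0 ρ, Metric.isOpen_ball.mem_nhds (mem_ball_zero_iff.2 h1),
      fun _ => B * s ^ m, integrableOn_const (by finiteness) (by finiteness), ?_⟩
    filter_upwards [ae_restrict_mem measurableSet_ball] with x hx ω' hω'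
    have hx' := (mem_ball_zero_iff.1 hx).le
    have h3 := hB _ (mem_closedBall_zero_iff.2 (add_stretch_norm_le hyi
      (mem_ball_zero_iff.1 hω').le hx' h0))
    rw [norm_mul, norm_pow, RCLike.norm_conj]
    exact mul_le_mul h3 (pow_le_pow_left₀ (norm_nonneg _) ((norm_le_pi_norm x i).trans hx') m)
      (by positivity) ((norm_nonneg _).trans h3)
  · filter_upwards [ae_restrict_mem measurableSet_ball] with x hx
    refine DifferentiableOn.mul_const (hg.comp ?_ fun ω hω => ?_) _
    · refine Differentiable.differentiableOn (differentiable_pi.2 fun j => ?_)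
      simp only [Pi.add_apply, stretch_apply]
      by_cases h : j = i
      · simp only [h, if_true]; fun_prop
      · simp only [h, if_false]; fun_prop
    · obtain ⟨ρ, h1, h0, h2⟩ := hmem ω hω
      exact mem_ball_zero_iff.2 ((add_stretch_norm_le hyi h1.le (mem_ball_zero_iff.1 hx).le h0).trans_lt h2)

theorem coordMean_of_norm_eq_one (hg : DifferentiableOn ℂ g (Metric.ball 0 R))
    (hys : ‖y‖ + s < R) (m : ℕ) {ω : ℂ} (hω : ‖ω‖ = 1) :
    coordMean i m s y g ω = ω ^ m * coordMean i m s y g 1 := by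
  have hω0 : ω ≠ 0 := by rintro rfl; simp at hω
  have hpre : stretch i ω ⁻¹' Metric.ball (0 : Fin n → ℂ) s = Metric.ball 0 s := by
    ext x
    have h1 := norm_stretch_le i hω.le x
    have h2 := norm_stretch_le i (ω := ω⁻¹) (by simp [hω]) (stretch i ω x)
    have h3 : stretch i ω⁻¹ (stretch i ω x) = x := by
      simp [stretch, hω0]
    rw [h3] at h2
    rw [Set.mem_preimage, mem_ball_zero_iff, mem_ball_zero_iff, le_antisymm h1 h2]
  have hmp := (measurePreserving_stretch i hω).restrict_preimage
    (measurableSet_ball (x := (0 : Fin n → ℂ)) (ε := s))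
  rw [hpre] at hmp
  unfold coordMean
  simp only [stretch_one]
  rw [← integral_const_mul]
  conv_rhs => rw [← hmp.map_eq]
  rw [integral_map hmp.aemeasurable]
  · refine setIntegral_congr_fun measurableSet_ball fun x _ => ?_
    have e : stretch i ω x i = ω * x i := by simp [stretch]
    have e2 : ω * conj ω = 1 := by rw [Complex.mul_conj, Complex.normSq_eq_norm_sq, hω]; simp
    simp only [e, map_mul, mul_pow]
    rw [mul_left_comm, ← mul_assoc (ω ^ m), ← mul_pow, e2, one_pow, one_mul]
  · rw [hmp.map_eq]
    refine ContinuousOn.aestronglyMeasurable ?_ measurableSet_ball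
    refine continuousOn_const.mul (ContinuousOn.mul (hg.continuousOn.comp (by fun_prop) ?_)
      (by fun_prop))
    intro x hx
    exact mem_ball_zero_iff.2 ((norm_add_le _ _).trans_lt
      (by linarith [mem_ball_zero_iff.1 hx]))

theorem coordMean_eq (hg : DifferentiableOn ℂ g (Metric.ball 0 R)) (hyi : y i = 0)
    (hs : 0 < s) (hys : ‖y‖ + s < R) (m : ℕ) {ω : ℂ} (hω : ‖ω‖ ≤ 1) :
    coordMean i m s y g ω = ω ^ m * coordMean i m s y g 1 := by
  have hRs : 1 < R / s := (one_lt_div hs).2 (by linarith [norm_nonneg y])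
  have hcl : closure (Metric.ball (0 : ℂ) 1) ⊆ Metric.ball 0 (R / s) := by
    rw [closure_ball _ one_ne_zero]
    exact Metric.closedBall_subset_ball hRs
  have h := Complex.eqOn_closure_of_eqOn_frontier (U := Metric.ball (0 : ℂ) 1)
    (f := coordMean i m s y g) (g := fun ω => ω ^ m * coordMean i m s y g 1) Metric.isBounded_ball
    ((differentiableOn_coordMean hg hyi hs hys m).mono hcl).diffContOnCl
    (Differentiable.diffContOnCl (by fun_prop)) (fun ω hω => by
      rw [frontier_ball _ one_ne_zero] at hω
      exact coordMean_of_norm_eq_one hg hys m (mem_sphere_zero_iff_norm.1 hω))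
  rw [closure_ball _ one_ne_zero] at h
  exact h (mem_closedBall_zero_iff.2 hω)

theorem enorm_coordMean_sq_le (hg : DifferentiableOn ℂ g (Metric.ball 0 R)) (hyi : y i = 0)
    (hs : 0 < s) (hys : ‖y‖ + s < R) (m : ℕ) {ω : ℂ} (hω : ‖ω‖ ≤ 1) (hω0 : ω ≠ 0)
    {w : (Fin n → ℂ) → ℝ≥0∞} (hw : Measurable w)
    (h1 : ∀ x ∈ Metric.ball (0 : Fin n → ℂ) s, 1 ≤ w (y + stretch i ω x)) :
    ‖coordMean i m s y g 1‖ₑ ^ 2 * ‖ω‖ₑ ^ (2 * m + 2) ≤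
      ENNReal.ofReal s ^ (2 * m) * volume (Metric.ball (0 : Fin n → ℂ) s) *
        ∫⁻ x in Metric.ball 0 R, ‖g x‖ₑ ^ 2 * w x := by
  have hmem : ∀ x ∈ Metric.ball (0 : Fin n → ℂ) s, y + stretch i ω x ∈ Metric.ball (0 : Fin n → ℂ) R :=
    fun x hx => mem_ball_zero_iff.2 ((norm_add_le _ _).trans_lt
      (by linarith [mem_ball_zero_iff.1 hx, norm_stretch_le i hω x]))
  have hst : Continuous fun x : Fin n → ℂ => y + stretch i ω x :=
    continuous_const.add ((continuous_stretch i).comp (by fun_prop : Continuous fun x => (ω, x)))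
  set K : (Fin n → ℂ) → ℝ≥0∞ := (Metric.ball 0 R).indicator fun x => ‖g x‖ₑ ^ 2 * w x with hK
  have hKm : Measurable K := hg.continuousOn.measurable_enorm_sq_mul Metric.isOpen_ball hw
  have hgm : AEMeasurable (fun x => ‖g (y + stretch i ω x)‖ₑ)
      (volume.restrict (Metric.ball (0 : Fin n → ℂ) s)) :=
    (ContinuousOn.aestronglyMeasurable (hg.continuousOn.comp hst.continuousOn hmem)
      measurableSet_ball).enorm
  have hA : ‖coordMean i m s y g ω‖ₑ ^ 2 ≤ ENNReal.ofReal s ^ (2 * m) *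
      volume (Metric.ball (0 : Fin n → ℂ) s) *
      ∫⁻ x in Metric.ball (0 : Fin n → ℂ) s, ‖g (y + stretch i ω x)‖ₑ ^ 2 := by
    have h2 : ‖coordMean i m s y g ω‖ₑ ≤ ∫⁻ x in Metric.ball (0 : Fin n → ℂ) s,
        ‖g (y + stretch i ω x)‖ₑ * ENNReal.ofReal s ^ m := by
      refine (enorm_integral_le_lintegral_enorm _).trans
        (lintegral_mono_ae ?_)
      filter_upwards [ae_restrict_mem measurableSet_ball] with x hx
      rw [enorm_mul, enorm_pow]
      refine mul_le_mul_right (pow_le_pow_left₀ zero_le ?_ m) _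
      rw [← ofReal_norm, RCLike.norm_conj]
      exact ENNReal.ofReal_le_ofReal ((norm_le_pi_norm x i).trans (mem_ball_zero_iff.1 hx).le)
    refine (pow_le_pow_left₀ zero_le h2 2).trans ((lintegral_mul_sq_le hgm
      aemeasurable_const).trans (le_of_eq ?_))
    rw [setLIntegral_const]
    ring
  have hB : (∫⁻ x in Metric.ball (0 : Fin n → ℂ) s, ‖g (y + stretch i ω x)‖ₑ ^ 2) * ‖ω‖ₑ ^ 2 ≤
      ∫⁻ x, K x := by
    rw [← lintegral_add_left_eq_self K y, ← lintegral_mul_const' _ _ (by finiteness)]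
    rw [← lintegral_indicator measurableSet_ball]
    have h3 : ∀ x, (Metric.ball (0 : Fin n → ℂ) s).indicator
        (fun x => ‖g (y + stretch i ω x)‖ₑ ^ 2 * ‖ω‖ₑ ^ 2) x ≤ K (y + stretch i ω x) * ‖ω‖ₑ ^ 2 := by
      intro x
      by_cases hx : x ∈ Metric.ball (0 : Fin n → ℂ) s
      · rw [Set.indicator_of_mem hx, hK, Set.indicator_of_mem (hmem x hx)]
        exact mul_le_mul_left (le_mul_of_one_le_right zero_le (h1 x hx)) _
      · rw [Set.indicator_of_notMem hx]; exact zero_le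
    refine (lintegral_mono h3).trans (lintegral_le_of_slice i ?_ ?_ fun x => ?_)
    · exact (hKm.comp hst.measurable).mul_const _
    · exact hKm.comp (by fun_prop)
    · rw [← lintegral_comp_const_mul hω0 (fun z => K (y + Function.update x i z))]
      simp [stretch]
  calc ‖coordMean i m s y g 1‖ₑ ^ 2 * ‖ω‖ₑ ^ (2 * m + 2)
      = ‖coordMean i m s y g ω‖ₑ ^ 2 * ‖ω‖ₑ ^ 2 := by
        rw [coordMean_eq hg hyi hs hys m hω, enorm_mul, enorm_pow]; ring
    _ ≤ _ := mul_le_mul_left hA _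
    _ = ENNReal.ofReal s ^ (2 * m) * volume (Metric.ball (0 : Fin n → ℂ) s) *
      ((∫⁻ x in Metric.ball (0 : Fin n → ℂ) s, ‖g (y + stretch i ω x)‖ₑ ^ 2) * ‖ω‖ₑ ^ 2) := by ring
    _ ≤ _ := mul_le_mul_right hB _
    _ = _ := by rw [hK, lintegral_indicator measurableSet_ball]

end MonomialFunctionals

section MonomialDivision

open scoped ENNReal ComplexConjugate

variable {n : ℕ} {R s : ℝ} {y : Fin n → ℂ} {i : Fin n} {g : (Fin n → ℂ) → ℂ}

theorem norm_mon_stretch_le (a : Fin n → ℕ) {M σ : ℝ} (hσ : 0 ≤ σ) (hyi : y i = 0)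
    {x : Fin n → ℂ} (hx : ‖y‖ + ‖x‖ ≤ M) :
    ‖mon a (y + stretch i σ x)‖ ≤ M ^ (∑ j, a j) * σ ^ a i := by
  have h : ∀ j, ‖(y + stretch i σ x) j ^ a j‖ ≤ M ^ a j * (if j = i then σ else 1) ^ a j := by
    intro j
    rw [norm_pow, ← mul_pow]
    refine pow_le_pow_left₀ (norm_nonneg _) ?_ _
    rw [Pi.add_apply, stretch_apply]
    split_ifs with h
    · subst h
      rw [hyi, zero_add, norm_mul, Complex.norm_real, Real.norm_of_nonneg hσ, mul_comm]
      exact mul_le_mul_of_nonneg_right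
        ((norm_le_pi_norm x j).trans (by linarith [norm_nonneg y])) hσ
    · rw [mul_one]
      exact (norm_add_le _ _).trans ((add_le_add (norm_le_pi_norm y j) (norm_le_pi_norm x j)).trans hx)
  rw [mon, norm_prod]
  refine (Finset.prod_le_prod (fun _ _ => norm_nonneg _) fun j _ => h j).trans (le_of_eq ?_)
  rw [Finset.prod_mul_distrib, Finset.prod_pow_eq_pow_sum]
  congr 1
  rw [Finset.prod_eq_single i] <;> simp +contextual

open scoped Classical in
theorem theta_coordMean {a : Fin n → ℕ} (ha : a i ≠ 0) {m : ℕ} {α β : ℝ} (hα : 0 ≤ α)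
    (hm : (m + 1 : ℝ) ≤ β * a i) (hyi : y i = 0) (hs : 0 < s) (hys : ‖y‖ + s < R) :
    Theta (Metric.ball 0 R) (mon a) α β (fun x => if x ∈ Metric.ball 0 s then y + x else y)
      ((Metric.ball (0 : Fin n → ℂ) s).indicator fun x => conj (x i) ^ m) ∧
    ∀ g : (Fin n → ℂ) → ℂ, ∫ x, g (if x ∈ Metric.ball 0 s then y + x else y) *
      (Metric.ball (0 : Fin n → ℂ) s).indicator (fun x => conj (x i) ^ m) x =
        coordMean i m s y g 1 := by
  have hval : ∀ g : (Fin n → ℂ) → ℂ, ∫ x, g (if x ∈ Metric.ball 0 s then y + x else y) *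
      (Metric.ball (0 : Fin n → ℂ) s).indicator (fun x => conj (x i) ^ m) x =
        coordMean i m s y g 1 := by
    intro g
    rw [coordMean, ← integral_indicator measurableSet_ball]
    congr 1
    ext x
    by_cases hx : x ∈ Metric.ball (0 : Fin n → ℂ) s
    · simp only [if_pos hx, Set.indicator_of_mem hx, stretch_one]
    · simp only [Set.indicator_of_notMem hx, mul_zero]
  refine ⟨⟨Measurable.ite measurableSet_ball (by fun_prop) measurable_const, ?_,
    ⟨Metric.closedBall 0 (‖y‖ + s), Metric.closedBall_subset_ball hys, isCompact_closedBall _ _,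
      fun x => ?_⟩, ?_⟩, hval⟩
  · refine (integrable_indicator_iff measurableSet_ball).2 ?_
    have : ContinuousOn (fun x : Fin n → ℂ => conj (x i) ^ m) (Metric.closedBall 0 s) := by fun_prop
    exact (this.integrableOn_compact (isCompact_closedBall _ _)).mono_set Metric.ball_subset_closedBall
  · rw [mem_closedBall_zero_iff]
    split_ifs with hx
    · exact (norm_add_le _ _).trans (by linarith [mem_ball_zero_iff.1 hx])
    · linarith
  set M : ℝ := max 1 R with hM
  set C₀ : ℝ≥0∞ := ENNReal.ofReal (M ^ ∑ j, a j) with hC₀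
  have hM1 : 1 ≤ M := le_max_left _ _
  have hC₀1 : 1 ≤ C₀ := by
    rw [hC₀, ← ENNReal.ofReal_one]
    exact ENNReal.ofReal_le_ofReal (one_le_pow₀ hM1)
  have hC₀t : C₀ ≠ ∞ := ENNReal.ofReal_ne_top
  set C₁ := ENNReal.ofReal s ^ (2 * m) * volume (Metric.ball (0 : Fin n → ℂ) s) with hC₁
  refine ⟨C₁ * C₀ ^ (2 * α), ENNReal.mul_ne_top (by finiteness)
    (ENNReal.rpow_ne_top_of_nonneg (by linarith) hC₀t), fun g hg r hr0 hr1 => ?_⟩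
  rw [hval]
  have hrt : r ≠ ∞ := ne_top_of_le_ne_top ENNReal.one_ne_top hr1
  set ρ := r.toReal with hρ
  have hρ0 : 0 < ρ := ENNReal.toReal_pos hr0 hrt
  have hρ1 : ρ ≤ 1 := ENNReal.toReal_mono ENNReal.one_ne_top hr1
  have hrρ : r = ENNReal.ofReal ρ := (ENNReal.ofReal_toReal hrt).symm
  have ha0 : (0 : ℝ) < a i := by exact_mod_cast Nat.pos_of_ne_zero ha
  set σ := ρ ^ (1 / (a i : ℝ)) with hσ
  have hσ0 : 0 < σ := Real.rpow_pos_of_pos hρ0 _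
  have hσ1 : σ ≤ 1 := Real.rpow_le_one hρ0.le hρ1 (by positivity)
  have hσa : σ ^ a i = ρ := by
    rw [hσ, ← Real.rpow_natCast, ← Real.rpow_mul hρ0.le, one_div, inv_mul_cancel₀ ha0.ne',
      Real.rpow_one]
  have hσe : ‖(σ : ℂ)‖ₑ = r ^ (1 / (a i : ℝ)) := by
    rw [← ofReal_norm, Complex.norm_real, Real.norm_of_nonneg hσ0.le, hσ, hrρ,
      ENNReal.ofReal_rpow_of_pos hρ0]
  have hn : ‖(σ : ℂ)‖ ≤ 1 := by rwa [Complex.norm_real, Real.norm_of_nonneg hσ0.le]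
  have hC₀r0 : C₀ * r ≠ 0 := mul_ne_zero (one_pos.trans_le hC₀1).ne' hr0
  have hC₀rt : C₀ * r ≠ ∞ := ENNReal.mul_ne_top hC₀t hrt
  have key := enorm_coordMean_sq_le (w := fun x => (C₀ * r) ^ (2 * α) * max ‖mon a x‖ₑ r ^ (-2 * α))
    hg hyi hs hys m hn (by exact_mod_cast hσ0.ne')
    (by have := (differentiable_mon a).continuous.measurable; fun_prop) (fun x hx => by
      have h1 : max ‖mon a (y + stretch i σ x)‖ₑ r ≤ C₀ * r := by
        refine max_le ?_ (le_mul_of_one_le_left zero_le hC₀1)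
        rw [hC₀, hrρ, ← ENNReal.ofReal_mul (by positivity), ← ofReal_norm, ← hσa]
        refine ENNReal.ofReal_le_ofReal (norm_mon_stretch_le a hσ0.le hyi ?_)
        linarith [mem_ball_zero_iff.1 hx, le_max_right 1 R]
      rw [show -2 * α = -(2 * α) by ring, ENNReal.rpow_neg,
        ← ENNReal.div_eq_inv_mul.trans (mul_comm _ _)]
      refine (ENNReal.le_div_iff_mul_le (Or.inl ?_) (Or.inl ?_)).2 ?_
      · exact (ENNReal.rpow_pos (lt_max_of_lt_right (pos_iff_ne_zero.2 hr0)) (by finiteness)).ne'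
      · exact ENNReal.rpow_ne_top_of_nonneg (by linarith) (by finiteness)
      · rw [one_mul]; exact ENNReal.rpow_le_rpow h1 (by linarith))
  have h2 : ‖(σ : ℂ)‖ₑ ^ (2 * m + 2) = r ^ ((2 * m + 2) / (a i : ℝ)) := by
    rw [hσe, ← ENNReal.rpow_natCast, ← ENNReal.rpow_mul]
    congr 1; push_cast; ring
  have h3 : r ^ (2 * β) ≤ ‖(σ : ℂ)‖ₑ ^ (2 * m + 2) := by
    rw [h2]
    refine ENNReal.rpow_le_rpow_of_exponent_ge hr1 ?_
    rw [div_le_iff₀ ha0]; linarith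
  have h4 : ‖coordMean i m s y g 1‖ₑ ^ 2 * r ^ (2 * β) ≤ C₁ * (C₀ ^ (2 * α) * r ^ (2 * α) *
      ∫⁻ x in Metric.ball 0 R, ‖g x‖ₑ ^ 2 * max ‖mon a x‖ₑ r ^ (-2 * α)) := by
    refine (mul_le_mul_right h3 _).trans (key.trans (le_of_eq ?_))
    rw [ENNReal.mul_rpow_of_ne_zero (one_pos.trans_le hC₀1).ne' hr0,
      ← lintegral_const_mul' _ _ (ENNReal.mul_ne_top
        (ENNReal.rpow_ne_top_of_nonneg (by linarith) hC₀t)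
        (ENNReal.rpow_ne_top_of_nonneg (by linarith) hrt))]
    congr 1
    exact lintegral_congr fun x => by ring
  have h5 : r ^ (2 * β) ≠ 0 := (ENNReal.rpow_pos (pos_iff_ne_zero.2 hr0) hrt).ne'
  have h6 : r ^ (2 * β) ≠ ∞ := by
    rw [hrρ, ENNReal.ofReal_rpow_of_pos hρ0]; exact ENNReal.ofReal_ne_top
  rw [← ENNReal.le_div_iff_mul_le (Or.inl h5) (Or.inl h6)] at h4
  refine h4.trans (le_of_eq ?_)
  rw [show 2 * (α - β) = 2 * α + -(2 * β) by ring, ENNReal.rpow_add _ _ hr0 hrt, ENNReal.rpow_neg,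
    ENNReal.div_eq_inv_mul]
  ring

/-- The mean vanishes only if the leading coefficient does. -/
theorem eq_zero_of_coordMean {m : ℕ} {G : (Fin n → ℂ) → ℂ}
    (hG : DifferentiableOn ℂ G (Metric.ball 0 R)) (hyi : y i = 0) (hy : ‖y‖ < R)
    (hg : ∀ x ∈ Metric.ball 0 R, g x = x i ^ m * G x)
    (h : ∀ s, 0 < s → ‖y‖ + s < R → coordMean i m s y g 1 = 0) : G y = 0 := by
  by_contra hne
  have hc : ContinuousAt G y :=
    hG.continuousOn.continuousAt (Metric.isOpen_ball.mem_nhds (mem_ball_zero_iff.2 hy))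
  obtain ⟨δ, hδ, hb⟩ := Metric.continuousAt_iff.1 hc (‖G y‖ / 2) (by positivity)
  set s := min δ ((R - ‖y‖) / 2) with hs
  have hs0 : 0 < s := lt_min hδ (by linarith)
  have hsR : ‖y‖ + s < R := by linarith [min_le_right δ ((R - ‖y‖) / 2)]
  have h0 := h s hs0 hsR
  set B := Metric.ball (0 : Fin n → ℂ) s with hB
  have hmem : ∀ x ∈ B, y + x ∈ Metric.ball (0 : Fin n → ℂ) R := fun x hx =>
    mem_ball_zero_iff.2 ((norm_add_le _ _).trans_lt (by linarith [mem_ball_zero_iff.1 hx]))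
  set w : (Fin n → ℂ) → ℝ := fun x => ‖x i‖ ^ (2 * m) with hw
  have hwi : IntegrableOn w B := by
    have : ContinuousOn w (Metric.closedBall 0 s) := by fun_prop
    exact (this.integrableOn_compact (isCompact_closedBall _ _)).mono_set Metric.ball_subset_closedBall
  have h1 : coordMean i m s y g 1 = ∫ x in B, (w x : ℂ) * G (y + x) := by
    refine setIntegral_congr_fun measurableSet_ball fun x hx => ?_
    simp only [stretch_one]
    rw [hg _ (hmem x hx), Pi.add_apply, hyi, zero_add, mul_right_comm, ← mul_pow, Complex.mul_conj,
      Complex.normSq_eq_norm_sq, hw]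
    push_cast
    ring
  have hGb : ∀ x ∈ B, ‖G (y + x) - G y‖ ≤ ‖G y‖ / 2 := by
    intro x hx
    have := @hb (y + x) (by
      rw [dist_eq_norm, add_sub_cancel_left]
      exact (mem_ball_zero_iff.1 hx).trans_le (min_le_left _ _))
    rw [dist_eq_norm] at this
    exact this.le
  have hGm : AEStronglyMeasurable (fun x => G (y + x) - G y) (volume.restrict B) :=
    (ContinuousOn.sub (hG.continuousOn.comp (by fun_prop) hmem) continuousOn_const).aestronglyMeasurable
      measurableSet_ball
  have hwc : Integrable (fun x => ((w x : ℝ) : ℂ)) (volume.restrict B) := hwi.ofReal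
  have hwe : ∫ x in B, ((w x : ℝ) : ℂ) = ((∫ x in B, w x : ℝ) : ℂ) := integral_ofReal
  have hdi : IntegrableOn (fun x => (w x : ℂ) * (G (y + x) - G y)) B := by
    exact hwc.mul_bdd (c := ‖G y‖ / 2) hGm (by
      filter_upwards [ae_restrict_mem measurableSet_ball] with x hx using hGb x hx)
  have h2 : ∫ x in B, (w x : ℂ) * G (y + x) =
      (∫ x in B, (w x : ℂ) * (G (y + x) - G y)) + ((∫ x in B, w x : ℝ) : ℂ) * G y := by
    rw [← hwe]
    have e : ∫ x in B, (w x : ℂ) * G (y + x) =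
        ∫ x in B, ((w x : ℂ) * (G (y + x) - G y) + (w x : ℂ) * G y) := by
      congr 1; ext x; ring
    rw [e, integral_add hdi (hwc.mul_const _), integral_mul_const]
  have h3 : ‖∫ x in B, (w x : ℂ) * (G (y + x) - G y)‖ ≤ (∫ x in B, w x) * (‖G y‖ / 2) := by
    rw [← integral_mul_const]
    refine norm_integral_le_of_norm_le (hwi.mul_const _) ?_
    filter_upwards [ae_restrict_mem measurableSet_ball] with x hx
    rw [norm_mul, Complex.norm_real, Real.norm_of_nonneg (by positivity)]
    exact mul_le_mul_of_nonneg_left (hGb x hx) (by positivity)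
  have h4 : 0 < ∫ x in B, w x := by
    rw [setIntegral_pos_iff_support_of_nonneg_ae (.of_forall fun x => by positivity) hwi]
    have : B ≤ᵐ[volume] (Function.support w ∩ B : Set _) := by
      filter_upwards [ae_coord_ne_zero (n := n)] with x hx hxB
      exact ⟨by simp only [hw, Function.mem_support]; exact pow_ne_zero _ (norm_ne_zero_iff.2 (hx i)), hxB⟩
    exact (Metric.measure_ball_pos volume 0 hs0).trans_le (measure_mono_ae this)
  rw [h1, h2] at h0
  have h5 := eq_neg_of_add_eq_zero_left h0
  rw [h5, norm_neg, norm_mul, Complex.norm_real, Real.norm_of_nonneg h4.le] at h3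
  have := norm_pos_iff.2 hne
  nlinarith [mul_pos h4 this]

/-- Uniform division by a coordinate. -/
theorem exists_coord_mul_ball {G : (Fin n → ℂ) → ℂ} (hG : DifferentiableOn ℂ G (Metric.ball 0 R))
    (h : ∀ y ∈ Metric.ball (0 : Fin n → ℂ) R, y i = 0 → G y = 0) :
    ∃ G', DifferentiableOn ℂ G' (Metric.ball 0 R) ∧
      ∀ x ∈ Metric.ball (0 : Fin n → ℂ) R, G x = x i * G' x := by
  have hup : ∀ x : Fin n → ℂ, ‖Function.update x i 0‖ ≤ ‖x‖ := fun x => by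
    simpa [stretch] using norm_stretch_le i (ω := 0) (by simp) x
  have hseg : ∀ x ∈ Metric.ball (0 : Fin n → ℂ) R, ∀ s ∈ Set.Icc (0 : ℝ) 1,
      Function.update x i 0 + (s : ℂ) • (x - Function.update x i 0) ∈ Metric.ball (0 : Fin n → ℂ) R :=
    fun x hx s hs => segment_mem_ball_of_norm hx (mem_ball_zero_iff.2
      ((hup x).trans_lt (mem_ball_zero_iff.1 hx))) hs
  refine ⟨_, hadamard_along Metric.isOpen_ball Metric.isOpen_ball hG _
    (differentiable_update_zero i) hseg (Pi.single i 1), fun x hx => ?_⟩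
  have h1 := integral_fderiv_segment Metric.isOpen_ball hG (x := x) (p := Function.update x i 0)
    (hseg x hx)
  rw [h _ (mem_ball_zero_iff.2 ((hup x).trans_lt (mem_ball_zero_iff.1 hx))) (by simp), sub_zero] at h1
  have e : x - Function.update x i 0 = x i • Pi.single i (1 : ℂ) := by
    ext j
    by_cases hj : j = i
    · subst hj; simp
    · simp [hj]
  rw [h1, ← intervalIntegral.integral_const_mul]
  refine intervalIntegral.integral_congr fun s _ => ?_
  simp only [e, map_smul, smul_eq_mul]

theorem exists_mon_mul_of_killed {a : Fin n → ℕ} {α β : ℝ} (hα : 0 ≤ α)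
    (hg : DifferentiableOn ℂ g (Metric.ball 0 R)) (hk : Killed (Metric.ball 0 R) (mon a) α β g)
    (N : ℕ) : ∀ b : Fin n → ℕ, ∑ j, b j = N → (∀ j, (b j : ℝ) ≤ β * a j) →
    ∃ G, DifferentiableOn ℂ G (Metric.ball 0 R) ∧
      ∀ x ∈ Metric.ball (0 : Fin n → ℂ) R, g x = mon b x * G x := by
  induction N with
  | zero =>
    intro b hb _
    have : b = 0 := funext fun j => by simpa using (Finset.sum_eq_zero_iff.1 hb) j (Finset.mem_univ j)
    subst this
    exact ⟨g, hg, fun x _ => by simp⟩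
  | succ N ih =>
    intro b hb hba
    obtain ⟨i, hi⟩ : ∃ i, b i ≠ 0 := by
      by_contra! h
      simp [h] at hb
    obtain ⟨m, hm⟩ := Nat.exists_eq_succ_of_ne_zero hi
    have hsplit : b = Function.update b i m + Pi.single i 1 := by
      ext j
      by_cases hj : j = i
      · subst hj; simp [hm]
      · simp [hj]
    have hsum : ∑ j, Function.update b i m j = N := by
      have := congrArg (fun f => ∑ j, f j) hsplit
      simp only [Pi.add_apply, Finset.sum_add_distrib, hb, Finset.sum_pi_single'] at this
      simp at this; omega
    obtain ⟨G, hG, e⟩ := ih (Function.update b i m) hsum fun j => by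
      by_cases hj : j = i
      · subst hj
        have := hba j
        rw [hm] at this; push_cast at this
        simp only [Function.update_self]; linarith
      · simpa [hj] using hba j
    have hai : a i ≠ 0 := by
      intro h0
      have := hba i
      rw [h0, Nat.cast_zero, mul_zero] at this
      exact hi (by exact_mod_cast le_antisymm this (Nat.cast_nonneg _))
    set c := Function.update b i 0 with hc
    have hbm : ∀ x, mon (Function.update b i m) x = x i ^ m * mon c x := by
      intro x
      have : Function.update b i m = m • Pi.single i 1 + c := by
        ext j
        by_cases hj : j = i
        · subst hj; simp [hc]
        · simp [hj, hc]
      rw [this, mon_add, mon_nsmul, ← mon_single i x]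
    have hzero : ∀ y ∈ Metric.ball (0 : Fin n → ℂ) R, y i = 0 → mon c y * G y = 0 := by
      intro y hy hyi
      refine eq_zero_of_coordMean (g := g) (m := m) (G := fun x => mon c x * G x)
        ((differentiable_mon c).differentiableOn.mul hG) hyi (mem_ball_zero_iff.1 hy)
        (fun x hx => by rw [e x hx, hbm]; ring) fun s hs hys => ?_
      have := theta_coordMean (s := s) (R := R) (y := y) hai (m := m) (β := β) hα
        (by have := hba i; rw [hm] at this; push_cast at this; exact this) hyi hs hys
      rw [← this.2]
      exact hk _ _ this.1
    have hzero' : ∀ y ∈ Metric.ball (0 : Fin n → ℂ) R, y i = 0 → G y = 0 := by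
      intro y hy hyi
      have hci : c i = 0 := by simp [hc]
      set v : ℂ → Fin n → ℂ := fun t => y + t • Function.update (1 : Fin n → ℂ) i 0 with hv
      have hvc : Continuous v := by fun_prop
      have hvt : Tendsto v (𝓝[≠] 0) (𝓝 y) := by
        have := hvc.tendsto 0
        simp only [hv, zero_smul, add_zero] at this
        exact this.mono_left nhdsWithin_le_nhds
      have h1 : ∀ᶠ t in 𝓝[≠] (0 : ℂ), ∀ j, j ≠ i → v t j ≠ 0 := by
        refine eventually_all.2 fun j => ?_
        by_cases hj : j = i
        · exact .of_forall fun t h => (h hj).elim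
        have hvj : ∀ t, v t j = y j + t := fun t => by simp [hv, hj]
        by_cases hyj : y j = 0
        · filter_upwards [self_mem_nhdsWithin] with t ht _
          rw [hvj, hyj, zero_add]; exact ht
        · have : ∀ᶠ t in 𝓝[≠] (0 : ℂ), v t j ≠ 0 :=
            ((tendsto_pi_nhds.1 hvt j).eventually_ne hyj)
          exact this.mono fun t ht _ => ht
      have h2 : Tendsto (fun t => G (v t)) (𝓝[≠] 0) (𝓝 (G y)) :=
        (hG.continuousOn.continuousAt (Metric.isOpen_ball.mem_nhds hy)).tendsto.comp hvt
      refine tendsto_nhds_unique h2 (tendsto_const_nhds.congr' ?_)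
      filter_upwards [h1, hvt (Metric.isOpen_ball.mem_nhds hy)] with t ht htB
      have h3 := hzero (v t) htB (by simp [hv, hyi])
      refine ((mul_eq_zero.1 h3).resolve_left ?_).symm
      refine Finset.prod_ne_zero_iff.2 fun j _ => ?_
      by_cases hj : j = i
      · subst hj; simp [hci]
      · exact pow_ne_zero _ (ht j hj)
    obtain ⟨G', hG', e'⟩ := exists_coord_mul_ball hG hzero'
    refine ⟨G', hG', fun x hx => ?_⟩
    rw [e x hx, e' x hx, hsplit, mon_add, ← mon_single i x, ← hsplit]
    ring

end MonomialDivision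

section BaseCases

open scoped ENNReal

variable {n : ℕ}

theorem ENNReal.rpow_le_rpow_of_nonpos {x y : ℝ≥0∞} {q : ℝ} (hq : q ≤ 0) (h : x ≤ y) :
    y ^ q ≤ x ^ q := by
  rw [← neg_neg q, ENNReal.rpow_neg y, ENNReal.rpow_neg x]
  exact ENNReal.inv_le_inv.2 (ENNReal.rpow_le_rpow h (by linarith))

theorem ENNReal.rpow_le_add_of_mem_Icc {c₁ c₂ x : ℝ≥0∞} (h₁ : c₁ ≤ x) (h₂ : x ≤ c₂) (q : ℝ) :
    x ^ q ≤ c₁ ^ q + c₂ ^ q := by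
  rcases le_total 0 q with hq | hq
  · exact (ENNReal.rpow_le_rpow h₂ hq).trans le_add_self
  · exact (ENNReal.rpow_le_rpow_of_nonpos hq h₁).trans le_self_add

/-- Functions with `∫ |b|² |f|^{-2γ} < ∞` are annihilated by functionals of positive order. -/
theorem killed_of_lintegral {V : Set (Fin n → ℂ)} (hV : IsOpen V) {f b : (Fin n → ℂ) → ℂ}
    (hf : Measurable f) (hb : DifferentiableOn ℂ b V) {α γ : ℝ} (hγ : 0 ≤ γ) (hγα : γ < α)
    (hne : ∀ᵐ x ∂volume.restrict V, f x ≠ 0)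
    (hfin : ∫⁻ x in V, ‖b x‖ₑ ^ 2 * ‖f x‖ₑ ^ (-2 * γ) ≠ ∞) : Killed V f α γ b := by
  rintro p k ⟨-, -, -, C, hC, hbd⟩
  set r : ℕ → ℝ≥0∞ := fun n => ((n : ℝ≥0∞) + 1)⁻¹ with hr
  have hr1 : ∀ n, r n ≤ 1 := fun n => ENNReal.inv_le_one.2 le_add_self
  have hr0 : ∀ n, r n ≠ 0 := fun n => ENNReal.inv_ne_zero.2 (by finiteness)
  have hrt : ∀ n, r n ≠ ∞ := fun n => ne_top_of_le_ne_top ENNReal.one_ne_top (hr1 n)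
  have hrlim : Tendsto r atTop (𝓝 0) := by
    have := (tendsto_add_atTop_iff_nat 1).2 ENNReal.tendsto_inv_nat_nhds_zero
    simpa [hr] using this
  have hrpow : Tendsto (fun n => r n ^ (2 * (α - γ))) atTop (𝓝 0) := by
    have := (ENNReal.continuous_rpow_const (y := 2 * (α - γ))).tendsto 0
    rw [ENNReal.zero_rpow_of_pos (by linarith)] at this
    exact this.comp hrlim
  have hpt : ∀ n, r n ^ (2 * (α - γ)) ≠ ∞ := fun n =>
    ENNReal.rpow_ne_top_of_nonneg (by linarith) (hrt n)
  set F : ℕ → (Fin n → ℂ) → ℝ≥0∞ := fun n x =>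
    r n ^ (2 * (α - γ)) * (‖b x‖ₑ ^ 2 * max ‖f x‖ₑ (r n) ^ (-2 * α)) with hF
  have hbm : AEMeasurable b (volume.restrict V) := hb.continuousOn.aemeasurable hV.measurableSet
  have hlim : Tendsto (fun n => ∫⁻ x in V, F n x) atTop (𝓝 (∫⁻ x in V, 0)) := by
    refine tendsto_lintegral_of_dominated_convergence' _ (fun n => ?_) (fun n => ?_) hfin ?_
    · exact ((hbm.enorm.pow_const 2).mul (by fun_prop)).const_mul _
    · refine .of_forall fun x => ?_
      simp only [hF]
      rw [mul_left_comm]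
      refine mul_le_mul_right ?_ _
      set M := max ‖f x‖ₑ (r n) with hM
      have hM0 : M ≠ 0 := ((pos_iff_ne_zero.2 (hr0 n)).trans_le (le_max_right _ _)).ne'
      have hMt : M ≠ ∞ := by simp [hM, hrt n]
      calc r n ^ (2 * (α - γ)) * M ^ (-2 * α) ≤ M ^ (2 * (α - γ)) * M ^ (-2 * α) :=
            mul_le_mul_left (ENNReal.rpow_le_rpow (le_max_right _ _) (by linarith)) _
        _ = M ^ (-2 * γ) := by rw [← ENNReal.rpow_add _ _ hM0 hMt]; congr 1; ring
        _ ≤ _ := ENNReal.rpow_le_rpow_of_nonpos (by linarith) (le_max_left _ _)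
    · filter_upwards [hne] with x hx
      have hx0 : ‖f x‖ₑ ≠ 0 := by simpa using hx
      have hK : ‖b x‖ₑ ^ 2 * ‖f x‖ₑ ^ (-2 * α) ≠ ∞ := by
        refine ENNReal.mul_ne_top (by finiteness) ?_
        simp [ENNReal.rpow_eq_top_iff, hx0]
      have h0 : Tendsto (fun n => r n ^ (2 * (α - γ)) * (‖b x‖ₑ ^ 2 * ‖f x‖ₑ ^ (-2 * α))) atTop
          (𝓝 0) := by
        simpa using ENNReal.Tendsto.mul_const hrpow (Or.inr hK)
      refine tendsto_of_tendsto_of_tendsto_of_le_of_le tendsto_const_nhds h0 (fun _ => zero_le)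
        fun n => ?_
      refine mul_le_mul_right (mul_le_mul_right ?_ _) _
      exact ENNReal.rpow_le_rpow_of_nonpos (by linarith) (le_max_left _ _)
  rw [lintegral_zero] at hlim
  have hle : ∀ n, ‖∫ x, b (p x) * k x‖ₑ ^ 2 ≤ C * ∫⁻ x in V, F n x := fun n => by
    simp only [hF]
    rw [lintegral_const_mul' _ _ (hpt n), ← mul_assoc]
    exact hbd b hb (r n) (hr0 n) (hr1 n)
  have h := ge_of_tendsto' (by simpa using ENNReal.Tendsto.const_mul hlim (Or.inr hC)) hle
  simpa using h

theorem setLIntegral_enorm_sq_mul_ne_top {V : Set (Fin n → ℂ)} (hV : MeasurableSet V)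
    {g : (Fin n → ℂ) → ℂ} {M : ℝ} (hM : ∀ x ∈ V, ‖g x‖ ≤ M) {w : (Fin n → ℂ) → ℝ≥0∞}
    (hw : ∫⁻ x in V, w x ≠ ∞) : ∫⁻ x in V, ‖g x‖ₑ ^ 2 * w x ≠ ∞ := by
  refine ne_top_of_le_ne_top (ENNReal.mul_ne_top (a := ENNReal.ofReal M ^ 2) (by finiteness) hw) ?_
  rw [← lintegral_const_mul' _ _ (by finiteness)]
  refine setLIntegral_mono' hV fun x hx => mul_le_mul_left ?_ _
  gcongr
  rw [← ofReal_norm]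
  exact ENNReal.ofReal_le_ofReal (hM x hx)

theorem DifferentiableOn.exists_bound_half {g : (Fin n → ℂ) → ℂ} {r : ℝ} (hr : 0 < r)
    (hg : DifferentiableOn ℂ g (Metric.ball 0 r)) :
    ∃ M, ∀ x ∈ Metric.ball (0 : Fin n → ℂ) (r / 2), ‖g x‖ ≤ M := by
  obtain ⟨M, hM⟩ := (isCompact_closedBall (0 : Fin n → ℂ) (r / 2)).exists_bound_of_continuousOn
    (hg.continuousOn.mono (Metric.closedBall_subset_ball (half_lt_self hr)))
  exact ⟨M, fun x hx => hM x (Metric.ball_subset_closedBall hx)⟩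

theorem exists_ball_norm_bounds {u : (Fin n → ℂ) → ℂ} (hu : Hol u) (h0 : u 0 ≠ 0) :
    ∃ ρ > 0, ∀ x ∈ Metric.ball (0 : Fin n → ℂ) ρ, ‖u 0‖ / 2 ≤ ‖u x‖ ∧ ‖u x‖ ≤ 2 * ‖u 0‖ := by
  have hp := norm_pos_iff.2 h0
  have h1 : Tendsto (fun x => ‖u x‖) (𝓝 0) (𝓝 ‖u 0‖) := hu.continuousAt.norm
  obtain ⟨ρ, hρ, h⟩ := Metric.eventually_nhds_iff_ball.1
    ((h1.eventually_const_le (half_lt_self hp)).and (h1.eventually_le_const (u := 2 * ‖u 0‖) (by linarith)))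
  exact ⟨ρ, hρ, h⟩

theorem nullZeros_unit {u : (Fin n → ℂ) → ℂ} (hu : Hol u) (h0 : u 0 ≠ 0) : NullZeros u := by
  obtain ⟨ρ, hρ, h⟩ := exists_ball_norm_bounds hu h0
  refine ⟨_, Metric.ball_mem_nhds 0 hρ, ?_⟩
  filter_upwards [ae_restrict_mem measurableSet_ball] with x hx
  exact norm_pos_iff.1 ((half_pos (norm_pos_iff.2 h0)).trans_le (h x hx).1)

theorem improves_unit {u : (Fin n → ℂ) → ℂ} (hu : Hol u) (h0 : u 0 ≠ 0) : Improves u := by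
  obtain ⟨ρ, hρ, h⟩ := exists_ball_norm_bounds hu h0
  refine improves_of_small hρ fun β α hβ hα r hr hrρ =>
    ⟨_, Metric.ball_mem_nhds 0 (half_pos hr), 1, one_pos, fun g hg _ s _ => ?_⟩
  obtain ⟨M, hM⟩ := hg.exists_bound_half hr
  refine setLIntegral_enorm_sq_mul_ne_top measurableSet_ball hM ?_
  have hp := norm_pos_iff.2 h0
  refine ne_top_of_le_ne_top (b := ∫⁻ x in Metric.ball (0 : Fin n → ℂ) (r / 2),
    (ENNReal.ofReal (‖u 0‖ / 2) ^ (-2 * s) + ENNReal.ofReal (2 * ‖u 0‖) ^ (-2 * s))) ?_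
    (setLIntegral_mono' measurableSet_ball fun x hx => ?_)
  · rw [setLIntegral_const, ENNReal.ofReal_rpow_of_pos (by positivity),
      ENNReal.ofReal_rpow_of_pos (by positivity)]
    exact ENNReal.mul_ne_top (by finiteness) measure_ball_lt_top.ne
  · have hx' := h x (Metric.ball_subset_ball (by linarith) hx)
    refine ENNReal.rpow_le_add_of_mem_Icc ?_ ?_ _ <;> rw [← ofReal_norm]
    exacts [ENNReal.ofReal_le_ofReal hx'.1, ENNReal.ofReal_le_ofReal hx'.2]

theorem translateBound_unit {u : (Fin n → ℂ) → ℂ} (hu : Hol u) (h0 : u 0 ≠ 0) :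
    TranslateBound u := by
  obtain ⟨ρ, hρ, h⟩ := exists_ball_norm_bounds hu h0
  intro β α hβ hβα hα g hg _
  have hp := norm_pos_iff.2 h0
  obtain ⟨r, hr, hgr⟩ := hg.exists_ball
  obtain ⟨M, hM⟩ := hgr.exists_bound_half hr
  set B := Metric.ball (0 : Fin n → ℂ) (min ρ (r / 2)) with hB
  refine ⟨B, Metric.ball_mem_nhds 0 (lt_min hρ (half_pos hr)),
    ∫⁻ x in B, ‖g x‖ₑ ^ 2 * ENNReal.ofReal ((‖u 0‖ / 4) ^ (-(2 * α))),
    setLIntegral_enorm_sq_mul_ne_top measurableSet_ball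
      (fun x hx => hM x (Metric.ball_subset_ball (min_le_right _ _) hx)) ?_,
    min 1 (‖u 0‖ / 4), by positivity, fun t ht htε => ?_⟩
  · rw [setLIntegral_const]
    exact ENNReal.mul_ne_top (by finiteness) measure_ball_lt_top.ne
  · have ht1 : 1 ≤ ‖t‖ₑ ^ (-2 * (α - β)) := by
      refine ENNReal.one_le_rpow_of_pos_of_le_one_of_neg (by simpa using ht) ?_ (by linarith)
      rw [← ofReal_norm, ← ENNReal.ofReal_one]
      exact ENNReal.ofReal_le_ofReal (htε.le.trans (min_le_left _ _))
    refine le_trans (setLIntegral_mono' measurableSet_ball fun x hx => ?_) (le_mul_of_one_le_right zero_le ht1)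
    refine mul_le_mul_right ?_ _
    rw [neg_mul]
    refine enorm_rpow_neg_le (by positivity) ?_ (by linarith)
    have h1 := (h x (Metric.ball_subset_ball (min_le_left _ _) hx)).1
    have h2 := norm_sub_le (u x + t) t
    rw [add_sub_cancel_right] at h2
    linarith [htε.le.trans (min_le_right _ _)]

theorem nullZeros_mon (a : Fin n → ℕ) : NullZeros (mon a) := by
  refine ⟨Set.univ, univ_mem, ae_restrict_of_ae ?_⟩
  filter_upwards [ae_coord_ne_zero (n := n)] with x hx
  exact Finset.prod_ne_zero_iff.2 fun j _ => pow_ne_zero _ (hx j)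

theorem lintegral_mon_ne_top {a b : Fin n → ℕ} {q : ℝ} (h : ∀ i, -2 < 2 * b i + q * a i) (R : ℝ) :
    ∫⁻ x in Metric.ball (0 : Fin n → ℂ) R, ‖mon b x‖ₑ ^ 2 * ‖mon a x‖ₑ ^ q ≠ ∞ := by
  rcases le_or_gt R 0 with hR | hR
  · simp [Metric.ball_eq_empty.2 hR]
  set f : Fin n → ℂ → ℝ≥0∞ := fun i => (Metric.ball (0 : ℂ) R).indicator
    fun z => ‖z‖ₑ ^ (2 * b i + q * a i) with hf
  have h1 := lintegral_pi_prod_ne_top (f := f)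
    (fun i => Measurable.indicator (by fun_prop) measurableSet_ball) fun i => by
      rw [lintegral_indicator measurableSet_ball]
      exact lintegral_ball_enorm_rpow_ne_top R (h i)
  refine ne_top_of_le_ne_top h1 ?_
  rw [← lintegral_indicator measurableSet_ball]
  refine lintegral_mono_ae ?_
  filter_upwards [ae_coord_ne_zero (n := n)] with x hx
  by_cases hxB : x ∈ Metric.ball (0 : Fin n → ℂ) R
  · rw [Set.indicator_of_mem hxB]
    have hxi : ∀ i, x i ∈ Metric.ball (0 : ℂ) R := fun i => mem_ball_zero_iff.2
      ((norm_le_pi_norm x i).trans_lt (mem_ball_zero_iff.1 hxB))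
    have hx0 : ∀ i, ‖x i‖ₑ ≠ 0 := fun i => by simpa using hx i
    refine le_of_eq ?_
    have e : ∀ c : Fin n → ℕ, ‖mon c x‖ₑ = ∏ i, ‖x i‖ₑ ^ (c i : ℝ) := fun c => by
      simp only [ENNReal.rpow_natCast, ← enorm_pow]
      rw [mon, ← ofReal_norm, norm_prod, ENNReal.ofReal_prod_of_nonneg fun _ _ => norm_nonneg _]
      simp only [ofReal_norm]
    rw [e, e, ← Finset.prod_pow, ← ENNReal.prod_rpow_of_ne_top (fun i _ => by finiteness),
      ← Finset.prod_mul_distrib]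
    refine Finset.prod_congr rfl fun i _ => ?_
    simp only [hf]
    rw [Set.indicator_of_mem (hxi i), ENNReal.rpow_add _ _ (hx0 i) enorm_ne_top, mul_comm q,
      ENNReal.rpow_mul _ (a i : ℝ) q, mul_comm (2 : ℝ), ENNReal.rpow_mul _ (b i : ℝ)]
    norm_cast
  · rw [Set.indicator_of_notMem hxB]; exact zero_le

theorem improves_mon (a : Fin n → ℕ) : Improves (mon a) := by
  refine improves_of_small one_pos fun β α hβ hα r hr _ => ?_
  set b : Fin n → ℕ := fun i => ⌊β * a i⌋₊ with hb
  have hb1 : ∀ i, (b i : ℝ) ≤ β * a i := fun i => Nat.floor_le (by positivity)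
  have hb2 : ∀ i, β * a i < b i + 1 := fun i => Nat.lt_floor_add_one _
  have hε : ∀ᶠ ε in 𝓝[>] (0 : ℝ), ∀ i, (β + ε) * a i < b i + 1 := by
    refine eventually_all.2 fun i => ?_
    have : Tendsto (fun ε : ℝ => (β + ε) * a i) (𝓝 0) (𝓝 (β * a i)) := by
      have h : Continuous fun ε : ℝ => (β + ε) * a i := by fun_prop
      simpa using h.tendsto 0
    exact (this.mono_left nhdsWithin_le_nhds).eventually_lt_const (hb2 i)
  obtain ⟨ε, hεb, hε0⟩ := (hε.and self_mem_nhdsWithin).exists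
  refine ⟨_, Metric.ball_mem_nhds 0 (half_pos hr), ε, hε0, fun g hg hk s hs => ?_⟩
  obtain ⟨G, hG, e⟩ := exists_mon_mul_of_killed (hβ.trans hα) hg hk _ b rfl hb1
  obtain ⟨M, hM⟩ := hG.exists_bound_half hr
  refine ne_of_eq_of_ne (setLIntegral_congr_fun measurableSet_ball fun x hx => ?_)
    (setLIntegral_enorm_sq_mul_ne_top measurableSet_ball hM
      (lintegral_mon_ne_top (a := a) (b := b) (q := -2 * s) (fun i => ?_) (r / 2)))
  · rw [e x (Metric.ball_subset_ball (by linarith) hx), enorm_mul]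
    ring
  · nlinarith [hεb i, mul_le_mul_of_nonneg_right hs (Nat.cast_nonneg (α := ℝ) (a i))]

theorem mon_update_coord (a : Fin n → ℕ) (i : Fin n) (x : Fin n → ℂ) (z : ℂ) :
    mon a (Function.update x i z) = z ^ a i * mon (Function.update a i 0) x := by
  have e : a = a i • Pi.single i 1 + Function.update a i 0 := by
    ext j
    by_cases hj : j = i
    · subst hj; simp
    · simp [hj]
  conv_lhs => rw [e, mon_add, mon_nsmul, mon_single, Function.update_self, mon_update (by simp)]

theorem lintegral_mon_translate_le {a b : Fin n → ℕ} {i : Fin n} (hi : a i ≠ 0) {β α : ℝ}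
    (hβ : 0 < β) (hβα : β < α) (hα : α < 1) (hb : ∀ j, β * a j < b j + 1) :
    ∃ C : ℝ≥0∞, C ≠ ∞ ∧ ∀ t : ℂ, t ≠ 0 → ∫⁻ x in Metric.ball (0 : Fin n → ℂ) 1,
      ‖mon b x‖ₑ ^ 2 * ‖mon a x + t‖ₑ ^ (-2 * α) ≤ C * ‖t‖ₑ ^ (-2 * (α - β)) := by
  obtain ⟨C, hC, hCb⟩ := lintegral_pow_translate_le hβ hβα hα hi
  set a' := Function.update a i 0 with ha'
  set b' := Function.update b i 0 with hb'
  set v := volume (Metric.ball (0 : ℂ) 1) with hv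
  have hv0 : v ≠ 0 := (Metric.measure_ball_pos volume _ one_pos).ne'
  have hvt : v ≠ ∞ := measure_ball_lt_top.ne
  have ha'u : ∀ x z, mon a' (Function.update x i z) = mon a' x := fun x z =>
    mon_update (by simp [ha']) x z
  have hb'u : ∀ x z, mon b' (Function.update x i z) = mon b' x := fun x z =>
    mon_update (by simp [hb']) x z
  have hmm : ∀ c : Fin n → ℕ, Measurable (mon c) := fun c => (differentiable_mon c).continuous.measurable
  have hfin := lintegral_mon_ne_top (a := a') (b := b') (q := -2 * β) (fun j => by
    by_cases hj : j = i
    · subst hj; simp [ha', hb']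
    · simp only [ha', hb', Function.update_of_ne hj]; linarith [hb j]) 1
  refine ⟨C * v⁻¹ * _, ENNReal.mul_ne_top (ENNReal.mul_ne_top hC (ENNReal.inv_ne_top.2 hv0)) hfin,
    fun t ht => ?_⟩
  set B := Metric.ball (0 : Fin n → ℂ) 1 with hB
  set F : (Fin n → ℂ) → ℝ≥0∞ := {x | mon a' x ≠ 0}.indicator (B.indicator fun x =>
    ‖mon b x‖ₑ ^ 2 * ‖mon a x + t‖ₑ ^ (-2 * α)) with hF
  set G : (Fin n → ℂ) → ℝ≥0∞ := B.indicator fun x => C * v⁻¹ * ‖t‖ₑ ^ (-2 * (α - β)) *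
    (‖mon b' x‖ₑ ^ 2 * ‖mon a' x‖ₑ ^ (-2 * β)) with hG
  have hms : MeasurableSet {x | mon a' x ≠ 0} := (hmm a') (measurableSet_singleton 0).compl
  have hFm : Measurable F := by
    refine Measurable.indicator (Measurable.indicator ?_ measurableSet_ball) hms
    have := hmm a; have := hmm b
    fun_prop
  have hGm : Measurable G := by
    refine Measurable.indicator ?_ measurableSet_ball
    have := hmm a'; have := hmm b'
    fun_prop
  have h1 : ∫⁻ x in B, ‖mon b x‖ₑ ^ 2 * ‖mon a x + t‖ₑ ^ (-2 * α) = ∫⁻ x, F x := by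
    rw [← lintegral_indicator measurableSet_ball]
    refine lintegral_congr_ae ?_
    filter_upwards [ae_coord_ne_zero (n := n)] with x hx
    rw [hF, Set.indicator_of_mem (s := {x | mon a' x ≠ 0})]
    exact Finset.prod_ne_zero_iff.2 fun j _ => pow_ne_zero _ (hx j)
  have h2 : ∫⁻ x, G x = C * v⁻¹ * (∫⁻ x in B, ‖mon b' x‖ₑ ^ 2 * ‖mon a' x‖ₑ ^ (-2 * β)) *
      ‖t‖ₑ ^ (-2 * (α - β)) := by
    rw [hG, lintegral_indicator measurableSet_ball, lintegral_const_mul _ (by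
      have := hmm a'; have := hmm b'; fun_prop)]
    ring
  rw [h1, ← h2]
  refine lintegral_le_of_slice i hFm hGm fun x => ?_
  have hBu : ∀ z, Function.update x i z ∈ B ↔ (∀ j, j ≠ i → ‖x j‖ < 1) ∧ ‖z‖ < 1 := by
    intro z
    rw [hB, mem_ball_zero_iff, pi_norm_lt_iff one_pos]
    constructor
    · exact fun h => ⟨fun j hj => by simpa [hj] using h j, by simpa using h i⟩
    · rintro ⟨h, hz⟩ j
      by_cases hj : j = i
      · subst hj; simpa using hz
      · simpa [hj] using h j hj
  by_cases hx : (∀ j, j ≠ i → ‖x j‖ < 1) ∧ mon a' x ≠ 0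
  swap
  · have : ∀ z, F (Function.update x i z) = 0 := by
      intro z
      rw [hF]
      by_cases h0 : mon a' x ≠ 0
      · rw [Set.indicator_of_mem (by simpa only [Set.mem_ofPred_eq, ha'u] using h0),
          Set.indicator_of_notMem fun hz => hx ⟨((hBu z).1 hz).1, h0⟩]
      · exact Set.indicator_of_notMem (by simpa only [Set.mem_ofPred_eq, ha'u] using h0) _
    simp [this]
  obtain ⟨hx1, hx0⟩ := hx
  have hrhs : ∫⁻ z, G (Function.update x i z) = C * ‖t‖ₑ ^ (-2 * (α - β)) *
      (‖mon b' x‖ₑ ^ 2 * ‖mon a' x‖ₑ ^ (-2 * β)) := by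
    have e : (fun z => G (Function.update x i z)) = (Metric.ball (0 : ℂ) 1).indicator
        fun _ => C * v⁻¹ * ‖t‖ₑ ^ (-2 * (α - β)) * (‖mon b' x‖ₑ ^ 2 * ‖mon a' x‖ₑ ^ (-2 * β)) := by
      ext z
      by_cases hz : ‖z‖ < 1
      · rw [hG, Set.indicator_of_mem ((hBu z).2 ⟨hx1, hz⟩),
          Set.indicator_of_mem (mem_ball_zero_iff.2 hz), ha'u, hb'u]
      · rw [hG, Set.indicator_of_notMem fun h => hz ((hBu z).1 h).2,
          Set.indicator_of_notMem fun h => hz (mem_ball_zero_iff.1 h)]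
    rw [e, lintegral_indicator measurableSet_ball, setLIntegral_const, ← hv]
    calc _ = C * (v⁻¹ * v) * ‖t‖ₑ ^ (-2 * (α - β)) *
          (‖mon b' x‖ₑ ^ 2 * ‖mon a' x‖ₑ ^ (-2 * β)) := by ring
      _ = _ := by rw [ENNReal.inv_mul_cancel hv0 hvt, mul_one]
  rw [hrhs]
  calc ∫⁻ z, F (Function.update x i z) ≤ ∫⁻ z, ‖mon b' x‖ₑ ^ 2 *
        (‖z‖ₑ ^ (2 * (a i * β - 1)) * ‖z ^ a i * mon a' x + t‖ₑ ^ (-2 * α)) := by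
        refine lintegral_mono fun z => ?_
        rw [hF]
        refine (Set.indicator_le_self _ _ _).trans ?_
        by_cases hz : ‖z‖ < 1
        · rw [Set.indicator_of_mem ((hBu z).2 ⟨hx1, hz⟩), mon_update_coord, mon_update_coord, enorm_mul,
            mul_pow, mul_comm (_ ^ 2) (_ ^ 2), mul_assoc]
          refine mul_le_mul_right (mul_le_mul_left ?_ _) _
          rw [enorm_pow, ← pow_mul, ← ENNReal.rpow_natCast]
          refine ENNReal.rpow_le_rpow_of_exponent_ge ?_ ?_
          · rw [← ofReal_norm, ← ENNReal.ofReal_one]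
            exact ENNReal.ofReal_le_ofReal hz.le
          · push_cast; linarith [hb i]
        · rw [Set.indicator_of_notMem fun h => hz ((hBu z).1 h).2]; exact zero_le
    _ ≤ ‖mon b' x‖ₑ ^ 2 * (C * ‖t‖ₑ ^ (-2 * (α - β)) * ‖mon a' x‖ₑ ^ (-2 * β)) := by
        rw [lintegral_const_mul' _ _ (by finiteness)]
        exact mul_le_mul_right (hCb _ t hx0 ht) _
    _ = _ := by ring

theorem translateBound_mon {a : Fin n → ℕ} {i : Fin n} (hi : a i ≠ 0) : TranslateBound (mon a) := by
  intro β α hβ hβα hα h hh ⟨V, hV, hfin⟩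
  obtain ⟨r₀, hr₀, hd⟩ := hh.exists_ball
  obtain ⟨r₁, hr₁, hB⟩ := Metric.mem_nhds_iff.1 (inter_mem hV (Metric.ball_mem_nhds 0 hr₀))
  set R := min r₁ 1 with hR
  have hR0 : 0 < R := lt_min hr₁ one_pos
  have hBR : Metric.ball (0 : Fin n → ℂ) R ⊆ V ∩ Metric.ball 0 r₀ :=
    (Metric.ball_subset_ball (min_le_left _ _)).trans hB
  have hdR : DifferentiableOn ℂ h (Metric.ball 0 R) := hd.mono fun x hx => (hBR hx).2
  have hne : ∀ᵐ x ∂volume.restrict (Metric.ball (0 : Fin n → ℂ) R), mon a x ≠ 0 := by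
    refine ae_restrict_of_ae ?_
    filter_upwards [ae_coord_ne_zero (n := n)] with x hx
    exact Finset.prod_ne_zero_iff.2 fun j _ => pow_ne_zero _ (hx j)
  have hk : Killed (Metric.ball 0 R) (mon a) α β h :=
    killed_of_lintegral Metric.isOpen_ball (differentiable_mon a).continuous.measurable hdR hβ.le hβα
      hne (ne_top_of_le_ne_top hfin (lintegral_mono_set fun x hx => (hBR hx).1))
  set b : Fin n → ℕ := fun i => ⌊β * a i⌋₊ with hb
  obtain ⟨G, hG, e⟩ := exists_mon_mul_of_killed (hβ.le.trans hβα.le) hdR hk _ b rfl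
    fun j => Nat.floor_le (by positivity)
  obtain ⟨M, hM⟩ := hG.exists_bound_half hR0
  obtain ⟨C, hC, hCb⟩ := lintegral_mon_translate_le hi hβ hβα hα (b := b)
    fun j => Nat.lt_floor_add_one _
  refine ⟨_, Metric.ball_mem_nhds 0 (half_pos hR0), ENNReal.ofReal M ^ 2 * C,
    ENNReal.mul_ne_top (by finiteness) hC, 1, one_pos, fun t ht _ => ?_⟩
  calc _ ≤ ∫⁻ x in Metric.ball (0 : Fin n → ℂ) (R / 2), ENNReal.ofReal M ^ 2 *
        (‖mon b x‖ₑ ^ 2 * ‖mon a x + t‖ₑ ^ (-2 * α)) := by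
        refine setLIntegral_mono' measurableSet_ball fun x hx => ?_
        rw [e x (Metric.ball_subset_ball (by linarith) hx), enorm_mul, mul_pow,
          mul_comm (_ ^ 2) (_ ^ 2), mul_assoc]
        refine mul_le_mul_left ?_ _
        gcongr
        rw [← ofReal_norm]
        exact ENNReal.ofReal_le_ofReal (hM x hx)
    _ ≤ ENNReal.ofReal M ^ 2 * (C * ‖t‖ₑ ^ (-2 * (α - β))) := by
        rw [lintegral_const_mul' _ _ (by finiteness)]
        refine mul_le_mul_right ((lintegral_mono_set ?_).trans (hCb t ht)) _
        exact Metric.ball_subset_ball (by linarith [min_le_right r₁ 1])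
    _ = _ := by ring

theorem Hol.localProperties {f : (Fin n → ℂ) → ℂ} (hf : Hol f) (h0 : ¬ f =ᶠ[𝓝 0] 0) :
    NullZeros f ∧ TranslateBound f ∧ Improves f := by
  refine (good_of_ne_zero hf h0).induct (P := fun f => NullZeros f ∧ TranslateBound f ∧ Improves f)
    (fun F G h e => ⟨h.1.congr e, h.2.1.congr e, h.2.2.congr e⟩) ?_
    (fun u hu h => ⟨nullZeros_unit hu h, translateBound_unit hu h, improves_unit hu h⟩)
    (fun a i hi => ⟨nullZeros_mon a, translateBound_mon hi, improves_mon a⟩)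
  intro ι π J hc F hF h
  obtain ⟨G, hGm, -, e⟩ := hF.exists_measurable
  have e' : ∀ i, (fun x => F (π i x)) =ᶠ[𝓝 0] fun x => G (π i x) := fun i =>
    ((hc.hol i).tendsto (hc.zero i)).eventually e
  exact ⟨(hc.nullZeros hGm fun i => (h i).1.congr (e' i)).congr e.symm,
    (hc.translateBound hGm fun i => (h i).2.1.congr (e' i)).congr e.symm,
    (hc.improves hGm fun i => (h i).2.2.congr (e' i)).congr e.symm⟩

end BaseCases

section GermRing

variable {X Y : Type*} [NormedAddCommGroup X] [NormedSpace ℂ X] [NormedAddCommGroup Y]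
  [NormedSpace ℂ Y] {n : ℕ}

/-- The ring of germs of holomorphic functions at the origin. -/
def holGerms (X : Type*) [NormedAddCommGroup X] [NormedSpace ℂ X] :
    Subring ((𝓝 (0 : X)).Germ ℂ) where
  carrier := {g | ∃ F : X → ℂ, Hol F ∧ (F : (𝓝 (0 : X)).Germ ℂ) = g}
  zero_mem' := ⟨fun _ => 0, Hol.const 0, rfl⟩
  one_mem' := ⟨fun _ => 1, Hol.const 1, rfl⟩
  add_mem' := by rintro _ _ ⟨F, hF, rfl⟩ ⟨G, hG, rfl⟩; exact ⟨_, hF.add hG, rfl⟩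
  mul_mem' := by rintro _ _ ⟨F, hF, rfl⟩ ⟨G, hG, rfl⟩; exact ⟨_, hF.mul hG, rfl⟩
  neg_mem' := by rintro _ ⟨F, hF, rfl⟩; exact ⟨_, hF.neg, rfl⟩

/-- The germ of a holomorphic function. -/
def Hol.germ {F : X → ℂ} (hF : Hol F) : holGerms X := ⟨(F : (𝓝 (0 : X)).Germ ℂ), F, hF, rfl⟩

theorem holGerms.exists_rep (g : holGerms X) : ∃ (F : X → ℂ) (hF : Hol F), hF.germ = g := by
  obtain ⟨_, F, hF, rfl⟩ := g
  exact ⟨F, hF, rfl⟩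

theorem Hol.germ_eq_germ {F G : X → ℂ} {hF : Hol F} {hG : Hol G} :
    hF.germ = hG.germ ↔ F =ᶠ[𝓝 0] G :=
  Subtype.ext_iff.trans Germ.coe_eq

theorem Hol.germ_mul {F G : X → ℂ} (hF : Hol F) (hG : Hol G) :
    (hF.mul hG).germ = hF.germ * hG.germ := rfl

theorem Hol.germ_add {F G : X → ℂ} (hF : Hol F) (hG : Hol G) :
    (hF.add hG).germ = hF.germ + hG.germ := rfl

theorem Hol.germ_sub {F G : X → ℂ} (hF : Hol F) (hG : Hol G) :
    (hF.sub hG).germ = hF.germ - hG.germ := rfl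

theorem Hol.germ_sum {ι : Type*} (s : Finset ι) {F : ι → X → ℂ} (hF : ∀ i, Hol (F i)) :
    (Hol.sum fun i (_ : i ∈ s) => hF i).germ = ∑ i ∈ s, (hF i).germ := by
  classical
  induction s using Finset.induction_on with
  | empty => exact Hol.germ_eq_germ (hG := Hol.const 0) |>.2 (.of_forall fun x => by simp)
  | insert a s ha ih =>
    rw [Finset.sum_insert ha, ← ih, ← Hol.germ_add, Hol.germ_eq_germ]
    exact .of_forall fun x => Finset.sum_insert ha

theorem Hol.germ_eq_zero {F : X → ℂ} {hF : Hol F} : hF.germ = 0 ↔ F =ᶠ[𝓝 0] 0 :=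
  Hol.germ_eq_germ (hG := Hol.const 0)

theorem Hol.isUnit_germ {F : X → ℂ} (hF : Hol F) (h : F 0 ≠ 0) : IsUnit hF.germ := by
  refine IsUnit.of_mul_eq_one (hF.inv h).germ ?_
  rw [← Hol.germ_mul]
  refine (Hol.germ_eq_germ (hG := Hol.const 1)).2 ?_
  filter_upwards [hF.continuousAt.eventually_ne h] with x hx using mul_inv_cancel₀ hx

instance : Nontrivial (holGerms X) :=
  ⟨⟨0, 1, fun h => by
    have := (Hol.germ_eq_germ (hF := Hol.const (X := X) 0) (hG := Hol.const 1)).1 h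
    simpa using this.self_of_nhds⟩⟩

instance : IsLocalRing (holGerms X) :=
  IsLocalRing.of_isUnit_or_isUnit_one_sub_self fun a => by
    obtain ⟨F, hF, rfl⟩ := holGerms.exists_rep a
    by_cases h : F 0 = 0
    · exact Or.inr (((Hol.const 1).sub hF).isUnit_germ (by simp [h]))
    · exact Or.inl (hF.isUnit_germ h)

theorem Hol.germ_mem_maximalIdeal {F : X → ℂ} (hF : Hol F) (h : F 0 = 0) :
    hF.germ ∈ IsLocalRing.maximalIdeal (holGerms X) := by
  rw [IsLocalRing.mem_maximalIdeal, mem_nonunits_iff]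
  intro hu
  obtain ⟨b, hb⟩ := hu.exists_right_inv
  obtain ⟨G, hG, rfl⟩ := holGerms.exists_rep b
  have := (Hol.germ_eq_germ (hF := hF.mul hG) (hG := Hol.const 1)).1 hb
  simpa [h] using this.self_of_nhds

/-- Pulling back germs along a holomorphic map. -/
def holGerms.comap {φ : X → Y} (hφ : Hol φ) (h0 : φ 0 = 0) : holGerms Y →+* holGerms X where
  toFun g := ⟨g.1.compTendsto φ (hφ.tendsto h0), by
    obtain ⟨_, F, hF, rfl⟩ := g
    exact ⟨_, hF.comp hφ h0, rfl⟩⟩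
  map_one' := rfl
  map_zero' := rfl
  map_add' := by
    rintro ⟨_, F, hF, rfl⟩ ⟨_, G, hG, rfl⟩
    rfl
  map_mul' := by
    rintro ⟨_, F, hF, rfl⟩ ⟨_, G, hG, rfl⟩
    rfl

theorem holGerms.comap_germ {φ : X → Y} (hφ : Hol φ) (h0 : φ 0 = 0) {F : Y → ℂ} (hF : Hol F) :
    holGerms.comap hφ h0 hF.germ = (hF.comp hφ h0).germ := rfl

/-- An ideal containing an element `b` modulo which the ring is finite over a Noetherian ring is
finitely generated. -/
theorem fg_of_division {A B : Type*} [CommRing A] [CommRing B] [Algebra A B] [IsNoetherianRing A]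
    {I : Ideal B} {b : B} (hb : b ∈ I) (z : B) (d : ℕ)
    (h : ∀ g : B, ∃ (q : B) (c : ℕ → A), g = q * b + ∑ j ∈ Finset.range d, c j • z ^ j) :
    I.FG := by
  classical
  have : Module.Finite A (B ⧸ Ideal.span {b}) := by
    refine ⟨⟨(Finset.range d).image fun j => Ideal.Quotient.mk _ (z ^ j), ?_⟩⟩
    refine eq_top_iff.2 fun x _ => ?_
    obtain ⟨g, rfl⟩ := Ideal.Quotient.mk_surjective x
    obtain ⟨q, c, rfl⟩ := h g
    have hm : Ideal.Quotient.mk (Ideal.span {b}) (q * b) = 0 :=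
      Ideal.Quotient.eq_zero_iff_mem.2 (Ideal.mul_mem_left _ _ (Ideal.mem_span_singleton_self _))
    rw [map_add, hm, zero_add, map_sum]
    refine Submodule.sum_mem _ fun j hj => ?_
    change c j • Ideal.Quotient.mk (Ideal.span {b}) (z ^ j) ∈ _
    exact Submodule.smul_mem _ _ (Submodule.subset_span (Finset.mem_coe.2
      (Finset.mem_image.2 ⟨j, hj, rfl⟩)))
  have hN : IsNoetherian B (B ⧸ Ideal.span {b}) := isNoetherian_of_tower A inferInstance
  refine Submodule.fg_of_fg_map_of_fg_inf_ker (Ideal.span {b}).mkQ (IsNoetherian.noetherian _) ?_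
  rw [Submodule.ker_mkQ, inf_eq_right.2 ((Ideal.span_singleton_le_iff_mem _).2 hb)]
  exact ⟨{b}, by simp⟩

theorem isNoetherianRing_holGerms_succ [IsNoetherianRing (holGerms (Fin n → ℂ))] :
    IsNoetherianRing (holGerms (Fin (n + 1) → ℂ)) := by
  refine (isNoetherianRing_iff_ideal_fg _).2 fun I => ?_
  by_cases hI : I = ⊥
  · subst hI; exact Submodule.fg_bot
  obtain ⟨f, hfI, hf0⟩ := Submodule.exists_mem_ne_zero_of_ne_bot hI
  obtain ⟨F, hF, rfl⟩ := holGerms.exists_rep f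
  by_cases h0 : F 0 = 0
  swap
  · rw [Ideal.eq_top_of_isUnit_mem _ hfI (hF.isUnit_germ h0)]
    exact ⟨{1}, by simp⟩
  obtain ⟨v, hv⟩ := exists_line_ne_zero hF fun h => hf0 (Hol.germ_eq_zero.2 h)
  have hv0 : v ≠ 0 := by
    rintro rfl
    exact hv (by simp [h0])
  have he : (Pi.single 0 1 : Fin (n + 1) → ℂ) ≠ 0 := by simp
  obtain ⟨L, hL⟩ := SeparatingDual.exists_continuousLinearEquiv_apply_eq (R := ℂ) he hv0
  have hLh : Hol L := L.differentiable.hol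
  have hLs : Hol L.symm := L.symm.differentiable.hol
  have hFL : Hol fun x => F (L x) := hF.comp hLh (by simp)
  have hcn : ∀ t : ℂ, cn t (0 : Fin n → ℂ) = t • (Pi.single 0 1 : Fin (n + 1) → ℂ) := by
    intro t; funext i; refine Fin.cases (by simp) (fun i => by simp) i
  obtain ⟨d, hd, _⟩ := hFL.exists_regularOrder (by simpa [hcn, hL] using hv)
  have hψ : Hol fun x => tl (L.symm x) := hol_tl.comp hLs (by simp)
  let _ : Algebra (holGerms (Fin n → ℂ)) (holGerms (Fin (n + 1) → ℂ)) :=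
    (holGerms.comap hψ (by ext; simp)).toAlgebra
  have hz : Hol fun x => L.symm x 0 := (hol_coord 0).comp hLs (by simp)
  refine fg_of_division (A := holGerms (Fin n → ℂ)) hfI hz.germ d fun g => ?_
  obtain ⟨G, hG, rfl⟩ := holGerms.exists_rep g
  obtain ⟨q, c, hq, hc, e⟩ := hd.exists_division (hG.comp hLh (by simp))
  have hqL : Hol fun x => q (L.symm x) := hq.comp hLs (by simp)
  refine ⟨hqL.germ, fun j => (hc j).germ, ?_⟩
  have hsmul (j : ℕ) : (hc j).germ • hz.germ ^ j = (((hc j).comp hψ (by ext; simp)).mul (hz.pow j)).germ :=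
    rfl
  simp only [hsmul]
  rw [← Hol.germ_sum, ← Hol.germ_mul, ← Hol.germ_add, Hol.germ_eq_germ]
  filter_upwards [(hLs.tendsto (by simp)).eventually e] with x hx
  simpa using hx

theorem isNoetherianRing_holGerms_pi (n : ℕ) : IsNoetherianRing (holGerms (Fin n → ℂ)) := by
  induction n with
  | zero =>
    refine (isNoetherianRing_iff_ideal_fg _).2 fun I => ?_
    by_cases hI : I = ⊥
    · subst hI; exact Submodule.fg_bot
    obtain ⟨f, hfI, hf0⟩ := Submodule.exists_mem_ne_zero_of_ne_bot hI
    obtain ⟨F, hF, rfl⟩ := holGerms.exists_rep f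
    rw [Ideal.eq_top_of_isUnit_mem _ hfI (hF.isUnit_germ fun h => hf0 (Hol.germ_eq_zero.2 ?_))]
    · exact ⟨{1}, by simp⟩
    · exact .of_forall fun x => by rw [Subsingleton.elim x 0, h]; rfl
  | succ n ih => exact isNoetherianRing_holGerms_succ

instance isNoetherianRing_holGerms [FiniteDimensional ℂ X] : IsNoetherianRing (holGerms X) := by
  have := isNoetherianRing_holGerms_pi (Module.finrank ℂ X)
  let L : X ≃L[ℂ] (Fin (Module.finrank ℂ X) → ℂ) := ContinuousLinearEquiv.ofFinrankEq (by simp)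
  refine isNoetherianRing_of_surjective _ _
    (holGerms.comap (L.differentiable.hol) (by simp)) fun g => ?_
  obtain ⟨F, hF, rfl⟩ := holGerms.exists_rep g
  refine ⟨(hF.comp L.symm.differentiable.hol (by simp)).germ, ?_⟩
  rw [holGerms.comap_germ, Hol.germ_eq_germ]
  exact .of_forall fun x => by simp

/-- Ideals of germs are closed in the adic topology. -/
theorem mem_ideal_of_forall_pow {R : Type*} [CommRing R] [IsNoetherianRing R] [IsLocalRing R]
    {I : Ideal R} {g : R} (h : ∀ N, ∃ s ∈ I, g - s ∈ IsLocalRing.maximalIdeal R ^ N) : g ∈ I := by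
  have hK := Ideal.iInf_pow_smul_eq_bot_of_isLocalRing (M := R ⧸ I) (IsLocalRing.maximalIdeal R)
    (Ideal.IsPrime.ne_top inferInstance)
  rw [← Ideal.Quotient.eq_zero_iff_mem, ← Submodule.mem_bot R, ← hK, Submodule.mem_iInf]
  intro N
  obtain ⟨s, hs, hgs⟩ := h N
  have : Ideal.Quotient.mk I g = (g - s) • (1 : R ⧸ I) := by
    rw [Algebra.smul_def, mul_one, Ideal.Quotient.algebraMap_eq, map_sub,
      Ideal.Quotient.eq_zero_iff_mem.2 hs, sub_zero]
  rw [this]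
  exact Submodule.smul_mem_smul hgs trivial

end GermRing

section Jets

variable {X Y : Type*} [NormedAddCommGroup X] [NormedSpace ℂ X] [FiniteDimensional ℂ X]
  [NormedAddCommGroup Y] [NormedSpace ℂ Y] [FiniteDimensional ℂ Y] {ι : Type*} {n : ℕ}

/-- Iterated directional derivatives. -/
def dirDeriv (v : ι → X) : List ι → (X → ℂ) → X → ℂ
  | [], F => F
  | i :: l, F => dirDeriv v l fun x => fderiv ℂ F x (v i)

theorem DifferentiableOn.dirDeriv {v : ι → X} {U : Set X} (hU : IsOpen U) (l : List ι) {F : X → ℂ}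
    (hF : DifferentiableOn ℂ F U) : DifferentiableOn ℂ (dirDeriv v l F) U := by
  induction l generalizing F with
  | nil => exact hF
  | cons i l ih => exact ih (hF.fderiv_apply hU (v i))

omit [FiniteDimensional ℂ X] in
theorem dirDeriv_congr {v : ι → X} {U : Set X} (hU : IsOpen U) (l : List ι) {F G : X → ℂ}
    (h : Set.EqOn F G U) : Set.EqOn (dirDeriv v l F) (dirDeriv v l G) U := by
  induction l generalizing F G with
  | nil => exact h
  | cons i l ih =>
    refine ih fun x hx => ?_
    rw [(h.eventuallyEq_of_mem (hU.mem_nhds hx)).fderiv_eq]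

theorem dirDeriv_add {v : ι → X} {U : Set X} (hU : IsOpen U) (l : List ι) {F G : X → ℂ}
    (hF : DifferentiableOn ℂ F U) (hG : DifferentiableOn ℂ G U) {x : X} (hx : x ∈ U) :
    dirDeriv v l (F + G) x = dirDeriv v l F x + dirDeriv v l G x := by
  induction l generalizing F G with
  | nil => rfl
  | cons i l ih =>
    refine Eq.trans (dirDeriv_congr hU l (fun y hy => ?_) hx)
      (ih (hF.fderiv_apply hU (v i)) (hG.fderiv_apply hU (v i)))
    simp only [fderiv_add (hF.differentiableAt (hU.mem_nhds hy))
      (hG.differentiableAt (hU.mem_nhds hy)), Pi.add_apply, add_apply]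

omit [FiniteDimensional ℂ X] in
theorem dirDeriv_smul {v : ι → X} (l : List ι) (c : ℂ) (F : X → ℂ) :
    dirDeriv v l (c • F) = c • dirDeriv v l F := by
  induction l generalizing F with
  | nil => rfl
  | cons i l ih =>
    simp only [dirDeriv]
    rw [← ih]
    congr 1
    funext x
    simp [fderiv_const_smul_field]

/-- Functions holomorphic on `U`. -/
def holOn (U : Set X) : Submodule ℂ (X → ℂ) where
  carrier := {F | DifferentiableOn ℂ F U}
  add_mem' h h' := h.add h'
  zero_mem' := differentiableOn_const 0
  smul_mem' c _ h := h.const_smul c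

/-- The derivatives of order less than `N` at `x`. -/
def jet (v : ι → X) (N : ℕ) {U : Set X} (hU : IsOpen U) {x : X} (hx : x ∈ U) :
    holOn U →ₗ[ℂ] ({l : List ι // l.length < N} → ℂ) where
  toFun F l := dirDeriv v l.1 F.1 x
  map_add' F G := funext fun l => dirDeriv_add hU l.1 F.2 G.2 hx
  map_smul' c F := funext fun l => congrFun (dirDeriv_smul l.1 c F.1) x

theorem dirDeriv_slice {v : ι → X} {U : Set X} {V : Set Y} (hU : IsOpen U) (hV : IsOpen V)
    (l : List ι) {g : X × Y → ℂ} (hg : DifferentiableOn ℂ g (U ×ˢ V)) {z : X} {w : Y} (hz : z ∈ U)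
    (hw : w ∈ V) :
    dirDeriv v l (fun z => g (z, w)) z = dirDeriv (fun i => (v i, (0 : Y))) l g (z, w) := by
  induction l generalizing g with
  | nil => rfl
  | cons i l ih =>
    refine Eq.trans (dirDeriv_congr hU l (fun y hy => ?_) hz)
      (ih (hg.fderiv_apply (hU.prod hV) (v i, 0)))
    have h1 := (hg.differentiableAt ((hU.prod hV).mem_nhds (Set.mk_mem_prod hy hw))).hasFDerivAt
    have h2 := h1.comp y (hasFDerivAt_prodMk_left (𝕜 := ℂ) y w)
    simp only [show fderiv ℂ (fun z => g (z, w)) y = _ from h2.fderiv]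
    simp

theorem dirDeriv_integral {v : ι → X} {A : Type*} [MeasurableSpace A] {μ : Measure A} {U : Set X}
    {V : Set Y} (hU : IsOpen U) (hV : IsOpen V) {K : Set Y} (hK : IsCompact K) (hKV : K ⊆ V)
    [MeasurableSpace Y] [BorelSpace Y]
    {p : A → Y} (hp : Measurable p) (hpK : ∀ a, p a ∈ K) {k : A → ℂ} (hk : Integrable k μ)
    (l : List ι) {g : X × Y → ℂ} (hg : DifferentiableOn ℂ g (U ×ˢ V)) :
    DifferentiableOn ℂ (fun z => ∫ a, g (z, p a) * k a ∂μ) U ∧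
    (∀ z ∈ U, Integrable (fun a => dirDeriv v l (fun z => g (z, p a)) z * k a) μ) ∧
    ∀ z ∈ U, dirDeriv v l (fun z => ∫ a, g (z, p a) * k a ∂μ) z =
      ∫ a, dirDeriv v l (fun z => g (z, p a)) z * k a ∂μ := by
  have : ProperSpace X := FiniteDimensional.proper ℂ X
  have : ProperSpace Y := FiniteDimensional.proper ℂ Y
  have hmeas : ∀ {g : X × Y → ℂ}, ContinuousOn g (U ×ˢ V) → ∀ z ∈ U,
      AEStronglyMeasurable (fun a => g (z, p a) * k a) μ := by
    intro g hg z hz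
    have h1 : ContinuousOn (fun w => g (z, w)) V :=
      hg.comp (by fun_prop) fun w hw => Set.mk_mem_prod hz hw
    have h2 : (fun a => g (z, p a)) = fun a => V.indicator (fun w => g (z, w)) (p a) := by
      funext a; rw [Set.indicator_of_mem (hKV (hpK a))]
    refine AEStronglyMeasurable.mul ?_ hk.1
    rw [h2]
    exact ((h1.measurable_indicator hV).comp hp).aestronglyMeasurable
  have hbd : ∀ {g : X × Y → ℂ}, ContinuousOn g (U ×ˢ V) → ∀ z ∈ U, ∃ r > 0, ∃ M,
      Metric.ball z r ⊆ U ∧ ∀ y ∈ Metric.ball z r, ∀ a, ‖g (y, p a) * k a‖ ≤ M * ‖k a‖ := by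
    intro g hg z hz
    obtain ⟨r, hr, hrU⟩ := Metric.nhds_basis_closedBall.mem_iff.1 (hU.mem_nhds hz)
    obtain ⟨M, hM⟩ := ((isCompact_closedBall z r).prod hK).exists_bound_of_continuousOn
      (hg.mono (Set.prod_mono hrU hKV))
    refine ⟨r, hr, M, Metric.ball_subset_closedBall.trans hrU, fun y hy a => ?_⟩
    rw [norm_mul]
    exact mul_le_mul_of_nonneg_right
      (hM (y, p a) ⟨Metric.ball_subset_closedBall hy, hpK a⟩) (norm_nonneg _)
  have hIntg : ∀ {g : X × Y → ℂ}, ContinuousOn g (U ×ˢ V) → ∀ z ∈ U,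
      Integrable (fun a => g (z, p a) * k a) μ := by
    intro g hg z hz
    obtain ⟨r, hr, M, -, h⟩ := hbd hg z hz
    exact (hk.norm.const_mul M).mono' (hmeas hg z hz)
      (.of_forall fun a => h z (Metric.mem_ball_self hr) a)
  have hslice : ∀ {g : X × Y → ℂ}, DifferentiableOn ℂ g (U ×ˢ V) → ∀ a,
      DifferentiableOn ℂ (fun z => g (z, p a) * k a) U := fun hg a =>
    (hg.comp (by fun_prop : Differentiable ℂ fun z : X => (z, p a)).differentiableOn
      fun z hz => Set.mk_mem_prod hz (hKV (hpK a))).mul_const _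
  have hdiff : ∀ {g : X × Y → ℂ}, DifferentiableOn ℂ g (U ×ˢ V) →
      DifferentiableOn ℂ (fun z => ∫ a, g (z, p a) * k a ∂μ) U := by
    intro g hg
    refine differentiableOn_integral_param hU (hmeas hg.continuousOn) (fun z hz => ?_)
      (.of_forall (hslice hg))
    obtain ⟨r, hr, M, -, h⟩ := hbd hg.continuousOn z hz
    exact ⟨_, Metric.ball_mem_nhds z hr, _, hk.norm.const_mul M,
      .of_forall fun a y hy => h y hy a⟩
  refine ⟨hdiff hg, fun z hz => ?_, ?_⟩
  · simp only [dirDeriv_slice hU hV l hg hz (hKV (hpK _))]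
    exact hIntg (hg.dirDeriv (hU.prod hV) l).continuousOn z hz
  induction l generalizing g with
  | nil => exact fun z _ => rfl
  | cons i l ih =>
    intro z hz
    have hg' := hg.fderiv_apply (hU.prod hV) (v i, (0 : Y))
    have hstep : ∀ w ∈ V, Set.EqOn (fun z => fderiv ℂ (fun z => g (z, w)) z (v i))
        (fun z => fderiv ℂ g (z, w) (v i, 0)) U := by
      intro w hw y hy
      exact dirDeriv_slice hU hV [i] hg hy hw
    refine Eq.trans (dirDeriv_congr hU l (fun y hy => ?_) hz) ((ih hg' z hz).trans ?_)
    · have hsub := hg'.continuousOn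
      obtain ⟨r, hr, M, hrU, hM⟩ := hbd hsub y hy
      have hline : Continuous fun t : ℂ => y + t • v i := by fun_prop
      have hs : (fun t : ℂ => y + t • v i) ⁻¹' Metric.ball y r ∈ 𝓝 (0 : ℂ) :=
        hline.continuousAt.preimage_mem_nhds (by simpa using Metric.ball_mem_nhds y hr)
      have key := (hasDerivAt_integral_of_dominated_loc_of_deriv_le (μ := μ) (𝕜 := ℂ) (x₀ := 0)
        (F := fun t a => g (y + t • v i, p a) * k a)
        (F' := fun t a => fderiv ℂ g (y + t • v i, p a) (v i, 0) * k a)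
        (bound := fun a => M * ‖k a‖) hs
        (by
          filter_upwards [hs] with t ht
          exact hmeas hg.continuousOn _ (hrU ht))
        (by simpa using hIntg hg.continuousOn y hy)
        (by simpa using hmeas hsub y hy)
        (.of_forall fun a t ht => hM _ ht a)
        (hk.norm.const_mul M)
        (.of_forall fun a t ht => by
          have h1 := (hg.differentiableAt ((hU.prod hV).mem_nhds
            (Set.mk_mem_prod (hrU ht) (hKV (hpK a))))).hasFDerivAt
          have h2 : HasDerivAt (fun t : ℂ => (y + t • v i, p a)) (v i, 0) t := by
            refine HasDerivAt.prodMk ?_ (hasDerivAt_const _ _)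
            simpa using ((hasDerivAt_id t).smul_const (v i)).const_add y
          exact (h1.comp_hasDerivAt t h2).mul_const _)).2
      have h3 := ((hdiff hg).differentiableAt (hU.mem_nhds hy)).hasFDerivAt
      have h4 : HasDerivAt (fun t : ℂ => y + t • v i) (v i) 0 := by
        simpa using ((hasDerivAt_id (0 : ℂ)).smul_const (v i)).const_add y
      have h5 := HasFDerivAt.comp_hasDerivAt (0 : ℂ) (f := fun t : ℂ => y + t • v i)
        (by simpa using h3) h4
      simpa using h5.unique key
    · refine integral_congr_ae (.of_forall fun a => ?_)
      have := dirDeriv_congr (v := v) hU l (hstep (p a) (hKV (hpK a))) hz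
      simp only [dirDeriv, this]

end Jets

section Vanishing

variable {Y : Type*} [NormedAddCommGroup Y] [NormedSpace ℂ Y] [FiniteDimensional ℂ Y] {n : ℕ}

/-- Vanishing to order `N` along `{0} × Y`. -/
def Vanishes : ℕ → ((Fin n → ℂ) × Y → ℂ) → Prop
  | 0, g => Hol g
  | N + 1, g => ∃ q : Fin n → (Fin n → ℂ) × Y → ℂ, (∀ i, Vanishes N (q i)) ∧
      g =ᶠ[𝓝 0] fun x => ∑ i, x.1 i * q i x

omit [FiniteDimensional ℂ Y] in
theorem hol_fst_apply (i : Fin n) : Hol fun x : (Fin n → ℂ) × Y => x.1 i :=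
  Differentiable.hol (by fun_prop)

omit [FiniteDimensional ℂ Y] in
theorem Vanishes.hol {N : ℕ} {g : (Fin n → ℂ) × Y → ℂ} (h : Vanishes N g) : Hol g := by
  induction N generalizing g with
  | zero => exact h
  | succ N ih =>
    obtain ⟨q, hq, e⟩ := h
    exact (Hol.sum fun i _ => (hol_fst_apply i).mul (ih (hq i))).congr e.symm

omit [FiniteDimensional ℂ Y] in
theorem Vanishes.germ_mem {N : ℕ} {g : (Fin n → ℂ) × Y → ℂ} (h : Vanishes N g) (hg : Hol g) :
    hg.germ ∈ IsLocalRing.maximalIdeal (holGerms ((Fin n → ℂ) × Y)) ^ N := by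
  induction N generalizing g with
  | zero => simp
  | succ N ih =>
    obtain ⟨q, hq, e⟩ := h
    have hm (i : Fin n) := (hol_fst_apply (Y := Y) i).mul (hq i).hol
    rw [show hg.germ = _ from (Hol.germ_eq_germ (hG := Hol.sum fun i _ => hm i)).2 e, Hol.germ_sum _ hm]
    refine Ideal.sum_mem _ fun i _ => ?_
    rw [Hol.germ_mul (hol_fst_apply i) (hq i).hol, pow_succ']
    exact Ideal.mul_mem_mul (Hol.germ_mem_maximalIdeal _ (by simp)) (ih (hq i) _)

omit [NormedSpace ℂ Y] [FiniteDimensional ℂ Y] in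
theorem norm_radial_le {x : (Fin n → ℂ) × Y} {t : ℝ} (ht : t ∈ Set.Icc (0 : ℝ) 1) :
    ‖(((t : ℂ) • x.1, x.2) : (Fin n → ℂ) × Y)‖ ≤ ‖x‖ := by
  rw [Prod.norm_def, Prod.norm_def]
  refine max_le_max ?_ le_rfl
  rw [norm_smul, Complex.norm_real, Real.norm_of_nonneg ht.1]
  exact mul_le_of_le_one_left (norm_nonneg _) ht.2

/-- Averaging over radii in the first variable. -/
def radial (k : ℕ) (q : (Fin n → ℂ) × Y → ℂ) (x : (Fin n → ℂ) × Y) : ℂ :=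
  ∫ t in (0 : ℝ)..1, (t : ℂ) ^ k * q ((t : ℂ) • x.1, x.2)

omit [FiniteDimensional ℂ Y] in
theorem continuousOn_radial {r : ℝ} {q : (Fin n → ℂ) × Y → ℂ}
    (hq : DifferentiableOn ℂ q (Metric.ball 0 r)) (k : ℕ) :
    ContinuousOn (fun p : ((Fin n → ℂ) × Y) × ℝ => (p.2 : ℂ) ^ k * q ((p.2 : ℂ) • p.1.1, p.1.2))
      (Metric.ball 0 r ×ˢ Set.Icc 0 1) := by
  refine ContinuousOn.mul (by fun_prop) (hq.continuousOn.comp (by fun_prop) fun p hp => ?_)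
  exact mem_ball_zero_iff.2 ((norm_radial_le hp.2).trans_lt (mem_ball_zero_iff.1 hp.1))

omit [FiniteDimensional ℂ Y] in
theorem intervalIntegrable_radial {r : ℝ} {q : (Fin n → ℂ) × Y → ℂ}
    (hq : DifferentiableOn ℂ q (Metric.ball 0 r)) (k : ℕ) {x : (Fin n → ℂ) × Y}
    (hx : x ∈ Metric.ball 0 r) :
    IntervalIntegrable (fun t : ℝ => (t : ℂ) ^ k * q ((t : ℂ) • x.1, x.2)) volume 0 1 := by
  refine ContinuousOn.intervalIntegrable ?_
  rw [Set.uIcc_of_le zero_le_one]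
  exact (continuousOn_radial hq k).comp (f := fun t : ℝ => (x, t)) (by fun_prop)
    fun t ht => Set.mk_mem_prod hx ht

theorem Hol.radial {q : (Fin n → ℂ) × Y → ℂ} (hq : Hol q) (k : ℕ) : Hol (radial k q) := by
  obtain ⟨r, hr, h⟩ := hq.exists_ball
  refine hol_of_differentiableOn (Metric.ball_mem_nhds _ hr)
    (differentiableOn_intervalIntegral_param Metric.isOpen_ball (continuousOn_radial h k)
      fun t ht => ?_)
  refine DifferentiableOn.const_mul (h.comp (by fun_prop) fun x hx => ?_) _
  exact mem_ball_zero_iff.2 ((norm_radial_le ht).trans_lt (mem_ball_zero_iff.1 hx))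

theorem Vanishes.radial {N : ℕ} {q : (Fin n → ℂ) × Y → ℂ} (h : Vanishes N q) (k : ℕ) :
    Vanishes N (radial k q) := by
  induction N generalizing q k with
  | zero => exact Hol.radial h k
  | succ N ih =>
    obtain ⟨q', hq', e⟩ := h
    refine ⟨fun i => _root_.radial (k + 1) (q' i), fun i => ih (hq' i) _, ?_⟩
    have hev : ∀ᶠ x in 𝓝 (0 : (Fin n → ℂ) × Y), ∀ i, DifferentiableAt ℂ (q' i) x :=
      eventually_all.2 fun i => (hq' i).hol
    obtain ⟨r, hr, hb⟩ := Metric.eventually_nhds_iff_ball.1 (e.and hev)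
    filter_upwards [Metric.ball_mem_nhds _ hr] with x hx
    have hI : ∀ i, IntervalIntegrable
        (fun t : ℝ => x.1 i * ((t : ℂ) ^ (k + 1) * q' i ((t : ℂ) • x.1, x.2))) volume 0 1 :=
      fun i => (intervalIntegrable_radial
        (fun y hy => ((hb y hy).2 i).differentiableWithinAt) (k + 1) hx).const_mul _
    simp only [_root_.radial, ← intervalIntegral.integral_const_mul]
    rw [← intervalIntegral.integral_finsetSum fun i _ => hI i]
    refine intervalIntegral.integral_congr fun t ht => ?_
    rw [Set.uIcc_of_le zero_le_one] at ht
    have := (hb ((t : ℂ) • x.1, x.2)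
      (mem_ball_zero_iff.2 ((norm_radial_le ht).trans_lt (mem_ball_zero_iff.1 hx)))).1
    simp only [this, Finset.mul_sum]
    refine Finset.sum_congr rfl fun i _ => ?_
    simp only [Pi.smul_apply, smul_eq_mul]
    ring

theorem vanishes_of_dirDeriv {N : ℕ} {g : (Fin n → ℂ) × Y → ℂ} (hg : Hol g)
    (h : ∀ l : List (Fin n), l.length < N →
      ∀ᶠ w in 𝓝 (0 : Y), dirDeriv (fun i => (Pi.single i 1, (0 : Y))) l g (0, w) = 0) :
    Vanishes N g := by
  induction N generalizing g with
  | zero => exact hg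
  | succ N ih =>
    refine ⟨fun i => radial 0 fun x => fderiv ℂ g x (Pi.single i 1, 0), fun i =>
      (ih (hg.fderiv_apply _) fun l hl => h (i :: l) (by simpa using hl)).radial 0, ?_⟩
    obtain ⟨r, hr, hd⟩ := hg.exists_ball
    have h0 : ∀ᶠ x in 𝓝 (0 : (Fin n → ℂ) × Y), g (0, x.2) = 0 :=
      (continuous_snd.tendsto (0 : (Fin n → ℂ) × Y)).eventually (h [] (by simp))
    filter_upwards [Metric.ball_mem_nhds _ hr, h0] with x hx hx0
    have hP : (((0 : ℝ) : ℂ) • x.1, x.2) = ((0, x.2) : (Fin n → ℂ) × Y) := by simp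
    have hseg : ∀ s ∈ Set.Icc (0 : ℝ) 1, ((0, x.2) : (Fin n → ℂ) × Y) + (s : ℂ) • (x - (0, x.2))
        ∈ Metric.ball 0 r := fun s hs => segment_mem_ball_of_norm hx (mem_ball_zero_iff.2
          (hP ▸ (norm_radial_le (by simp)).trans_lt (mem_ball_zero_iff.1 hx))) hs
    have key := integral_fderiv_segment Metric.isOpen_ball hd hseg
    rw [hx0, sub_zero] at key
    have hI : ∀ i, IntervalIntegrable (fun t : ℝ => x.1 i * ((t : ℂ) ^ 0 *
        fderiv ℂ g ((t : ℂ) • x.1, x.2) (Pi.single i 1, 0))) volume 0 1 := fun i =>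
      (intervalIntegrable_radial (hd.fderiv_apply Metric.isOpen_ball (Pi.single i 1, 0)) 0 hx).const_mul _
    simp only [radial, ← intervalIntegral.integral_const_mul]
    rw [key, ← intervalIntegral.integral_finsetSum fun i _ => hI i]
    refine intervalIntegral.integral_congr fun t ht => ?_
    have e1 : ((0, x.2) : (Fin n → ℂ) × Y) + (t : ℂ) • (x - (0, x.2)) = ((t : ℂ) • x.1, x.2) := by
      ext <;> simp
    have e2 : x - (0, x.2) = ∑ i, x.1 i • ((Pi.single i 1, 0) : (Fin n → ℂ) × Y) := by
      ext j
      · simp [Prod.fst_sum, Finset.sum_apply, Pi.single_apply]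
      · simp [Prod.snd_sum]
    simp only [e1, pow_zero, one_mul]
    rw [e2, map_sum]
    simp only [map_smul, smul_eq_mul]

end Vanishing

section Multipliers

open scoped ENNReal

section General

variable {X : Type*} [NormedAddCommGroup X] [NormedSpace ℂ X] [MeasureSpace X] [BorelSpace X]

/-- Local integrability of `|g|² |f|^{-2s}` at the origin. -/
def Mult {X : Type*} [NormedAddCommGroup X] [MeasureSpace X] (f g : X → ℂ) (s : ℝ) : Prop :=
  ∃ V ∈ 𝓝 (0 : X), ∫⁻ x in V, ‖g x‖ₑ ^ 2 * ‖f x‖ₑ ^ (-2 * s) ≠ ∞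

omit [NormedSpace ℂ X] in
theorem aemeasurable_enorm_sq_mul {V : Set X} (hV : IsOpen V) {f g : X → ℂ}
    (hf : ContinuousOn f V) (hg : ContinuousOn g V) (q : ℝ) :
    AEMeasurable (fun x => ‖g x‖ₑ ^ 2 * ‖f x‖ₑ ^ q) (volume.restrict V) :=
  ((hg.aemeasurable hV.measurableSet).enorm.pow_const 2).mul
    ((hf.aemeasurable hV.measurableSet).enorm.pow_const q)

omit [NormedSpace ℂ X] [BorelSpace X] in
theorem Mult.exists_ball {f g : X → ℂ} {s : ℝ} (h : Mult f g s) :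
    ∃ r > 0, ∀ ρ ≤ r, ∫⁻ x in Metric.ball 0 ρ, ‖g x‖ₑ ^ 2 * ‖f x‖ₑ ^ (-2 * s) ≠ ∞ := by
  obtain ⟨V, hV, h⟩ := h
  obtain ⟨r, hr, hrV⟩ := Metric.mem_nhds_iff.1 hV
  exact ⟨r, hr, fun ρ hρ => ne_top_of_le_ne_top h
    (lintegral_mono_set ((Metric.ball_subset_ball hρ).trans hrV))⟩

omit [NormedSpace ℂ X] in
theorem Mult.of_le {f f' g g' : X → ℂ} {s : ℝ} (h : Mult f g s) {C : ℝ≥0∞} (hC : C ≠ ∞)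
    (e : ∀ᶠ x in 𝓝 0, ‖g' x‖ₑ ^ 2 * ‖f' x‖ₑ ^ (-2 * s) ≤ C * (‖g x‖ₑ ^ 2 * ‖f x‖ₑ ^ (-2 * s))) :
    Mult f' g' s := by
  obtain ⟨r, hr, h⟩ := h.exists_ball
  obtain ⟨ρ, hρ, hb⟩ := Metric.eventually_nhds_iff_ball.1 e
  refine ⟨_, Metric.ball_mem_nhds 0 (lt_min hr hρ), ?_⟩
  refine ne_top_of_le_ne_top (ENNReal.mul_ne_top hC (h _ (min_le_left r ρ))) ?_
  rw [← lintegral_const_mul' _ _ hC]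
  exact setLIntegral_mono' measurableSet_ball fun x hx =>
    hb x (Metric.ball_subset_ball (min_le_right _ _) hx)

omit [NormedSpace ℂ X] in
theorem Mult.congr {f f' g g' : X → ℂ} {s : ℝ} (h : Mult f g s) (ef : f =ᶠ[𝓝 0] f')
    (eg : g =ᶠ[𝓝 0] g') : Mult f' g' s :=
  h.of_le ENNReal.one_ne_top (by filter_upwards [ef, eg] with x h1 h2; simp [h1, h2])

theorem Mult.hol_mul {f g u : X → ℂ} {s : ℝ} (h : Mult f g s) (hu : Hol u) :
    Mult f (fun x => u x * g x) s := by
  have hb : ∀ᶠ x in 𝓝 0, ‖u x‖ₑ < ‖u 0‖ₑ + 1 :=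
    hu.continuousAt.enorm.eventually_lt_const (ENNReal.lt_add_right (by finiteness) one_ne_zero)
  refine h.of_le (C := (‖u 0‖ₑ + 1) ^ 2) (by finiteness) ?_
  filter_upwards [hb] with x hx
  rw [enorm_mul, mul_pow, mul_assoc]
  gcongr

theorem Mult.sum {k : ℕ} {f : X → ℂ} (hf : Hol f) {g : Fin k → X → ℂ} (hg : ∀ i, Hol (g i)) {s : ℝ}
    (h : ∀ i, Mult f (g i) s) : Mult f (fun x => ∑ i, g i x) s := by
  have hev : ∀ᶠ x in 𝓝 (0 : X), DifferentiableAt ℂ f x ∧ ∀ i, DifferentiableAt ℂ (g i) x :=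
    hf.and (eventually_all.2 hg)
  obtain ⟨r, hr, hb⟩ := Metric.eventually_nhds_iff_ball.1 hev
  choose ρ hρ h using fun i => (h i).exists_ball
  obtain ⟨δ, hδ, hδr, hδρ⟩ : ∃ δ > 0, δ ≤ r ∧ ∀ i, δ ≤ ρ i := by
    have h1 : ∀ᶠ δ in 𝓝[>] (0 : ℝ), δ ≤ r ∧ ∀ i, δ ≤ ρ i :=
      (eventually_nhdsWithin_of_eventually_nhds (eventually_le_nhds hr)).and
        (eventually_all.2 fun i => eventually_nhdsWithin_of_eventually_nhds (eventually_le_nhds (hρ i)))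
    obtain ⟨δ, h2, h3⟩ := (h1.and self_mem_nhdsWithin).exists
    exact ⟨δ, h3, h2⟩
  refine ⟨_, Metric.ball_mem_nhds 0 hδ, ?_⟩
  have hm : ∀ i, AEMeasurable (fun x => ‖g i x‖ₑ ^ 2 * ‖f x‖ₑ ^ (-2 * s))
      (volume.restrict (Metric.ball 0 δ)) := fun i =>
    aemeasurable_enorm_sq_mul Metric.isOpen_ball
      (fun x hx => (hb x (Metric.ball_subset_ball hδr hx)).1.continuousAt.continuousWithinAt)
      (fun x hx => ((hb x (Metric.ball_subset_ball hδr hx)).2 i).continuousAt.continuousWithinAt) _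
  have hle : ∀ x, ‖∑ i, g i x‖ₑ ^ 2 * ‖f x‖ₑ ^ (-2 * s) ≤
      k * ∑ i, ‖g i x‖ₑ ^ 2 * ‖f x‖ₑ ^ (-2 * s) := by
    intro x
    rw [← Finset.sum_mul, ← mul_assoc]
    gcongr
    refine (pow_le_pow_left₀ zero_le (enorm_sum_le _ _) 2).trans ?_
    have hcs : ∀ a : Fin k → NNReal, (∑ i, a i) ^ 2 ≤ k * ∑ i, a i ^ 2 := fun a => by
      simpa using sq_sum_le_card_mul_sum_sq (s := Finset.univ) (f := a)
    simp only [enorm_eq_nnnorm]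
    exact_mod_cast hcs fun i => ‖g i x‖₊
  refine ne_top_of_le_ne_top ?_ (lintegral_mono hle)
  rw [lintegral_const_mul' _ _ (by finiteness), lintegral_finsetSum' _ fun i _ => hm i]
  exact ENNReal.mul_ne_top (by finiteness) (ENNReal.sum_ne_top.2 fun i _ => h i _ (hδρ i))

end General

variable {n₁ n₂ : ℕ} {f₁ : (Fin n₁ → ℂ) → ℂ} {f₂ : (Fin n₂ → ℂ) → ℂ}

theorem TranslateBound.ae_ne_zero {n : ℕ} {f : (Fin n → ℂ) → ℂ} (h : TranslateBound f)
    (hf : Hol f) (h0 : NullZeros f) :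
    ∃ V ∈ 𝓝 (0 : Fin n → ℂ), ∃ ε > 0, ∀ t : ℂ, ‖t‖ < ε → ∀ᵐ x ∂volume.restrict V, f x + t ≠ 0 := by
  obtain ⟨r, hr, hd⟩ := hf.exists_ball
  obtain ⟨M, hM⟩ := hd.exists_bound_half hr
  have hfin : Mult f f (1 / 4) := by
    refine ⟨_, Metric.ball_mem_nhds 0 (half_pos hr), ?_⟩
    refine ne_top_of_le_ne_top (b := ∫⁻ x in Metric.ball (0 : Fin n → ℂ) (r / 2),
      ENNReal.ofReal M ^ (3 / 2 : ℝ)) (by simp only [setLIntegral_const]; finiteness) ?_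
    refine setLIntegral_mono' measurableSet_ball fun x hx => ?_
    have h1 : ‖f x‖ₑ ≤ ENNReal.ofReal M := by
      rw [← ofReal_norm]; exact ENNReal.ofReal_le_ofReal (hM x hx)
    refine le_trans ?_ (ENNReal.rpow_le_rpow h1 (by norm_num))
    rcases eq_or_ne (f x) 0 with h2 | h2
    · simp [h2]
    · rw [← ENNReal.rpow_natCast, ← ENNReal.rpow_add _ _ (by simpa using h2) (by finiteness)]
      norm_num
  obtain ⟨V, hV, C, hC, ε, hε, hb⟩ := h (1 / 4) (1 / 2) (by norm_num) (by norm_num) (by norm_num)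
    f hf hfin
  obtain ⟨V₀, hV₀, h0⟩ := h0
  obtain ⟨ρ, hρ, hρV⟩ := Metric.mem_nhds_iff.1 (inter_mem (Metric.ball_mem_nhds 0 hr)
    (inter_mem hV hV₀))
  have h0' := ae_restrict_of_ae_restrict_of_subset (fun x hx => (hρV hx).2.2) h0
  refine ⟨_, Metric.ball_mem_nhds 0 hρ, ε, hε, fun t ht => ?_⟩
  rcases eq_or_ne t 0 with rfl | ht0
  · simpa using h0'
  have hc : ContinuousOn f (Metric.ball 0 ρ) := hd.continuousOn.mono fun x hx => (hρV hx).1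
  have hlt := ae_lt_top' (aemeasurable_enorm_sq_mul Metric.isOpen_ball
    (hc.add (continuousOn_const (c := t))) hc (-2 * (1 / 2))) (ne_top_of_le_ne_top
      (ENNReal.mul_ne_top hC (ENNReal.rpow_ne_top_of_ne_zero (by simpa using ht0) (by finiteness)))
      ((lintegral_mono_set fun x hx => (hρV hx).2.1).trans (hb t ht0 ht)))
  filter_upwards [h0', hlt] with x hx0 hx
  intro hxt
  simp only [Pi.add_apply, hxt, enorm_zero] at hx
  rw [ENNReal.zero_rpow_of_neg (by norm_num), ENNReal.mul_top (by simpa using hx0)] at hx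
  exact hx.ne rfl

theorem exists_ae_add_ne_zero (hm₁ : Measurable f₁) (hm₂ : Measurable f₂) (hf₁ : ContinuousAt f₁ 0)
    (h₁ : f₁ 0 = 0) (hf₂ : Hol f₂) (hne₂ : ¬ f₂ =ᶠ[𝓝 0] 0) :
    ∃ V ∈ 𝓝 (0 : (Fin n₁ → ℂ) × (Fin n₂ → ℂ)), ∀ᵐ p ∂volume.restrict V, f₁ p.1 + f₂ p.2 ≠ 0 := by
  obtain ⟨hN, hT, -⟩ := hf₂.localProperties hne₂
  obtain ⟨V₂, hV₂, ε, hε, hb⟩ := hT.ae_ne_zero hf₂ hN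
  obtain ⟨r, hr, hV₁⟩ := Metric.continuousAt_iff.1 hf₁ ε hε
  refine ⟨Metric.ball 0 r ×ˢ V₂, prod_mem_nhds (Metric.ball_mem_nhds 0 hr) hV₂, ?_⟩
  rw [Measure.volume_eq_prod, ← Measure.prod_restrict, ae_iff]
  have hms : MeasurableSet {p : (Fin n₁ → ℂ) × (Fin n₂ → ℂ) | ¬ f₁ p.1 + f₂ p.2 ≠ 0} := by
    have : Measurable fun p : (Fin n₁ → ℂ) × (Fin n₂ → ℂ) => f₁ p.1 + f₂ p.2 := by fun_prop
    have h0 := this (measurableSet_singleton (0 : ℂ))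
    convert h0 using 1
    ext p
    simp only [Set.mem_ofPred_eq, Set.mem_preimage, Set.mem_singleton_iff, not_not]
  rw [Measure.measure_prod_null hms]
  filter_upwards [ae_restrict_mem measurableSet_ball] with z hz
  have := hb (f₁ z) (by simpa [h₁] using hV₁ hz)
  rw [ae_iff] at this
  simpa [add_comm] using this

theorem Mult.prod {g₁ : (Fin n₁ → ℂ) → ℂ} {g₂ : (Fin n₂ → ℂ) → ℂ} {a₁ a₂ α : ℝ}
    (hf₁ : Hol f₁) (hf₂ : Hol f₂) (hne₁ : ¬ f₁ =ᶠ[𝓝 0] 0) (hne₂ : ¬ f₂ =ᶠ[𝓝 0] 0) (h₂ : f₂ 0 = 0)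
    (hg₁ : Hol g₁) (hg₂ : Hol g₂) (ha₁ : 0 < a₁) (ha₂ : 0 < a₂) (hα : a₁ + a₂ = α) (hα1 : α < 1)
    (hM₁ : Mult f₁ g₁ a₁) (hM₂ : Mult f₂ g₂ a₂) :
    Mult (fun p : (Fin n₁ → ℂ) × (Fin n₂ → ℂ) => f₁ p.1 + f₂ p.2) (fun p => g₁ p.1 * g₂ p.2) α := by
  obtain ⟨-, hT, -⟩ := hf₁.localProperties hne₁
  obtain ⟨V₀, hV₀, hN⟩ := (hf₂.localProperties hne₂).1
  obtain ⟨V₁, hV₁, C, hC, ε, hε, hb⟩ := hT a₁ α ha₁ (by linarith) hα1 g₁ hg₁ hM₁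
  obtain ⟨r₁, hr₁, hB₁⟩ := Metric.eventually_nhds_iff_ball.1 (hf₁.and (hg₁.and hV₁))
  have hsmall : ∀ᶠ w in 𝓝 0, ‖f₂ w‖ < ε :=
    hf₂.continuousAt.norm.eventually_lt_const (by simpa [h₂] using hε)
  obtain ⟨r₀, hr₀, hM₂⟩ := hM₂.exists_ball
  obtain ⟨r, hr, hB⟩ := Metric.eventually_nhds_iff_ball.1
    (hf₂.and (hg₂.and (hsmall.and hV₀)))
  set r₂ := min r r₀
  have hB₂ : Metric.ball (0 : Fin n₂ → ℂ) r₂ ⊆ Metric.ball 0 r :=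
    Metric.ball_subset_ball (min_le_left _ _)
  refine ⟨Metric.ball 0 r₁ ×ˢ Metric.ball 0 r₂, prod_mem_nhds (Metric.ball_mem_nhds 0 hr₁)
    (Metric.ball_mem_nhds 0 (lt_min hr hr₀)), ?_⟩
  have c₁ : ContinuousOn f₁ (Metric.ball 0 r₁) := fun x hx =>
    (hB₁ x hx).1.continuousAt.continuousWithinAt
  have d₁ : ContinuousOn g₁ (Metric.ball 0 r₁) := fun x hx =>
    (hB₁ x hx).2.1.continuousAt.continuousWithinAt
  have c₂ : ContinuousOn f₂ (Metric.ball 0 r₂) := fun x hx =>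
    (hB x (hB₂ hx)).1.continuousAt.continuousWithinAt
  have d₂ : ContinuousOn g₂ (Metric.ball 0 r₂) := fun x hx =>
    (hB x (hB₂ hx)).2.1.continuousAt.continuousWithinAt
  have hmeas := aemeasurable_enorm_sq_mul (Metric.isOpen_ball.prod Metric.isOpen_ball)
    (f := fun p : (Fin n₁ → ℂ) × (Fin n₂ → ℂ) => f₁ p.1 + f₂ p.2)
    (g := fun p : (Fin n₁ → ℂ) × (Fin n₂ → ℂ) => g₁ p.1 * g₂ p.2)
    ((c₁.comp continuousOn_fst fun p hp => hp.1).add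
      (c₂.comp continuousOn_snd fun p hp => hp.2))
    ((d₁.comp continuousOn_fst fun p hp => hp.1).mul
      (d₂.comp continuousOn_snd fun p hp => hp.2)) (-2 * α)
  rw [Measure.volume_eq_prod, ← Measure.prod_restrict] at hmeas ⊢
  rw [lintegral_prod_symm _ hmeas]
  refine ne_top_of_le_ne_top (ENNReal.mul_ne_top hC (hM₂ r₂ (min_le_right _ _))) ?_
  rw [← lintegral_const_mul' _ _ hC]
  refine lintegral_mono_ae ?_
  filter_upwards [ae_restrict_mem measurableSet_ball,
    ae_restrict_of_ae_restrict_of_subset (fun x hx => (hB x (hB₂ hx)).2.2.2) hN] with w hw hw0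
  simp only [enorm_mul, mul_pow]
  calc ∫⁻ z in Metric.ball 0 r₁, ‖g₁ z‖ₑ ^ 2 * ‖g₂ w‖ₑ ^ 2 * ‖f₁ z + f₂ w‖ₑ ^ (-2 * α)
      = ‖g₂ w‖ₑ ^ 2 * ∫⁻ z in Metric.ball 0 r₁, ‖g₁ z‖ₑ ^ 2 * ‖f₁ z + f₂ w‖ₑ ^ (-2 * α) := by
        rw [← lintegral_const_mul' _ _ (by finiteness)]
        exact lintegral_congr fun z => by ring
    _ ≤ ‖g₂ w‖ₑ ^ 2 * (C * ‖f₂ w‖ₑ ^ (-2 * (α - a₁))) := by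
        gcongr
        exact (lintegral_mono_set fun z hz => (hB₁ z hz).2.2).trans
          (hb _ hw0 (hB w (hB₂ hw)).2.2.1)
    _ = _ := by rw [← hα]; ring_nf

end Multipliers

section Duality

open scoped ENNReal

variable {n₁ n₂ : ℕ}

/-- The ideal generated by products of multipliers of complementary exponents. -/
def productIdeal (f₁ : (Fin n₁ → ℂ) → ℂ) (f₂ : (Fin n₂ → ℂ) → ℂ) (α : ℚ) :
    Ideal (holGerms ((Fin n₁ → ℂ) × (Fin n₂ → ℂ))) :=
  Ideal.span {q | ∃ (e : (Fin n₁ → ℂ) → ℂ) (b : (Fin n₂ → ℂ) → ℂ) (a₁ a₂ : ℚ),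
    0 < a₁ ∧ 0 < a₂ ∧ a₁ + a₂ = α ∧ Hol e ∧ Hol b ∧ Mult f₁ e a₁ ∧ Mult f₂ b a₂ ∧
    ∃ h : Hol fun p : (Fin n₁ → ℂ) × (Fin n₂ → ℂ) => e p.1 * b p.2, q = h.germ}

/-- The derivatives of `g` of order less than `N` along `{0} × V`. -/
def jetAt (N : ℕ) (g : (Fin n₁ → ℂ) × (Fin n₂ → ℂ) → ℂ) (w : Fin n₂ → ℂ) :
    {l : List (Fin n₁) // l.length < N} → ℂ :=
  fun l => dirDeriv (fun i => Pi.single i 1) l.1 (fun z => g (z, w)) 0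

/-- A product of neighborhoods on which all data are defined and suitably bounded. -/
structure Adapted (f₁ : (Fin n₁ → ℂ) → ℂ) (f₂ : (Fin n₂ → ℂ) → ℂ)
    (g : (Fin n₁ → ℂ) × (Fin n₂ → ℂ) → ℂ) (α : ℝ) (N : ℕ)
    (V₁ : Set (Fin n₁ → ℂ)) (V₂ : Set (Fin n₂ → ℂ)) : Prop where
  open₁ : IsOpen V₁
  open₂ : IsOpen V₂
  mem₁ : 0 ∈ V₁
  mem₂ : 0 ∈ V₂
  hol : DifferentiableOn ℂ g (V₁ ×ˢ V₂)
  meas₁ : Measurable f₁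
  meas₂ : Measurable f₂
  ne₁ : ∀ᵐ z ∂volume.restrict V₁, f₁ z ≠ 0
  ne₂ : ∀ᵐ w ∂volume.restrict V₂, f₂ w ≠ 0
  small : ∀ z ∈ V₁, ‖f₁ z‖ₑ ≤ 1
  vol : volume V₂ ≠ ∞
  fin : ∫⁻ p in V₁ ×ˢ V₂, ‖g p‖ₑ ^ 2 * ‖f₁ p.1 + f₂ p.2‖ₑ ^ (-2 * α) ≠ ∞
  bdd : ∃ M, ∀ w ∈ V₂, ∀ l, ‖jetAt N g w l‖ ≤ M

variable {f₁ : (Fin n₁ → ℂ) → ℂ} {f₂ : (Fin n₂ → ℂ) → ℂ}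
  {g : (Fin n₁ → ℂ) × (Fin n₂ → ℂ) → ℂ} {α : ℝ} {N : ℕ}
  {V₁ : Set (Fin n₁ → ℂ)} {V₂ : Set (Fin n₂ → ℂ)}

instance (N : ℕ) : Finite {l : List (Fin n₁) // l.length < N} :=
  List.finite_length_lt _ N

instance (N : ℕ) : Fintype {l : List (Fin n₁) // l.length < N} := Fintype.ofFinite _

theorem differentiableOn_jetAt (h₁ : IsOpen V₁) (h₂ : IsOpen V₂) (h0 : 0 ∈ V₁)
    (hg : DifferentiableOn ℂ g (V₁ ×ˢ V₂)) (l : {l : List (Fin n₁) // l.length < N}) :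
    DifferentiableOn ℂ (fun w => jetAt N g w l) V₂ := by
  have h := hg.dirDeriv (v := fun i => (Pi.single i 1, 0)) (h₁.prod h₂) l.1
  refine (h.comp (by fun_prop : Differentiable ℂ fun w : Fin n₂ → ℂ =>
    ((0 : Fin n₁ → ℂ), w)).differentiableOn fun w hw => Set.mk_mem_prod h0 hw).congr fun w hw => ?_
  exact dirDeriv_slice h₁ h₂ l.1 hg h0 hw

theorem exists_eq_sum_mul {ι : Type*} [Fintype ι] (L : (ι → ℂ) →ₗ[ℂ] ℂ) :
    ∃ c : ι → ℂ, ∀ v, L v = ∑ i, c i * v i := by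
  classical
  refine ⟨fun i => L (Pi.single i 1), fun v => ?_⟩
  conv_lhs => rw [pi_eq_sum_univ' v]
  simp [map_sum, mul_comm]

theorem Adapted.differentiableOn_apply (h : Adapted f₁ f₂ g α N V₁ V₂)
    (L : ({l : List (Fin n₁) // l.length < N} → ℂ) →ₗ[ℂ] ℂ) :
    DifferentiableOn ℂ (fun w => L (jetAt N g w)) V₂ := by
  obtain ⟨c, hc⟩ := exists_eq_sum_mul L
  simp only [hc]
  exact DifferentiableOn.fun_sum fun l _ =>
    (differentiableOn_jetAt h.open₁ h.open₂ h.mem₁ h.hol l).const_mul _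

theorem enorm_max_rpow_le {a b : ℂ} (hα : 0 ≤ α) :
    max ‖b‖ₑ ‖a‖ₑ ^ (-2 * α) ≤ 2 ^ (2 * α) * ‖a + b‖ₑ ^ (-2 * α) := by
  have h1 : ‖a + b‖ₑ ≤ 2 * max ‖b‖ₑ ‖a‖ₑ := by
    rw [two_mul]
    exact (enorm_add_le a b).trans (add_le_add (le_max_right _ _) (le_max_left _ _))
  have h2 := ENNReal.rpow_le_rpow_of_nonpos (q := -2 * α) (by linarith) h1
  rw [ENNReal.mul_rpow_of_ne_top (by finiteness) (by simp)] at h2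
  calc max ‖b‖ₑ ‖a‖ₑ ^ (-2 * α)
      = 2 ^ (2 * α) * (2 ^ (-2 * α) * max ‖b‖ₑ ‖a‖ₑ ^ (-2 * α)) := by
        rw [← mul_assoc, ← ENNReal.rpow_add _ _ (by norm_num) (by finiteness)]
        simp
    _ ≤ _ := by gcongr

/-- Pairing `g` with a small functional in the second variable gives a multiplier in the first. -/
theorem Adapted.lintegral_pairing_ne_top (h : Adapted f₁ f₂ g α N V₁ V₂) (hα : 0 ≤ α) {β : ℝ}
    {p : (Fin n₂ → ℂ) → (Fin n₂ → ℂ)} {k : (Fin n₂ → ℂ) → ℂ} (hT : Theta V₂ f₂ α (α - β) p k) :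
    ∫⁻ z in V₁, ‖∫ a, g (z, p a) * k a‖ₑ ^ 2 * ‖f₁ z‖ₑ ^ (-2 * β) ≠ ∞ := by
  obtain ⟨C, hC, hb⟩ := hT.bound
  have hslice : ∀ z ∈ V₁, DifferentiableOn ℂ (fun w => g (z, w)) V₂ := fun z hz =>
    h.hol.comp (by fun_prop : Differentiable ℂ fun w : Fin n₂ → ℂ => (z, w)).differentiableOn
      fun w hw => Set.mk_mem_prod hz hw
  have hmeas : AEMeasurable (fun p : (Fin n₁ → ℂ) × (Fin n₂ → ℂ) =>
      ‖g p‖ₑ ^ 2 * ‖f₁ p.1 + f₂ p.2‖ₑ ^ (-2 * α)) (volume.restrict (V₁ ×ˢ V₂)) := by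
    have m₁ := h.meas₁
    have m₂ := h.meas₂
    refine ((h.hol.continuousOn.aemeasurable
      (h.open₁.prod h.open₂).measurableSet).enorm.pow_const 2).mul ?_
    exact Measurable.aemeasurable (by fun_prop)
  have hfin := h.fin
  rw [Measure.volume_eq_prod, ← Measure.prod_restrict] at hfin hmeas
  rw [lintegral_prod _ hmeas] at hfin
  have h2α : (2 : ℝ≥0∞) ^ (2 * α) ≠ ∞ := by finiteness
  refine ne_top_of_le_ne_top (ENNReal.mul_ne_top (ENNReal.mul_ne_top hC h2α) hfin) ?_
  rw [← lintegral_const_mul' _ _ (ENNReal.mul_ne_top hC h2α)]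
  refine lintegral_mono_ae ?_
  filter_upwards [h.ne₁, ae_restrict_mem h.open₁.measurableSet] with z hz0 hz
  have hz0' : ‖f₁ z‖ₑ ≠ 0 := by simpa using hz0
  calc ‖∫ a, g (z, p a) * k a‖ₑ ^ 2 * ‖f₁ z‖ₑ ^ (-2 * β)
      ≤ (C * ‖f₁ z‖ₑ ^ (2 * (α - (α - β))) *
        ∫⁻ w in V₂, ‖g (z, w)‖ₑ ^ 2 * max ‖f₂ w‖ₑ ‖f₁ z‖ₑ ^ (-2 * α)) * ‖f₁ z‖ₑ ^ (-2 * β) := by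
        gcongr
        exact hb _ (hslice z hz) _ hz0' (h.small z hz)
    _ = C * (‖f₁ z‖ₑ ^ (2 * (α - (α - β))) * ‖f₁ z‖ₑ ^ (-2 * β)) *
        ∫⁻ w in V₂, ‖g (z, w)‖ₑ ^ 2 * max ‖f₂ w‖ₑ ‖f₁ z‖ₑ ^ (-2 * α) := by ring
    _ = C * ∫⁻ w in V₂, ‖g (z, w)‖ₑ ^ 2 * max ‖f₂ w‖ₑ ‖f₁ z‖ₑ ^ (-2 * α) := by
        rw [← ENNReal.rpow_add _ _ hz0' (by finiteness)]
        ring_nf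
        simp
    _ ≤ C * ∫⁻ w in V₂, 2 ^ (2 * α) * (‖g (z, w)‖ₑ ^ 2 * ‖f₁ z + f₂ w‖ₑ ^ (-2 * α)) := by
        refine mul_le_mul_right (lintegral_mono fun w => ?_) _
        calc _ ≤ ‖g (z, w)‖ₑ ^ 2 * (2 ^ (2 * α) * ‖f₁ z + f₂ w‖ₑ ^ (-2 * α)) := by
              gcongr; exact enorm_max_rpow_le hα
          _ = _ := by ring
    _ = _ := by rw [lintegral_const_mul' _ _ h2α, mul_assoc]

theorem Adapted.killed_zero (h : Adapted f₁ f₂ g α N V₁ V₂) (hα : 0 < α)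
    (L : ({l : List (Fin n₁) // l.length < N} → ℂ) →ₗ[ℂ] ℂ) :
    Killed V₂ f₂ α 0 fun w => L (jetAt N g w) := by
  obtain ⟨c, hc⟩ := exists_eq_sum_mul L
  refine killed_of_lintegral h.open₂ h.meas₂ (h.differentiableOn_apply L) le_rfl hα h.ne₂ ?_
  obtain ⟨M, hM⟩ := h.bdd
  have hb : ∀ w ∈ V₂, ‖L (jetAt N g w)‖ ≤ ∑ l, ‖c l‖ * M := fun w hw => by
    rw [hc]
    refine (norm_sum_le _ _).trans (Finset.sum_le_sum fun l _ => ?_)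
    rw [norm_mul]
    exact mul_le_mul_of_nonneg_left (hM w hw l) (norm_nonneg _)
  refine setLIntegral_enorm_sq_mul_ne_top h.open₂.measurableSet hb ?_
  simpa using h.vol

/-- If a functional on jets annihilates the killed functions of exponent `β`, applying it to `g`
in the first variable gives a killed function of exponent `α - β` in the second one. -/
theorem Adapted.killed_apply (h : Adapted f₁ f₂ g α N V₁ V₂) (hα : 0 < α) {β : ℝ} (hβ : 0 ≤ β)
    (hβα : β ≤ α) (L : ({l : List (Fin n₁) // l.length < N} → ℂ) →ₗ[ℂ] ℂ)
    (hL : ∀ e : holOn V₁, Killed V₁ f₁ α β e.1 → L (jet (fun i => Pi.single i 1) N h.open₁ h.mem₁ e) = 0) :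
    Killed V₂ f₂ α (α - β) fun w => L (jetAt N g w) := by
  obtain ⟨c, hc⟩ := exists_eq_sum_mul L
  rcases hβα.eq_or_lt with rfl | hlt
  · rw [sub_self]
    exact h.killed_zero hα L
  · intro p k hT
    obtain ⟨K, hKV, hK, hpK⟩ := hT.compact
    have hI := fun l => dirDeriv_integral (v := fun i : Fin n₁ => Pi.single i (1 : ℂ)) h.open₁
      h.open₂ hK hKV hT.meas hpK hT.int l h.hol
    have hk := killed_of_lintegral h.open₁ h.meas₁ (hI []).1 hβ hlt h.ne₁
      (h.lintegral_pairing_ne_top hα.le hT)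
    have h0 := hL ⟨_, (hI []).1⟩ hk
    rw [hc] at h0
    simp only [hc, Finset.sum_mul]
    rw [integral_finsetSum _ fun l _ => ?_]
    · rw [← h0]
      refine Finset.sum_congr rfl fun l _ => ?_
      simp only [mul_assoc, integral_const_mul]
      exact congrArg _ ((hI l.1).2.2 0 h.mem₁).symm
    · simp only [mul_assoc]
      exact ((hI l.1).2.1 0 h.mem₁).const_mul _

end Duality

section Sweep

open scoped ENNReal

variable {n₁ n₂ : ℕ} {f₁ : (Fin n₁ → ℂ) → ℂ} {f₂ : (Fin n₂ → ℂ) → ℂ}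
  {g : (Fin n₁ → ℂ) × (Fin n₂ → ℂ) → ℂ} {α : ℚ} {N : ℕ}
  {V₁ : Set (Fin n₁ → ℂ)} {V₂ : Set (Fin n₂ → ℂ)}

/-- A property that propagates by locally uniform steps holds up to the endpoint. -/
theorem of_forall_step {T : ℝ → Prop} {ε : ℝ → ℝ} {a : ℝ} (ha : 0 ≤ a)
    (hε : ∀ x, 0 ≤ x → x ≤ a → 0 < ε x) (h0 : T 0)
    (hT : ∀ x y, 0 ≤ x → x < y → y ≤ a → y < x + ε x + ε y → T x → T y) : T a := by
  set S := {x | 0 ≤ x ∧ x ≤ a ∧ T x} with hS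
  have hne : S.Nonempty := ⟨0, le_rfl, ha, h0⟩
  have hbd : BddAbove S := ⟨a, fun x hx => hx.2.1⟩
  have hs0 : 0 ≤ sSup S := le_csSup hbd ⟨le_rfl, ha, h0⟩
  have hsa : sSup S ≤ a := csSup_le hne fun x hx => hx.2.1
  have hs := hε _ hs0 hsa
  have hTs : T (sSup S) := by
    obtain ⟨x, hx, hlt⟩ := exists_lt_of_lt_csSup hne (sub_lt_self (sSup S) hs)
    rcases (le_csSup hbd hx).eq_or_lt with h | h
    · exact h ▸ hx.2.2
    · exact hT x _ hx.1 h hsa (by linarith [hε x hx.1 hx.2.1]) hx.2.2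
  rcases hsa.eq_or_lt with h | h
  · exact h ▸ hTs
  have hlt : sSup S < min a (sSup S + ε (sSup S) / 2) := lt_min h (by linarith)
  have hle : min a (sSup S + ε (sSup S) / 2) ≤ a := min_le_left _ _
  have := hT _ _ hs0 hlt hle (by
    linarith [min_le_right a (sSup S + ε (sSup S) / 2), hε _ (hs0.trans hlt.le) hle]) hTs
  exact absurd (le_csSup hbd ⟨hs0.trans hlt.le, hle, this⟩) (not_le.2 hlt)

/-- A linear map with values in the image of a submodule `K` is a finite sum of functionals times
images of elements of `K`. -/
theorem exists_eq_sum_of_range_le_map {F J M : Type*} [Field F] [AddCommGroup J] [Module F J]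
    [FiniteDimensional F J] [AddCommGroup M] [Module F M] (T : M →ₗ[F] J) (K : Submodule F M)
    (π : J →ₗ[F] J) (h : ∀ v, π v ∈ K.map T) :
    ∃ (m : ℕ) (L : Fin m → J →ₗ[F] F) (e : Fin m → M), (∀ i, e i ∈ K) ∧
      (∀ v, π v = ∑ i, L i v • T (e i)) ∧ ∀ v, π v = 0 → ∀ i, L i v = 0 := by
  set b := Module.finBasis F (LinearMap.range π)
  have hb : ∀ i, ∃ e ∈ K, T e = b i := fun i => by
    obtain ⟨v, hv⟩ := (b i).2
    rw [← hv]
    exact h v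
  choose e heK he using hb
  refine ⟨_, fun i => b.coord i ∘ₗ π.rangeRestrict, e, heK, fun v => ?_, fun v hv i => ?_⟩
  · have := congrArg (LinearMap.range π).subtype (b.sum_repr (π.rangeRestrict v))
    rw [map_sum] at this
    simp only [he]
    exact this.symm
  · have : π.rangeRestrict v = 0 := Subtype.ext hv
    simp [this]

/-- `φ` is the jet of an element of the product ideal. -/
def Represents (f₁ : (Fin n₁ → ℂ) → ℂ) (f₂ : (Fin n₂ → ℂ) → ℂ) (α : ℚ) (V₁ : Set (Fin n₁ → ℂ))
    (V₂ : Set (Fin n₂ → ℂ)) (φ : (Fin n₂ → ℂ) → {l : List (Fin n₁) // l.length < N} → ℂ) : Prop :=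
  ∃ S : (Fin n₁ → ℂ) × (Fin n₂ → ℂ) → ℂ, DifferentiableOn ℂ S (V₁ ×ˢ V₂) ∧
    (∃ h : Hol S, h.germ ∈ productIdeal f₁ f₂ α) ∧ ∀ w ∈ V₂, jetAt N S w = φ w

theorem jetAt_eq_jet (h₁ : IsOpen V₁) (h0 : 0 ∈ V₁) (hg : DifferentiableOn ℂ g (V₁ ×ˢ V₂))
    {w : Fin n₂ → ℂ} (hw : w ∈ V₂) :
    ∃ h : DifferentiableOn ℂ (fun z => g (z, w)) V₁,
      jetAt N g w = jet (fun i => Pi.single i 1) N h₁ h0 ⟨_, h⟩ :=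
  ⟨hg.comp (by fun_prop : Differentiable ℂ fun z : Fin n₁ → ℂ => (z, w)).differentiableOn
    fun _ hz => Set.mk_mem_prod hz hw, rfl⟩

theorem Represents.zero (h₁ : IsOpen V₁) (h0 : 0 ∈ V₁) :
    Represents (N := N) f₁ f₂ α V₁ V₂ fun _ => 0 := by
  have hd : DifferentiableOn ℂ (fun _ : (Fin n₁ → ℂ) × (Fin n₂ → ℂ) => (0 : ℂ)) (V₁ ×ˢ V₂) :=
    differentiableOn_const 0
  refine ⟨fun _ => 0, hd, ⟨Hol.const 0, ?_⟩, fun w hw => ?_⟩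
  · rw [show (Hol.const 0).germ = 0 from rfl]
    exact zero_mem _
  · obtain ⟨_, h⟩ := jetAt_eq_jet (N := N) h₁ h0 hd hw
    rw [h]
    exact map_zero (jet (fun i => Pi.single i 1) N h₁ h0)

theorem Represents.add (h₁ : IsOpen V₁) (h0 : 0 ∈ V₁)
    {φ ψ : (Fin n₂ → ℂ) → {l : List (Fin n₁) // l.length < N} → ℂ}
    (hφ : Represents f₁ f₂ α V₁ V₂ φ) (hψ : Represents f₁ f₂ α V₁ V₂ ψ) :
    Represents f₁ f₂ α V₁ V₂ fun w => φ w + ψ w := by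
  obtain ⟨S, hS, ⟨hSh, hSI⟩, hφ⟩ := hφ
  obtain ⟨R, hR, ⟨hRh, hRI⟩, hψ⟩ := hψ
  refine ⟨fun p => S p + R p, hS.add hR, ⟨hSh.add hRh, ?_⟩, fun w hw => ?_⟩
  · rw [Hol.germ_add hSh hRh]
    exact add_mem hSI hRI
  · obtain ⟨_, h⟩ := jetAt_eq_jet (N := N) h₁ h0 hS hw
    obtain ⟨_, h'⟩ := jetAt_eq_jet (N := N) h₁ h0 hR hw
    beta_reduce
    rw [← hφ w hw, ← hψ w hw, h, h']
    exact map_add (jet (fun i => Pi.single i 1) N h₁ h0) ⟨_, _⟩ ⟨_, _⟩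

theorem Represents.sum (h₁ : IsOpen V₁) (h0 : 0 ∈ V₁) {m : ℕ}
    {φ : Fin m → (Fin n₂ → ℂ) → {l : List (Fin n₁) // l.length < N} → ℂ}
    (hφ : ∀ i, Represents f₁ f₂ α V₁ V₂ (φ i)) :
    Represents f₁ f₂ α V₁ V₂ fun w => ∑ i, φ i w := by
  induction m with
  | zero => simpa using Represents.zero h₁ h0
  | succ m ih =>
    simp only [Fin.sum_univ_succ]
    exact (hφ 0).add h₁ h0 (ih fun i => hφ i.succ)

/-- The gain `ε β` in integrability of killed functions, for both variables. -/
def Gain (f₁ : (Fin n₁ → ℂ) → ℂ) (f₂ : (Fin n₂ → ℂ) → ℂ) (α : ℝ) (V₁ : Set (Fin n₁ → ℂ))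
    (V₂ : Set (Fin n₂ → ℂ)) (ε : ℝ → ℝ) : Prop :=
  ∀ β, 0 ≤ β → β ≤ α → 0 < ε β ∧
    (∀ e, DifferentiableOn ℂ e V₁ → Killed V₁ f₁ α β e → ∀ s ≤ β + ε β, Mult f₁ e s) ∧
    (∀ b, DifferentiableOn ℂ b V₂ → Killed V₂ f₂ α (α - β) b → ∀ s ≤ α - β + ε β, Mult f₂ b s)

theorem exists_gain (h₁ : Improves f₁) (h₂ : Improves f₂) {α : ℝ} (o₁ : IsOpen V₁) (o₂ : IsOpen V₂)
    (m₁ : 0 ∈ V₁) (m₂ : 0 ∈ V₂) : ∃ ε, Gain f₁ f₂ α V₁ V₂ ε := by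
  have : ∀ β, ∃ ε : ℝ, 0 ≤ β → β ≤ α → 0 < ε ∧
      (∀ e, DifferentiableOn ℂ e V₁ → Killed V₁ f₁ α β e → ∀ s ≤ β + ε, Mult f₁ e s) ∧
      (∀ b, DifferentiableOn ℂ b V₂ → Killed V₂ f₂ α (α - β) b → ∀ s ≤ α - β + ε, Mult f₂ b s) := by
    intro β
    by_cases hβ : 0 ≤ β ∧ β ≤ α
    · obtain ⟨W₁, hW₁, δ₁, hδ₁, H₁⟩ := h₁ β α hβ.1 hβ.2 V₁ o₁ m₁
      obtain ⟨W₂, hW₂, δ₂, hδ₂, H₂⟩ := h₂ (α - β) α (sub_nonneg.2 hβ.2) (by linarith) V₂ o₂ m₂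
      refine ⟨min δ₁ δ₂, fun _ _ => ⟨lt_min hδ₁ hδ₂, fun e he hk s hs => ⟨W₁, hW₁, ?_⟩,
        fun b hb hk s hs => ⟨W₂, hW₂, ?_⟩⟩⟩
      · exact H₁ e he hk s (hs.trans (by gcongr; exact min_le_left _ _))
      · exact H₂ b hb hk s (hs.trans (by gcongr; exact min_le_right _ _))
    · exact ⟨0, fun h h' => absurd ⟨h, h'⟩ hβ⟩
  choose ε hε using this
  exact ⟨ε, hε⟩

theorem Represents.of_killed (hA : Adapted f₁ f₂ g α N V₁ V₂) (hα : 0 < α) {ε : ℝ → ℝ}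
    (hε : Gain f₁ f₂ α V₁ V₂ ε) {x y : ℝ} (hx : 0 ≤ x) (hxα : x ≤ α) (hy : 0 ≤ y) (hyα : y ≤ α)
    (hxy : y < x + ε x + ε y) {e : holOn V₁} {b : (Fin n₂ → ℂ) → ℂ}
    (he : Killed V₁ f₁ α x e.1) (hb : DifferentiableOn ℂ b V₂) (hk : Killed V₂ f₂ α (α - y) b) :
    Represents f₁ f₂ α V₁ V₂
      fun w => b w • jet (fun i => Pi.single i 1) N hA.open₁ hA.mem₁ e := by
  obtain ⟨hεx, H₁, -⟩ := hε x hx hxα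
  obtain ⟨hεy, -, H₂⟩ := hε y hy hyα
  have hα' : (0 : ℝ) < α := by exact_mod_cast hα
  obtain ⟨a, ha, ha'⟩ := exists_rat_btwn (show max 0 (y - ε y) < min (α : ℝ) (x + ε x) from
    max_lt (lt_min hα' (by linarith)) (lt_min (by linarith) (by linarith)))
  have ha0 : (0 : ℝ) < a := (le_max_left _ _).trans_lt ha
  have haα : (a : ℝ) < α := ha'.trans_le (min_le_left _ _)
  have h1 : (a : ℝ) < x + ε x := ha'.trans_le (min_le_right _ _)
  have h2 : y - ε y < a := (le_max_right _ _).trans_lt ha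
  have heh : Hol e.1 := hol_of_differentiableOn (hA.open₁.mem_nhds hA.mem₁) e.2
  have hbh : Hol b := hol_of_differentiableOn (hA.open₂.mem_nhds hA.mem₂) hb
  have hd : DifferentiableOn ℂ (fun p : (Fin n₁ → ℂ) × (Fin n₂ → ℂ) => e.1 p.1 * b p.2)
      (V₁ ×ˢ V₂) :=
    (e.2.comp differentiableOn_fst fun p hp => hp.1).mul
      (hb.comp differentiableOn_snd fun p hp => hp.2)
  have hh : Hol fun p : (Fin n₁ → ℂ) × (Fin n₂ → ℂ) => e.1 p.1 * b p.2 :=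
    hol_of_differentiableOn (prod_mem_nhds (hA.open₁.mem_nhds hA.mem₁)
      (hA.open₂.mem_nhds hA.mem₂)) hd
  refine ⟨_, hd, ⟨hh, Ideal.subset_span ⟨e.1, b, a, α - a, by exact_mod_cast ha0,
    sub_pos.2 (by exact_mod_cast haα), by ring, heh, hbh, H₁ _ e.2 he _ h1.le,
    H₂ b hb hk _ ?_, hh, rfl⟩⟩, fun w hw => ?_⟩
  · push_cast
    linarith
  · obtain ⟨_, h⟩ := jetAt_eq_jet (N := N) hA.open₁ hA.mem₁ hd hw
    refine h.trans (Eq.trans ?_ (map_smul (jet (fun i => Pi.single i 1) N hA.open₁ hA.mem₁) (b w) e))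
    congr 1
    ext z
    exact mul_comm _ _

theorem Theta.integrable {V : Set (Fin n₁ → ℂ)} (hV : IsOpen V) {f e : (Fin n₁ → ℂ) → ℂ} {α β : ℝ}
    {p : (Fin n₁ → ℂ) → (Fin n₁ → ℂ)} {k : (Fin n₁ → ℂ) → ℂ} (h : Theta V f α β p k)
    (he : ContinuousOn e V) : Integrable fun x => e (p x) * k x := by
  obtain ⟨K, hKV, hK, hpK⟩ := h.compact
  obtain ⟨M, hM⟩ := hK.exists_bound_of_continuousOn (he.mono hKV)
  refine h.int.bdd_mul (c := M) ?_ (.of_forall fun x => hM _ (hpK x))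
  have h2 : (fun x => e (p x)) = fun x => V.indicator e (p x) := by
    funext x
    rw [Set.indicator_of_mem (hKV (hpK x))]
  rw [h2]
  exact ((he.measurable_indicator hV).comp h.meas).aestronglyMeasurable

theorem Killed.anti {V : Set (Fin n₁ → ℂ)} {f e : (Fin n₁ → ℂ) → ℂ} {α β γ : ℝ}
    (h : Killed V f α γ e) (hβ : β ≤ γ) : Killed V f α β e := by
  rintro p k ⟨h1, h2, h3, C, hC, hb⟩
  refine h p k ⟨h1, h2, h3, C, hC, fun g hg r h0 h1 => (hb g hg r h0 h1).trans ?_⟩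
  exact mul_le_mul_left (mul_le_mul_right
    (ENNReal.rpow_le_rpow_of_exponent_ge h1 (by linarith)) _) _

/-- The killed functions on `V`, as a submodule. -/
def killedOn {V : Set (Fin n₁ → ℂ)} (hV : IsOpen V) (f : (Fin n₁ → ℂ) → ℂ) (α β : ℝ) :
    Submodule ℂ (holOn V) where
  carrier := {e | Killed V f α β e.1}
  add_mem' {a b} ha hb p k h := by
    have := integral_add (h.integrable hV a.2.continuousOn) (h.integrable hV b.2.continuousOn)
    rw [ha p k h, hb p k h, add_zero] at this
    rw [← this]
    exact integral_congr_ae (.of_forall fun x => add_mul _ _ _)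
  zero_mem' p k _ := by simp
  smul_mem' c a ha p k h := by
    have := integral_const_mul (μ := volume) c fun x => a.1 (p x) * k x
    rw [ha p k h, mul_zero] at this
    rw [← this]
    exact integral_congr_ae (.of_forall fun x => mul_assoc _ _ _)

theorem represents_of_range (hA : Adapted f₁ f₂ g α N V₁ V₂) (hα : 0 < α) {ε : ℝ → ℝ}
    (hε : Gain f₁ f₂ α V₁ V₂ ε) {x y : ℝ} (hx : 0 ≤ x) (hxα : x ≤ α) (hy : 0 ≤ y) (hyα : y ≤ α)
    (hxy : y < x + ε x + ε y)
    (π : ({l : List (Fin n₁) // l.length < N} → ℂ) →ₗ[ℂ] ({l : List (Fin n₁) // l.length < N} → ℂ))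
    (hπ : ∀ v, π v ∈ (killedOn hA.open₁ f₁ α x).map (jet (fun i => Pi.single i 1) N hA.open₁ hA.mem₁))
    (hk : ∀ (L : ({l : List (Fin n₁) // l.length < N} → ℂ) →ₗ[ℂ] ℂ), (∀ v, π v = 0 → L v = 0) →
      Killed V₂ f₂ α (α - y) fun w => L (jetAt N g w)) :
    Represents f₁ f₂ α V₁ V₂ fun w => π (jetAt N g w) := by
  obtain ⟨m, L, e, he, hsum, hL⟩ := exists_eq_sum_of_range_le_map _ _ π hπ
  simp only [hsum]
  exact Represents.sum hA.open₁ hA.mem₁ fun i => Represents.of_killed hA hα hε hx hxα hy hyα hxy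
    (he i) (hA.differentiableOn_apply (L i)) (hk (L i) fun v hv => hL v hv i)

theorem Adapted.represents (hA : Adapted f₁ f₂ g α N V₁ V₂) (hα : 0 < α) {ε : ℝ → ℝ}
    (hε : Gain f₁ f₂ α V₁ V₂ ε) (hg : ∃ M, ∀ p ∈ V₁ ×ˢ V₂, ‖g p‖ ≤ M) (hvol : volume V₁ ≠ ∞) :
    Represents f₁ f₂ α V₁ V₂ (jetAt N g) := by
  have hα' : (0 : ℝ) < α := by exact_mod_cast hα
  set F : ℝ → Submodule ℂ ({l : List (Fin n₁) // l.length < N} → ℂ) := fun β =>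
    (killedOn hA.open₁ f₁ α β).map (jet (fun i => Pi.single i 1) N hA.open₁ hA.mem₁) with hF
  have hFanti : ∀ x y, x ≤ y → F y ≤ F x := by
    intro x y hxy
    refine Submodule.map_mono fun e he => ?_
    exact Killed.anti he hxy
  have key : ∃ P : ({l : List (Fin n₁) // l.length < N} → ℂ) →ₗ[ℂ]
      ({l : List (Fin n₁) // l.length < N} → ℂ), (∀ v, P v ∈ F α) ∧ (∀ v ∈ F α, P v = v) ∧
      Represents f₁ f₂ α V₁ V₂ fun w => jetAt N g w - P (jetAt N g w) := by
    have hproj : ∀ β, ∃ P : ({l : List (Fin n₁) // l.length < N} → ℂ) →ₗ[ℂ]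
        ({l : List (Fin n₁) // l.length < N} → ℂ), (∀ v, P v ∈ F β) ∧ (∀ v ∈ F β, P v = v) := by
      intro β
      obtain ⟨p, hp⟩ := (F β).subtype.exists_leftInverse_of_injective (F β).ker_subtype
      refine ⟨(F β).subtype ∘ₗ p, fun v => (p v).2, fun v hv => ?_⟩
      exact congrArg Subtype.val (LinearMap.congr_fun hp ⟨v, hv⟩)
    refine of_forall_step (T := fun β => ∃ P : ({l : List (Fin n₁) // l.length < N} → ℂ) →ₗ[ℂ]
      ({l : List (Fin n₁) // l.length < N} → ℂ), (∀ v, P v ∈ F β) ∧ (∀ v ∈ F β, P v = v) ∧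
      Represents f₁ f₂ α V₁ V₂ fun w => jetAt N g w - P (jetAt N g w)) hα'.le
      (fun x hx hx' => (hε x hx hx').1) ?_ ?_
    · obtain ⟨P, hP, hP'⟩ := hproj 0
      refine ⟨P, hP, hP', ?_⟩
      obtain ⟨S, hS, hSI, hSj⟩ := Represents.zero (f₁ := f₁) (f₂ := f₂) (α := α) (N := N)
        (V₂ := V₂) hA.open₁ hA.mem₁
      refine ⟨S, hS, hSI, fun w hw => ?_⟩
      obtain ⟨hd, h⟩ := jetAt_eq_jet (N := N) hA.open₁ hA.mem₁ hA.hol hw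
      suffices hmem : jetAt N g w ∈ F 0 by
        beta_reduce
        rw [hSj w hw, hP' _ hmem, sub_self]
      rw [h]
      refine Submodule.mem_map_of_mem ?_
      obtain ⟨M, hM⟩ := hg
      refine killed_of_lintegral hA.open₁ hA.meas₁ hd le_rfl hα' hA.ne₁ ?_
      refine setLIntegral_enorm_sq_mul_ne_top hA.open₁.measurableSet
        (fun z hz => hM (z, w) ⟨hz, hw⟩) ?_
      simpa using hvol
    · rintro x y hx hxy hyα hlt ⟨P, hP, hP', hR⟩
      obtain ⟨Q, hQ, hQ'⟩ := hproj y
      refine ⟨Q, hQ, hQ', ?_⟩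
      have hxα : x ≤ α := hxy.le.trans hyα
      have hy := hx.trans hxy.le
      have := represents_of_range hA hα hε hx hxα hy hyα hlt (P - Q)
        (fun v => sub_mem (hP v) (hFanti x y hxy.le (hQ v))) fun L hL =>
          hA.killed_apply hα' hy hyα L fun e he => hL _ ?_
      · convert hR.add hA.open₁ hA.mem₁ this using 2 with w
        simp
      · have hm : jet (fun i => Pi.single i 1) N hA.open₁ hA.mem₁ e ∈ F y :=
          Submodule.mem_map_of_mem he
        rw [LinearMap.sub_apply, hP' _ (hFanti x y hxy.le hm), hQ' _ hm, sub_self]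
  obtain ⟨P, hP, hP', hR⟩ := key
  have := represents_of_range hA hα hε hα'.le le_rfl hα'.le le_rfl
    (by linarith [(hε α hα'.le le_rfl).1]) P hP fun L _ => by
      rw [sub_self]
      exact hA.killed_zero hα' L
  convert hR.add hA.open₁ hA.mem₁ this using 2 with w
  simp

end Sweep

section Decomposition

open scoped ENNReal

variable {n₁ n₂ : ℕ} {f₁ : (Fin n₁ → ℂ) → ℂ} {f₂ : (Fin n₂ → ℂ) → ℂ}
  {g : (Fin n₁ → ℂ) × (Fin n₂ → ℂ) → ℂ} {α : ℚ}

theorem exists_adapted (hm₁ : Measurable f₁) (hm₂ : Measurable f₂) (hf₁ : Hol f₁) (h₁ : f₁ 0 = 0)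
    (hN₁ : NullZeros f₁) (hN₂ : NullZeros f₂) (hg : Hol g) {α : ℝ}
    (hM : Mult (fun p => f₁ p.1 + f₂ p.2) g α) (N : ℕ) :
    ∃ r > 0, Adapted f₁ f₂ g α N (Metric.ball 0 r) (Metric.ball 0 r) ∧
      ∃ M, ∀ p ∈ Metric.ball 0 r ×ˢ Metric.ball 0 r, ‖g p‖ ≤ M := by
  obtain ⟨W₁, hW₁, hN₁⟩ := hN₁
  obtain ⟨W₂, hW₂, hN₂⟩ := hN₂
  obtain ⟨s, hs, hM⟩ := hM.exists_ball
  obtain ⟨s', hs', hd⟩ := hg.exists_ball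
  have hsmall : ∀ᶠ z in 𝓝 0, ‖f₁ z‖ₑ < 1 :=
    hf₁.continuousAt.enorm.eventually_lt_const (by simp [h₁])
  obtain ⟨r₁, hr₁, hB₁⟩ := Metric.eventually_nhds_iff_ball.1 (hsmall.and hW₁)
  obtain ⟨r₂, hr₂, hB₂⟩ := Metric.mem_nhds_iff.1 hW₂
  obtain ⟨ρ, hρ, hρs, hρs', hρ₁, hρ₂⟩ : ∃ ρ > 0, ρ ≤ s ∧ ρ ≤ s' ∧ ρ ≤ r₁ ∧ ρ ≤ r₂ :=
    ⟨min (min s s') (min r₁ r₂), by positivity, by simp, by simp, by simp, by simp⟩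
  have hlt := half_lt_self hρ
  have hd' : DifferentiableOn ℂ g (Metric.ball 0 ρ ×ˢ Metric.ball 0 ρ) := by
    rw [ball_prod_same]
    exact hd.mono (Metric.ball_subset_ball hρs')
  have hsub₁ : Metric.ball (0 : Fin n₁ → ℂ) (ρ / 2) ⊆ Metric.ball 0 ρ :=
    Metric.ball_subset_ball hlt.le
  have hsub₂ : Metric.ball (0 : Fin n₂ → ℂ) (ρ / 2) ⊆ Metric.ball 0 ρ :=
    Metric.ball_subset_ball hlt.le
  refine ⟨ρ / 2, half_pos hρ, ⟨Metric.isOpen_ball, Metric.isOpen_ball,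
    Metric.mem_ball_self (half_pos hρ), Metric.mem_ball_self (half_pos hρ),
    hd'.mono (Set.prod_mono hsub₁ hsub₂), hm₁, hm₂, ?_, ?_, fun z hz => ?_,
    measure_ball_lt_top.ne, ?_, ?_⟩, ?_⟩
  · exact ae_restrict_of_ae_restrict_of_subset (fun z hz =>
      (hB₁ z (Metric.ball_subset_ball hρ₁ (hsub₁ hz))).2) hN₁
  · exact ae_restrict_of_ae_restrict_of_subset (fun z hz =>
      hB₂ (Metric.ball_subset_ball hρ₂ (hsub₂ hz))) hN₂
  · exact (hB₁ z (Metric.ball_subset_ball hρ₁ (hsub₁ hz))).1.le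
  · rw [ball_prod_same]
    exact hM _ (hlt.le.trans hρs)
  · have := fun l => (differentiableOn_jetAt (N := N) Metric.isOpen_ball Metric.isOpen_ball
      (Metric.mem_ball_self hρ) hd' l).exists_bound_half hρ
    choose M hM using this
    refine ⟨∑ l, |M l|, fun w hw l => (hM l w hw).trans ((le_abs_self _).trans ?_)⟩
    exact Finset.single_le_sum (f := fun l => |M l|) (fun l _ => abs_nonneg _) (Finset.mem_univ l)
  · obtain ⟨M, hM⟩ := ((isCompact_closedBall (0 : Fin n₁ → ℂ) (ρ / 2)).prod
      (isCompact_closedBall (0 : Fin n₂ → ℂ) (ρ / 2))).exists_bound_of_continuousOn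
      (hd'.continuousOn.mono (Set.prod_mono (Metric.closedBall_subset_ball hlt)
        (Metric.closedBall_subset_ball hlt)))
    exact ⟨M, fun p hp => hM p (Set.prod_mono Metric.ball_subset_closedBall
      Metric.ball_subset_closedBall hp)⟩

theorem germ_mem_productIdeal (hm₁ : Measurable f₁) (hm₂ : Measurable f₂) (hf₁ : Hol f₁)
    (hf₂ : Hol f₂) (h₁ : f₁ 0 = 0) (hne₁ : ¬ f₁ =ᶠ[𝓝 0] 0) (hne₂ : ¬ f₂ =ᶠ[𝓝 0] 0) (hα : 0 < α)
    (hg : Hol g) (hM : Mult (fun p => f₁ p.1 + f₂ p.2) g α) :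
    hg.germ ∈ productIdeal f₁ f₂ α := by
  obtain ⟨hN₁, -, hI₁⟩ := hf₁.localProperties hne₁
  obtain ⟨hN₂, -, hI₂⟩ := hf₂.localProperties hne₂
  refine mem_ideal_of_forall_pow fun N => ?_
  obtain ⟨r, hr, hA, hb⟩ := exists_adapted hm₁ hm₂ hf₁ h₁ hN₁ hN₂ hg hM N
  obtain ⟨ε, hε⟩ := exists_gain hI₁ hI₂ (α := α) hA.open₁ hA.open₂ hA.mem₁ hA.mem₂
  obtain ⟨S, hS, ⟨hSh, hSI⟩, hSj⟩ := hA.represents hα hε hb measure_ball_lt_top.ne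
  refine ⟨_, hSI, ?_⟩
  rw [← Hol.germ_sub hg hSh]
  refine Vanishes.germ_mem (vanishes_of_dirDeriv (hg.sub hSh) fun l hl => ?_) _
  filter_upwards [hA.open₂.mem_nhds hA.mem₂] with w hw
  have hd : DifferentiableOn ℂ (fun p => g p - S p) (Metric.ball 0 r ×ˢ Metric.ball 0 r) :=
    hA.hol.sub hS
  rw [← dirDeriv_slice hA.open₁ hA.open₂ l hd hA.mem₁ hw]
  obtain ⟨_, e₁⟩ := jetAt_eq_jet (N := N) hA.open₁ hA.mem₁ hA.hol hw
  obtain ⟨_, e₂⟩ := jetAt_eq_jet (N := N) hA.open₁ hA.mem₁ hS hw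
  have h0 := sub_eq_zero.2 (hSj w hw).symm
  rw [e₁, e₂] at h0
  have h0' := (map_sub (jet (fun i => Pi.single i 1) N hA.open₁ hA.mem₁) ⟨_, _⟩ ⟨_, _⟩).trans h0
  exact congrFun h0' ⟨l, hl⟩

/-- The multiplier condition at the origin decomposes along a sum of functions in separate
variables. -/
theorem mult_add_iff (hm₁ : Measurable f₁) (hm₂ : Measurable f₂) (hf₁ : Hol f₁)
    (hf₂ : Hol f₂) (h₁ : f₁ 0 = 0) (h₂ : f₂ 0 = 0) (hne₁ : ¬ f₁ =ᶠ[𝓝 0] 0)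
    (hne₂ : ¬ f₂ =ᶠ[𝓝 0] 0) (hα : 0 < α) (hα1 : α < 1) (hg : Hol g) :
    Mult (fun p => f₁ p.1 + f₂ p.2) g α ↔
      ∃ (k : ℕ) (h : Fin k → (Fin n₁ → ℂ) × (Fin n₂ → ℂ) → ℂ) (g₁ : Fin k → (Fin n₁ → ℂ) → ℂ)
        (g₂ : Fin k → (Fin n₂ → ℂ) → ℂ) (α₁ α₂ : Fin k → ℚ),
        (∀ i, 0 < α₁ i ∧ 0 < α₂ i ∧ α₁ i + α₂ i = α ∧ Hol (h i) ∧ Hol (g₁ i) ∧ Hol (g₂ i) ∧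
          Mult f₁ (g₁ i) (α₁ i) ∧ Mult f₂ (g₂ i) (α₂ i)) ∧
        g =ᶠ[𝓝 0] fun p => ∑ i, h i p * (g₁ i p.1 * g₂ i p.2) := by
  have hfst : Hol fun p : (Fin n₁ → ℂ) × (Fin n₂ → ℂ) => p.1 := differentiable_fst.hol
  have hsnd : Hol fun p : (Fin n₁ → ℂ) × (Fin n₂ → ℂ) => p.2 := differentiable_snd.hol
  constructor
  · intro hM
    have := germ_mem_productIdeal hm₁ hm₂ hf₁ hf₂ h₁ hne₁ hne₂ hα hg hM
    obtain ⟨k, c, q, hsum⟩ := Submodule.mem_span_set'.1 this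
    choose e b α₁ α₂ h0₁ h0₂ hadd he hb hMe hMb hh hq using fun i => (q i).2
    choose u hu huc using fun i => holGerms.exists_rep (c i)
    refine ⟨k, u, e, b, α₁, α₂, fun i => ⟨h0₁ i, h0₂ i, hadd i, hu i, he i, hb i, hMe i, hMb i⟩, ?_⟩
    have hs : ∑ i, c i • (q i : holGerms ((Fin n₁ → ℂ) × (Fin n₂ → ℂ))) =
        ∑ i, ((hu i).mul (hh i)).germ :=
      Finset.sum_congr rfl fun i _ => by rw [Hol.germ_mul (hu i) (hh i), huc i, ← hq i]; rfl
    rw [hs, ← Hol.germ_sum Finset.univ fun i => (hu i).mul (hh i)] at hsum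
    exact (Hol.germ_eq_germ.1 hsum).symm
  · rintro ⟨k, h, g₁, g₂, α₁, α₂, H, e⟩
    refine Mult.congr (Mult.sum ((hf₁.comp hfst rfl).add (hf₂.comp hsnd rfl))
      (fun i => ?_) fun i => ?_) .rfl e.symm
    · obtain ⟨-, -, -, hh, hg₁, hg₂, -⟩ := H i
      exact hh.mul ((hg₁.comp hfst rfl).mul (hg₂.comp hsnd rfl))
    · obtain ⟨h0₁, h0₂, hadd, hh, hg₁, hg₂, hM₁, hM₂⟩ := H i
      exact (Mult.prod hf₁ hf₂ hne₁ hne₂ h₂ hg₁ hg₂ (by exact_mod_cast h0₁)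
        (by exact_mod_cast h0₂) (by exact_mod_cast hadd) (by exact_mod_cast hα1) hM₁ hM₂).hol_mul hh

end Decomposition

section Translation

open scoped ENNReal

theorem enorm_sq_div_rpow {a b : ℂ} (hb : b ≠ 0) (s : ℝ) :
    ‖‖a‖ ^ 2 / ‖b‖ ^ (2 * s)‖ₑ = ‖a‖ₑ ^ 2 * ‖b‖ₑ ^ (-2 * s) := by
  have hb' := norm_pos_iff.2 hb
  rw [div_eq_mul_inv, ← Real.rpow_neg hb'.le, enorm_mul, enorm_pow, enorm_norm,
    Real.enorm_of_nonneg (by positivity), ← ENNReal.ofReal_rpow_of_pos hb', ofReal_norm]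
  ring_nf

theorem enorm_sq_div_rpow_le {a b : ℂ} {s : ℝ} (hs : 0 < s) :
    ‖‖a‖ ^ 2 / ‖b‖ ^ (2 * s)‖ₑ ≤ ‖a‖ₑ ^ 2 * ‖b‖ₑ ^ (-2 * s) := by
  rcases eq_or_ne b 0 with rfl | hb
  · simp [Real.zero_rpow (by positivity : 2 * s ≠ 0)]
  · exact (enorm_sq_div_rpow hb s).le

variable {X : Type*} [NormedAddCommGroup X] [NormedSpace ℂ X] [MeasureSpace X] [BorelSpace X]
  [(volume : Measure X).IsAddLeftInvariant] {f g : X → ℂ} {U : Set X} {x : X} {s : ℝ}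

omit [NormedSpace ℂ X] in
theorem setLIntegral_comp_add_left (F : X → ℝ≥0∞) (V : Set X) (x : X) :
    ∫⁻ y in (x + ·) ⁻¹' V, F (x + y) = ∫⁻ y in V, F y :=
  (measurePreserving_add_left volume x).setLIntegral_comp_preimage_emb
    (measurableEmbedding_addLeft x) F V

omit [NormedSpace ℂ X] [MeasureSpace X] [BorelSpace X]
  [(volume : Measure X).IsAddLeftInvariant] in
theorem preimage_add_left_mem_nhds {V : Set X} : (x + ·) ⁻¹' V ∈ 𝓝 0 ↔ V ∈ 𝓝 x := by
  rw [← map_add_left_nhds_zero x, mem_map]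

theorem MultCond.mult (h : MultCond f U g x s)
    (hne : ∃ V ∈ 𝓝 (0 : X), ∀ᵐ y ∂volume.restrict V, f (x + y) ≠ 0) :
    Mult (fun y => f (x + y)) (fun y => g (x + y)) s := by
  obtain ⟨V, hV, hxV, -, -, hI⟩ := h
  obtain ⟨W, hW, hne⟩ := hne
  refine ⟨(x + ·) ⁻¹' V ∩ W, inter_mem (preimage_add_left_mem_nhds.2 (hV.mem_nhds hxV)) hW, ?_⟩
  refine ne_top_of_le_ne_top (b := ∫⁻ y in V, ‖‖g y‖ ^ 2 / ‖f y‖ ^ (2 * s)‖ₑ) hI.2.ne ?_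
  rw [← setLIntegral_comp_add_left _ V x]
  refine le_trans (le_of_eq (lintegral_congr_ae ?_)) (lintegral_mono_set Set.inter_subset_left)
  filter_upwards [ae_restrict_of_ae_restrict_of_subset Set.inter_subset_right hne] with y hy
  exact (enorm_sq_div_rpow hy s).symm

theorem Mult.multCond (hU : IsOpen U) (hx : x ∈ U) (hf : DifferentiableOn ℂ f U)
    (hg : HolNear g x) (hs : 0 < s) (h : Mult (fun y => f (x + y)) (fun y => g (x + y)) s) :
    MultCond f U g x s := by
  obtain ⟨W, hW, hxW, hg⟩ := hg
  obtain ⟨V, hV, h⟩ := h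
  have hV' : (fun y => -x + y) ⁻¹' V ∈ 𝓝 x := by
    rw [← preimage_add_left_mem_nhds]
    simpa [← Set.preimage_comp, Function.comp_def] using hV
  set T := interior ((fun y => -x + y) ⁻¹' V) ∩ (U ∩ W)
  have hT : IsOpen T := isOpen_interior.inter (hU.inter hW)
  refine ⟨T, hT, ⟨mem_interior_iff_mem_nhds.2 hV', hx, hxW⟩, fun y hy => hy.2.1,
    hg.mono fun y hy => hy.2.2, ?_, ?_⟩
  · have c₁ : ContinuousOn f T := hf.continuousOn.mono fun y hy => hy.2.1
    have c₂ : ContinuousOn g T := hg.continuousOn.mono fun y hy => hy.2.2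
    exact (((c₂.aemeasurable hT.measurableSet).norm.pow_const 2).div
      ((c₁.aemeasurable hT.measurableSet).norm.pow_const (2 * s))).aestronglyMeasurable
  · refine lt_of_le_of_lt (lintegral_mono fun y => enorm_sq_div_rpow_le hs) ?_
    rw [← setLIntegral_comp_add_left _ T x]
    refine lt_of_le_of_lt (lintegral_mono_set fun y hy => ?_) h.lt_top
    simpa using interior_subset hy.1

omit [MeasureSpace X] [BorelSpace X] [(volume : Measure X).IsAddLeftInvariant] in
theorem HolNear.hol (h : HolNear g x) : Hol fun y => g (x + y) := by
  obtain ⟨W, hW, hxW, hg⟩ := h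
  refine hol_of_differentiableOn (preimage_add_left_mem_nhds.2 (hW.mem_nhds hxW)) ?_
  exact hg.comp (by fun_prop) fun y hy => hy

omit [MeasureSpace X] [BorelSpace X] [(volume : Measure X).IsAddLeftInvariant] in
theorem Hol.holNear (h : Hol g) : HolNear (fun y => g (y - x)) x := by
  obtain ⟨r, hr, hg⟩ := h.exists_ball
  refine ⟨Metric.ball x r, Metric.isOpen_ball, Metric.mem_ball_self hr, ?_⟩
  exact hg.comp (by fun_prop) fun y hy => by simpa [dist_eq_norm] using hy

omit [NormedSpace ℂ X] [MeasureSpace X] [BorelSpace X]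
  [(volume : Measure X).IsAddLeftInvariant] in
theorem eventuallyEq_comp_add_left {F G : X → ℂ} :
    (fun y => F (x + y)) =ᶠ[𝓝 0] (fun y => G (x + y)) ↔ F =ᶠ[𝓝 x] G :=
  preimage_add_left_mem_nhds (V := {y | F y = G y})

omit [BorelSpace X] [(volume : Measure X).IsAddLeftInvariant] in
theorem MultCond.holNear (h : MultCond f U g x s) : HolNear g x := by
  obtain ⟨V, hV, hxV, -, hg, -⟩ := h
  exact ⟨V, hV, hxV, hg⟩

end Translation

section Main

variable {n₁ n₂ : ℕ} {f₁ f₁' : (Fin n₁ → ℂ) → ℂ} {f₂ f₂' : (Fin n₂ → ℂ) → ℂ}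

theorem eventuallyEq_add_prod (e₁ : f₁ =ᶠ[𝓝 0] f₁') (e₂ : f₂ =ᶠ[𝓝 0] f₂') :
    (fun p : (Fin n₁ → ℂ) × (Fin n₂ → ℂ) => f₁ p.1 + f₂ p.2) =ᶠ[𝓝 0]
      fun p => f₁' p.1 + f₂' p.2 :=
  (e₁.comp_tendsto (continuous_fst.tendsto (0 : (Fin n₁ → ℂ) × (Fin n₂ → ℂ)))).add
    (e₂.comp_tendsto (continuous_snd.tendsto (0 : (Fin n₁ → ℂ) × (Fin n₂ → ℂ))))

theorem Hol.exists_ae_add_ne_zero (hf₁ : Hol f₁) (hf₂ : Hol f₂) (h₁ : f₁ 0 = 0)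
    (hne₂ : ¬ f₂ =ᶠ[𝓝 0] 0) :
    ∃ V ∈ 𝓝 (0 : (Fin n₁ → ℂ) × (Fin n₂ → ℂ)),
      ∀ᵐ p ∂volume.restrict V, f₁ p.1 + f₂ p.2 ≠ 0 := by
  obtain ⟨F₁, hm₁, hF₁, e₁⟩ := hf₁.exists_measurable
  obtain ⟨F₂, hm₂, hF₂, e₂⟩ := hf₂.exists_measurable
  obtain ⟨V, hV, h⟩ := _root_.exists_ae_add_ne_zero hm₁ hm₂ hF₁.continuousAt
    (e₁.self_of_nhds.symm.trans h₁) hF₂ fun h => hne₂ (e₂.trans h)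
  obtain ⟨W, hWs, hW, hW0⟩ := mem_nhds_iff.1 (eventuallyEq_add_prod e₁ e₂)
  refine ⟨V ∩ W, inter_mem hV (hW.mem_nhds hW0), ?_⟩
  filter_upwards [ae_restrict_of_ae_restrict_of_subset Set.inter_subset_left h,
    ae_restrict_of_ae_restrict_of_subset Set.inter_subset_right
      (ae_restrict_mem hW.measurableSet)] with p hp hpW
  exact fun h0 => hp ((hWs hpW).symm.trans h0)

theorem Hol.mult_add_iff {g : (Fin n₁ → ℂ) × (Fin n₂ → ℂ) → ℂ} {α : ℚ} (hf₁ : Hol f₁)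
    (hf₂ : Hol f₂) (h₁ : f₁ 0 = 0) (h₂ : f₂ 0 = 0) (hne₁ : ¬ f₁ =ᶠ[𝓝 0] 0)
    (hne₂ : ¬ f₂ =ᶠ[𝓝 0] 0) (hα : 0 < α) (hα1 : α < 1) (hg : Hol g) :
    Mult (fun p => f₁ p.1 + f₂ p.2) g α ↔
      ∃ (k : ℕ) (h : Fin k → (Fin n₁ → ℂ) × (Fin n₂ → ℂ) → ℂ) (g₁ : Fin k → (Fin n₁ → ℂ) → ℂ)
        (g₂ : Fin k → (Fin n₂ → ℂ) → ℂ) (α₁ α₂ : Fin k → ℚ),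
        (∀ i, 0 < α₁ i ∧ 0 < α₂ i ∧ α₁ i + α₂ i = α ∧ Hol (h i) ∧ Hol (g₁ i) ∧ Hol (g₂ i) ∧
          Mult f₁ (g₁ i) (α₁ i) ∧ Mult f₂ (g₂ i) (α₂ i)) ∧
        g =ᶠ[𝓝 0] fun p => ∑ i, h i p * (g₁ i p.1 * g₂ i p.2) := by
  obtain ⟨F₁, hm₁, hF₁, e₁⟩ := hf₁.exists_measurable
  obtain ⟨F₂, hm₂, hF₂, e₂⟩ := hf₂.exists_measurable
  have e := eventuallyEq_add_prod e₁ e₂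
  have c : ∀ {X : Type} [NormedAddCommGroup X] [NormedSpace ℂ X] [MeasureSpace X] [BorelSpace X]
      {u v w : X → ℂ} {s : ℝ}, u =ᶠ[𝓝 0] v → (Mult u w s ↔ Mult v w s) := fun h =>
    ⟨fun m => m.congr h .rfl, fun m => m.congr h.symm .rfl⟩
  simp only [c e, c e₁, c e₂]
  exact _root_.mult_add_iff hm₁ hm₂ hF₁ hF₂ (e₁.self_of_nhds.symm.trans h₁)
    (e₂.self_of_nhds.symm.trans h₂) (fun h => hne₁ (e₁.trans h)) (fun h => hne₂ (e₂.trans h))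
    hα hα1 hg

end Main

/-- Thom–Sebastiani theorem for multiplier ideals (germ-level version of Theorem 1 (1)):
for `f = f₁ ∘ pr₁ + f₂ ∘ pr₂` and `α ∈ (0,1)` rational, a holomorphic germ `g` at
`x = (x₁, x₂)` lies in `𝒥(f^α)_x` iff it is a finite sum `Σᵢ hᵢ·(g₁ᵢ ∘ pr₁)·(g₂ᵢ ∘ pr₂)`
with `hᵢ` holomorphic germs at `x`, rationals `α₁ᵢ, α₂ᵢ ∈ (0, α)` with `α₁ᵢ + α₂ᵢ = α`,
and `g₁ᵢ ∈ 𝒥(f₁^{α₁ᵢ})_{x₁}`, `g₂ᵢ ∈ 𝒥(f₂^{α₂ᵢ})_{x₂}`. -/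
theorem thomSebastiani_multiplier_ideals
    {n₁ n₂ : ℕ} (hn₁ : 1 ≤ n₁) (hn₂ : 1 ≤ n₂)
    (U₁ : Set (Fin n₁ → ℂ)) (U₂ : Set (Fin n₂ → ℂ))
    (hU₁ : IsOpen U₁) (hU₂ : IsOpen U₂)
    (f₁ : (Fin n₁ → ℂ) → ℂ) (f₂ : (Fin n₂ → ℂ) → ℂ)
    (hf₁ : DifferentiableOn ℂ f₁ U₁) (hf₂ : DifferentiableOn ℂ f₂ U₂)
    (x₁ : Fin n₁ → ℂ) (x₂ : Fin n₂ → ℂ) (hx₁ : x₁ ∈ U₁) (hx₂ : x₂ ∈ U₂)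
    (hf₁0 : f₁ x₁ = 0) (hf₂0 : f₂ x₂ = 0)
    (hne₁ : ¬ (f₁ =ᶠ[𝓝 x₁] 0)) (hne₂ : ¬ (f₂ =ᶠ[𝓝 x₂] 0))
    (f : ((Fin n₁ → ℂ) × (Fin n₂ → ℂ)) → ℂ) (hf : f = fun p => f₁ p.1 + f₂ p.2)
    (x : (Fin n₁ → ℂ) × (Fin n₂ → ℂ)) (hx : x = (x₁, x₂))
    (α : ℚ) (hα0 : 0 < α) (hα1 : α < 1)
    (g : ((Fin n₁ → ℂ) × (Fin n₂ → ℂ)) → ℂ) (hg : HolNear g x) :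
    MultCond f (U₁ ×ˢ U₂) g x (α : ℝ) ↔
      ∃ (k : ℕ) (h : Fin k → ((Fin n₁ → ℂ) × (Fin n₂ → ℂ)) → ℂ)
        (g₁ : Fin k → (Fin n₁ → ℂ) → ℂ) (g₂ : Fin k → (Fin n₂ → ℂ) → ℂ)
        (α₁ α₂ : Fin k → ℚ),
        (∀ i : Fin k, 0 < α₁ i ∧ α₁ i < α ∧ 0 < α₂ i ∧ α₂ i < α ∧ α₁ i + α₂ i = α ∧
          HolNear (h i) x ∧
          MultCond f₁ U₁ (g₁ i) x₁ ((α₁ i : ℝ)) ∧ MultCond f₂ U₂ (g₂ i) x₂ ((α₂ i : ℝ))) ∧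
        g =ᶠ[𝓝 x] fun p => ∑ i : Fin k, h i p * g₁ i p.1 * g₂ i p.2 := by
  subst hf hx
  have : (volume : Measure ((Fin n₁ → ℂ) × (Fin n₂ → ℂ))).IsAddLeftInvariant :=
    Measure.prod.instIsAddLeftInvariant
  have hF₁ : Hol fun y => f₁ (x₁ + y) := HolNear.hol ⟨U₁, hU₁, hx₁, hf₁⟩
  have hF₂ : Hol fun y => f₂ (x₂ + y) := HolNear.hol ⟨U₂, hU₂, hx₂, hf₂⟩
  have h₁ : f₁ (x₁ + 0) = 0 := by rwa [add_zero]
  have h₂ : f₂ (x₂ + 0) = 0 := by rwa [add_zero]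
  have hn₁' : ¬ (fun y => f₁ (x₁ + y)) =ᶠ[𝓝 0] 0 := fun h =>
    hne₁ (eventuallyEq_comp_add_left (G := 0).1 h)
  have hn₂' : ¬ (fun y => f₂ (x₂ + y)) =ᶠ[𝓝 0] 0 := fun h =>
    hne₂ (eventuallyEq_comp_add_left (G := 0).1 h)
  have hf : DifferentiableOn ℂ (fun p : (Fin n₁ → ℂ) × (Fin n₂ → ℂ) => f₁ p.1 + f₂ p.2)
      (U₁ ×ˢ U₂) :=
    (hf₁.comp differentiableOn_fst fun p hp => hp.1).add
      (hf₂.comp differentiableOn_snd fun p hp => hp.2)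
  have key := hF₁.mult_add_iff hF₂ h₁ h₂ hn₁' hn₂' hα0 hα1 hg.hol
  constructor
  · intro hM
    obtain ⟨k, h, g₁, g₂, α₁, α₂, hi, he⟩ := key.1
      (hM.mult (hF₁.exists_ae_add_ne_zero hF₂ h₁ hn₂'))
    refine ⟨k, fun i y => h i (y - (x₁, x₂)), fun i y => g₁ i (y - x₁), fun i y => g₂ i (y - x₂),
      α₁, α₂, fun i => ?_, ?_⟩
    · obtain ⟨p₁, p₂, hadd, hh, hg₁, hg₂, m₁, m₂⟩ := hi i
      refine ⟨p₁, by linarith, p₂, by linarith, hadd, hh.holNear, ?_, ?_⟩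
      · exact Mult.multCond hU₁ hx₁ hf₁ hg₁.holNear (by exact_mod_cast p₁)
          (by simpa only [add_sub_cancel_left] using m₁)
      · exact Mult.multCond hU₂ hx₂ hf₂ hg₂.holNear (by exact_mod_cast p₂)
          (by simpa only [add_sub_cancel_left] using m₂)
    · rw [← eventuallyEq_comp_add_left]
      simpa only [Prod.fst_add, Prod.snd_add, add_sub_cancel_left, mul_assoc] using he
  · rintro ⟨k, h, g₁, g₂, α₁, α₂, hi, he⟩
    refine Mult.multCond (hU₁.prod hU₂) ⟨hx₁, hx₂⟩ hf hg (by exact_mod_cast hα0) (key.2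
      ⟨k, fun i y => h i ((x₁, x₂) + y), fun i y => g₁ i (x₁ + y), fun i y => g₂ i (x₂ + y),
      α₁, α₂, fun i => ?_, ?_⟩)
    · obtain ⟨p₁, -, p₂, -, hadd, hh, m₁, m₂⟩ := hi i
      exact ⟨p₁, p₂, hadd, hh.hol, m₁.holNear.hol, m₂.holNear.hol,
        m₁.mult (hF₁.localProperties hn₁').1, m₂.mult (hF₂.localProperties hn₂').1⟩
    · simpa only [Prod.fst_add, Prod.snd_add, mul_assoc] using eventuallyEq_comp_add_left.2 he
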